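/- The Riemann hypothesis is true if and only if the set of extremely abundant numbers is infinite. -/

import Mathlib

open Real Finset

noncomputable section

/-- Sum of divisors of `n`. -/
def sigma1 (n : ℕ) : ℕ := n.divisors.sum id

/-- `n` is superabundant if `σ(n)/n > σ(m)/m` for all positive `m < n`. -/
def Superabundant (n : ℕ) : Prop :=
  0 < n ∧ ∀ m : ℕ, 0 < m → m < n → (sigma1 m : ℝ) / m < (sigma1 n : ℝ) / n

/-- Robin's quotient `f(n) = σ(n)/(n log log n)`. -/
def robinF (n : ℕ) : ℝ := (sigma1 n : ℝ) / (n * Real.log (Real.log n))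

/-- `n` is extremely abundant. -/
def ExtremelyAbundant (n : ℕ) : Prop :=
  n = 10080 ∨ (10080 < n ∧ ∀ m : ℕ, 10080 ≤ m → m < n → robinF m < robinF n)

namespace Robin

open MeasureTheory Filter Topology
open ArithmeticFunction (vonMangoldt)

/-- The sum of `Λ(n)/n` over `n ≤ x`. -/
def lambdaSum (x : ℝ) : ℝ := ∑ n ∈ Ioc 0 ⌊x⌋₊, vonMangoldt n / n

/-- The sum of `Λ(n)/(n log n)` over `n ≤ x`. -/
def primeSum (x : ℝ) : ℝ := ∑ n ∈ Ioc 0 ⌊x⌋₊, vonMangoldt n / (n * log n)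

theorem sum_vonMangoldt_mul_div (N : ℕ) :
    ∑ n ∈ Ioc 0 N, vonMangoldt n * ((N / n : ℕ) : ℝ) = log (N.factorial) := by
  rw [← ArithmeticFunction.sum_Ioc_mul_zeta_eq_sum, ArithmeticFunction.vonMangoldt_mul_zeta]
  induction N with
  | zero => simp
  | succ n ih =>
    rw [← Finset.insert_Ioc_right_eq_Ioc_add_one (by omega), Finset.sum_insert (by simp), ih,
      Nat.factorial_succ, Nat.cast_mul, Real.log_mul (by positivity) (by positivity)]
    simp [ArithmeticFunction.log_apply]

theorem log_factorial_le (N : ℕ) : log (N.factorial) ≤ N * log N := by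
  rcases Nat.eq_zero_or_pos N with rfl | h
  · simp
  rw [← Real.log_pow]
  apply Real.log_le_log (by positivity)
  exact_mod_cast Nat.factorial_le_pow N

theorem le_log_factorial (N : ℕ) : N * log N - N ≤ log (N.factorial) := by
  induction N with
  | zero => simp
  | succ n ih =>
    rcases Nat.eq_zero_or_pos n with rfl | h
    · simp
    rw [Nat.factorial_succ, Nat.cast_mul, Real.log_mul (by positivity) (by positivity)]
    have hn : (0 : ℝ) < n := by exact_mod_cast h
    have h1 : n * (log (n + 1) - log n) ≤ 1 := by
      rw [← Real.log_div (by positivity) (by positivity)]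
      have := Real.log_le_sub_one_of_pos (x := ((n : ℝ) + 1) / n) (by positivity)
      calc n * log (((n : ℝ) + 1) / n) ≤ n * ((n + 1) / n - 1) := by gcongr
        _ = 1 := by field_simp; ring
    push_cast at *
    nlinarith

theorem lambdaSum_natCast_ge (N : ℕ) (hN : 0 < N) : log N - 1 ≤ lambdaSum N := by
  have h1 := le_log_factorial N
  rw [← sum_vonMangoldt_mul_div] at h1
  have hN' : (0 : ℝ) < N := by exact_mod_cast hN
  have h2 : ∑ n ∈ Ioc 0 N, vonMangoldt n * ((N / n : ℕ) : ℝ) ≤ N * lambdaSum N := by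
    rw [lambdaSum, Nat.floor_natCast, Finset.mul_sum]
    refine Finset.sum_le_sum fun n _ => ?_
    calc vonMangoldt n * ((N / n : ℕ) : ℝ) ≤ vonMangoldt n * (N / n) :=
          mul_le_mul_of_nonneg_left Nat.cast_div_le ArithmeticFunction.vonMangoldt_nonneg
      _ = N * (vonMangoldt n / n) := by ring
  have : N * (log N - 1) ≤ N * lambdaSum N := by linarith
  exact le_of_mul_le_mul_left this hN'

theorem lambdaSum_natCast_le (N : ℕ) (hN : 0 < N) : lambdaSum N ≤ log N + (log 4 + 4) := by
  have h1 := log_factorial_le N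
  rw [← sum_vonMangoldt_mul_div] at h1
  have hN' : (0 : ℝ) < N := by exact_mod_cast hN
  have h2 : N * lambdaSum N - Chebyshev.psi N ≤
      ∑ n ∈ Ioc 0 N, vonMangoldt n * ((N / n : ℕ) : ℝ) := by
    rw [lambdaSum, Chebyshev.psi, Nat.floor_natCast, Finset.mul_sum, ← Finset.sum_sub_distrib]
    refine Finset.sum_le_sum fun n hn => ?_
    have h3 : (N : ℝ) / n - 1 ≤ ((N / n : ℕ) : ℝ) := by
      rw [← Nat.floor_div_eq_div (K := ℝ)]
      linarith [Nat.lt_floor_add_one ((N : ℝ) / n)]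
    calc N * (vonMangoldt n / n) - vonMangoldt n = vonMangoldt n * (N / n - 1) := by ring
      _ ≤ _ := mul_le_mul_of_nonneg_left h3 ArithmeticFunction.vonMangoldt_nonneg
  have h4 := Chebyshev.psi_le_const_mul_self (x := N) hN'.le
  have : N * lambdaSum N ≤ N * (log N + (log 4 + 4)) := by linarith
  exact le_of_mul_le_mul_left this hN'

theorem lambdaSum_floor (x : ℝ) : lambdaSum (⌊x⌋₊ : ℝ) = lambdaSum x := by
  simp [lambdaSum]

theorem abs_lambdaSum_sub_log_le {x : ℝ} (hx : 1 ≤ x) : |lambdaSum x - log x| ≤ 6 := by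
  have h1 : 0 < ⌊x⌋₊ := Nat.floor_pos.2 hx
  have h1' : (1 : ℝ) ≤ ⌊x⌋₊ := by exact_mod_cast h1
  have h2 := lambdaSum_natCast_ge _ h1
  have h3 := lambdaSum_natCast_le _ h1
  rw [lambdaSum_floor] at h2 h3
  have h4 : log ⌊x⌋₊ ≤ log x := Real.log_le_log (by linarith) (Nat.floor_le (by linarith))
  have h5 : log x ≤ log ⌊x⌋₊ + log 2 := by
    rw [← Real.log_mul (by positivity) (by positivity)]
    apply Real.log_le_log (by linarith)
    linarith [Nat.lt_floor_add_one x]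
  have h6 : log 4 = 2 * log 2 := by
    rw [show (4 : ℝ) = 2 ^ 2 by norm_num, Real.log_pow]; norm_num
  have := Real.log_two_lt_d9
  rw [abs_le]; constructor <;> linarith

theorem primeSum_nonneg (x : ℝ) : 0 ≤ primeSum x :=
  Finset.sum_nonneg fun n _ => div_nonneg ArithmeticFunction.vonMangoldt_nonneg
    (mul_nonneg (by positivity) (Real.log_natCast_nonneg n))

theorem primeSum_mono : Monotone primeSum := fun x y h =>
  Finset.sum_le_sum_of_subset_of_nonneg
    (Finset.Ioc_subset_Ioc_right (Nat.floor_mono h)) fun n _ _ =>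
      div_nonneg ArithmeticFunction.vonMangoldt_nonneg
        (mul_nonneg (by positivity) (Real.log_natCast_nonneg n))

theorem lambdaSum_mono : Monotone lambdaSum := fun x y h =>
  Finset.sum_le_sum_of_subset_of_nonneg
    (Finset.Ioc_subset_Ioc_right (Nat.floor_mono h)) fun n _ _ =>
      div_nonneg ArithmeticFunction.vonMangoldt_nonneg (by positivity)

theorem hasDerivAt_inv_log {t : ℝ} (ht : 1 < t) :
    HasDerivAt (fun t => (log t)⁻¹) (-(1 / (t * log t ^ 2))) t := by
  have h0 : 0 < log t := Real.log_pos ht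
  have := (Real.hasDerivAt_log (by linarith : t ≠ 0)).fun_inv h0.ne'
  refine this.congr_deriv ?_
  field_simp

theorem hasDerivAt_log_log {t : ℝ} (ht : 1 < t) :
    HasDerivAt (fun t => log (log t)) (1 / (t * log t)) t := by
  have h0 : 0 < log t := Real.log_pos ht
  have := (Real.hasDerivAt_log (by linarith : t ≠ 0)).log h0.ne'
  convert this using 1
  rw [one_div, mul_inv, div_eq_mul_inv]

theorem continuousOn_inv_mul_log_sq : ContinuousOn (fun t : ℝ => 1 / (t * log t ^ 2)) (Set.Ioi 1) := by
  intro t ht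
  have h0 : 0 < log t := Real.log_pos ht
  have h1 : (0 : ℝ) < t := by linarith [Set.mem_Ioi.1 ht]
  apply ContinuousAt.continuousWithinAt
  have := Real.continuousAt_log h1.ne'
  fun_prop (disch := positivity)

theorem integrableOn_inv_mul_log_sq : IntegrableOn (fun t : ℝ => 1 / (t * log t ^ 2)) (Set.Ioi 2) := by
  have h := integrableOn_Ioi_deriv_of_nonneg' (g := fun t => -(log t)⁻¹)
    (g' := fun t => 1 / (t * log t ^ 2)) (a := 2) (l := 0)
  apply h
  · intro x hx
    have := (hasDerivAt_inv_log (t := x) (by linarith [Set.mem_Ici.1 hx])).fun_neg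
    simpa only [neg_neg] using this
  · intro x hx
    have : (0 : ℝ) < x := by linarith [Set.mem_Ioi.1 hx]
    positivity
  · simpa using (Real.tendsto_log_atTop.inv_tendsto_atTop).neg

theorem primeSum_eq (x : ℝ) :
    primeSum x = lambdaSum x / log x + ∫ t in Set.Ioc 2 x, lambdaSum t / (t * log t ^ 2) := by
  have hI : ∀ y : ℝ, ∑ k ∈ Finset.Icc 0 ⌊y⌋₊, vonMangoldt k / (k : ℝ) = lambdaSum y := by
    intro y
    rw [lambdaSum, ← Finset.sum_erase (s := Finset.Icc 0 ⌊y⌋₊) (a := 0) (by simp)]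
    congr 1
  have h := sum_mul_eq_sub_integral_mul₁ (fun n => vonMangoldt n / n)
    (f := fun t => (log t)⁻¹) (by simp) (by simp) x
    (fun t ht => (hasDerivAt_inv_log (by linarith [ht.1])).differentiableAt) ?_
  · rw [hI] at h
    have h2 : primeSum x =
        ∑ k ∈ Finset.Icc 0 ⌊x⌋₊, (log k)⁻¹ * (vonMangoldt k / (k : ℝ)) := by
      rw [primeSum, ← Finset.sum_erase (s := Finset.Icc 0 ⌊x⌋₊) (a := 0) (by simp)]
      have : Finset.Ioc 0 ⌊x⌋₊ = (Finset.Icc 0 ⌊x⌋₊).erase 0 := by ext n; simp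
      rw [this]
      refine Finset.sum_congr rfl fun n _ => ?_
      rw [div_mul_eq_div_div, div_eq_mul_inv _ (log n), mul_comm]
    rw [h2, h, sub_eq_add_neg, ← integral_neg, inv_mul_eq_div]
    congr 1
    apply setIntegral_congr_fun measurableSet_Ioc
    intro t ht
    simp only
    rw [hI, (hasDerivAt_inv_log (by linarith [ht.1])).deriv]
    ring
  · apply ContinuousOn.integrableOn_Icc
    apply ContinuousOn.congr (f := fun t => -(1 / (t * log t ^ 2)))
    · exact (continuousOn_inv_mul_log_sq.mono fun t ht => by
        simp only [Set.mem_Ioi]; linarith [ht.1]).neg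
    · intro t ht
      exact (hasDerivAt_inv_log (by linarith [ht.1])).deriv

theorem integral_inv_mul_log {x : ℝ} (hx : 2 ≤ x) :
    ∫ t in Set.Ioc 2 x, 1 / (t * log t) = log (log x) - log (log 2) := by
  rw [← intervalIntegral.integral_of_le hx]
  apply intervalIntegral.integral_eq_sub_of_hasDerivAt
  · intro t ht
    rw [Set.uIcc_of_le hx] at ht
    exact hasDerivAt_log_log (by linarith [ht.1])
  · apply ContinuousOn.intervalIntegrable
    intro t ht
    rw [Set.uIcc_of_le hx] at ht
    have h1 : 1 < t := by linarith [ht.1]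
    have h0 : 0 < log t := Real.log_pos h1
    have h2 : (0 : ℝ) < t := by linarith
    apply ContinuousAt.continuousWithinAt
    have := Real.continuousAt_log h2.ne'
    fun_prop (disch := positivity)

theorem measurable_lambdaSum : Measurable lambdaSum := lambdaSum_mono.measurable

theorem integrableOn_lambdaSum_sub_log :
    IntegrableOn (fun t => (lambdaSum t - log t) / (t * log t ^ 2)) (Set.Ioi 2) := by
  refine (integrableOn_inv_mul_log_sq.const_mul 6).mono' ?_ ?_
  · have := measurable_lambdaSum
    exact Measurable.aestronglyMeasurable (by fun_prop)
  · refine (ae_restrict_iff' measurableSet_Ioi).2 (Eventually.of_forall fun t ht => ?_)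
    have h2 : (0 : ℝ) < t := by linarith [Set.mem_Ioi.1 ht]
    rw [norm_eq_abs, abs_div, abs_of_nonneg (by positivity : 0 ≤ t * log t ^ 2), mul_one_div]
    gcongr
    exact abs_lambdaSum_sub_log_le (by linarith [Set.mem_Ioi.1 ht])

theorem primeSum_sub_log_log {x : ℝ} (hx : 2 ≤ x) :
    primeSum x - log (log x) = 1 - log (log 2) + (lambdaSum x - log x) / log x
      + ∫ t in Set.Ioc 2 x, (lambdaSum t - log t) / (t * log t ^ 2) := by
  have h0 : 0 < log x := Real.log_pos (by linarith)
  have h1 : ∫ t in Set.Ioc 2 x, lambdaSum t / (t * log t ^ 2) =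
      (∫ t in Set.Ioc 2 x, (lambdaSum t - log t) / (t * log t ^ 2)) +
        ∫ t in Set.Ioc 2 x, 1 / (t * log t) := by
    rw [← integral_add]
    · apply setIntegral_congr_fun measurableSet_Ioc
      intro t ht
      have h1 : 1 < t := by linarith [ht.1]
      have h0 : 0 < log t := Real.log_pos h1
      simp only
      field_simp
      ring
    · exact integrableOn_lambdaSum_sub_log.mono_set Set.Ioc_subset_Ioi_self
    · apply (ContinuousOn.integrableOn_Icc _).mono_set Set.Ioc_subset_Icc_self
      intro t ht
      have h1 : 1 < t := by linarith [ht.1]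
      have h0 : 0 < log t := Real.log_pos h1
      have h2 : (0 : ℝ) < t := by linarith
      apply ContinuousAt.continuousWithinAt
      have := Real.continuousAt_log h2.ne'
      fun_prop (disch := positivity)
  rw [primeSum_eq x, h1, integral_inv_mul_log hx]
  field_simp
  ring

theorem exists_tendsto_primeSum_sub_log_log :
    ∃ c, Tendsto (fun x => primeSum x - log (log x)) atTop (𝓝 c) := by
  refine ⟨1 - log (log 2) + 0 + ∫ t in Set.Ioi 2, (lambdaSum t - log t) / (t * log t ^ 2), ?_⟩
  have h1 : Tendsto (fun x => (lambdaSum x - log x) / log x) atTop (𝓝 0) := by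
    have h6 : Tendsto (fun x => 6 / log x) atTop (𝓝 0) :=
      tendsto_const_nhds.div_atTop Real.tendsto_log_atTop
    refine squeeze_zero_norm' ?_ h6
    filter_upwards [eventually_ge_atTop 2] with x hx
    have h0 : 0 < log x := Real.log_pos (by linarith)
    rw [norm_eq_abs, abs_div, abs_of_pos h0]
    gcongr
    exact abs_lambdaSum_sub_log_le (by linarith)
  have h2 : Tendsto (fun x => ∫ t in (2:ℝ)..x, (lambdaSum t - log t) / (t * log t ^ 2)) atTop
      (𝓝 (∫ t in Set.Ioi 2, (lambdaSum t - log t) / (t * log t ^ 2))) :=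
    intervalIntegral_tendsto_integral_Ioi _ integrableOn_lambdaSum_sub_log tendsto_id
  refine Tendsto.congr' ?_ ((tendsto_const_nhds.add h1).add h2)
  filter_upwards [eventually_ge_atTop 2] with x hx
  rw [primeSum_sub_log_log hx, intervalIntegral.integral_of_le hx]

/-- The coefficients `Λ(n)/log n` of `log ζ`. -/
def logZetaCoeff (n : ℕ) : ℝ := vonMangoldt n / log n

theorem logZetaCoeff_nonneg (n : ℕ) : 0 ≤ logZetaCoeff n :=
  div_nonneg ArithmeticFunction.vonMangoldt_nonneg (Real.log_natCast_nonneg n)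

theorem logZetaCoeff_le_one (n : ℕ) : logZetaCoeff n ≤ 1 :=
  div_le_one_of_le₀ ArithmeticFunction.vonMangoldt_le_log (Real.log_natCast_nonneg n)

theorem abscissa_logZetaCoeff_le :
    LSeries.abscissaOfAbsConv (fun n => (logZetaCoeff n : ℂ)) ≤ 1 := by
  refine LSeries.abscissaOfAbsConv_le_of_le_const ⟨1, fun n _ => ?_⟩
  rw [Complex.norm_real, norm_eq_abs, abs_of_nonneg (logZetaCoeff_nonneg n)]
  exact logZetaCoeff_le_one n

theorem hasDerivAt_LSeries_logZetaCoeff {s : ℂ} (hs : 1 < s.re) :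
    HasDerivAt (LSeries fun n => (logZetaCoeff n : ℂ)) (deriv riemannZeta s / riemannZeta s) s := by
  have h := LSeries_hasDerivAt (s := s) (lt_of_le_of_lt abscissa_logZetaCoeff_le
    (by exact_mod_cast hs))
  refine h.congr_deriv ?_
  rw [LSeries_congr (g := fun n => (vonMangoldt n : ℂ)) _ s,
    ArithmeticFunction.LSeries_vonMangoldt_eq_deriv_riemannZeta_div hs]
  · ring
  · intro n hn
    simp only [LSeries.logMul, logZetaCoeff]
    rw [← Complex.natCast_log, ← Complex.ofReal_mul]
    rcases eq_or_ne (log n) 0 with h | h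
    · have : vonMangoldt n = 0 :=
        le_antisymm (h ▸ ArithmeticFunction.vonMangoldt_le_log)
          ArithmeticFunction.vonMangoldt_nonneg
      simp [this]
    · rw [mul_div_cancel₀ _ h]

theorem convex_one_lt_re : Convex ℝ {s : ℂ | 1 < s.re} := convex_halfSpace_re_gt 1

theorem exp_LSeries_logZetaCoeff {s : ℂ} (hs : 1 < s.re) :
    Complex.exp (LSeries (fun n => (logZetaCoeff n : ℂ)) s) = riemannZeta s := by
  set D := LSeries fun n => (logZetaCoeff n : ℂ) with hD
  have hder : ∀ z : ℂ, 1 < z.re →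
      HasDerivAt (fun z => Complex.exp (-D z) * riemannZeta z) 0 z := by
    intro z hz
    have h1 := (hasDerivAt_LSeries_logZetaCoeff hz).fun_neg.cexp
    have hz1 : z ≠ 1 := by rintro rfl; simp at hz
    have h2 := (differentiableAt_riemannZeta hz1).hasDerivAt
    refine (h1.mul h2).congr_deriv ?_
    have := riemannZeta_ne_zero_of_one_lt_re hz
    field_simp
    ring
  have hconst : ∀ z w : ℂ, 1 < z.re → 1 < w.re →
      Complex.exp (-D z) * riemannZeta z = Complex.exp (-D w) * riemannZeta w := by
    intro z w hz hw
    refine IsOpen.is_const_of_deriv_eq_zero (s := {s : ℂ | 1 < s.re})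
      (f := fun z => Complex.exp (-D z) * riemannZeta z)
      (isOpen_lt continuous_const Complex.continuous_re)
      convex_one_lt_re.isPreconnected
      (fun z hz => (hder z hz).differentiableAt.differentiableWithinAt)
      (fun z hz => (hder z hz).deriv) hz hw
  have hlim : Tendsto (fun x : ℝ => Complex.exp (-D x) * riemannZeta x) atTop (𝓝 1) := by
    have h1 : Tendsto (fun x : ℝ => D x) atTop (𝓝 0) := by
      have := LSeries.tendsto_atTop (f := fun n => (logZetaCoeff n : ℂ))
        (lt_of_le_of_lt abscissa_logZetaCoeff_le (EReal.coe_lt_top 1))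
      have h0 : ((logZetaCoeff 1 : ℝ) : ℂ) = 0 := by simp [logZetaCoeff]
      rwa [h0] at this
    have h2 : Tendsto (fun x : ℝ => riemannZeta x) atTop (𝓝 1) := by
      have := LSeries.tendsto_atTop (f := 1)
        (lt_of_le_of_lt (LSeries.abscissaOfAbsConv_le_of_le_const ⟨1, fun n _ => by simp⟩)
          (EReal.coe_lt_top 1))
      refine Tendsto.congr' ?_ this
      filter_upwards [eventually_gt_atTop 1] with x hx
      exact LSeries_one_eq_riemannZeta (by simpa using hx)
    have h3 := (Complex.continuous_exp.tendsto _).comp h1.neg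
    simpa using h3.mul h2
  have hone : Complex.exp (-D s) * riemannZeta s = 1 := by
    refine tendsto_nhds_unique (tendsto_const_nhds.congr' ?_) hlim
    filter_upwards [eventually_gt_atTop 1] with x hx
    exact hconst s x hs (by simpa using hx)
  calc Complex.exp (D s) = Complex.exp (D s) * (Complex.exp (-D s) * riemannZeta s) := by
        rw [hone, mul_one]
    _ = riemannZeta s := by rw [← mul_assoc, ← Complex.exp_add]; simp

theorem primeSum_le {x : ℝ} (hx : 1 ≤ x) : primeSum x ≤ 1 + log x := by
  have h1 : primeSum x ≤ ∑ n ∈ Finset.Ioc 0 ⌊x⌋₊, (n : ℝ)⁻¹ := by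
    refine Finset.sum_le_sum fun n _ => ?_
    have := logZetaCoeff_le_one n
    rw [mul_comm, div_mul_eq_div_div, ← one_div]
    exact div_le_div_of_nonneg_right this (by positivity)
  have h2 := harmonic_floor_le_one_add_log x hx
  rw [harmonic_eq_sum_Icc] at h2
  push_cast at h2
  exact h1.trans h2

theorem measurable_primeSum : Measurable primeSum := primeSum_mono.measurable

theorem integrableOn_mul_rpow_of_le {f : ℝ → ℝ} (hf : Measurable f) {C a c σ : ℝ} (hc : 0 < c)
    (hb : ∀ x, c < x → |f x| ≤ C * x ^ a) (ha : a < σ) :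
    IntegrableOn (fun x => f x * x ^ (-σ - 1)) (Set.Ioi c) := by
  have h := (integrableOn_Ioi_rpow_of_lt (a := a - σ - 1) (by linarith) hc).const_mul C
  refine h.mono' (by exact Measurable.aestronglyMeasurable (by fun_prop)) ?_
  refine (ae_restrict_iff' measurableSet_Ioi).2 (Eventually.of_forall fun x hx => ?_)
  have hx0 : 0 < x := hc.trans hx
  rw [norm_mul, norm_eq_abs, norm_eq_abs, abs_of_pos (Real.rpow_pos_of_pos hx0 _),
    show a - σ - 1 = a + (-σ - 1) by ring, Real.rpow_add hx0, ← mul_assoc]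
  exact mul_le_mul_of_nonneg_right (hb x hx) (Real.rpow_pos_of_pos hx0 _).le

theorem one_add_log_le_rpow {a x : ℝ} (ha : 0 < a) (hx : 1 ≤ x) :
    1 + log x ≤ (1 + 1 / a) * x ^ a := by
  have h1 := Real.log_le_rpow_div (by linarith : 0 ≤ x) ha
  have h2 : 1 ≤ x ^ a := Real.one_le_rpow hx ha.le
  calc 1 + log x ≤ x ^ a + x ^ a / a := add_le_add h2 h1
    _ = _ := by ring

theorem integrableOn_primeSum {σ : ℝ} (hσ : 0 < σ) :
    IntegrableOn (fun x => primeSum x * x ^ (-σ - 1)) (Set.Ioi 1) := by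
  refine integrableOn_mul_rpow_of_le measurable_primeSum (a := σ / 2) (C := 1 + 1 / (σ / 2))
    one_pos (fun x hx => ?_) (by linarith)
  rw [abs_of_nonneg (primeSum_nonneg x)]
  exact (primeSum_le hx.le).trans (one_add_log_le_rpow (by linarith) hx.le)

/-- `log ζ(1+s) = s ∫ P(x) x^{-s-1} dx`. -/
theorem LSeries_logZetaCoeff_eq {s : ℂ} (hs : 0 < s.re) :
    LSeries (fun n => (logZetaCoeff n : ℂ)) (1 + s) =
      s * ∫ x in Set.Ioi (1 : ℝ), (primeSum x : ℂ) * (x : ℂ) ^ (-(s + 1)) := by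
  have hN : ∀ N : ℕ, ∑ k ∈ Finset.Icc 1 N, vonMangoldt k / (k * log k) = primeSum N := by
    intro N; simp only [primeSum, Nat.floor_natCast]; rfl
  have h := LSeries_eq_mul_integral_of_nonneg (fun n => vonMangoldt n / (n * log n))
    (r := s.re / 2) (by linarith) (s := s) (by linarith) ?_ ?_
  · rw [← LSeries_congr (f := fun n => (logZetaCoeff n : ℂ) / n)] at h
    · have h3 : LSeries (fun n => (logZetaCoeff n : ℂ)) (1 + s) =
          LSeries (fun n => (logZetaCoeff n : ℂ) / n) s := by
        unfold LSeries
        congr 1; ext n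
        rcases eq_or_ne n 0 with rfl | hn
        · simp
        · have hn' : (n : ℂ) ≠ 0 := by exact_mod_cast hn
          rw [LSeries.term_of_ne_zero hn, LSeries.term_of_ne_zero hn, Complex.cpow_add _ _ hn',
            Complex.cpow_one, div_mul_eq_div_div]
      rw [h3, h]
      congr 1
      apply setIntegral_congr_fun measurableSet_Ioi
      intro t _
      simp only
      congr 1
      rw [← Complex.ofReal_sum]
      congr 1
    · intro n hn
      simp only [logZetaCoeff]
      push_cast
      rw [div_div, mul_comm]
  · simp only [hN]
    refine Asymptotics.IsBigO.of_bound (1 + 1 / (s.re / 2)) ?_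
    filter_upwards [eventually_ge_atTop 1] with n hn
    have hn' : (1 : ℝ) ≤ n := by exact_mod_cast hn
    rw [norm_eq_abs, norm_eq_abs, abs_of_nonneg (primeSum_nonneg _), abs_of_nonneg (by positivity)]
    exact (primeSum_le hn').trans (one_add_log_le_rpow (by linarith) hn')
  · intro n
    exact div_nonneg ArithmeticFunction.vonMangoldt_nonneg
      (mul_nonneg (by positivity) (Real.log_natCast_nonneg n))

/-- Real form of `log ζ(1+s) = s ∫ P(x) x^{-s-1} dx`. -/
theorem riemannZeta_one_add_eq_exp {δ : ℝ} (hδ : 0 < δ) :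
    riemannZeta (1 + δ) =
      (Real.exp (δ * ∫ x in Set.Ioi (1 : ℝ), primeSum x * x ^ (-δ - 1)) : ℝ) := by
  rw [← exp_LSeries_logZetaCoeff (by simpa using hδ), LSeries_logZetaCoeff_eq (by simpa using hδ)]
  push_cast
  rw [← integral_complex_ofReal]
  congr 2
  apply setIntegral_congr_fun measurableSet_Ioi
  intro x hx
  have hx0 : (0 : ℝ) ≤ x := by linarith [Set.mem_Ioi.1 hx]
  simp only
  push_cast
  rw [Complex.ofReal_cpow hx0]
  push_cast
  ring_nf

/-- Substitution `x = e^u`. -/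
theorem integral_comp_exp_Ioi {E : Type*} [NormedAddCommGroup E] [NormedSpace ℝ E]
    (g : ℝ → E) : ∫ x in Set.Ioi 1, g x = ∫ u in Set.Ioi 0, Real.exp u • g (Real.exp u) := by
  have himg : Real.exp '' Set.Ioi 0 = Set.Ioi 1 := by
    ext x; constructor
    · rintro ⟨u, hu, rfl⟩; exact Real.one_lt_exp_iff.2 hu
    · intro hx
      exact ⟨log x, Real.log_pos hx, Real.exp_log (by linarith [Set.mem_Ioi.1 hx])⟩
  rw [← himg, integral_image_eq_integral_abs_deriv_smul measurableSet_Ioi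
    (fun x _ => (Real.hasDerivAt_exp x).hasDerivWithinAt) Real.exp_injective.injOn]
  simp only [abs_of_pos (Real.exp_pos _)]

theorem integrableOn_comp_exp_Ioi {E : Type*} [NormedAddCommGroup E] [NormedSpace ℝ E]
    (g : ℝ → E) : IntegrableOn g (Set.Ioi 1) ↔
      IntegrableOn (fun u => Real.exp u • g (Real.exp u)) (Set.Ioi 0) := by
  have himg : Real.exp '' Set.Ioi 0 = Set.Ioi 1 := by
    ext x; constructor
    · rintro ⟨u, hu, rfl⟩; exact Real.one_lt_exp_iff.2 hu
    · intro hx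
      exact ⟨log x, Real.log_pos hx, Real.exp_log (by linarith [Set.mem_Ioi.1 hx])⟩
  rw [← himg, integrableOn_image_iff_integrableOn_abs_deriv_smul measurableSet_Ioi
    (fun x _ => (Real.hasDerivAt_exp x).hasDerivWithinAt) Real.exp_injective.injOn]
  simp only [abs_of_pos (Real.exp_pos _)]

theorem integrableOn_log_mul_exp_neg :
    IntegrableOn (fun u => log u * Real.exp (-u)) (Set.Ioi 0) := by
  have h1 : IntegrableOn (fun u => Real.exp (-u) * u ^ ((1 / 2 : ℝ) - 1)) (Set.Ioi 0) :=
    Real.GammaIntegral_convergent (by norm_num)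
  have h2 : IntegrableOn (fun u => Real.exp (-u) * u ^ ((3 / 2 : ℝ) - 1)) (Set.Ioi 0) :=
    Real.GammaIntegral_convergent (by norm_num)
  refine ((h1.const_mul 2).add (h2.const_mul 2)).mono'
    (Measurable.aestronglyMeasurable (by fun_prop)) ?_
  refine (ae_restrict_iff' measurableSet_Ioi).2 (Eventually.of_forall fun u hu => ?_)
  have hu0 : 0 < u := hu
  have ha : log u ≤ 2 * u ^ ((3 / 2 : ℝ) - 1) := by
    have := Real.log_le_rpow_div hu0.le (by norm_num : (0:ℝ) < 3 / 2 - 1)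
    refine this.trans (le_of_eq ?_)
    norm_num
    ring
  have hb : -log u ≤ 2 * u ^ ((1 / 2 : ℝ) - 1) := by
    have := Real.log_le_rpow_div (inv_pos.2 hu0).le (by norm_num : (0:ℝ) < 1 / 2)
    rw [Real.log_inv, Real.inv_rpow hu0.le, ← Real.rpow_neg hu0.le] at this
    norm_num at this ⊢
    linarith
  have hc : |log u| ≤ 2 * u ^ ((1 / 2 : ℝ) - 1) + 2 * u ^ ((3 / 2 : ℝ) - 1) := by
    have h1 := Real.rpow_pos_of_pos hu0 ((1 / 2 : ℝ) - 1)
    have h2 := Real.rpow_pos_of_pos hu0 ((3 / 2 : ℝ) - 1)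
    rw [abs_le]; constructor <;> linarith
  rw [norm_mul, norm_eq_abs, norm_eq_abs, Real.abs_exp]
  have := mul_le_mul_of_nonneg_right hc (Real.exp_pos (-u)).le
  simp only [Pi.add_apply]
  linarith

theorem integral_log_mul_exp_neg :
    ∫ u in Set.Ioi 0, log u * Real.exp (-u) = -eulerMascheroniConstant := by
  have h1 := Complex.hasDerivAt_GammaIntegral (s := 1) (by simp)
  have h2 : HasDerivAt Complex.GammaIntegral (-(eulerMascheroniConstant : ℂ)) 1 := by
    refine Complex.hasDerivAt_Gamma_one.congr_of_eventuallyEq ?_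
    have : {s : ℂ | 0 < s.re} ∈ 𝓝 (1 : ℂ) :=
      (isOpen_lt continuous_const Complex.continuous_re).mem_nhds (by simp)
    filter_upwards [this] with s hs
    exact (Complex.Gamma_eq_integral hs).symm
  have h3 := h1.unique h2
  have h4 : ((∫ u in Set.Ioi 0, log u * Real.exp (-u) : ℝ) : ℂ) =
      ((-eulerMascheroniConstant : ℝ) : ℂ) := by
    rw [← integral_complex_ofReal]
    push_cast
    rw [← h3]
    simp
  exact_mod_cast h4

theorem integral_log_mul_exp_neg_mul {s : ℝ} (hs : 0 < s) :
    ∫ u in Set.Ioi 0, log u * Real.exp (-(s * u)) = (-eulerMascheroniConstant - log s) / s := by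
  have h := integral_comp_mul_left_Ioi (fun u => (log u - log s) * Real.exp (-u)) 0 hs
  simp only [mul_zero] at h
  have h1 : ∫ u in Set.Ioi 0, log u * Real.exp (-(s * u)) =
      ∫ u in Set.Ioi 0, (log (s * u) - log s) * Real.exp (-(s * u)) := by
    apply setIntegral_congr_fun measurableSet_Ioi
    intro u hu
    simp only
    rw [Real.log_mul hs.ne' (ne_of_gt hu)]
    ring_nf
  rw [h1, h]
  simp only [sub_mul]
  rw [integral_sub integrableOn_log_mul_exp_neg
    ((integrableOn_exp_neg_Ioi 0).const_mul _), integral_log_mul_exp_neg,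
    integral_const_mul, integral_exp_neg_Ioi_zero, smul_eq_mul]
  field_simp

theorem integrableOn_log_mul_exp_neg_mul {s : ℝ} (hs : 0 < s) :
    IntegrableOn (fun u => log u * Real.exp (-(s * u))) (Set.Ioi 0) := by
  have h := integrableOn_Ioi_comp_mul_left_iff (fun u => (log u - log s) * Real.exp (-u)) 0 hs
  rw [mul_zero] at h
  have h2 := h.2 (by
    simp only [sub_mul]
    exact integrableOn_log_mul_exp_neg.sub ((integrableOn_exp_neg_Ioi 0).const_mul _))
  refine h2.congr_fun ?_ measurableSet_Ioi
  intro u hu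
  simp only
  rw [Real.log_mul hs.ne' (ne_of_gt hu)]
  ring_nf

theorem exp_mul_rpow_exp (u σ : ℝ) : Real.exp u * Real.exp u ^ (-σ - 1) = Real.exp (-(σ * u)) := by
  rw [← Real.exp_mul, ← Real.exp_add]; ring_nf

theorem integral_log_log_mul_rpow {s : ℝ} (hs : 0 < s) :
    ∫ x in Set.Ioi 1, log (log x) * x ^ (-s - 1) = (-eulerMascheroniConstant - log s) / s := by
  rw [integral_comp_exp_Ioi, ← integral_log_mul_exp_neg_mul hs]
  congr 1; ext u
  rw [smul_eq_mul, mul_left_comm, exp_mul_rpow_exp, Real.log_exp]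

theorem integrableOn_log_log_mul_rpow {s : ℝ} (hs : 0 < s) :
    IntegrableOn (fun x => log (log x) * x ^ (-s - 1)) (Set.Ioi 1) := by
  rw [integrableOn_comp_exp_Ioi]
  convert integrableOn_log_mul_exp_neg_mul hs using 2 with u
  rw [smul_eq_mul, mul_left_comm, exp_mul_rpow_exp, Real.log_exp]

theorem integral_rpow_Ioi_one {s : ℝ} (hs : 0 < s) :
    ∫ x in Set.Ioi (1 : ℝ), x ^ (-s - 1) = 1 / s := by
  rw [integral_Ioi_rpow_of_lt (by linarith) one_pos]
  simp

/-- Abelian theorem: a convergent function has the same Abel mean. -/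
theorem tendsto_mul_integral_rpow {D : ℝ → ℝ} {c : ℝ} (hD : Tendsto D atTop (𝓝 c))
    (hintg : ∀ s : ℝ, 0 < s → IntegrableOn (fun x => D x * x ^ (-s - 1)) (Set.Ioi 1)) :
    Tendsto (fun s => s * ∫ x in Set.Ioi 1, D x * x ^ (-s - 1)) (𝓝[>] 0) (𝓝 c) := by
  rw [Metric.tendsto_nhds]
  intro ε hε
  obtain ⟨T, hT⟩ := (Metric.tendsto_atTop.1 hD) (ε / 2) (by positivity)
  set T' := max T 1
  have hone : ∀ s : ℝ, 0 < s → IntegrableOn (fun x : ℝ => x ^ (-s - 1)) (Set.Ioi 1) := fun s hs =>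
    integrableOn_Ioi_rpow_of_lt (by linarith) one_pos
  have hint2 : ∀ s : ℝ, 0 < s → IntegrableOn (fun x => (D x - c) * x ^ (-s - 1)) (Set.Ioi 1) := by
    intro s hs
    simp only [sub_mul]
    exact (hintg s hs).sub ((hone s hs).const_mul c)
  have hnorm : ∀ s : ℝ, 0 < s → IntegrableOn (fun x => |D x - c| * x ^ (-s - 1)) (Set.Ioi 1) := by
    intro s hs
    refine (hint2 s hs).norm.congr ?_
    refine (ae_restrict_iff' measurableSet_Ioi).2 (Eventually.of_forall fun x hx => ?_)
    have hx0 : (0 : ℝ) < x := by linarith [Set.mem_Ioi.1 hx]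
    simp only
    rw [norm_mul, norm_eq_abs, norm_eq_abs, abs_of_pos (Real.rpow_pos_of_pos hx0 _)]
  set K := ∫ x in Set.Ioc 1 T', |D x - c| * (T' ^ 2 * x ^ (-(1:ℝ) - 1)) with hK
  have hKi : IntegrableOn (fun x => |D x - c| * (T' ^ 2 * x ^ (-(1:ℝ) - 1))) (Set.Ioc 1 T') := by
    have : IntegrableOn (fun x => T' ^ 2 * (|D x - c| * x ^ (-(1:ℝ) - 1))) (Set.Ioc 1 T') :=
      ((hnorm 1 one_pos).mono_set Set.Ioc_subset_Ioi_self).const_mul _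
    refine this.congr_fun (fun x _ => ?_) measurableSet_Ioc
    simp only; ring
  have hlim : Tendsto (fun s : ℝ => s * K) (𝓝[>] 0) (𝓝 0) := by
    have : Tendsto (fun s : ℝ => s * K) (𝓝 0) (𝓝 (0 * K)) := tendsto_id.mul_const K
    rw [zero_mul] at this
    exact this.mono_left nhdsWithin_le_nhds
  filter_upwards [self_mem_nhdsWithin, hlim.eventually (gt_mem_nhds (half_pos hε))] with s hs hsK
  have hs0 : 0 < s := hs
  have hT1 : (1 : ℝ) ≤ T' := le_max_right _ _
  have e1 : s * (∫ x in Set.Ioi 1, D x * x ^ (-s - 1)) - c =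
      s * ∫ x in Set.Ioi 1, (D x - c) * x ^ (-s - 1) := by
    simp only [sub_mul]
    rw [integral_sub (hintg s hs0) ((hone s hs0).const_mul c), integral_const_mul,
      integral_rpow_Ioi_one hs0]
    field_simp
  have e2 : ‖∫ x in Set.Ioi 1, (D x - c) * x ^ (-s - 1)‖ ≤
      ∫ x in Set.Ioi 1, |D x - c| * x ^ (-s - 1) := by
    refine (norm_integral_le_integral_norm _).trans (le_of_eq ?_)
    apply setIntegral_congr_fun measurableSet_Ioi
    intro x hx
    have hx0 : (0 : ℝ) < x := by linarith [Set.mem_Ioi.1 hx]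
    simp only
    rw [norm_mul, norm_eq_abs, norm_eq_abs, abs_of_pos (Real.rpow_pos_of_pos hx0 _)]
  have e3 : ∫ x in Set.Ioi 1, |D x - c| * x ^ (-s - 1) =
      (∫ x in Set.Ioc 1 T', |D x - c| * x ^ (-s - 1)) +
        ∫ x in Set.Ioi T', |D x - c| * x ^ (-s - 1) := by
    rw [← Set.Ioc_union_Ioi_eq_Ioi hT1, setIntegral_union (by
      rw [Set.disjoint_left]; intro x hx hx'; exact absurd hx.2 (not_le.2 hx')) measurableSet_Ioi
      ((hnorm s hs0).mono_set Set.Ioc_subset_Ioi_self)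
      ((hnorm s hs0).mono_set (Set.Ioi_subset_Ioi hT1))]
  have e4 : ∫ x in Set.Ioc 1 T', |D x - c| * x ^ (-s - 1) ≤ K := by
    refine setIntegral_mono_on ((hnorm s hs0).mono_set Set.Ioc_subset_Ioi_self) hKi
      measurableSet_Ioc fun x hx => ?_
    have hx0 : (0 : ℝ) < x := by linarith [hx.1]
    refine mul_le_mul_of_nonneg_left ?_ (abs_nonneg _)
    calc x ^ (-s - 1) ≤ 1 := Real.rpow_le_one_of_one_le_of_nonpos hx.1.le (by linarith)
      _ = x ^ 2 * x ^ (-(1:ℝ) - 1) := by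
        rw [← Real.rpow_natCast x 2, ← Real.rpow_add hx0]; norm_num
      _ ≤ T' ^ 2 * x ^ (-(1:ℝ) - 1) := by
        gcongr
        exact hx.2
  have e5 : ∫ x in Set.Ioi T', |D x - c| * x ^ (-s - 1) ≤ ε / 2 * (1 / s) := by
    have : ∫ x in Set.Ioi T', |D x - c| * x ^ (-s - 1) ≤
        ∫ x in Set.Ioi T', ε / 2 * x ^ (-s - 1) := by
      refine setIntegral_mono_on ((hnorm s hs0).mono_set (Set.Ioi_subset_Ioi hT1))
        (((hone s hs0).mono_set (Set.Ioi_subset_Ioi hT1)).const_mul _) measurableSet_Ioi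
        fun x hx => ?_
      have hx1 : T' < x := hx
      have hx0 : (0 : ℝ) < x := by linarith
      refine mul_le_mul_of_nonneg_right ?_ (Real.rpow_pos_of_pos hx0 _).le
      have := hT x ((le_max_left _ _).trans hx1.le)
      rw [Real.dist_eq] at this
      exact this.le
    refine this.trans ?_
    rw [integral_const_mul]
    refine mul_le_mul_of_nonneg_left ?_ (by positivity)
    rw [← integral_rpow_Ioi_one hs0]
    refine setIntegral_mono_set (hone s hs0) ?_ (Set.Ioi_subset_Ioi hT1).eventuallyLE
    refine (ae_restrict_iff' measurableSet_Ioi).2 (Eventually.of_forall fun x hx => ?_)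
    have hx0 : (0 : ℝ) < x := by linarith [Set.mem_Ioi.1 hx]
    exact (Real.rpow_pos_of_pos hx0 _).le
  rw [Real.dist_eq, e1, abs_mul, abs_of_pos hs0]
  rw [norm_eq_abs] at e2
  calc s * |∫ x in Set.Ioi 1, (D x - c) * x ^ (-s - 1)| ≤ s * (K + ε / 2 * (1 / s)) := by
        gcongr; linarith
    _ = s * K + ε / 2 := by field_simp
    _ < ε := by linarith

/-- **Mertens' theorem** for `Λ(n)/(n log n)`. -/
theorem tendsto_primeSum_sub_log_log :
    Tendsto (fun x => primeSum x - log (log x)) atTop (𝓝 eulerMascheroniConstant) := by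
  obtain ⟨c, hc⟩ := exists_tendsto_primeSum_sub_log_log
  have h1 := tendsto_mul_integral_rpow hc (fun s hs => by
    simp only [sub_mul]
    exact (integrableOn_primeSum hs).sub (integrableOn_log_log_mul_rpow hs))
  have h2 : ∀ s : ℝ, 0 < s →
      s * ∫ x in Set.Ioi 1, (primeSum x - log (log x)) * x ^ (-s - 1) =
        log (s * (riemannZeta (1 + s)).re) + eulerMascheroniConstant := by
    intro s hs
    simp only [sub_mul]
    rw [integral_sub (integrableOn_primeSum hs) (integrableOn_log_log_mul_rpow hs),
      integral_log_log_mul_rpow hs, riemannZeta_one_add_eq_exp hs, Complex.ofReal_re,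
      Real.log_mul hs.ne' (Real.exp_pos _).ne', Real.log_exp]
    field_simp
    ring
  have h3 : Tendsto (fun s : ℝ => log (s * (riemannZeta (1 + s)).re) + eulerMascheroniConstant)
      (𝓝[>] 0) (𝓝 (0 + eulerMascheroniConstant)) := by
    refine Tendsto.add ?_ tendsto_const_nhds
    have h4 : Tendsto (fun s : ℝ => ((1 : ℂ) + s)) (𝓝[>] 0) (𝓝[≠] 1) := by
      refine tendsto_nhdsWithin_iff.2 ⟨?_, ?_⟩
      · have : Tendsto (fun s : ℝ => ((1 : ℂ) + s)) (𝓝 0) (𝓝 (1 + (0 : ℝ))) :=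
          (Continuous.tendsto (by fun_prop) 0)
        simp only [Complex.ofReal_zero, add_zero] at this
        exact this.mono_left nhdsWithin_le_nhds
      · filter_upwards [self_mem_nhdsWithin] with s hs
        simpa using (ne_of_gt hs)
    have h5 := (Complex.continuous_re.tendsto _).comp (riemannZeta_residue_one.comp h4)
    have h6 := (Real.continuousAt_log (by simp : (1 : ℂ).re ≠ 0)).tendsto.comp h5
    simp only [Complex.one_re, Real.log_one] at h6
    refine h6.congr fun s => ?_
    simp
  have h4 := tendsto_nhds_unique (h1.congr' (by
    filter_upwards [self_mem_nhdsWithin] with s hs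
    exact h2 s hs)) h3
  rw [zero_add] at h4
  exact h4 ▸ hc

/-- `log (σ(p^j)/p^j)`. -/
def logSigma (p j : ℕ) : ℝ := log (∑ i ∈ range (j + 1), ((p : ℝ)⁻¹) ^ i)

theorem logSigma_zero (p : ℕ) : logSigma p 0 = 0 := by simp [logSigma]

theorem log_sigma1_div {n : ℕ} (hn : n ≠ 0) :
    log (sigma1 n / n) = ∑ p ∈ n.primeFactors, logSigma p (n.factorization p) := by
  have h1 : (sigma1 n : ℝ) =
      ∏ p ∈ n.primeFactors, ∑ k ∈ range (n.factorization p + 1), (p : ℝ) ^ k := by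
    have := Nat.sum_divisors hn
    simp only [sigma1, id]
    rw [this]; push_cast; rfl
  have h2 : (n : ℝ) = ∏ p ∈ n.primeFactors, (p : ℝ) ^ (n.factorization p) := by
    conv_lhs => rw [← Nat.prod_factorization_pow_eq_self hn]
    rw [Nat.prod_factorization_eq_prod_primeFactors]
    push_cast; rfl
  rw [h1]
  conv_lhs => rw [h2]
  rw [← Finset.prod_div_distrib, Real.log_prod]
  · refine Finset.sum_congr rfl fun p hp => ?_
    have hp0 : (p : ℝ) ≠ 0 := by exact_mod_cast (Nat.prime_of_mem_primeFactors hp).ne_zero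
    rw [logSigma]
    congr 1
    rw [Finset.sum_div, ← Finset.sum_range_reflect]
    refine Finset.sum_congr rfl fun i hi => ?_
    have hi' : i ≤ n.factorization p := by simp at hi; omega
    rw [show n.factorization p + 1 - 1 - i = n.factorization p - i by omega,
      pow_sub₀ _ hp0 hi', inv_pow]
    field_simp
  · intro p hp
    have hp0 : (0 : ℝ) < p := by exact_mod_cast (Nat.prime_of_mem_primeFactors hp).pos
    have : (0:ℝ) < ∑ k ∈ range (n.factorization p + 1), (p : ℝ) ^ k :=
      Finset.sum_pos (fun i _ => by positivity) ⟨0, by simp⟩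
    positivity

theorem log_natCast_eq {n : ℕ} (hn : n ≠ 0) :
    log n = ∑ p ∈ n.primeFactors, n.factorization p * log p := by
  conv_lhs => rw [← Nat.prod_factorization_pow_eq_self hn]
  rw [Nat.prod_factorization_eq_prod_primeFactors]
  push_cast
  rw [Real.log_prod]
  · simp
  · intro p hp
    have hp0 : (p : ℝ) ≠ 0 := by exact_mod_cast (Nat.prime_of_mem_primeFactors hp).ne_zero
    positivity

theorem logSigma_eq {p : ℕ} (hp : 2 ≤ p) (j : ℕ) :
    logSigma p j = -log (1 - (p : ℝ)⁻¹) + log (1 - ((p : ℝ)⁻¹) ^ (j + 1)) := by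
  have hp' : (2 : ℝ) ≤ p := by exact_mod_cast hp
  have h1 : (p : ℝ)⁻¹ < 1 := inv_lt_one_of_one_lt₀ (by linarith)
  have h0 : 0 < (p : ℝ)⁻¹ := by positivity
  have h2 : ((p : ℝ)⁻¹) ^ (j + 1) < 1 := pow_lt_one₀ h0.le h1 (by omega)
  rw [logSigma, geom_sum_eq h1.ne, ← neg_div_neg_eq, neg_sub, neg_sub,
    Real.log_div (by linarith) (by linarith)]
  ring

theorem logSigma_le {p : ℕ} (hp : 2 ≤ p) (j : ℕ) : logSigma p j ≤ -log (1 - (p : ℝ)⁻¹) := by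
  have hp' : (2 : ℝ) ≤ p := by exact_mod_cast hp
  have h1 : (p : ℝ)⁻¹ < 1 := inv_lt_one_of_one_lt₀ (by linarith)
  have h0 : 0 < (p : ℝ)⁻¹ := by positivity
  have h2 : ((p : ℝ)⁻¹) ^ (j + 1) < 1 := pow_lt_one₀ h0.le h1 (by omega)
  rw [logSigma_eq hp]
  have : log (1 - ((p : ℝ)⁻¹) ^ (j + 1)) ≤ 0 :=
    Real.log_nonpos (by linarith) (by linarith [pow_pos h0 (j + 1)])
  linarith

/-- The increment of `logSigma`. -/
theorem logSigma_succ {p : ℕ} (hp : 2 ≤ p) (j : ℕ) :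
    logSigma p (j + 1) - logSigma p j = log (1 + 1 / ∑ i ∈ Finset.Icc 1 (j + 1), (p : ℝ) ^ i) := by
  have hp' : (0 : ℝ) < p := by exact_mod_cast (by omega : 0 < p)
  have hpos : ∀ k, (0:ℝ) < ∑ i ∈ range (k + 1), ((p : ℝ)⁻¹) ^ i := fun k =>
    Finset.sum_pos (fun i _ => by positivity) ⟨0, by simp⟩
  rw [logSigma, logSigma, ← Real.log_div (hpos _).ne' (hpos _).ne', Finset.sum_range_succ _ (j + 1)]
  congr 1
  have h1 : ∑ i ∈ Finset.Icc 1 (j + 1), (p : ℝ) ^ i =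
      (p : ℝ) ^ (j + 1) * ∑ i ∈ range (j + 1), ((p : ℝ)⁻¹) ^ i := by
    have h2 : ∀ k : ℕ, ∑ i ∈ Finset.Icc 1 k, (p : ℝ) ^ i =
        (p : ℝ) ^ k * ∑ i ∈ range k, ((p : ℝ)⁻¹) ^ i := by
      intro k
      induction k with
      | zero => simp
      | succ k ih =>
        rw [Finset.sum_Icc_succ_top (by omega), ih, Finset.sum_range_succ', Finset.mul_sum,
          mul_add, Finset.mul_sum]
        congr 1
        · refine Finset.sum_congr rfl fun i _ => ?_
          rw [pow_succ, pow_succ]; field_simp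
        · simp
    exact h2 _
  rw [h1, add_div, div_self (hpos _).ne', inv_pow]
  field_simp

theorem logSigma_succ_le {p : ℕ} (hp : 2 ≤ p) (j : ℕ) :
    logSigma p (j + 1) - logSigma p j ≤ log (1 + 1 / p) := by
  rw [logSigma_succ hp]
  have hp' : (0 : ℝ) < p := by exact_mod_cast (by omega : 0 < p)
  have h1 : (p : ℝ) ≤ ∑ i ∈ Finset.Icc 1 (j + 1), (p : ℝ) ^ i := by
    have := Finset.single_le_sum (f := fun i => (p : ℝ) ^ i) (s := Finset.Icc 1 (j + 1))
      (fun i _ => by positivity) (a := 1) (by simp)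
    simpa using this
  apply Real.log_le_log (by positivity)
  gcongr

theorem logSigma_le_mul {p : ℕ} (hp : 2 ≤ p) (j : ℕ) : logSigma p j ≤ j * log (1 + 1 / p) := by
  induction j with
  | zero => simp [logSigma_zero]
  | succ k ih =>
    have := logSigma_succ_le hp k
    push_cast
    linarith

theorem sum_Icc_pow_le {p : ℕ} (hp : 2 ≤ p) (j : ℕ) :
    ∑ i ∈ Finset.Icc 1 j, (p : ℝ) ^ i ≤ 2 * (p : ℝ) ^ j := by
  have hp' : (2 : ℝ) ≤ p := by exact_mod_cast hp
  induction j with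
  | zero => simp
  | succ k ih =>
    rw [Finset.sum_Icc_succ_top (by omega), pow_succ]
    nlinarith [pow_pos (by linarith : (0:ℝ) < p) k]

/-- `ε(x) = log(1+1/x)/log x`. -/
def eps (x : ℝ) : ℝ := log (1 + 1 / x) / log x

theorem eps_pos {x : ℝ} (hx : 1 < x) : 0 < eps x :=
  div_pos (Real.log_pos (by simp; linarith)) (Real.log_pos hx)

theorem eps_anti {x y : ℝ} (hx : 1 < x) (hxy : x ≤ y) : eps y ≤ eps x := by
  have : 0 < x := by linarith
  have : 0 < y := by linarith
  apply div_le_div₀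
  · exact Real.log_nonneg (by simp; linarith)
  · apply Real.log_le_log (by positivity)
    gcongr
  · exact Real.log_pos hx
  · exact Real.log_le_log (by linarith) hxy

theorem eps_mul_log_le_logSigma_succ {p j : ℕ} (hp : 2 ≤ p) {x : ℝ}
    (hx : (p : ℝ) ^ (j + 1) ≤ x) :
    eps x * log p ≤ logSigma p (j + 1) - logSigma p j := by
  have hp' : (2 : ℝ) ≤ p := by exact_mod_cast hp
  have hlp : 0 < log p := Real.log_pos (by linarith)
  set X := (p : ℝ) ^ (j + 1) with hX
  have hX1 : 1 < X := one_lt_pow₀ (by linarith) (by omega)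
  have h1 : eps x * log p ≤ eps X * log p := by
    gcongr; exact eps_anti hX1 hx
  refine h1.trans ?_
  have h2 : eps X * log p = log (1 + 1 / X) / (j + 1) := by
    rw [eps, hX, Real.log_pow]; push_cast; field_simp
  rw [h2, logSigma_succ hp, div_le_iff₀ (by positivity), mul_comm, ← Nat.cast_add_one,
    ← Real.log_pow]
  apply Real.log_le_log (by positivity)
  rcases Nat.eq_zero_or_pos j with rfl | hj
  · simp [hX]
  · have h3 := sum_Icc_pow_le hp (j + 1)
    have h4 : 0 < ∑ i ∈ Finset.Icc 1 (j + 1), (p : ℝ) ^ i :=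
      Finset.sum_pos (fun i _ => by positivity) ⟨1, by simp⟩
    calc 1 + 1 / X ≤ (1 + 1 / (2 * X)) ^ 2 := by
          have : 0 ≤ (1 / (2 * X)) ^ 2 := by positivity
          have e : 1 / X = 2 * (1 / (2 * X)) := by field_simp
          rw [e]; nlinarith
      _ ≤ (1 + 1 / (2 * X)) ^ (j + 1) := by
          apply pow_le_pow_right₀ _ (by omega)
          have : 0 ≤ 1 / (2 * X) := by positivity
          linarith
      _ ≤ _ := by gcongr

/-- The saving at the prime `p`. -/
def saving (x : ℝ) (p : ℕ) : ℝ :=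
  min (eps x * log p) (-log (1 - ((p : ℝ)⁻¹) ^ (Nat.log p ⌊x⌋₊ + 1)))

theorem logSigma_add_le {p k j : ℕ} (hp : 2 ≤ p) {x : ℝ} (hx : (p : ℝ) ^ k ≤ x) (hjk : j ≤ k) :
    logSigma p j + eps x * ((k - j : ℝ) * log p) ≤ logSigma p k := by
  induction k, hjk using Nat.le_induction with
  | base => simp
  | succ k hk ih =>
    have hp' : (1 : ℝ) ≤ p := by exact_mod_cast (by omega : 1 ≤ p)
    have h1 := ih (le_trans (pow_le_pow_right₀ hp' (by omega)) hx)
    have h2 := eps_mul_log_le_logSigma_succ hp hx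
    push_cast
    linarith

theorem pow_log_floor_le {p : ℕ} {x : ℝ} (hpx : (p : ℝ) ≤ x) (hp : 2 ≤ p) :
    (p : ℝ) ^ (Nat.log p ⌊x⌋₊) ≤ x := by
  have hx0 : (0:ℝ) ≤ x := le_trans (by positivity) hpx
  have : p ≤ ⌊x⌋₊ := Nat.le_floor hpx
  have h := Nat.pow_log_le_self p (x := ⌊x⌋₊) (by omega)
  have h2 : ((p ^ Nat.log p ⌊x⌋₊ : ℕ) : ℝ) ≤ x :=
    le_trans (by exact_mod_cast h) (Nat.floor_le hx0)
  exact_mod_cast h2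

theorem lt_pow_log_floor {p : ℕ} {x : ℝ} (hp : 2 ≤ p) :
    x < (p : ℝ) ^ (Nat.log p ⌊x⌋₊ + 1) := by
  have h := Nat.lt_pow_succ_log_self (b := p) (by omega) ⌊x⌋₊
  have h2 : (⌊x⌋₊ : ℝ) + 1 ≤ (p : ℝ) ^ (Nat.log p ⌊x⌋₊ + 1) := by exact_mod_cast h
  exact lt_of_lt_of_le (Nat.lt_floor_add_one x) h2

theorem logSigma_le_small {p : ℕ} (hp : 2 ≤ p) {x : ℝ} (hpx : (p : ℝ) ≤ x) (j : ℕ) :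
    logSigma p j ≤ eps x * (j * log p) +
      (-log (1 - (p : ℝ)⁻¹) - saving x p - eps x * (Nat.log p ⌊x⌋₊ * log p)) := by
  have hp' : (2 : ℝ) ≤ p := by exact_mod_cast hp
  have hlp : 0 < log p := Real.log_pos (by linarith)
  have he : 0 < eps x := eps_pos (by linarith)
  set k := Nat.log p ⌊x⌋₊ with hk
  rcases lt_or_ge k j with h | h
  · have h1 := logSigma_le hp j
    have h2 : saving x p ≤ eps x * log p := min_le_left _ _
    have h3 : (k : ℝ) + 1 ≤ j := by exact_mod_cast h
    have h4 : eps x * ((k + 1) * log p) ≤ eps x * (j * log p) := by gcongr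
    linarith
  · have h1 := logSigma_add_le hp (pow_log_floor_le hpx hp) h
    have h2 : saving x p ≤ -log (1 - ((p : ℝ)⁻¹) ^ (k + 1)) := min_le_right _ _
    rw [logSigma_eq hp k] at h1
    linarith

theorem logSigma_le_large {p : ℕ} (hp : 2 ≤ p) {x : ℝ} (hx : 1 < x) (hpx : x < (p : ℝ)) (j : ℕ) :
    logSigma p j ≤ eps x * (j * log p) := by
  have hp' : (2 : ℝ) ≤ p := by exact_mod_cast hp
  have hlp : 0 < log p := Real.log_pos (by linarith)
  have h1 := logSigma_le_mul hp j
  have h2 : log (1 + 1 / p) = eps p * log p := by rw [eps]; field_simp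
  rw [h2] at h1
  have h3 := eps_anti hx hpx.le
  calc logSigma p j ≤ j * (eps p * log p) := h1
    _ ≤ j * (eps x * log p) := by gcongr
    _ = _ := by ring

theorem psi_eq_sum_primesLE (x : ℝ) :
    Chebyshev.psi x = ∑ p ∈ Nat.primesLE ⌊x⌋₊, Nat.log p ⌊x⌋₊ * log p := by
  rw [← Chebyshev.psi_eq_sum_mul_log_prime, Chebyshev.psi, Chebyshev.psi, Nat.floor_natCast]

/-- The basic upper bound for `log (σ(n)/n)`, for an arbitrary parameter `x`. -/
theorem log_sigma1_div_le {n : ℕ} (hn : n ≠ 0) {x : ℝ} (hx : 1 < x) :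
    log (sigma1 n / n) ≤ eps x * (log n - Chebyshev.psi x) +
      ∑ p ∈ Nat.primesLE ⌊x⌋₊, (-log (1 - (p : ℝ)⁻¹) - saving x p) := by
  set U := n.primeFactors ∪ Nat.primesLE ⌊x⌋₊ with hU
  have hUp : ∀ p ∈ U, p.Prime := by
    intro p hp
    rcases Finset.mem_union.1 hp with h | h
    · exact Nat.prime_of_mem_primeFactors h
    · exact Nat.prime_of_mem_primesLE h
  have hfac : ∀ p ∈ U, p ∉ n.primeFactors → n.factorization p = 0 := by
    intro p _ hp
    rwa [← Nat.support_factorization, Finsupp.notMem_support_iff] at hp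
  have h1 : log (sigma1 n / n) = ∑ p ∈ U, logSigma p (n.factorization p) := by
    rw [log_sigma1_div hn]
    refine Finset.sum_subset Finset.subset_union_left fun p hp hp' => ?_
    rw [hfac p hp hp', logSigma_zero]
  have h2 : log n = ∑ p ∈ U, n.factorization p * log p := by
    rw [log_natCast_eq hn]
    refine Finset.sum_subset Finset.subset_union_left fun p hp hp' => ?_
    rw [hfac p hp hp']; simp
  have h3 : ∀ p ∈ U, logSigma p (n.factorization p) ≤ eps x * (n.factorization p * log p) +
      if p ∈ Nat.primesLE ⌊x⌋₊ then
        (-log (1 - (p : ℝ)⁻¹) - saving x p - eps x * (Nat.log p ⌊x⌋₊ * log p)) else 0 := by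
    intro p hp
    have hp2 := (hUp p hp).two_le
    split_ifs with h
    · refine logSigma_le_small hp2 ?_ _
      exact (Nat.le_floor_iff (by linarith)).1 (Nat.le_of_mem_primesLE h)
    · rw [add_zero]
      refine logSigma_le_large hp2 hx ?_ _
      by_contra h'
      exact h (Nat.mem_primesLE.2 ⟨Nat.le_floor (not_lt.1 h'), hUp p hp⟩)
  rw [h1]
  refine (Finset.sum_le_sum h3).trans (le_of_eq ?_)
  rw [Finset.sum_add_distrib, ← Finset.mul_sum, ← h2, Finset.sum_ite_mem,
    Finset.inter_eq_right.2 Finset.subset_union_right, Finset.sum_sub_distrib, ← Finset.mul_sum,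
    ← psi_eq_sum_primesLE]
  ring

/-- Sums against `Λ` regrouped over primes. -/
theorem sum_vonMangoldt_mul_eq (N : ℕ) (g : ℕ → ℝ) :
    ∑ n ∈ Ioc 0 N, vonMangoldt n * g n =
      ∑ p ∈ Nat.primesLE N, ∑ j ∈ Finset.Icc 1 (Nat.log p N), log p * g (p ^ j) := by
  rw [Finset.sum_sigma']
  symm
  refine Finset.sum_bij_ne_zero (fun x _ _ => x.1 ^ x.2) ?_ ?_ ?_ ?_
  · rintro ⟨p, j⟩ h _
    simp only [Finset.mem_sigma, Finset.mem_Icc, Nat.mem_primesLE] at h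
    have hp := h.1.2.pos
    exact Finset.mem_Ioc.2 ⟨by positivity, Nat.pow_le_of_le_log (by have := h.1.2.two_le; omega) h.2.2⟩
  · rintro ⟨p, j⟩ h _ ⟨q, i⟩ h' _ he
    simp only [Finset.mem_sigma, Finset.mem_Icc, Nat.mem_primesLE] at h h'
    simp only at he
    have hpq : p = q := (Nat.prime_dvd_prime_iff_eq h.1.2 h'.1.2).1 <|
      h.1.2.dvd_of_dvd_pow (he ▸ dvd_pow_self p (by omega))
    subst hpq
    have : j = i := Nat.pow_right_injective h.1.2.two_le he
    rw [this]
  · intro n hn hne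
    have hpp : IsPrimePow n := by
      rw [← ArithmeticFunction.vonMangoldt_ne_zero_iff]; exact left_ne_zero_of_mul hne
    obtain ⟨p, k, hp, hk, rfl⟩ := (isPrimePow_nat_iff _).1 hpp
    have hn' := (Finset.mem_Ioc.1 hn).2
    refine ⟨⟨p, k⟩, ?_, ?_, rfl⟩
    · simp only [Finset.mem_sigma, Finset.mem_Icc, Nat.mem_primesLE]
      exact ⟨⟨(Nat.le_self_pow (by omega) p).trans hn', hp⟩, hk, Nat.le_log_of_pow_le hp.one_lt hn'⟩
    · simpa [ArithmeticFunction.vonMangoldt_apply_pow hk.ne', ArithmeticFunction.vonMangoldt_apply_prime hp]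
        using hne
  · rintro ⟨p, j⟩ h _
    simp only [Finset.mem_sigma, Finset.mem_Icc, Nat.mem_primesLE] at h
    simp only
    rw [ArithmeticFunction.vonMangoldt_apply_pow (by omega), ArithmeticFunction.vonMangoldt_apply_prime h.1.2]

/-- The tail `∑_{j > k} 1/(j p^j)`, with `k` the largest exponent with `p^k ≤ x`. -/
def powTail (x : ℝ) (p : ℕ) : ℝ :=
  -log (1 - (p : ℝ)⁻¹) - ∑ j ∈ range (Nat.log p ⌊x⌋₊), ((p : ℝ)⁻¹) ^ (j + 1) / (j + 1)

theorem primeSum_eq_sum_primesLE (x : ℝ) : primeSum x = ∑ p ∈ Nat.primesLE ⌊x⌋₊,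
    ∑ j ∈ range (Nat.log p ⌊x⌋₊), ((p : ℝ)⁻¹) ^ (j + 1) / (j + 1) := by
  have h : primeSum x = ∑ n ∈ Ioc 0 ⌊x⌋₊, vonMangoldt n * (fun n : ℕ => 1 / (n * log n)) n := by
    refine Finset.sum_congr rfl fun n _ => ?_
    simp only [mul_one_div]
  rw [h, sum_vonMangoldt_mul_eq]
  refine Finset.sum_congr rfl fun p hp => ?_
  have hp2 : (2 : ℝ) ≤ p := by exact_mod_cast (Nat.prime_of_mem_primesLE hp).two_le
  have hl : 0 < log p := Real.log_pos (by linarith)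
  have hIcc : Finset.Icc 1 (Nat.log p ⌊x⌋₊) = Finset.Ico (0 + 1) (Nat.log p ⌊x⌋₊ + 1) := by
    ext; simp
  rw [hIcc, ← Finset.sum_Ico_add', Finset.range_eq_Ico]
  refine Finset.sum_congr rfl fun j _ => ?_
  push_cast
  rw [Real.log_pow, inv_pow]
  push_cast
  field_simp

theorem sum_neg_log_eq (x : ℝ) : ∑ p ∈ Nat.primesLE ⌊x⌋₊, -log (1 - (p : ℝ)⁻¹) =
    primeSum x + ∑ p ∈ Nat.primesLE ⌊x⌋₊, powTail x p := by
  rw [primeSum_eq_sum_primesLE, ← Finset.sum_add_distrib]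
  refine Finset.sum_congr rfl fun p _ => ?_
  rw [powTail]; ring

theorem neg_log_one_sub_sub_sum_nonneg {q : ℝ} (h0 : 0 ≤ q) (h1 : q < 1) (k : ℕ) :
    0 ≤ -log (1 - q) - ∑ j ∈ range k, q ^ (j + 1) / (j + 1) := by
  have h := Real.hasSum_pow_div_log_of_abs_lt_one (x := q) (by rwa [abs_of_nonneg h0])
  have := h.summable.sum_le_tsum (range k) (fun i _ => by positivity)
  rw [h.tsum_eq] at this
  linarith

theorem neg_log_one_sub_sub_sum_le {q : ℝ} (h0 : 0 ≤ q) (h1 : q < 1) (k : ℕ) :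
    -log (1 - q) - ∑ j ∈ range k, q ^ (j + 1) / (j + 1) ≤ q ^ (k + 1) / ((k + 1) * (1 - q)) := by
  have h := Real.hasSum_pow_div_log_of_abs_lt_one (x := q) (by rwa [abs_of_nonneg h0])
  have h2 := (hasSum_nat_add_iff' k).2 h
  have h3 : HasSum (fun n : ℕ => q ^ (k + 1) / (k + 1) * q ^ n) (q ^ (k + 1) / (k + 1) * (1 - q)⁻¹) :=
    (hasSum_geometric_of_lt_one h0 h1).mul_left _
  have h4 := hasSum_le (fun n => ?_) h2 h3
  · refine h4.trans (le_of_eq ?_)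
    have : 1 - q ≠ 0 := by linarith
    field_simp
  · rw [div_mul_eq_mul_div, ← pow_add, show k + 1 + n = n + k + 1 by ring]
    gcongr
    linarith

theorem inv_prime_bounds {p : ℕ} (hp : p.Prime) : 0 < (p : ℝ)⁻¹ ∧ (p : ℝ)⁻¹ ≤ 1 / 2 := by
  have hp2 : (2 : ℝ) ≤ p := by exact_mod_cast hp.two_le
  refine ⟨by positivity, ?_⟩
  rw [inv_le_comm₀ (by positivity) (by positivity)]
  norm_num; exact hp.two_le

theorem powTail_nonneg {p : ℕ} (hp : p.Prime) (x : ℝ) : 0 ≤ powTail x p := by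
  obtain ⟨h0, h1⟩ := inv_prime_bounds hp
  exact neg_log_one_sub_sub_sum_nonneg h0.le (by linarith) _

theorem powTail_le {p : ℕ} (hp : p.Prime) (x : ℝ) : powTail x p ≤
    ((p : ℝ)⁻¹) ^ (Nat.log p ⌊x⌋₊ + 1) / ((Nat.log p ⌊x⌋₊ + 1) * (1 - (p : ℝ)⁻¹)) := by
  obtain ⟨h0, h1⟩ := inv_prime_bounds hp
  exact neg_log_one_sub_sub_sum_le h0.le (by linarith) _

theorem one_le_log_of_mem_primesLE {p N : ℕ} (hp : p ∈ Nat.primesLE N) : 1 ≤ Nat.log p N :=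
  Nat.log_pos (Nat.prime_of_mem_primesLE hp).one_lt (Nat.le_of_mem_primesLE hp)

theorem powTail_le_pow {p : ℕ} {x : ℝ} (hp : p ∈ Nat.primesLE ⌊x⌋₊) :
    powTail x p ≤ ((p : ℝ)⁻¹) ^ (Nat.log p ⌊x⌋₊ + 1) := by
  obtain ⟨h0, h1⟩ := inv_prime_bounds (Nat.prime_of_mem_primesLE hp)
  have hk : (1 : ℝ) ≤ Nat.log p ⌊x⌋₊ := by exact_mod_cast one_le_log_of_mem_primesLE hp
  refine (powTail_le (Nat.prime_of_mem_primesLE hp) x).trans (div_le_self (by positivity) ?_)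
  nlinarith

theorem sum_inv_pow_le {x : ℝ} (hx : 1 ≤ x) :
    ∑ p ∈ Nat.primesLE ⌊x⌋₊, ((p : ℝ)⁻¹) ^ (Nat.log p ⌊x⌋₊ + 1) ≤ 3 / √x := by
  have hs : 0 < √x := Real.sqrt_pos.2 (by linarith)
  set S := Nat.primesLE ⌊x⌋₊
  rw [← Finset.sum_filter_add_sum_filter_not S (fun p => p ≤ ⌊√x⌋₊)]
  have h1 : ∑ p ∈ S with p ≤ ⌊√x⌋₊, ((p : ℝ)⁻¹) ^ (Nat.log p ⌊x⌋₊ + 1) ≤ 1 / √x := by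
    have hc : ((S.filter (fun p => p ≤ ⌊√x⌋₊)).card : ℝ) ≤ √x := by
      refine le_trans ?_ (Nat.floor_le hs.le)
      have : S.filter (fun p => p ≤ ⌊√x⌋₊) ⊆ Finset.Icc 1 ⌊√x⌋₊ := by
        intro p hp
        rw [Finset.mem_filter] at hp
        exact Finset.mem_Icc.2 ⟨(Nat.prime_of_mem_primesLE hp.1).one_le, hp.2⟩
      have := Finset.card_le_card this
      rw [Nat.card_Icc] at this
      exact_mod_cast this
    calc _ ≤ ∑ p ∈ S with p ≤ ⌊√x⌋₊, x⁻¹ := by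
          refine Finset.sum_le_sum fun p hp => ?_
          rw [inv_pow]
          exact inv_anti₀ (by linarith)
            (lt_pow_log_floor (Nat.prime_of_mem_primesLE (Finset.mem_filter.1 hp).1).two_le).le
      _ ≤ √x * x⁻¹ := by
          rw [Finset.sum_const, nsmul_eq_mul]; gcongr
      _ = _ := by
          rw [← div_eq_mul_inv, Real.sqrt_div_self']
  have h2 : ∑ p ∈ S with ¬ p ≤ ⌊√x⌋₊, ((p : ℝ)⁻¹) ^ (Nat.log p ⌊x⌋₊ + 1) ≤ 2 / √x := by
    calc _ ≤ ∑ p ∈ S with ¬ p ≤ ⌊√x⌋₊, ((p : ℝ) ^ 2)⁻¹ := by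
          refine Finset.sum_le_sum fun p hp => ?_
          have hp := (Finset.mem_filter.1 hp).1
          obtain ⟨h0, h1⟩ := inv_prime_bounds (Nat.prime_of_mem_primesLE hp)
          rw [← inv_pow]
          exact pow_le_pow_of_le_one h0.le (by linarith) (by have := one_le_log_of_mem_primesLE hp; omega)
      _ ≤ ∑ p ∈ Finset.Ioo ⌊√x⌋₊ (⌊x⌋₊ + 1), ((p : ℝ) ^ 2)⁻¹ := by
          refine Finset.sum_le_sum_of_subset_of_nonneg ?_ fun _ _ _ => by positivity
          intro p hp
          rw [Finset.mem_filter] at hp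
          rw [Finset.mem_Ioo]
          have := Nat.le_of_mem_primesLE hp.1
          omega
      _ ≤ 2 / (⌊√x⌋₊ + 1) := sum_Ioo_inv_sq_le _ _
      _ ≤ _ := by
          gcongr; exact (Nat.lt_floor_add_one _).le
  calc _ ≤ 1 / √x + 2 / √x := add_le_add h1 h2
    _ = _ := by ring

theorem saving_nonneg {p : ℕ} {x : ℝ} (hx : 1 < x) (hp : p.Prime) : 0 ≤ saving x p := by
  obtain ⟨h0, h1⟩ := inv_prime_bounds hp
  have hp1 : (1 : ℝ) ≤ p := by exact_mod_cast hp.one_le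
  refine le_min (mul_nonneg (eps_pos hx).le (Real.log_nonneg hp1)) (neg_nonneg.2 ?_)
  have : ((p : ℝ)⁻¹) ^ (Nat.log p ⌊x⌋₊ + 1) ≤ 1 := pow_le_one₀ h0.le (by linarith)
  exact Real.log_nonpos (by linarith) (by linarith [pow_pos h0 (Nat.log p ⌊x⌋₊ + 1)])

theorem sum_powTail_le {x : ℝ} (hx : 1 ≤ x) :
    ∑ p ∈ Nat.primesLE ⌊x⌋₊, powTail x p ≤ 3 / √x :=
  (Finset.sum_le_sum fun _ hp => powTail_le_pow hp).trans (sum_inv_pow_le hx)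

theorem eps_mul_le {x : ℝ} (hx : 1 < x) : eps x * x ≤ 1 / log x := by
  have hl := Real.log_pos hx
  have : log (1 + 1 / x) ≤ 1 / x := by
    have := Real.log_le_sub_one_of_pos (x := 1 + 1 / x) (by positivity)
    linarith
  rw [eps, div_mul_eq_mul_div]
  gcongr
  calc log (1 + 1 / x) * x ≤ 1 / x * x := by gcongr
    _ = 1 := by field_simp

theorem log_sigma1_div_le_of_log {n : ℕ} (hn : 1 < log n) :
    log (sigma1 n / n) ≤ 1 / log (log n) + primeSum (log n) + 3 / √(log n) := by
  have hn0 : n ≠ 0 := by rintro rfl; norm_num at hn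
  have h := log_sigma1_div_le hn0 hn
  rw [Finset.sum_sub_distrib, sum_neg_log_eq] at h
  have h1 := sum_powTail_le hn.le
  have h2 : 0 ≤ ∑ p ∈ Nat.primesLE ⌊log n⌋₊, saving (log n) p :=
    Finset.sum_nonneg fun p hp => saving_nonneg hn (Nat.prime_of_mem_primesLE hp)
  have h3 := eps_mul_le hn
  have h4 : 0 ≤ eps (log n) * Chebyshev.psi (log n) :=
    mul_nonneg (eps_pos hn).le (Chebyshev.psi_nonneg _)
  linarith

theorem neg_log_one_sub_le {y : ℝ} (h0 : 0 ≤ y) (h1 : y ≤ 1 / 2) : -log (1 - y) ≤ 2 * y := by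
  have h := Real.one_sub_inv_le_log_of_pos (x := 1 - y) (by linarith)
  have : (1 - y)⁻¹ ≤ 1 + 2 * y := by
    rw [inv_le_iff_one_le_mul₀ (by linarith)]
    nlinarith
  linarith

theorem le_log_sigma1_lcmUpto {N : ℕ} (hN : 1 ≤ N) :
    primeSum N - 6 / √N ≤ log (sigma1 (Nat.lcmUpto N) / (Nat.lcmUpto N : ℕ)) := by
  have h := sum_inv_pow_le (x := N) (by exact_mod_cast hN)
  have h2 := sum_neg_log_eq (N : ℝ)
  rw [Nat.floor_natCast] at h h2
  rw [log_sigma1_div (Nat.lcmUpto_ne_zero N), Nat.primeFactors_lcmUpto]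
  have h3 : ∀ p ∈ Nat.primesLE N, -log (1 - (p : ℝ)⁻¹) - 2 * ((p : ℝ)⁻¹) ^ (Nat.log p N + 1) ≤
      logSigma p ((Nat.lcmUpto N).factorization p) := by
    intro p hp
    have hpp := Nat.prime_of_mem_primesLE hp
    obtain ⟨h0, h1⟩ := inv_prime_bounds hpp
    rw [Nat.factorization_lcmUpto N hpp, logSigma_eq hpp.two_le]
    have := neg_log_one_sub_le (y := ((p : ℝ)⁻¹) ^ (Nat.log p N + 1)) (by positivity)
      ((pow_le_of_le_one h0.le (by linarith) (by omega)).trans h1)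
    linarith
  have h4 := Finset.sum_le_sum h3
  rw [Finset.sum_sub_distrib, ← Finset.mul_sum, h2] at h4
  have h5 : 0 ≤ ∑ p ∈ Nat.primesLE N, powTail N p :=
    Finset.sum_nonneg fun p hp => powTail_nonneg (Nat.prime_of_mem_primesLE hp) _
  have : 6 / √(N : ℝ) = 2 * (3 / √N) := by ring
  linarith

theorem sigma1_pos {n : ℕ} (hn : n ≠ 0) : 0 < sigma1 n := by
  have : n ≤ sigma1 n := Finset.single_le_sum (f := id) (fun _ _ => Nat.zero_le _)
    (Nat.mem_divisors_self n hn)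
  omega

theorem robinF_eq_exp {n : ℕ} (hn : n ≠ 0) (h : 0 < log (log n)) :
    robinF n = exp (log (sigma1 n / n) - log (log (log n))) := by
  have h1 : (0 : ℝ) < sigma1 n := by exact_mod_cast sigma1_pos hn
  have h2 : (0 : ℝ) < n := by positivity
  rw [Real.exp_sub, Real.exp_log (by positivity), Real.exp_log h, robinF, div_div]

theorem tendsto_log_log_natCast : Tendsto (fun n : ℕ => log (log n)) atTop atTop :=
  Real.tendsto_log_atTop.comp (Real.tendsto_log_atTop.comp tendsto_natCast_atTop_atTop)

theorem tendsto_const_div_sqrt (c : ℝ) : Tendsto (fun x : ℝ => c / √x) atTop (𝓝 0) :=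
  Real.tendsto_sqrt_atTop.const_div_atTop c

/-- The upper half of Gronwall's theorem. -/
theorem eventually_robinF_lt {a : ℝ} (ha : exp eulerMascheroniConstant < a) :
    ∀ᶠ n : ℕ in atTop, robinF n < a := by
  have h1 : Tendsto (fun x : ℝ => exp (1 / log x + (primeSum x - log (log x)) + 3 / √x)) atTop
      (𝓝 (exp (0 + eulerMascheroniConstant + 0))) := by
    refine (Real.continuous_exp.tendsto _).comp ?_
    refine (Tendsto.add ?_ tendsto_primeSum_sub_log_log).add (tendsto_const_div_sqrt 3)
    exact Real.tendsto_log_atTop.const_div_atTop 1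
  rw [zero_add, add_zero] at h1
  have h2 := h1.comp (Real.tendsto_log_atTop.comp (tendsto_natCast_atTop_atTop (R := ℝ)))
  filter_upwards [h2.eventually_lt_const ha, tendsto_log_log_natCast.eventually_gt_atTop 0,
    (Real.tendsto_log_atTop.comp tendsto_natCast_atTop_atTop).eventually_gt_atTop 1,
    eventually_ne_atTop 0] with n hn1 hn2 hn3 hn4
  refine lt_of_le_of_lt ?_ hn1
  rw [robinF_eq_exp hn4 hn2]
  have := log_sigma1_div_le_of_log hn3
  exact Real.exp_le_exp.2 (by simp only [Function.comp_apply]; linarith)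

theorem log_lcmUpto_le {N : ℕ} : log (Nat.lcmUpto N : ℕ) ≤ 6 * N := by
  rw [← Chebyshev.psi_eq_log_lcmUpto]
  refine (Chebyshev.psi_le_const_mul_self (by positivity)).trans ?_
  have : log 4 ≤ 2 := by
    rw [show (4 : ℝ) = 2 ^ 2 by norm_num, Real.log_pow]; push_cast; linarith [Real.log_two_lt_d9]
  gcongr
  linarith

theorem le_lcmUpto {N : ℕ} : N ≤ Nat.lcmUpto N := by
  rcases Nat.eq_zero_or_pos N with rfl | h
  · simp
  · exact Nat.le_of_dvd (Nat.lcmUpto_pos N)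
      (Finset.dvd_lcm (f := id) (by simp; omega))

/-- The lower half of Gronwall's theorem. -/
theorem frequently_lt_robinF {a : ℝ} (ha : a < exp eulerMascheroniConstant) :
    ∃ᶠ n : ℕ in atTop, a < robinF n := by
  have hlog : Tendsto (fun x : ℝ => log (log (6 * x)) - log (log x)) atTop (𝓝 0) := by
    have h : Tendsto (fun x : ℝ => log (1 + log 6 / log x)) atTop (𝓝 (log (1 + 0))) := by
      refine Tendsto.log ?_ (by norm_num)
      exact tendsto_const_nhds.add (Real.tendsto_log_atTop.const_div_atTop _)
    rw [add_zero, Real.log_one] at h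
    refine h.congr' ?_
    filter_upwards [eventually_gt_atTop 1] with x hx
    have := Real.log_pos hx
    have h6 : 0 < log 6 := Real.log_pos (by norm_num)
    rw [Real.log_mul (by norm_num) (by linarith), ← Real.log_div (by positivity) (by positivity)]
    congr 1
    field_simp
    ring
  have h1 : Tendsto (fun x : ℝ => exp ((primeSum x - log (log x)) - 6 / √x -
      (log (log (6 * x)) - log (log x)))) atTop (𝓝 (exp (eulerMascheroniConstant - 0 - 0))) :=
    (Real.continuous_exp.tendsto _).comp
      ((tendsto_primeSum_sub_log_log.sub (tendsto_const_div_sqrt 6)).sub hlog)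
  rw [sub_zero, sub_zero] at h1
  have h2 := h1.comp (tendsto_natCast_atTop_atTop (R := ℝ))
  have h3 : ∀ᶠ N : ℕ in atTop, a < robinF (Nat.lcmUpto N) := by
    filter_upwards [h2.eventually_const_lt ha, tendsto_log_log_natCast.eventually_gt_atTop 0,
      (Real.tendsto_log_atTop.comp (tendsto_natCast_atTop_atTop (R := ℝ))).eventually_gt_atTop 1,
      eventually_ge_atTop 1] with N hN1 hN2 hN3 hN4
    refine lt_of_lt_of_le hN1 ?_
    have hle : log N ≤ log (Nat.lcmUpto N : ℕ) :=
      Real.log_le_log (by positivity) (by exact_mod_cast le_lcmUpto)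
    simp only [Function.comp_apply] at hN3
    have h0 : 0 < log (log (Nat.lcmUpto N : ℕ)) := Real.log_pos (by linarith)
    rw [robinF_eq_exp (Nat.lcmUpto_ne_zero N) h0]
    have h4 := le_log_sigma1_lcmUpto hN4
    have h5 : log (log (log (Nat.lcmUpto N : ℕ))) ≤ log (log (6 * N)) :=
      Real.log_le_log h0 (Real.log_le_log (by linarith) log_lcmUpto_le)
    exact Real.exp_le_exp.2 (by linarith)
  rw [Filter.frequently_atTop]
  intro M
  obtain ⟨N, hN1, hN2⟩ := (h3.and (eventually_ge_atTop M)).exists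
  exact ⟨_, hN2.trans le_lcmUpto, hN1⟩

/-- There are infinitely many extremely abundant numbers exactly when Robin's inequality holds from
`10080` on. -/
theorem infinite_extremelyAbundant_iff : {n : ℕ | ExtremelyAbundant n}.Infinite ↔
    ∀ n : ℕ, 10080 ≤ n → robinF n < exp eulerMascheroniConstant := by
  constructor
  · intro h n hn
    have key : ∀ N, ∃ n, N < n ∧ ExtremelyAbundant n := fun N => by
      obtain ⟨m, hm, hm'⟩ := h.exists_gt N
      exact ⟨m, hm', hm⟩
    have step : ∀ a b : ℕ, 10080 ≤ a → a < b → ExtremelyAbundant b → robinF a < robinF b := by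
      rintro a b ha hab (rfl | ⟨_, h⟩)
      · omega
      · exact h a ha hab
    obtain ⟨m, hm, hm'⟩ := key n
    refine (step n m hn hm hm').trans_le ?_
    by_contra hlt
    push Not at hlt
    obtain ⟨N, hN⟩ := eventually_atTop.1 (eventually_robinF_lt hlt)
    obtain ⟨k, hk, hk'⟩ := key (max m N)
    have h1 := hN k (by omega)
    have h2 := step m k (by omega) (by omega) hk'
    linarith
  · intro h
    rw [Set.infinite_iff_exists_gt]
    intro N₀
    set N := max N₀ 10080 with hN
    obtain ⟨M, hM, hMax⟩ := Finset.exists_max_image (Finset.Icc 10080 N) robinF ⟨N, by simp [hN]⟩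
    have hMlt := h M (Finset.mem_Icc.1 hM).1
    obtain ⟨n, hn, hn'⟩ := (Filter.frequently_atTop.1 (frequently_lt_robinF hMlt)) (N + 1)
    have hex : ∃ n, N < n ∧ robinF M < robinF n := ⟨n, by omega, hn'⟩
    classical
    refine ⟨Nat.find hex, Or.inr ⟨?_, fun m hm hmlt => ?_⟩, ?_⟩
    · have := (Nat.find_spec hex).1; omega
    · rcases le_or_gt m N with hmN | hmN
      · exact (hMax m (Finset.mem_Icc.2 ⟨hm, hmN⟩)).trans_lt (Nat.find_spec hex).2
      · have := Nat.find_min hex hmlt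
        push Not at this
        exact (this hmN).trans_lt (Nat.find_spec hex).2
    · have := (Nat.find_spec hex).1; omega

/-- `f` is measurable and `O(x^a)` on `(1, ∞)`. -/
def PolyBound (f : ℝ → ℝ) (a : ℝ) : Prop :=
  Measurable f ∧ ∃ C, ∀ x, 1 < x → |f x| ≤ C * x ^ a

/-- The Mellin-type integral `∫_1^∞ f(x) x^{-s-1} dx`. -/
def mellinTail (f : ℝ → ℝ) (s : ℂ) : ℂ := ∫ x in Set.Ioi (1 : ℝ), (f x : ℂ) * (x : ℂ) ^ (-(s + 1))

theorem PolyBound.add {f g : ℝ → ℝ} {a : ℝ} (hf : PolyBound f a) (hg : PolyBound g a) :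
    PolyBound (fun x => f x + g x) a := by
  obtain ⟨hf, C, hC⟩ := hf
  obtain ⟨hg, D, hD⟩ := hg
  refine ⟨hf.add hg, C + D, fun x hx => ?_⟩
  have := abs_add_le (f x) (g x)
  have := hC x hx
  have := hD x hx
  linarith

theorem PolyBound.const_mul {f : ℝ → ℝ} {a : ℝ} (hf : PolyBound f a) (c : ℝ) :
    PolyBound (fun x => c * f x) a := by
  obtain ⟨hf, C, hC⟩ := hf
  refine ⟨hf.const_mul c, |c| * C, fun x hx => ?_⟩
  rw [abs_mul, mul_assoc]
  exact mul_le_mul_of_nonneg_left (hC x hx) (abs_nonneg c)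

theorem PolyBound.mono {f : ℝ → ℝ} {a b : ℝ} (hf : PolyBound f a) (h : a ≤ b) : PolyBound f b := by
  obtain ⟨hf, C, hC⟩ := hf
  refine ⟨hf, |C|, fun x hx => (hC x hx).trans ?_⟩
  have h1 : x ^ a ≤ x ^ b := Real.rpow_le_rpow_of_exponent_le hx.le h
  have : 0 ≤ x ^ a := by positivity
  calc C * x ^ a ≤ |C| * x ^ a := by gcongr; exact le_abs_self C
    _ ≤ _ := by gcongr

theorem norm_mellinTail_integrand (f : ℝ → ℝ) (s : ℂ) {x : ℝ} (hx : 0 < x) :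
    ‖(f x : ℂ) * (x : ℂ) ^ (-(s + 1))‖ = |f x| * x ^ (-s.re - 1) := by
  rw [norm_mul, Complex.norm_real, Complex.norm_cpow_eq_rpow_re_of_pos hx, Real.norm_eq_abs]
  congr 2
  simp; ring

theorem PolyBound.integrableOn {f : ℝ → ℝ} {a : ℝ} (hf : PolyBound f a) {s : ℂ} (hs : a < s.re) :
    IntegrableOn (fun x : ℝ => (f x : ℂ) * (x : ℂ) ^ (-(s + 1))) (Set.Ioi 1) := by
  obtain ⟨hm, C, hC⟩ := hf
  have h := integrableOn_mul_rpow_of_le (f := fun x => |f x|) (by fun_prop) one_pos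
    (fun x hx => by rw [abs_abs]; exact hC x hx) hs
  refine h.mono' (by exact Measurable.aestronglyMeasurable (by fun_prop)) ?_
  filter_upwards [ae_restrict_mem measurableSet_Ioi] with x hx
  rw [norm_mellinTail_integrand f s (zero_lt_one.trans hx)]

theorem mellinTail_ofReal (f : ℝ → ℝ) (s : ℝ) :
    mellinTail f s = ((∫ x in Set.Ioi (1 : ℝ), f x * x ^ (-s - 1) : ℝ) : ℂ) := by
  rw [mellinTail, ← integral_complex_ofReal]
  refine setIntegral_congr_fun measurableSet_Ioi fun x hx => ?_
  have hx0 : (0 : ℝ) ≤ x := by linarith [Set.mem_Ioi.1 hx]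
  push_cast
  rw [Complex.ofReal_cpow hx0]
  push_cast
  congr 2; ring

theorem mellinTail_add {f g : ℝ → ℝ} {a b : ℝ} (hf : PolyBound f a) (hg : PolyBound g b) {s : ℂ}
    (hs : a < s.re) (hs' : b < s.re) :
    mellinTail (fun x => f x + g x) s = mellinTail f s + mellinTail g s := by
  rw [mellinTail, mellinTail, mellinTail, ← integral_add (hf.integrableOn hs) (hg.integrableOn hs')]
  congr 1; ext x; push_cast; ring

theorem mellinTail_const_mul (f : ℝ → ℝ) (c : ℝ) (s : ℂ) :
    mellinTail (fun x => c * f x) s = c * mellinTail f s := by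
  rw [mellinTail, mellinTail, ← integral_const_mul]
  congr 1; ext x; push_cast; ring

theorem mellinTail_congr {f g : ℝ → ℝ} (h : ∀ x, 1 < x → f x = g x) (s : ℂ) :
    mellinTail f s = mellinTail g s := by
  refine setIntegral_congr_fun measurableSet_Ioi fun x hx => ?_
  simp only [h x hx]

theorem polyBound_rpow (a : ℝ) : PolyBound (fun x => x ^ a) a :=
  ⟨by fun_prop, 1, fun x hx => by rw [abs_of_nonneg (by positivity), one_mul]⟩

theorem mellinTail_rpow (a : ℝ) {s : ℂ} (hs : a < s.re) :
    mellinTail (fun x => x ^ a) s = 1 / (s - a) := by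
  have h : mellinTail (fun x => x ^ a) s = ∫ x in Set.Ioi (1 : ℝ), (x : ℂ) ^ (a - s - 1) := by
    refine setIntegral_congr_fun measurableSet_Ioi fun x hx => ?_
    have hx0 : (0 : ℝ) < x := by linarith [Set.mem_Ioi.1 hx]
    have hx1 : (x : ℂ) ≠ 0 := by exact_mod_cast hx0.ne'
    simp only
    rw [Complex.ofReal_cpow hx0.le, ← Complex.cpow_add _ _ hx1]
    congr 1; ring
  rw [h, integral_Ioi_cpow_of_lt (by simp; linarith) one_pos]
  have : s - a ≠ 0 := fun h => by
    have := congrArg Complex.re h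
    simp at this; linarith
  simp
  rw [← neg_sub, neg_div_neg_eq, one_div]

theorem PolyBound.norm_mellinTail_le {f : ℝ → ℝ} {a C : ℝ}
    (hC : ∀ x, 1 < x → |f x| ≤ C * x ^ a) {s : ℂ} (hs : a < s.re) :
    ‖mellinTail f s‖ ≤ C / (s.re - a) := by
  have hi : IntegrableOn (fun x : ℝ => C * x ^ (a - s.re - 1)) (Set.Ioi 1) :=
    (integrableOn_Ioi_rpow_of_lt (by linarith) one_pos).const_mul C
  refine (norm_integral_le_of_norm_le hi ?_).trans (le_of_eq ?_)
  · filter_upwards [ae_restrict_mem measurableSet_Ioi] with x hx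
    have hx0 : (0 : ℝ) < x := by linarith [Set.mem_Ioi.1 hx]
    rw [norm_mellinTail_integrand f s hx0, show a - s.re - 1 = a + (-s.re - 1) by ring,
      Real.rpow_add hx0, ← mul_assoc]
    gcongr
    exact hC x hx
  · rw [integral_const_mul, integral_Ioi_rpow_of_lt (by linarith) one_pos]
    have : a - s.re ≠ 0 := by linarith
    simp
    rw [← neg_sub s.re a, div_eq_mul_inv, inv_neg, neg_one_mul, neg_neg, div_eq_mul_inv]

theorem mellinTail_eq_mellin (f : ℝ → ℝ) (z : ℂ) :
    mellinTail f z = mellin ((Set.Ioi (1 : ℝ)).indicator fun x => (f x : ℂ)) (-z) := by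
  set g : ℝ → ℂ := (Set.Ioi (1 : ℝ)).indicator fun x => (f x : ℂ) with hg
  rw [mellin, mellinTail]
  have : ∀ t : ℝ, (t : ℂ) ^ (-z - 1) • g t =
      (Set.Ioi (1 : ℝ)).indicator (fun x => (f x : ℂ) * (x : ℂ) ^ (-(z + 1))) t := by
    intro t
    rw [hg]
    by_cases ht : t ∈ Set.Ioi (1 : ℝ)
    · rw [Set.indicator_of_mem ht, Set.indicator_of_mem ht, smul_eq_mul, mul_comm]
      congr 2; ring
    · rw [Set.indicator_of_notMem ht, Set.indicator_of_notMem ht, smul_zero]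
  simp only [this]
  rw [setIntegral_indicator measurableSet_Ioi]
  congr 2
  ext x; simp

theorem PolyBound.hasDerivAt_mellinTail {f : ℝ → ℝ} {a : ℝ} (hf : PolyBound f a) {s : ℂ}
    (hs : a < s.re) :
    HasDerivAt (mellinTail f) (-mellinTail (fun x => log x * f x) s) s := by
  set g : ℝ → ℂ := (Set.Ioi (1 : ℝ)).indicator fun x => (f x : ℂ) with hg
  have heq : mellinTail f = fun s => mellin g (-s) := funext fun z => mellinTail_eq_mellin f z
  rw [heq]
  have hO : g =O[atTop] (fun x : ℝ => x ^ (-(-a))) := by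
    obtain ⟨_, C, hC⟩ := hf
    refine Asymptotics.IsBigO.of_bound C ?_
    filter_upwards [eventually_gt_atTop 1] with x hx
    rw [hg, Set.indicator_of_mem (Set.mem_Ioi.2 hx), Complex.norm_real, Real.norm_eq_abs,
      Real.norm_eq_abs, neg_neg, abs_of_nonneg (by positivity : 0 ≤ x ^ a)]
    exact hC x hx
  have hO' : g =O[𝓝[>] 0] (fun x : ℝ => x ^ (-((-s).re - 1))) := by
    refine Asymptotics.IsBigO.of_bound 1 ?_
    have : ∀ᶠ x : ℝ in 𝓝[>] 0, x < 1 := nhdsWithin_le_nhds (gt_mem_nhds one_pos)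
    filter_upwards [this] with x hx
    rw [hg, Set.indicator_of_notMem (by simp [hx.le])]
    simp
  have hloc : LocallyIntegrableOn g (Set.Ioi 0) := by
    have hmg : Measurable g := by
      have := hf.1
      exact Measurable.indicator (by fun_prop) measurableSet_Ioi
    rw [locallyIntegrableOn_iff (isLocallyClosed_Ioi)]
    intro K hK hKc
    obtain ⟨B, hB⟩ := hKc.bddAbove
    obtain ⟨_, C, hC⟩ := hf
    refine Measure.integrableOn_of_bounded (M := |C| * (|B| + 1) ^ |a|) hKc.measure_lt_top.ne
      hmg.aestronglyMeasurable ?_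
    filter_upwards [ae_restrict_mem hKc.measurableSet] with x hx
    by_cases h1 : x ∈ Set.Ioi (1 : ℝ)
    · rw [hg, Set.indicator_of_mem h1, Complex.norm_real, Real.norm_eq_abs]
      have h1' : 1 < x := h1
      have hxB : x ≤ |B| + 1 := (hB hx).trans (by linarith [le_abs_self B])
      calc |f x| ≤ C * x ^ a := hC x h1
        _ ≤ |C| * x ^ |a| := by
            have : x ^ a ≤ x ^ |a| := Real.rpow_le_rpow_of_exponent_le h1'.le (le_abs_self a)
            have h3 : 0 ≤ x ^ a := by positivity
            calc C * x ^ a ≤ |C| * x ^ a := by gcongr; exact le_abs_self C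
              _ ≤ _ := by gcongr
        _ ≤ _ := by gcongr
    · rw [hg, Set.indicator_of_notMem h1]; simp; positivity
  have h := (mellin_hasDerivAt_of_isBigO_rpow (s := -s) hloc hO (by simp; linarith) hO'
    (by simp)).2
  refine (h.comp s (hasDerivAt_neg s)).congr_deriv ?_
  rw [mellinTail_eq_mellin, mul_neg_one]
  congr 2
  ext x
  by_cases hx : x ∈ Set.Ioi (1 : ℝ)
  · simp [hg, Set.indicator_of_mem hx]
  · simp [hg, Set.indicator_of_notMem hx]

theorem PolyBound.differentiableAt {f : ℝ → ℝ} {a : ℝ} (hf : PolyBound f a) {s : ℂ}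
    (hs : a < s.re) : DifferentiableAt ℂ (mellinTail f) s :=
  (hf.hasDerivAt_mellinTail hs).differentiableAt

theorem polyBound_fract : PolyBound Int.fract 0 :=
  ⟨measurable_fract, 1, fun x _ => by
    rw [abs_of_nonneg (Int.fract_nonneg x)]; simp [(Int.fract_lt_one x).le]⟩

theorem isPreconnected_re_gt (a : ℝ) : IsPreconnected {s : ℂ | a < s.re} :=
  (convex_halfSpace_re_gt a).isPreconnected

theorem isOpen_re_gt (a : ℝ) : IsOpen {s : ℂ | a < s.re} :=
  isOpen_lt continuous_const Complex.continuous_re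

/-- Two functions holomorphic on a right half plane that agree further to the right are equal. -/
theorem eqOn_re_gt {f g : ℂ → ℂ} {a b : ℝ} (hf : ∀ s : ℂ, a < s.re → DifferentiableAt ℂ f s)
    (hg : ∀ s : ℂ, a < s.re → DifferentiableAt ℂ g s) (h : ∀ s : ℂ, b < s.re → f s = g s) {s : ℂ}
    (hs : a < s.re) : f s = g s := by
  have hfa : AnalyticOnNhd ℂ f {s : ℂ | a < s.re} :=
    DifferentiableOn.analyticOnNhd (fun z hz => (hf z hz).differentiableWithinAt) (isOpen_re_gt a)
  have hga : AnalyticOnNhd ℂ g {s : ℂ | a < s.re} :=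
    DifferentiableOn.analyticOnNhd (fun z hz => (hg z hz).differentiableWithinAt) (isOpen_re_gt a)
  set z₀ : ℂ := ((max a b + 1 : ℝ) : ℂ)
  refine hfa.eqOn_of_preconnected_of_eventuallyEq hga (isPreconnected_re_gt a) (z₀ := z₀) ?_ ?_ hs
  · simp only [z₀, Set.mem_ofPred_eq, Complex.ofReal_re]; linarith [le_max_left a b]
  · have : {s : ℂ | b < s.re} ∈ 𝓝 z₀ := (isOpen_re_gt b).mem_nhds (by
      simp only [z₀, Set.mem_ofPred_eq, Complex.ofReal_re]; linarith [le_max_right a b])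
    filter_upwards [this] with z hz using h z hz

theorem riemannZeta_eq_of_one_lt_re {s : ℂ} (hs : 1 < s.re) :
    riemannZeta s = s / (s - 1) - s * mellinTail Int.fract s := by
  have h := LSeries_eq_mul_integral' (fun _ => (1 : ℂ)) (r := 1) zero_le_one hs (by
    simpa using Asymptotics.isBigO_refl (fun n : ℕ => (n : ℝ)) atTop)
  rw [show (fun _ : ℕ => (1 : ℂ)) = 1 from rfl, LSeries_one_eq_riemannZeta hs] at h
  have h1 : mellinTail (fun x : ℝ => x ^ (1 : ℝ)) s = 1 / (s - 1) := by
    simpa using mellinTail_rpow 1 (s := s) hs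
  have h2 := mellinTail_add (polyBound_rpow 1) (polyBound_fract.const_mul (-1)) (s := s) hs
    (by linarith)
  rw [h1, mellinTail_const_mul] at h2
  have h3 : mellinTail (fun x : ℝ => x ^ (1 : ℝ) + -1 * Int.fract x) s =
      ∫ t in Set.Ioi (1 : ℝ), (∑ k ∈ Finset.Icc 1 ⌊t⌋₊, (1 : ℂ)) * t ^ (-(s + 1)) := by
    refine setIntegral_congr_fun measurableSet_Ioi fun x hx => ?_
    have hx0 : (0 : ℝ) ≤ x := by linarith [Set.mem_Ioi.1 hx]
    simp only
    congr 1
    rw [Finset.sum_const, Nat.card_Icc]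
    simp only [Real.rpow_one, Nat.add_sub_cancel, nsmul_eq_mul, mul_one]
    rw [← Complex.ofReal_natCast]
    congr 1
    rw [natCast_floor_eq_intCast_floor hx0]
    have := Int.self_sub_fract x
    linarith
  have h4 : riemannZeta s = s * (1 / (s - 1) + ((-1 : ℝ) : ℂ) * mellinTail Int.fract s) := by
    rw [h, ← h2, h3]; rfl
  rw [h4]; push_cast; ring

/-- `(s-1)ζ(s)` on the right half plane. -/
theorem riemannZeta₁_eq {s : ℂ} (hs : 0 < s.re) :
    riemannZeta₁ s = s - s * (s - 1) * mellinTail Int.fract s := by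
  refine eqOn_re_gt (a := 0) (b := 1) (f := riemannZeta₁)
    (g := fun s => s - s * (s - 1) * mellinTail Int.fract s)
    (fun z _ => differentiable_riemannZeta₁ z) ?_ ?_ hs
  · intro z hz
    have := polyBound_fract.differentiableAt hz
    fun_prop
  · intro z hz
    have hz1 : z ≠ 1 := by rintro rfl; simp at hz
    have hz2 : z - 1 ≠ 0 := sub_ne_zero.2 hz1
    have h1 := riemannZeta_eq_of_one_lt_re hz
    rw [riemannZeta_eq_inv_sub_mul hz1] at h1
    have : riemannZeta₁ z = (z - 1) * ((z - 1)⁻¹ * riemannZeta₁ z) := by field_simp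
    rw [this, h1]
    field_simp

theorem norm_riemannZeta₁_le {s : ℂ} (hs : 0 < s.re) :
    ‖riemannZeta₁ s‖ ≤ ‖s‖ + ‖s‖ * ‖s - 1‖ / s.re := by
  rw [riemannZeta₁_eq hs]
  refine (norm_sub_le _ _).trans ?_
  have h := PolyBound.norm_mellinTail_le (f := Int.fract) (C := 1) (a := 0) (fun x _ => by
    rw [abs_of_nonneg (Int.fract_nonneg x)]; simp [(Int.fract_lt_one x).le]) hs
  rw [sub_zero] at h
  rw [norm_mul, norm_mul, ← mul_one_div]
  gcongr

/-- `(s-1)ζ(s)` is positive on the positive real axis. -/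
theorem riemannZeta₁_ofReal_pos {s : ℝ} (hs : 0 < s) : ∃ r : ℝ, 0 < r ∧ riemannZeta₁ s = r := by
  rcases le_or_gt s 1 with h1 | h1
  · refine ⟨s - s * (s - 1) * ∫ x in Set.Ioi (1 : ℝ), Int.fract x * x ^ (-s - 1), ?_, ?_⟩
    · have : 0 ≤ ∫ x in Set.Ioi (1 : ℝ), Int.fract x * x ^ (-s - 1) :=
        setIntegral_nonneg measurableSet_Ioi fun x hx =>
          mul_nonneg (Int.fract_nonneg x) (Real.rpow_nonneg (by linarith [Set.mem_Ioi.1 hx]) _)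
      nlinarith [mul_nonneg (mul_nonneg hs.le (sub_nonneg.2 h1)) this]
    · rw [riemannZeta₁_eq (by simpa using hs), mellinTail_ofReal]; push_cast; ring
  · have h := riemannZeta_one_add_eq_exp (δ := s - 1) (by linarith)
    refine ⟨(s - 1) * rexp ((s - 1) * ∫ x in Set.Ioi (1 : ℝ), primeSum x * x ^ (-(s - 1) - 1)),
      mul_pos (by linarith) (Real.exp_pos _), ?_⟩
    have hs1 : (s : ℂ) ≠ 1 := by exact_mod_cast h1.ne'
    have hs2 : (s : ℂ) - 1 ≠ 0 := sub_ne_zero.2 hs1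
    have e : (1 : ℂ) + ((s - 1 : ℝ) : ℂ) = s := by push_cast; ring
    rw [e, riemannZeta_eq_inv_sub_mul hs1] at h
    rw [Complex.ofReal_mul, ← h]
    push_cast
    field_simp

section Landau

open ProbabilityTheory

theorem analyticAt_comp_ofReal {f : ℂ → ℂ} {t : ℝ} (hf : AnalyticAt ℂ f t) :
    AnalyticAt ℝ (fun x : ℝ => f x) t :=
  (hf.restrictScalars (𝕜 := ℝ)).comp (Complex.ofRealCLM.analyticAt t)

theorem eventually_eq_of_forall_real {f g : ℂ → ℂ} {t : ℝ} (hf : AnalyticAt ℂ f t)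
    (hg : AnalyticAt ℂ g t) (h : ∀ᶠ x : ℝ in 𝓝 t, f x = g x) : f =ᶠ[𝓝 (t : ℂ)] g := by
  refine (hf.frequently_eq_iff_eventually_eq hg).1 ?_
  have h1 : Tendsto (fun x : ℝ => (x : ℂ)) (𝓝[≠] t) (𝓝[≠] (t : ℂ)) := by
    refine tendsto_nhdsWithin_iff.2
      ⟨(Complex.continuous_ofReal.tendsto t).mono_left nhdsWithin_le_nhds, ?_⟩
    filter_upwards [self_mem_nhdsWithin] with x hx
    simpa using hx
  exact h1.frequently (h.filter_mono nhdsWithin_le_nhds).frequently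

variable {Ω : Type*} {mΩ : MeasurableSpace Ω} {X : Ω → ℝ} {μ : Measure Ω}

theorem exists_gt_mem_integrableExpSet (hX : 0 ≤ᵐ[μ] X) {c : ℝ} {G : ℂ → ℂ}
    (hG : AnalyticAt ℂ G c) (hc : Set.Iio c ⊆ integrableExpSet X μ)
    (h : ∀ t : ℝ, t < c → G t = complexMGF X μ t) : ∃ b, c < b ∧ b ∈ integrableExpSet X μ := by
  obtain ⟨r, hr, hGr⟩ := hG.exists_ball_analyticOnNhd
  set a : ℝ := c - r / 4 with ha
  have hintg : ∀ t : ℝ, t < c → t ∈ interior (integrableExpSet X μ) := fun t ht =>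
    interior_mono hc (by rw [interior_Iio]; exact ht)
  have haS := hintg a (by linarith)
  have hsub : Metric.ball (a : ℂ) (3 * r / 4) ⊆ Metric.ball (c : ℂ) r := by
    refine Metric.ball_subset_ball' ?_
    rw [Complex.dist_eq, ← Complex.ofReal_sub, Complex.norm_real, ha, Real.norm_eq_abs,
      show c - r / 4 - c = -(r / 4) by ring, abs_neg, abs_of_pos (by positivity)]
    linarith
  have hGa : AnalyticAt ℂ G a := hGr _ (hsub (Metric.mem_ball_self (by positivity)))
  have heq : G =ᶠ[𝓝 (a : ℂ)] complexMGF X μ := by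
    refine eventually_eq_of_forall_real hGa (analyticAt_complexMGF (by simpa using haS)) ?_
    filter_upwards [Iio_mem_nhds (show a < c by linarith)] with x hx using h x hx
  have hsum := Complex.hasSum_taylorSeries_on_ball (f := G) (c := a) (r := 3 * r / 4)
    (z := ((a + r / 2 : ℝ) : ℂ)) (hGr.differentiableOn.mono hsub) (by
      rw [Metric.mem_ball, Complex.dist_eq, ← Complex.ofReal_sub, Complex.norm_real,
        Real.norm_eq_abs, add_sub_cancel_left, abs_of_pos (by positivity)]
      linarith)
  have hXm : AEMeasurable X μ := aemeasurable_of_mem_interior_integrableExpSet haS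
  set F : ℕ → Ω → ℝ := fun n ω => (n.factorial : ℝ)⁻¹ * (r / 2) ^ n * (X ω ^ n * exp (a * X ω))
    with hF
  have hFint : ∀ n, Integrable (F n) μ := fun n =>
    (integrable_pow_mul_exp_of_mem_interior_integrableExpSet haS n).const_mul _
  have hF0 : ∀ n, 0 ≤ᵐ[μ] F n := fun n => by
    filter_upwards [hX] with ω hω
    have : 0 ≤ X ω := hω
    simp only [hF, Pi.zero_apply]; positivity
  have hFsum : Summable fun n => ∫ ω, F n ω ∂μ := by
    refine (Complex.summable_ofReal).1 (hsum.summable.congr fun n => ?_)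
    rw [(heq.iteratedDeriv_eq n), iteratedDeriv_complexMGF (by simpa using haS), hF,
      integral_const_mul, smul_eq_mul, smul_eq_mul, ← Complex.ofReal_sub, add_sub_cancel_left]
    push_cast
    rw [← integral_complex_ofReal]
    push_cast
    ring
  refine ⟨a + r / 2, by linarith, ?_⟩
  change Integrable (fun ω => exp ((a + r / 2) * X ω)) μ
  refine ⟨(by fun_prop : AEMeasurable (fun ω => exp ((a + r / 2) * X ω)) μ).aestronglyMeasurable, ?_⟩
  rw [hasFiniteIntegral_iff_norm]
  have hpt : ∀ᵐ ω ∂μ, ENNReal.ofReal ‖exp ((a + r / 2) * X ω)‖ = ∑' n, ENNReal.ofReal (F n ω) := by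
    filter_upwards [ae_all_iff.2 hF0] with ω hω
    have hs : HasSum (fun n => F n ω) (exp ((a + r / 2) * X ω)) := by
      have := (NormedSpace.expSeries_div_hasSum_exp (r / 2 * X ω)).mul_right (exp (a * X ω))
      rw [← Real.exp_eq_exp_ℝ, ← Real.exp_add] at this
      rw [show (a + r / 2) * X ω = r / 2 * X ω + a * X ω by ring]
      have h2 : (fun n => F n ω) = fun n : ℕ =>
          (r / 2 * X ω) ^ n / (n.factorial : ℝ) * exp (a * X ω) := by
        funext n; simp only [hF, mul_pow]; ring
      rwa [h2]
    rw [Real.norm_of_nonneg (exp_pos _).le, ← hs.tsum_eq, ENNReal.ofReal_tsum_of_nonneg hω hs.summable]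
  rw [lintegral_congr_ae hpt, lintegral_tsum fun n => (hFint n).aemeasurable.ennreal_ofReal]
  have : ∀ n, ∫⁻ ω, ENNReal.ofReal (F n ω) ∂μ = ENNReal.ofReal (∫ ω, F n ω ∂μ) := fun n =>
    (ofReal_integral_eq_lintegral_ofReal (hFint n) (hF0 n)).symm
  simp_rw [this]
  rw [← ENNReal.ofReal_tsum_of_nonneg (fun n => integral_nonneg_of_ae (hF0 n)) hFsum]
  exact ENNReal.ofReal_lt_top

/-- **Landau's theorem** on the abscissa of convergence, for moment generating functions. -/
theorem Iio_subset_integrableExpSet (hX : 0 ≤ᵐ[μ] X) {t₀ t₁ : ℝ} {G : ℂ → ℂ}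
    (hG : ∀ t : ℝ, t < t₁ → AnalyticAt ℂ G t) (ht₀ : Set.Iio t₀ ⊆ integrableExpSet X μ)
    (h : ∀ t : ℝ, t < t₀ → G t = complexMGF X μ t) : Set.Iio t₁ ⊆ integrableExpSet X μ := by
  by_contra hcon
  obtain ⟨u, hu, huS⟩ := Set.not_subset.1 hcon
  have hcv : Convex ℝ (integrableExpSet X μ) := convex_integrableExpSet
  have hlow : ∀ a b : ℝ, b ∈ integrableExpSet X μ → a < b → a ∈ integrableExpSet X μ := by
    intro a b hb hab
    have := hcv.ordConnected.out (ht₀ (show min a t₀ - 1 < t₀ by linarith [min_le_right a t₀])) hb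
    exact this ⟨by linarith [min_le_left a t₀], hab.le⟩
  have hbdd : BddAbove (integrableExpSet X μ) := ⟨u, fun b hb => by
    by_contra hlt
    exact huS (hlow u b hb (not_le.1 hlt))⟩
  have hne : (integrableExpSet X μ).Nonempty := ⟨t₀ - 1, ht₀ (by simp)⟩
  set c := sSup (integrableExpSet X μ) with hcdef
  have hcsub : Set.Iio c ⊆ integrableExpSet X μ := fun a ha => by
    obtain ⟨b, hb, hab⟩ := exists_lt_of_lt_csSup hne ha
    exact hlow a b hb hab
  have hcu : c ≤ u := csSup_le hne fun b hb => by
    by_contra hlt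
    exact huS (hlow u b hb (not_le.1 hlt))
  have hct : t₀ ≤ c := le_of_forall_lt_imp_le_of_dense fun a ha => le_csSup hbdd (ht₀ ha)
  have hu' : u < t₁ := hu
  have heq : Set.EqOn (fun t : ℝ => G t) (fun t : ℝ => complexMGF X μ t) (Set.Iio c) := by
    refine AnalyticOnNhd.eqOn_of_preconnected_of_eventuallyEq (𝕜 := ℝ) (z₀ := t₀ - 1)
      (fun t ht => analyticAt_comp_ofReal (hG t ?_))
      (fun t ht => analyticAt_comp_ofReal (analyticAt_complexMGF ?_)) isPreconnected_Iio ?_ ?_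
    · have : t < c := ht
      linarith
    · exact interior_mono hcsub (by rw [interior_Iio]; simpa using ht)
    · show t₀ - 1 < c
      linarith
    · filter_upwards [Iio_mem_nhds (show t₀ - 1 < t₀ by linarith)] with x hx using h x hx
  obtain ⟨b, hcb, hb⟩ := exists_gt_mem_integrableExpSet hX (hG c (by linarith)) hcsub
    fun t ht => heq ht
  exact absurd (le_csSup hbdd hb) (not_le.2 hcb)

end Landau

/-- The measure whose moment generating function is `mellinTail f`. -/
def mellinMeasure (f : ℝ → ℝ) : Measure ℝ :=
  (volume.restrict (Set.Ioi 1)).withDensity fun x => ENNReal.ofReal (f x * x⁻¹)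

theorem cexp_mul_log {x : ℝ} (hx : 0 < x) (z : ℂ) : Complex.exp (z * log x) = (x : ℂ) ^ z := by
  rw [Complex.cpow_def_of_ne_zero (by exact_mod_cast hx.ne'), Complex.ofReal_log hx.le, mul_comm]

theorem mellinMeasure_smul_cexp {f : ℝ → ℝ} (hf0 : ∀ x, 1 < x → 0 ≤ f x) (z : ℂ) {x : ℝ}
    (hx : x ∈ Set.Ioi (1 : ℝ)) :
    (ENNReal.ofReal (f x * x⁻¹)).toReal • Complex.exp (z * log x) =
      (f x : ℂ) * (x : ℂ) ^ (-(-z + 1)) := by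
  have hx0 : 0 < x := zero_lt_one.trans hx
  have hxc : (x : ℂ) ≠ 0 := by exact_mod_cast hx0.ne'
  have := hf0 x hx
  rw [ENNReal.toReal_ofReal (by positivity), cexp_mul_log hx0, Complex.real_smul,
    show -(-z + 1) = z - 1 by ring, Complex.cpow_sub _ _ hxc, Complex.cpow_one]
  push_cast
  field_simp

theorem complexMGF_mellinMeasure {f : ℝ → ℝ} (hf : Measurable f) (hf0 : ∀ x, 1 < x → 0 ≤ f x)
    (z : ℂ) : ProbabilityTheory.complexMGF log (mellinMeasure f) z = mellinTail f (-z) := by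
  rw [ProbabilityTheory.complexMGF, mellinMeasure, integral_withDensity_eq_integral_toReal_smul
    (by fun_prop) (by simp), mellinTail]
  exact setIntegral_congr_fun measurableSet_Ioi fun x hx => mellinMeasure_smul_cexp hf0 z hx

theorem mem_integrableExpSet_mellinMeasure {f : ℝ → ℝ} (hf : Measurable f)
    (hf0 : ∀ x, 1 < x → 0 ≤ f x) (t : ℝ) :
    t ∈ ProbabilityTheory.integrableExpSet log (mellinMeasure f) ↔
      IntegrableOn (fun x : ℝ => (f x : ℂ) * (x : ℂ) ^ (-(-(t : ℂ) + 1))) (Set.Ioi 1) := by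
  have h1 : t ∈ ProbabilityTheory.integrableExpSet log (mellinMeasure f) ↔
      Integrable (fun x => Complex.exp (t * log x)) (mellinMeasure f) := by
    have : (fun x : ℝ => Complex.exp (t * log x)) = fun x => ((exp (t * log x) : ℝ) : ℂ) := by
      ext x; push_cast; rfl
    rw [this]
    exact ⟨fun h => h.ofReal, fun h => h.re⟩
  rw [h1, mellinMeasure, integrable_withDensity_iff_integrable_smul' (by fun_prop) (by simp)]
  exact integrableOn_congr_fun (fun x hx => mellinMeasure_smul_cexp hf0 t hx) measurableSet_Ioi

/-- **Landau's theorem** for Mellin transforms of nonnegative functions. -/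
theorem differentiableAt_mellinTail_of_nonneg {f : ℝ → ℝ} {a b : ℝ} (hf : PolyBound f a)
    (hf0 : ∀ x, 1 < x → 0 ≤ f x) {G : ℂ → ℂ} (hG : ∀ s : ℝ, b < s → AnalyticAt ℂ G s)
    (h : ∀ s : ℝ, a < s → G s = mellinTail f s) {s : ℂ} (hs : b < s.re) :
    DifferentiableAt ℂ (mellinTail f) s := by
  have hX : 0 ≤ᵐ[mellinMeasure f] log := by
    have : 0 ≤ᵐ[volume.restrict (Set.Ioi 1)] log := by
      filter_upwards [ae_restrict_mem measurableSet_Ioi] with x hx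
      exact Real.log_nonneg (le_of_lt hx)
    exact (withDensity_absolutelyContinuous _ _).ae_le this
  have hsub := Iio_subset_integrableExpSet hX (t₀ := -a) (t₁ := -b) (G := fun z => G (-z))
    (fun t ht => by
      have h1 : AnalyticAt ℂ G (-(t : ℂ)) := by simpa using hG (-t) (by linarith)
      exact h1.comp (f := fun z : ℂ => -z) (analyticAt_id.neg))
    (fun t ht => by
      rw [mem_integrableExpSet_mellinMeasure hf.1 hf0]
      have : t < -a := ht
      exact hf.integrableOn (by simp; linarith))
    (fun t ht => by
      rw [complexMGF_mellinMeasure hf.1 hf0]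
      simpa using h (-t) (by linarith))
  have h1 : DifferentiableAt ℂ (ProbabilityTheory.complexMGF log (mellinMeasure f)) (-s) :=
    (ProbabilityTheory.analyticAt_complexMGF (interior_mono hsub (by
      rw [interior_Iio]; simpa using hs))).differentiableAt
  have h2 : mellinTail f = fun s => ProbabilityTheory.complexMGF log (mellinMeasure f) (-s) := by
    ext s; rw [complexMGF_mellinMeasure hf.1 hf0, neg_neg]
  rw [h2]
  exact h1.comp s differentiable_neg.differentiableAt

theorem mellinTail_psi {s : ℂ} (hs : 1 < s.re) :
    s * mellinTail Chebyshev.psi s = -(deriv riemannZeta s / riemannZeta s) := by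
  have hN : ∀ N : ℕ, ∑ k ∈ Finset.Icc 1 N, vonMangoldt k = Chebyshev.psi N := by
    intro N; rw [Chebyshev.psi, Nat.floor_natCast]; rfl
  have h := LSeries_eq_mul_integral_of_nonneg (fun n => vonMangoldt n) (r := 1) zero_le_one hs (by
    simp only [hN, Real.rpow_one]
    refine Asymptotics.IsBigO.of_bound (log 4 + 4) (Eventually.of_forall fun n => ?_)
    rw [Real.norm_of_nonneg (Chebyshev.psi_nonneg _), Real.norm_of_nonneg (by positivity)]
    exact Chebyshev.psi_le_const_mul_self (by positivity))
    fun n => ArithmeticFunction.vonMangoldt_nonneg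
  rw [← neg_div, ← ArithmeticFunction.LSeries_vonMangoldt_eq_deriv_riemannZeta_div hs, h, mellinTail]
  congr 1
  refine setIntegral_congr_fun measurableSet_Ioi fun x _ => ?_
  rw [← Complex.ofReal_sum]
  congr 2

theorem mellinTail_shift (f : ℝ → ℝ) (s : ℂ) :
    mellinTail (fun x => f x / x) s = mellinTail f (s + 1) := by
  refine setIntegral_congr_fun measurableSet_Ioi fun x hx => ?_
  have hx0 : (x : ℂ) ≠ 0 := by
    have : (1 : ℝ) < x := hx
    exact_mod_cast (by linarith : x ≠ 0)
  simp only
  rw [show -(s + 1 + 1) = -(s + 1) - 1 by ring, Complex.cpow_sub _ _ hx0, Complex.cpow_one]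
  push_cast
  ring

theorem log_le_two_mul_sqrt {x : ℝ} (hx : 1 < x) : log x ≤ 2 * √x := by
  have h1 : log x = 2 * log (√x) := by rw [Real.log_sqrt (by linarith)]; ring
  have := Real.log_le_sub_one_of_pos (Real.sqrt_pos.2 (by linarith : 0 < x))
  linarith

theorem log_sq_le {x : ℝ} (hx : 1 < x) : log x ^ 2 ≤ 4 * x := by
  have h1 := log_le_two_mul_sqrt hx
  have h2 : √x ^ 2 = x := Real.sq_sqrt (by linarith)
  have h3 := Real.log_nonneg hx.le
  nlinarith

theorem abs_mul_log_le {u : ℝ} (hu : 0 < u) : |u * log u| ≤ 1 + u ^ 2 := by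
  have h1 := Real.log_le_sub_one_of_pos hu
  have h2 := Real.one_sub_inv_le_log_of_pos hu
  have h3 : u * (1 - u⁻¹) = u - 1 := by field_simp
  rw [abs_le]
  constructor <;> nlinarith [mul_le_mul_of_nonneg_left h1 hu.le, mul_le_mul_of_nonneg_left h2 hu.le]

theorem polyBound_log : PolyBound log 1 :=
  ⟨Real.measurable_log, 1, fun x hx => by
    rw [abs_of_nonneg (Real.log_nonneg hx.le), Real.rpow_one, one_mul]
    linarith [Real.log_le_sub_one_of_pos (by linarith : 0 < x)]⟩

theorem polyBound_log_mul_log_log : PolyBound (fun x => log x * log (log x)) 1 :=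
  ⟨by fun_prop, 5, fun x hx => by
    rw [Real.rpow_one]
    linarith [abs_mul_log_le (Real.log_pos hx), log_sq_le hx]⟩

theorem polyBound_log_mul_primeSum : PolyBound (fun x => log x * primeSum x) 1 :=
  ⟨Real.measurable_log.mul measurable_primeSum, 5, fun x hx => by
    have h0 := Real.log_nonneg hx.le
    rw [Real.rpow_one, abs_of_nonneg (mul_nonneg h0 (primeSum_nonneg x))]
    have h1 := mul_le_mul_of_nonneg_left (primeSum_le hx.le) h0
    nlinarith [log_sq_le hx, Real.log_le_sub_one_of_pos (by linarith : 0 < x)]⟩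

theorem polyBound_primeSum : PolyBound primeSum 1 :=
  ⟨measurable_primeSum, 1, fun x hx => by
    rw [Real.rpow_one, abs_of_nonneg (primeSum_nonneg x)]
    linarith [primeSum_le hx.le, Real.log_le_sub_one_of_pos (by linarith : 0 < x)]⟩

theorem measurable_psi : Measurable Chebyshev.psi := Chebyshev.psi_mono.measurable

theorem abs_psi_div_le {x : ℝ} (hx : 0 < x) : |Chebyshev.psi x / x| ≤ log 4 + 4 := by
  rw [abs_of_nonneg (div_nonneg (Chebyshev.psi_nonneg x) hx.le), div_le_iff₀ hx]
  exact Chebyshev.psi_le_const_mul_self hx.le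

theorem polyBound_psi_div : PolyBound (fun x => Chebyshev.psi x / x) 0 :=
  ⟨measurable_psi.div measurable_id, log 4 + 4, fun x hx => by
    rw [Real.rpow_zero, mul_one]; exact abs_psi_div_le (by linarith)⟩

theorem mellinTail_log {s : ℂ} (hs : 0 < s.re) : mellinTail log s = 1 / s ^ 2 := by
  have h := (polyBound_rpow 0).hasDerivAt_mellinTail hs
  have hs0 : s ≠ 0 := by rintro rfl; simp at hs
  have h2 : HasDerivAt (mellinTail fun x : ℝ => x ^ (0 : ℝ)) (-(s ^ 2)⁻¹) s := by
    refine (hasDerivAt_inv hs0).congr_of_eventuallyEq ?_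
    filter_upwards [(isOpen_re_gt 0).mem_nhds hs] with z hz
    rw [mellinTail_rpow 0 hz]; simp
  have h3 := h.unique h2
  simp only [Real.rpow_zero, mul_one, neg_inj] at h3
  rw [one_div]; exact h3

theorem integrableOn_mul_log_mul_exp {s : ℝ} (hs : 1 < s) :
    IntegrableOn (fun u => u * log u * Real.exp (-(s * u))) (Set.Ioi 0) := by
  have h := (polyBound_log_mul_log_log.integrableOn (s := (s : ℂ)) (by simpa using hs)).norm
  have h2 : IntegrableOn (fun x : ℝ => ‖log x * log (log x) * x ^ (-s - 1)‖) (Set.Ioi 1) := by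
    refine IntegrableOn.congr_fun h (fun x hx => ?_) measurableSet_Ioi
    have hx0 : (0 : ℝ) < x := zero_lt_one.trans hx
    rw [norm_mellinTail_integrand (fun x => log x * log (log x)) _ hx0, norm_mul, Real.norm_eq_abs, Complex.ofReal_re,
      Real.norm_of_nonneg (Real.rpow_nonneg hx0.le _)]
  have h3 : IntegrableOn (fun x : ℝ => log x * log (log x) * x ^ (-s - 1)) (Set.Ioi 1) :=
    (integrable_norm_iff (Measurable.aestronglyMeasurable (by fun_prop))).1 h2
  rw [integrableOn_comp_exp_Ioi] at h3
  refine h3.congr_fun (fun u _ => ?_) measurableSet_Ioi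
  simp only
  rw [smul_eq_mul, mul_left_comm, exp_mul_rpow_exp, Real.log_exp]

theorem integral_mul_log_mul_exp {s : ℝ} (hs : 1 < s) :
    ∫ u in Set.Ioi 0, u * log u * Real.exp (-(s * u)) =
      (1 - eulerMascheroniConstant - log s) / s ^ 2 := by
  have hs0 : 0 < s := by linarith
  have hI1 := integrableOn_log_mul_exp_neg_mul hs0
  have hI2 := integrableOn_mul_log_mul_exp hs
  have hI3 : IntegrableOn (fun u => Real.exp (-(s * u))) (Set.Ioi 0) := by
    simpa [neg_mul] using integrableOn_exp_mul_Ioi (a := -s) (by linarith) 0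
  have hv3 : ∫ u in Set.Ioi 0, Real.exp (-(s * u)) = 1 / s := by
    have := integral_exp_mul_Ioi (a := -s) (by linarith) 0
    simp only [neg_mul, mul_zero, Real.exp_zero] at this
    rw [this]; field_simp
  have hder : ∀ u ∈ Set.Ioi (0 : ℝ), HasDerivAt (fun u => u * log u * Real.exp (-(s * u)))
      (log u * Real.exp (-(s * u)) + Real.exp (-(s * u)) -
        s * (u * log u * Real.exp (-(s * u)))) u := by
    intro u hu
    have h1 := Real.hasDerivAt_mul_log (ne_of_gt hu)
    have h2 : HasDerivAt (fun u => Real.exp (-(s * u))) (Real.exp (-(s * u)) * (-(s * 1))) u :=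
      (((hasDerivAt_id u).const_mul s).neg).exp
    exact (h1.mul h2).congr_deriv (by ring)
  have hcont : Continuous (fun u : ℝ => u * log u * Real.exp (-(s * u))) :=
    Real.continuous_mul_log.mul (by fun_prop)
  have htend : Tendsto (fun u : ℝ => u * log u * Real.exp (-(s * u))) atTop (𝓝 0) := by
    have h1 : Tendsto (fun u : ℝ => u ^ 2 * Real.exp (-u)) atTop (𝓝 0) :=
      Real.tendsto_pow_mul_exp_neg_atTop_nhds_zero 2
    refine squeeze_zero_norm' ?_ h1
    filter_upwards [eventually_ge_atTop 1] with u hu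
    have h2 := Real.log_nonneg hu
    have h3 := Real.log_le_sub_one_of_pos (by linarith : 0 < u)
    rw [Real.norm_of_nonneg (by positivity)]
    have h4 : Real.exp (-(s * u)) ≤ Real.exp (-u) := Real.exp_le_exp.2 (by nlinarith)
    have h5 : u * log u ≤ u ^ 2 := by nlinarith
    exact mul_le_mul h5 h4 (Real.exp_pos _).le (by positivity)
  have h := integral_Ioi_of_hasDerivAt_of_tendsto hcont.continuousWithinAt hder
    ((hI1.add hI3).sub (hI2.const_mul s)) htend
  have hs1 : ∫ u in Set.Ioi 0, (log u * Real.exp (-(s * u)) + Real.exp (-(s * u)) -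
        s * (u * log u * Real.exp (-(s * u)))) = (-eulerMascheroniConstant - log s) / s + 1 / s -
        s * ∫ u in Set.Ioi 0, u * log u * Real.exp (-(s * u)) := by
    rw [integral_sub (by exact hI1.add hI3) (hI2.const_mul s), integral_add hI1 hI3, hv3,
      integral_log_mul_exp_neg_mul hs0, integral_const_mul]
  rw [hs1] at h
  simp only [zero_mul, sub_zero] at h
  field_simp at h ⊢
  linarith

theorem mellinTail_log_mul_log_log {s : ℝ} (hs : 1 < s) :
    mellinTail (fun x => log x * log (log x)) s =
      (((1 - eulerMascheroniConstant - log s) / s ^ 2 : ℝ) : ℂ) := by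
  rw [mellinTail_ofReal, ← integral_mul_log_mul_exp hs, integral_comp_exp_Ioi]
  congr 2; ext u
  rw [smul_eq_mul, mul_left_comm, exp_mul_rpow_exp, Real.log_exp]

theorem mellinTail_log_mul_primeSum {s : ℂ} (hs : 1 < s.re) :
    s * mellinTail (fun x => log x * primeSum x) s =
      mellinTail primeSum s - deriv riemannZeta (1 + s) / riemannZeta (1 + s) := by
  have h1 := polyBound_primeSum.hasDerivAt_mellinTail hs
  have h2 := (hasDerivAt_id s).mul h1
  have h3 : HasDerivAt (fun z => LSeries (fun n => (logZetaCoeff n : ℂ)) (1 + z))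
      (deriv riemannZeta (1 + s) / riemannZeta (1 + s)) s := by
    have := (hasDerivAt_LSeries_logZetaCoeff (s := 1 + s) (by simp; linarith)).comp s
      ((hasDerivAt_id s).const_add 1)
    exact this.congr_deriv (mul_one _)
  have h4 : HasDerivAt (fun z => z * mellinTail primeSum z)
      (deriv riemannZeta (1 + s) / riemannZeta (1 + s)) s := by
    refine h3.congr_of_eventuallyEq ?_
    filter_upwards [(isOpen_re_gt 1).mem_nhds hs] with z hz
    have hz' : 1 < z.re := hz
    rw [LSeries_logZetaCoeff_eq (by linarith)]; rfl
  have := h2.unique h4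
  simp only [id_eq, one_mul] at this
  linear_combination -this

/-- The function `s ζ(1+s)`, entire and equal to `1` at `s = 0`. -/
def zetaShift (s : ℂ) : ℂ := riemannZeta₁ (1 + s)

theorem differentiable_zetaShift : Differentiable ℂ zetaShift := by
  unfold zetaShift
  exact differentiable_riemannZeta₁.comp (by fun_prop)

theorem analyticAt_zetaShift (s : ℂ) : AnalyticAt ℂ zetaShift s :=
  differentiable_zetaShift.analyticAt s

theorem zetaShift_zero : zetaShift 0 = 1 := by simp [zetaShift, riemannZeta₁_one]

theorem zetaShift_eq {s : ℂ} (hs : s ≠ 0) : zetaShift s = s * riemannZeta (1 + s) := by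
  rw [zetaShift, riemannZeta_eq_inv_sub_mul (by simpa using hs), add_sub_cancel_left,
    mul_inv_cancel_left₀ hs]

theorem zetaShift_mem_slitPlane {s : ℝ} (hs : -1 < s) : zetaShift s ∈ Complex.slitPlane := by
  obtain ⟨r, hr, h⟩ := riemannZeta₁_ofReal_pos (s := 1 + s) (by linarith)
  rw [zetaShift, show (1 : ℂ) + s = ((1 + s : ℝ) : ℂ) by push_cast; ring, h]
  exact Complex.ofReal_mem_slitPlane.2 hr

theorem deriv_zetaShift_div {s : ℂ} (hs : 0 < s.re) :
    deriv zetaShift s / zetaShift s =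
      1 / s + deriv riemannZeta (1 + s) / riemannZeta (1 + s) := by
  have hs0 : s ≠ 0 := by rintro rfl; simp at hs
  have hz : riemannZeta (1 + s) ≠ 0 := riemannZeta_ne_zero_of_one_le_re (by simp; linarith)
  have h1 : HasDerivAt (fun z => z * riemannZeta (1 + z))
      (1 * riemannZeta (1 + s) + s * (deriv riemannZeta (1 + s) * 1)) s :=
    (hasDerivAt_id s).mul ((differentiableAt_riemannZeta (by simpa using hs0)).hasDerivAt.comp s
      ((hasDerivAt_id s).const_add 1))
  have h2 : HasDerivAt zetaShift
      (1 * riemannZeta (1 + s) + s * (deriv riemannZeta (1 + s) * 1)) s := by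
    refine h1.congr_of_eventuallyEq ?_
    filter_upwards [isOpen_ne.mem_nhds hs0] with z hz using zetaShift_eq hz
  rw [h2.deriv, zetaShift_eq hs0]
  field_simp

theorem clog_zetaShift {s : ℝ} (hs : 0 < s) :
    Complex.log (zetaShift s) = (log s : ℝ) + s * mellinTail primeSum s := by
  have hs0 : (s : ℂ) ≠ 0 := by exact_mod_cast hs.ne'
  rw [zetaShift_eq hs0, riemannZeta_one_add_eq_exp hs, mellinTail_ofReal, ← Complex.ofReal_mul,
    ← Complex.ofReal_log (by positivity), Real.log_mul hs.ne' (Real.exp_pos _).ne', Real.log_exp]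
  push_cast; ring

/-- `log x` times the deviation of `primeSum x` from its first-order expansion. -/
def errLog (x : ℝ) : ℝ :=
  log x * (eulerMascheroniConstant + log (log x) - primeSum x) + (Chebyshev.psi x - x) / x

theorem errLog_eq {x : ℝ} (hx : 1 < x) : errLog x =
    (eulerMascheroniConstant * log x + log x * log (log x)) + ((-1) * (log x * primeSum x) +
      (Chebyshev.psi x / x + (-1) * x ^ (0 : ℝ))) := by
  have : x ≠ 0 := by linarith
  rw [errLog, Real.rpow_zero]
  field_simp
  ring

theorem measurable_errLog : Measurable errLog := by
  have := measurable_primeSum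
  have := measurable_psi
  unfold errLog
  fun_prop

theorem polyBound_errLog_terms : PolyBound (fun x =>
    (eulerMascheroniConstant * log x + log x * log (log x)) + ((-1) * (log x * primeSum x) +
      (Chebyshev.psi x / x + (-1) * x ^ (0 : ℝ)))) 1 :=
  ((polyBound_log.const_mul _).add polyBound_log_mul_log_log).add
    ((polyBound_log_mul_primeSum.const_mul _).add
      ((polyBound_psi_div.add ((polyBound_rpow 0).const_mul _)).mono zero_le_one))

theorem polyBound_errLog : PolyBound errLog 1 := by
  obtain ⟨_, C, hC⟩ := polyBound_errLog_terms
  exact ⟨measurable_errLog, C, fun x hx => by rw [errLog_eq hx]; exact hC x hx⟩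

/-- The analytic continuation of `s² · mellinTail errLog s`. -/
def errTransform (s : ℂ) : ℂ :=
  -s ^ 2 / (1 + s) + s / (1 + s) * (deriv zetaShift s / zetaShift s) - Complex.log (zetaShift s)

theorem mellinTail_errLog {s : ℝ} (hs : 1 < s) :
    (s : ℂ) ^ 2 * mellinTail errLog s = errTransform s := by
  have hs' : 1 < ((s : ℂ)).re := by simpa using hs
  have hs0' : 0 < ((s : ℂ)).re := by simpa using (by linarith : 0 < s)
  have hs0 : (s : ℂ) ≠ 0 := by exact_mod_cast (by linarith : s ≠ 0)
  have hs1 : (1 : ℂ) + s ≠ 0 := by exact_mod_cast (by linarith : 1 + s ≠ 0)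
  have h4 := (polyBound_psi_div.add ((polyBound_rpow 0).const_mul (-1))).mono zero_le_one
  rw [mellinTail_congr (fun x hx => errLog_eq hx),
    mellinTail_add ((polyBound_log.const_mul _).add polyBound_log_mul_log_log)
      ((polyBound_log_mul_primeSum.const_mul _).add h4) hs' hs',
    mellinTail_add (polyBound_log.const_mul _) polyBound_log_mul_log_log hs' hs',
    mellinTail_add (polyBound_log_mul_primeSum.const_mul _) h4 hs' hs',
    mellinTail_add polyBound_psi_div ((polyBound_rpow 0).const_mul (-1)) hs0' hs0']
  simp only [mellinTail_const_mul]
  rw [mellinTail_log hs0', mellinTail_log_mul_log_log hs, mellinTail_shift, mellinTail_rpow 0 hs0',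
    errTransform, deriv_zetaShift_div hs0', clog_zetaShift (by linarith)]
  have h1 := mellinTail_log_mul_primeSum hs'
  have h2 := mellinTail_psi (s := s + 1) (by simp; linarith)
  rw [add_comm (s : ℂ) 1] at h2 ⊢
  set D := deriv riemannZeta (1 + s) / riemannZeta (1 + s)
  rw [mul_comm, ← eq_div_iff hs0] at h1
  rw [mul_comm, ← eq_div_iff hs1] at h2
  rw [h1, h2]
  push_cast
  field_simp
  ring

theorem analyticAt_errTransform {s : ℝ} (hs : -1 < s) : AnalyticAt ℂ errTransform s := by
  have hs1 : (1 : ℂ) + s ≠ 0 := by exact_mod_cast (by linarith : 1 + s ≠ 0)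
  have hZ := analyticAt_zetaShift s
  have hm := zetaShift_mem_slitPlane hs
  have h1 : AnalyticAt ℂ (fun z : ℂ => 1 + z) s := analyticAt_const.add analyticAt_id
  exact ((((analyticAt_id.pow 2).neg).div h1 hs1).add ((analyticAt_id.div h1 hs1).mul
    (hZ.deriv.div hZ (Complex.slitPlane_ne_zero hm)))).sub (hZ.clog hm)

theorem errTransform_zero : errTransform 0 = 0 := by simp [errTransform, zetaShift_zero]

theorem deriv_errTransform_zero : deriv errTransform 0 = 0 := by
  have h1 : HasDerivAt (fun z : ℂ => 1 + z) 1 0 := (hasDerivAt_id 0).const_add 1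
  have hZ := differentiable_zetaShift.differentiableAt.hasDerivAt (x := (0 : ℂ))
  have hZ' := (analyticAt_zetaShift 0).deriv.differentiableAt.hasDerivAt
  have h2 := (((hasDerivAt_id (0 : ℂ)).pow 2).neg.div h1 (by simp))
  have h3 := ((hasDerivAt_id (0 : ℂ)).div h1 (by simp)).mul
    (hZ'.div hZ (by rw [zetaShift_zero]; exact one_ne_zero))
  have h4 := hZ.clog (by rw [zetaShift_zero]; exact Complex.one_mem_slitPlane)
  have h := ((h2.add h3).sub h4).deriv
  change deriv errTransform 0 = _ at h
  rw [h]
  simp [zetaShift_zero]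

theorem analyticAt_dslope {f : ℂ → ℂ} {c z : ℂ} (hf : AnalyticAt ℂ f z) :
    AnalyticAt ℂ (dslope f c) z := by
  rcases eq_or_ne z c with rfl | hzc
  · obtain ⟨p, hp⟩ := hf
    exact ⟨_, hp.has_fpower_series_dslope_fslope⟩
  · have h1 : AnalyticAt ℂ (fun w => (w - c)⁻¹ * (f w - f c)) z :=
      ((analyticAt_id.sub analyticAt_const).inv (sub_ne_zero.2 hzc)).mul (hf.sub analyticAt_const)
    refine h1.congr ?_
    filter_upwards [isOpen_ne.mem_nhds hzc] with w hw
    rw [dslope_of_ne _ hw, slope_def_module, smul_eq_mul]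

/-- The analytic continuation of `mellinTail errLog`. -/
def errQuot : ℂ → ℂ := dslope (dslope errTransform 0) 0

theorem sq_mul_errQuot (s : ℂ) : s ^ 2 * errQuot s = errTransform s := by
  rcases eq_or_ne s 0 with rfl | hs
  · simp [errTransform_zero]
  · rw [errQuot, dslope_of_ne _ hs, slope_def_module, dslope_of_ne _ hs, slope_def_module, dslope_same,
      deriv_errTransform_zero, errTransform_zero]
    simp only [sub_zero, smul_eq_mul]
    field_simp

theorem log_log_le_tangent {x y : ℝ} (hx : 1 < x) (hy : 1 < y) :
    log (log y) ≤ log (log x) + (y - x) / (x * log x) := by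
  have h (a b : ℝ) (ha : 0 < a) (hb : 0 < b) : log b ≤ log a + (b - a) / a := by
    have h1 := Real.log_le_sub_one_of_pos (div_pos hb ha)
    rw [Real.log_div hb.ne' ha.ne'] at h1
    have : (b - a) / a = b / a - 1 := by field_simp
    linarith
  have hlx := Real.log_pos hx
  refine (h (log x) (log y) hlx (Real.log_pos hy)).trans ?_
  have h2 := h x y (by linarith) (by linarith)
  have h3 : (log y - log x) / log x ≤ ((y - x) / x) / log x := by gcongr; linarith
  rw [div_div] at h3
  linarith

theorem neg_errLog_le (hR : ∀ n : ℕ, 10080 ≤ n → robinF n < exp eulerMascheroniConstant) {x : ℝ}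
    (hx : 10080 ≤ x) : -(12 * (log x / √x)) ≤ errLog x := by
  have hN : 10080 ≤ ⌊x⌋₊ := Nat.le_floor (by exact_mod_cast hx)
  have hN' : (10080 : ℝ) ≤ ⌊x⌋₊ := by exact_mod_cast hN
  have hn : 10080 ≤ Nat.lcmUpto ⌊x⌋₊ := hN.trans le_lcmUpto
  have hn' : (10080 : ℝ) ≤ (Nat.lcmUpto ⌊x⌋₊ : ℕ) := by exact_mod_cast hn
  have hψ : log (Nat.lcmUpto ⌊x⌋₊ : ℕ) = Chebyshev.psi x := by
    rw [Chebyshev.psi_eq_psi_coe_floor, Chebyshev.psi_eq_log_lcmUpto]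
  have hψ1 : 1 < Chebyshev.psi x := by
    rw [← hψ, Real.lt_log_iff_exp_lt (by linarith)]
    linarith [Real.exp_one_lt_d9]
  have h1 := hR _ hn
  rw [robinF_eq_exp (by omega) (by rw [hψ]; exact Real.log_pos hψ1), Real.exp_lt_exp, hψ] at h1
  have h2 := le_log_sigma1_lcmUpto (N := ⌊x⌋₊) (by omega)
  have h3 : primeSum (⌊x⌋₊ : ℝ) = primeSum x := by simp [primeSum]
  have h4 := log_log_le_tangent (x := x) (by linarith) hψ1
  have h5 : 6 / √(⌊x⌋₊ : ℝ) ≤ 12 / √x := by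
    have h6 : √x ≤ 2 * √(⌊x⌋₊ : ℝ) := by
      have : √(2 ^ 2 * (⌊x⌋₊ : ℝ)) = 2 * √(⌊x⌋₊ : ℝ) := by
        rw [Real.sqrt_mul (by norm_num), Real.sqrt_sq (by norm_num)]
      rw [← this]
      exact Real.sqrt_le_sqrt (by linarith [Nat.lt_floor_add_one x])
    have : 0 < √(⌊x⌋₊ : ℝ) := Real.sqrt_pos.2 (by linarith)
    have : 0 < √x := Real.sqrt_pos.2 (by linarith)
    rw [div_le_div_iff₀ (by assumption) (by assumption)]
    linarith
  have hl : 0 < log x := Real.log_pos (by linarith)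
  have h7 : (Chebyshev.psi x - x) / x = log x * ((Chebyshev.psi x - x) / (x * log x)) := by
    have : x ≠ 0 := by linarith
    field_simp
  rw [errLog, h7, ← mul_add, show -(12 * (log x / √x)) = log x * (-(12 / √x)) by ring]
  refine mul_le_mul_of_nonneg_left ?_ hl.le
  linarith

theorem exists_nonneg_errLog_add
    (hR : ∀ n : ℕ, 10080 ≤ n → robinF n < exp eulerMascheroniConstant) {b : ℝ} (hb0 : 0 ≤ b)
    (hb : b < 1 / 2) : ∃ C : ℝ, ∀ x, 1 < x → 0 ≤ errLog x + C * x ^ (-b) := by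
  obtain ⟨_, D, hD⟩ := polyBound_errLog
  refine ⟨12 / (1 / 2 - b) + |D| * (10080 * 10080 ^ b), fun x hx => ?_⟩
  have hx0 : (0 : ℝ) < x := by linarith
  have hp : 0 < x ^ (-b) := by positivity
  have hb' : 0 < 1 / 2 - b := by linarith
  rw [add_mul]
  rcases le_total 10080 x with h | h
  · have h1 := neg_errLog_le hR h
    have h2 := Real.log_le_rpow_div hx0.le hb'
    have h3 : log x / √x ≤ x ^ (-b) / (1 / 2 - b) := by
      rw [div_le_iff₀ (by positivity), Real.sqrt_eq_rpow, div_mul_eq_mul_div,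
        ← Real.rpow_add hx0]
      rwa [show -b + 1 / 2 = 1 / 2 - b by ring]
    have h4 : 0 ≤ |D| * (10080 * 10080 ^ b) * x ^ (-b) := by positivity
    have h5 : 12 / (1 / 2 - b) * x ^ (-b) = 12 * (x ^ (-b) / (1 / 2 - b)) := by ring
    linarith
  · have h1 := (abs_le.1 (hD x hx)).1
    rw [Real.rpow_one] at h1
    have h2 : D * x ≤ |D| * 10080 := by
      have := le_abs_self D
      have := abs_nonneg D
      nlinarith
    have h3 : (1 : ℝ) ≤ 10080 ^ b * x ^ (-b) := by
      rw [Real.rpow_neg hx0.le, ← div_eq_mul_inv, ← Real.div_rpow (by norm_num) hx0.le]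
      exact Real.one_le_rpow ((one_le_div hx0).2 h) hb0
    have h4 : |D| * 10080 * 1 ≤ |D| * 10080 * (10080 ^ b * x ^ (-b)) := by gcongr
    have h5 : 0 ≤ 12 / (1 / 2 - b) * x ^ (-b) := by positivity
    linarith

/-- If `errLog x + C x^{-b}` is nonnegative, `mellinTail errLog` continues to `Re s > -b`. -/
theorem exists_differentiableAt_errTransform {b C : ℝ} (hb1 : b < 1) (hb0 : 0 ≤ b)
    (hC : ∀ x, 1 < x → 0 ≤ errLog x + C * x ^ (-b)) :
    ∃ K : ℂ → ℂ, (∀ s : ℂ, -b < s.re → DifferentiableAt ℂ K s) ∧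
      ∀ s : ℝ, 1 < s → (s : ℂ) ^ 2 * K s = errTransform s := by
  have hp := (polyBound_rpow (-b)).const_mul C
  have hne {s : ℂ} (hs : -b < s.re) : s + b ≠ 0 := fun h => by
    have := congrArg Complex.re h
    simp at this
    linarith
  have hm {s : ℂ} (hs : -b < s.re) : mellinTail (fun x => C * x ^ (-b)) s = C / (s + b) := by
    rw [mellinTail_const_mul, mellinTail_rpow _ hs]
    push_cast
    rw [sub_neg_eq_add, mul_one_div]
  have hsum {s : ℝ} (hs : 1 < s) : mellinTail (fun x => errLog x + C * x ^ (-b)) s =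
      mellinTail errLog s + C / (s + b) := by
    rw [mellinTail_add polyBound_errLog hp (by simpa using hs) (by simp; linarith),
      hm (by simp; linarith)]
  refine ⟨fun s => mellinTail (fun x => errLog x + C * x ^ (-b)) s - C / (s + b),
    fun s hs => ?_, fun s hs => ?_⟩
  · refine DifferentiableAt.sub ?_ ((differentiableAt_const _).div
      (differentiableAt_id.add_const _) (hne hs))
    refine differentiableAt_mellinTail_of_nonneg (a := 1) (b := -b)
      (G := fun s => errQuot s + C / (s + b)) (polyBound_errLog.add (hp.mono (by linarith))) hC
      (fun t ht => ?_) (fun t ht => ?_) hs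
    · exact (analyticAt_dslope (analyticAt_dslope (analyticAt_errTransform (by linarith)))).add
        (analyticAt_const.div (analyticAt_id.add analyticAt_const) (hne (by simpa using ht)))
    · have h0 : (t : ℂ) ^ 2 ≠ 0 := by
        have : (t : ℂ) ≠ 0 := by exact_mod_cast (by linarith : t ≠ 0)
        positivity
      rw [hsum ht, mul_left_cancel₀ h0 ((sq_mul_errQuot t).trans (mellinTail_errLog ht).symm)]
  · simp only
    rw [hsum hs, add_sub_cancel_right, mellinTail_errLog hs]

theorem zetaShift_ne_zero_of_errTransform {b : ℝ} (hb1 : b < 1) (hb0 : 0 ≤ b) {K : ℂ → ℂ}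
    (hK : ∀ s : ℂ, -b < s.re → DifferentiableAt ℂ K s)
    (hK' : ∀ s : ℝ, 1 < s → (s : ℂ) ^ 2 * K s = errTransform s) {R : ℝ} (hR : 1 < R) {s : ℂ}
    (hs : s ∈ Metric.ball (R : ℂ) (R + b)) : zetaShift s ≠ 0 := by
  have hre {z : ℂ} (hz : z ∈ Metric.ball (R : ℂ) (R + b)) : -b < z.re := by
    have h1 := Complex.abs_re_le_norm (z - R)
    rw [Metric.mem_ball, Complex.dist_eq] at hz
    simp only [Complex.sub_re, Complex.ofReal_re] at h1
    have := (abs_le.1 h1).1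
    linarith
  set V : ℂ → ℂ := fun z => (K z + 1 / (1 + z)) * (1 + z) * Complex.exp (-z) with hV
  have hne {z : ℂ} (hz : -b < z.re) : 1 + z ≠ 0 := fun h => by
    have := congrArg Complex.re h
    simp at this
    linarith
  have hVd : DifferentiableOn ℂ V (Metric.ball (R : ℂ) (R + b)) := fun z hz => by
    refine DifferentiableAt.differentiableWithinAt ?_
    have h1 : DifferentiableAt ℂ (fun z : ℂ => 1 + z) z := by fun_prop
    exact (((hK z (hre hz)).add ((differentiableAt_const _).div h1 (hne (hre hz)))).mul h1).mul
      (by fun_prop)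
  obtain ⟨U, hU⟩ := hVd.isExactOn_ball
  have hRball : (R : ℂ) ∈ Metric.ball (R : ℂ) (R + b) := Metric.mem_ball_self (by linarith)
  have hKan : AnalyticAt ℂ K R := by
    rw [Complex.analyticAt_iff_eventually_differentiableAt]
    filter_upwards [(isOpen_re_gt (-b)).mem_nhds (hre hRball)] with z hz using hK z hz
  have heq : (fun z : ℂ => z ^ 2 * K z) =ᶠ[𝓝 (R : ℂ)] errTransform :=
    eventually_eq_of_forall_real ((analyticAt_id.pow 2).mul hKan)
      (analyticAt_errTransform (by linarith))
      (by filter_upwards [Ioi_mem_nhds hR] with x hx using hK' x hx)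
  set W : ℂ → ℂ := fun z => Complex.log (zetaShift z) * (Complex.exp (-z) / z) with hW
  have hslit : ∀ᶠ z in 𝓝 (R : ℂ), zetaShift z ∈ Complex.slitPlane :=
    differentiable_zetaShift.continuous.continuousAt.eventually_mem
      (Complex.isOpen_slitPlane.mem_nhds (zetaShift_mem_slitPlane (by linarith)))
  have hz0 : ∀ᶠ z in 𝓝 (R : ℂ), z ≠ 0 :=
    isOpen_ne.mem_nhds (Complex.ofReal_ne_zero.2 (by linarith))
  obtain ⟨r, hr, hball⟩ := Metric.eventually_nhds_iff_ball.1
    (((heq.and hslit).and hz0).and (Metric.isOpen_ball.mem_nhds hRball))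
  have hWU : ∀ z ∈ Metric.ball (R : ℂ) r, HasDerivAt (fun z => W z - U z) 0 z := fun z hz => by
    obtain ⟨⟨⟨h1, h2⟩, h3⟩, h4⟩ := hball z hz
    have hq : HasDerivAt (fun z => Complex.log (zetaShift z)) (deriv zetaShift z / zetaShift z) z :=
      (differentiable_zetaShift z).hasDerivAt.clog h2
    have he : HasDerivAt (fun z : ℂ => Complex.exp (-z) / z)
        ((Complex.exp (-z) * (-1) * z - Complex.exp (-z) * 1) / z ^ 2) z :=
      ((hasDerivAt_id z).neg.cexp).div (hasDerivAt_id z) h3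
    refine ((hq.mul he).sub (hU z h4)).congr_deriv ?_
    have h5 := hne (hre h4)
    simp only [errTransform] at h1
    have h6 : Complex.log (zetaShift z) = -z ^ 2 / (1 + z) +
      z / (1 + z) * (deriv zetaShift z / zetaShift z) - z ^ 2 * K z := by rw [h1]; ring
    simp only [hV]
    rw [h6]
    generalize deriv zetaShift z / zetaShift z = q
    field_simp
    ring
  have hcon : ∀ z ∈ Metric.ball (R : ℂ) r, W z - U z = W R - U R := fun z hz =>
    Metric.isOpen_ball.is_const_of_deriv_eq_zero (Metric.isPreconnected_ball)
      (fun z hz => (hWU z hz).differentiableAt.differentiableWithinAt)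
      (fun z hz => (hWU z hz).deriv) hz (Metric.mem_ball_self hr)
  have hexp : ∀ z ∈ Metric.ball (R : ℂ) r,
      zetaShift z = Complex.exp (z * Complex.exp z * (U z + (W R - U R))) := fun z hz => by
    obtain ⟨⟨⟨_, h2⟩, h3⟩, _⟩ := hball z hz
    rw [← hcon z hz, add_sub_cancel]
    simp only [hW]
    rw [show z * Complex.exp z * (Complex.log (zetaShift z) * (Complex.exp (-z) / z)) =
      Complex.log (zetaShift z) * (Complex.exp z * Complex.exp (-z)) by field_simp,
      ← Complex.exp_add, add_neg_cancel, Complex.exp_zero, mul_one,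
      Complex.exp_log (Complex.slitPlane_ne_zero h2)]
  have hUd : DifferentiableOn ℂ (fun z => Complex.exp (z * Complex.exp z * (U z + (W R - U R))))
      (Metric.ball (R : ℂ) (R + b)) := fun z hz => by
    have := (hU z hz).differentiableAt
    exact DifferentiableAt.differentiableWithinAt (by fun_prop)
  have key := AnalyticOnNhd.eqOn_of_preconnected_of_eventuallyEq
    (differentiable_zetaShift.differentiableOn.analyticOnNhd (s := Metric.ball (R : ℂ) (R + b))
      Metric.isOpen_ball) (hUd.analyticOnNhd Metric.isOpen_ball) Metric.isPreconnected_ball hRball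
    (by filter_upwards [Metric.ball_mem_nhds (R : ℂ) hr] with z hz using hexp z hz)
  rw [key hs]
  exact Complex.exp_ne_zero _

theorem exists_mem_ball_of_neg_lt_re {s : ℂ} {b : ℝ} (hb : 0 ≤ b) (hs : -b < s.re) :
    ∃ R : ℝ, 1 < R ∧ s ∈ Metric.ball (R : ℂ) (R + b) := by
  have h : Tendsto (fun R : ℝ => 2 * (s.re + b) * R) atTop atTop :=
    tendsto_id.const_mul_atTop (by linarith)
  obtain ⟨R, h1, h2⟩ := ((h.eventually_gt_atTop (s.re ^ 2 + s.im ^ 2)).and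
    (eventually_gt_atTop 1)).exists
  refine ⟨R, h2, ?_⟩
  rw [Metric.mem_ball, Complex.dist_eq, ← abs_of_nonneg (norm_nonneg (s - R)),
    ← abs_of_nonneg (by linarith : 0 ≤ R + b), ← sq_lt_sq, Complex.sq_norm, Complex.normSq_apply]
  simp only [Complex.sub_re, Complex.ofReal_re, Complex.sub_im, Complex.ofReal_im]
  nlinarith

theorem riemannZeta_ne_zero_of_robin
    (hR : ∀ n : ℕ, 10080 ≤ n → robinF n < exp eulerMascheroniConstant) {s : ℂ}
    (hs : 1 / 2 < s.re) : riemannZeta s ≠ 0 := by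
  rcases le_or_gt 1 s.re with h1 | h1
  · exact riemannZeta_ne_zero_of_one_le_re h1
  set z := s - 1 with hz
  have hzre : z.re = s.re - 1 := by simp [hz]
  obtain ⟨b, hb1, hb2⟩ := exists_between (show 1 - s.re < 1 / 2 by linarith)
  obtain ⟨C, hC⟩ := exists_nonneg_errLog_add hR (by linarith : 0 ≤ b) hb2
  obtain ⟨K, hK, hK'⟩ := exists_differentiableAt_errTransform (by linarith : b < 1)
    (by linarith) hC
  obtain ⟨R, hR1, hR2⟩ := exists_mem_ball_of_neg_lt_re (s := z) (b := b) (by linarith)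
    (by rw [hzre]; linarith)
  have h := zetaShift_ne_zero_of_errTransform (by linarith) (by linarith) hK hK' hR1 hR2
  have hz0 : z ≠ 0 := fun h0 => by
    rw [h0] at hzre
    simp at hzre
    linarith
  rw [zetaShift_eq hz0, hz, add_sub_cancel] at h
  exact right_ne_zero_of_mul h

theorem riemannHypothesis_of_ne_zero (h : ∀ s : ℂ, 1 / 2 < s.re → riemannZeta s ≠ 0) :
    RiemannHypothesis := by
  intro s hs htriv hs1
  rcases lt_trichotomy s.re (1 / 2) with h1 | h1 | h1
  · exfalso
    have hs0 : s ≠ 0 := fun h0 => by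
      rw [h0, riemannZeta_zero] at hs
      norm_num at hs
    have hre : 1 / 2 < (1 - s).re := by simp; linarith
    have hΓ : ∀ n : ℕ, 1 - s ≠ -n := fun n hn => by
      have := congrArg Complex.re hn
      simp at this
      have h0 : (0 : ℝ) ≤ n := by positivity
      simp at hre
      linarith
    have h2 := riemannZeta_one_sub hΓ (fun h => hs0 (by linear_combination -h))
    rw [sub_sub_cancel, hs] at h2
    have h3 : Complex.cos (π * (1 - s) / 2) = 0 := by
      have hp : (2 * π : ℂ) ≠ 0 := by exact_mod_cast (by positivity : (2 * π) ≠ 0)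
      have := h2.symm
      simp only [mul_eq_zero, Complex.cpow_eq_zero_iff, h _ hre, Complex.Gamma_ne_zero hΓ, hp,
        or_false, false_and] at this
      simpa using this
    obtain ⟨k, hk⟩ := Complex.cos_eq_zero_iff.1 h3
    have hpi : (π : ℂ) ≠ 0 := by exact_mod_cast Real.pi_ne_zero
    have hk' : s = -(2 * (k : ℂ)) := by
      have h4 : (π : ℂ) * (1 - s) = π * (2 * k + 1) := by linear_combination 2 * hk
      have := mul_left_cancel₀ hpi h4
      linear_combination -this
    have hkre : s.re = -(2 * (k : ℝ)) := by rw [hk']; simp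
    have hkpos : 0 < k := by
      by_contra hneg
      have : k ≤ 0 := by omega
      rcases this.lt_or_eq with hlt | rfl
      · have : (k : ℝ) ≤ -1 := by exact_mod_cast (by omega : k ≤ -1)
        linarith
      · exact hs0 (by simpa using hk')
    refine htriv ⟨(k - 1).toNat, ?_⟩
    have : (((k - 1).toNat : ℤ) : ℂ) = (k : ℂ) - 1 := by
      rw [Int.toNat_of_nonneg (by omega)]; push_cast; ring
    rw [Int.cast_natCast] at this
    rw [this, hk']
    ring
  · exact h1
  · exact absurd hs (h s h1)

theorem riemannHypothesis_of_robin
    (hR : ∀ n : ℕ, 10080 ≤ n → robinF n < exp eulerMascheroniConstant) : RiemannHypothesis :=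
  riemannHypothesis_of_ne_zero fun _ hs => riemannZeta_ne_zero_of_robin hR hs

/-- The Riemann `ξ`-function, normalised by `ξ(0) = ξ(1) = 1`. -/
def xi (s : ℂ) : ℂ := s * (s - 1) * completedRiemannZeta₀ s + 1

theorem differentiable_xi : Differentiable ℂ xi := by
  have := differentiable_completedZeta₀
  unfold xi
  fun_prop

theorem xi_one_sub (s : ℂ) : xi (1 - s) = xi s := by
  rw [xi, xi, completedRiemannZeta₀_one_sub]
  ring

theorem riemannZeta₁_eq_mul {s : ℂ} (hs : s ≠ 1) : riemannZeta₁ s = (s - 1) * riemannZeta s := by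
  have := zetaShift_eq (sub_ne_zero.2 hs)
  rwa [zetaShift, add_sub_cancel] at this

theorem xi_eq {s : ℂ} (hs : 0 < s.re) :
    xi s = 2 * (π : ℂ) ^ (-s / 2) * Complex.Gamma (s / 2 + 1) * riemannZeta₁ s := by
  have hs0 : s ≠ 0 := fun h => by simp [h] at hs
  rcases eq_or_ne s 1 with rfl | h1
  · have hpi : (0 : ℝ) < π := Real.pi_pos
    rw [xi, riemannZeta₁_one, Complex.Gamma_add_one _ (by norm_num), Complex.Gamma_one_half_eq]
    have : (π : ℂ) ^ (-1 / 2 : ℂ) * (π : ℂ) ^ (1 / 2 : ℂ) = 1 := by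
      rw [← Complex.cpow_add _ _ (by exact_mod_cast hpi.ne')]
      norm_num
    linear_combination -this
  · have hG : Complex.Gammaℝ s ≠ 0 := Complex.Gammaℝ_ne_zero_of_re_pos hs
    have h2 := riemannZeta_def_of_ne_zero hs0
    rw [eq_div_iff hG, completedRiemannZeta_eq, Complex.Gammaℝ_def] at h2
    have h3 : (1 : ℂ) - s ≠ 0 := sub_ne_zero.2 (Ne.symm h1)
    have h4 : s * (s - 1) * (completedRiemannZeta₀ s - 1 / s - 1 / (1 - s)) = xi s := by
      rw [xi]; field_simp; ring
    rw [← h4, ← h2, riemannZeta₁_eq_mul h1, Complex.Gamma_add_one _ (by simpa using hs0)]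
    ring

theorem xi_conj {s : ℂ} (hs : 0 < s.re) : xi ((starRingEnd ℂ) s) = (starRingEnd ℂ) (xi s) := by
  rcases eq_or_ne s 1 with rfl | h1
  · simp [xi]
  have h1' : (starRingEnd ℂ) s ≠ 1 := fun h => h1 (by
    rw [← Complex.conj_conj s, h, map_one])
  have hs' : 0 < ((starRingEnd ℂ) s).re := by simpa using hs
  rw [xi_eq hs, xi_eq hs', riemannZeta₁_eq_mul h1, riemannZeta₁_eq_mul h1', riemannZeta_conj]
  simp only [map_mul, map_sub, map_one, map_ofNat, ← Complex.Gamma_conj, map_add, map_div₀]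
  congr 3
  have hc := Complex.cpow_conj (π : ℂ) (-s / 2) (by
    rw [Complex.arg_ofReal_of_nonneg Real.pi_pos.le]; exact Real.pi_pos.ne)
  rw [Complex.conj_ofReal] at hc
  rw [← hc, map_div₀, map_neg, map_ofNat]

theorem norm_Gamma_le {s : ℂ} (hs : 0 < s.re) : ‖Complex.Gamma s‖ ≤ Real.Gamma s.re := by
  rw [Complex.Gamma_eq_integral hs, Real.Gamma_eq_integral hs, Complex.GammaIntegral]
  refine (norm_integral_le_integral_norm _).trans (le_of_eq ?_)
  refine setIntegral_congr_fun measurableSet_Ioi fun x hx => ?_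
  simp only [norm_mul, Complex.norm_real, Real.norm_eq_abs, abs_of_pos (Real.exp_pos _)]
  rw [Complex.norm_cpow_eq_rpow_re_of_pos hx]
  simp

theorem Gamma_le_rpow {x : ℝ} (hx : 1 ≤ x) : Real.Gamma x ≤ (x + 1) ^ (x + 1) := by
  have h1 : Real.Gamma x ≤ Real.Gamma (x + 1) := by
    rw [Real.Gamma_add_one (by linarith)]
    nlinarith [Real.Gamma_pos_of_pos (by linarith : 0 < x)]
  have h2 : Real.Gamma (x + 1) ≤ Real.Gamma ((⌊x + 1⌋₊ : ℝ) + 1) := by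
    have := Nat.lt_floor_add_one (x + 1)
    exact Real.Gamma_strictMonoOn_Ici.monotoneOn (by simp; linarith) (by simp; linarith) this.le
  rw [Real.Gamma_nat_eq_factorial] at h2
  have h3 : ((⌊x + 1⌋₊.factorial : ℕ) : ℝ) ≤ (⌊x + 1⌋₊ : ℝ) ^ ⌊x + 1⌋₊ := by
    exact_mod_cast Nat.factorial_le_pow _
  have h4 : (⌊x + 1⌋₊ : ℝ) ≤ x + 1 := Nat.floor_le (by linarith)
  calc Real.Gamma x ≤ (⌊x + 1⌋₊ : ℝ) ^ ⌊x + 1⌋₊ := by linarith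
    _ ≤ (x + 1) ^ ⌊x + 1⌋₊ := by gcongr
    _ = (x + 1) ^ (⌊x + 1⌋₊ : ℝ) := (Real.rpow_natCast _ _).symm
    _ ≤ (x + 1) ^ (x + 1) := Real.rpow_le_rpow_of_exponent_le (by linarith) h4

theorem norm_pi_cpow (s : ℂ) : ‖(π : ℂ) ^ (-s / 2)‖ = π ^ (-s.re / 2) := by
  rw [Complex.norm_cpow_eq_rpow_re_of_pos Real.pi_pos]
  congr 1
  simp

theorem norm_xi_le {s : ℂ} (hs : 1 / 4 ≤ s.re) :
    ‖xi s‖ ≤ exp (20 * (1 + ‖s‖) ^ (3 / 2 : ℝ)) := by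
  have hs0 : 0 < s.re := by linarith
  set n := 1 + ‖s‖ with hn
  have hn1 : 1 ≤ n := by linarith [norm_nonneg s]
  have hren : s.re ≤ n := by linarith [Complex.re_le_norm s]
  rw [xi_eq hs0, norm_mul, norm_mul, norm_mul, norm_pi_cpow]
  have h1 : π ^ (-s.re / 2) ≤ 1 :=
    Real.rpow_le_one_of_one_le_of_nonpos (by linarith [Real.pi_gt_three]) (by linarith)
  have h3n : log (3 * n) ≤ 4 * √n := by
    have h := log_le_two_mul_sqrt (x := 3 * n) (by linarith)
    have : √(3 * n) ≤ 2 * √n := by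
      rw [show 2 * √n = √(2 ^ 2 * n) by
        rw [Real.sqrt_mul (by norm_num), Real.sqrt_sq (by norm_num)]]
      exact Real.sqrt_le_sqrt (by linarith)
    linarith
  have hsq : n ^ (3 / 2 : ℝ) = n * √n := by
    rw [show (3 / 2 : ℝ) = 1 + 1 / 2 by norm_num, Real.rpow_add (by linarith), Real.rpow_one,
      Real.sqrt_eq_rpow]
  have hsq1 : 1 ≤ √n := Real.one_le_sqrt.2 hn1
  have h2 : ‖Complex.Gamma (s / 2 + 1)‖ ≤ exp (12 * (n * √n)) := by
    have hre : (s / 2 + 1).re = s.re / 2 + 1 := by simp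
    refine (norm_Gamma_le (by rw [hre]; linarith)).trans ?_
    rw [hre]
    refine (Gamma_le_rpow (by linarith)).trans ?_
    calc (s.re / 2 + 1 + 1) ^ (s.re / 2 + 1 + 1) ≤ (3 * n) ^ (s.re / 2 + 1 + 1) :=
          Real.rpow_le_rpow (by linarith) (by linarith) (by linarith)
      _ ≤ (3 * n) ^ (3 * n) := Real.rpow_le_rpow_of_exponent_le (by linarith) (by linarith)
      _ = exp (log (3 * n) * (3 * n)) := Real.rpow_def_of_pos (by linarith) _
      _ ≤ _ := Real.exp_le_exp.2 (by nlinarith)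
  have h3 : ‖riemannZeta₁ s‖ ≤ 5 * n ^ 2 := by
    refine (norm_riemannZeta₁_le hs0).trans ?_
    have h4 : ‖s - 1‖ ≤ n := by
      refine (norm_sub_le _ _).trans ?_
      rw [norm_one, hn, add_comm]
    have h5 : ‖s‖ * ‖s - 1‖ / s.re ≤ n * n / (1 / 4) := by
      gcongr
      linarith
    nlinarith [norm_nonneg s]
  have h4 : 5 * n ^ 2 ≤ exp (7 * (n * √n)) := by
    have : n ≤ exp n := by linarith [Real.add_one_le_exp n]
    calc 5 * n ^ 2 ≤ exp 5 * (exp n) ^ 2 := by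
          gcongr
          linarith [Real.add_one_le_exp (5 : ℝ)]
      _ = exp (5 + 2 * n) := by rw [Real.exp_add 5, two_mul, Real.exp_add n n, sq]
      _ ≤ _ := Real.exp_le_exp.2 (by nlinarith)
  have h5 : (2 : ℝ) ≤ exp (n * √n) := by
    have := Real.add_one_le_exp (n * √n)
    nlinarith
  calc ‖(2 : ℂ)‖ * π ^ (-s.re / 2) * ‖Complex.Gamma (s / 2 + 1)‖ * ‖riemannZeta₁ s‖
      ≤ exp (n * √n) * 1 * exp (12 * (n * √n)) * exp (7 * (n * √n)) := by
        have : ‖(2 : ℂ)‖ = 2 := by simp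
        rw [this]
        have := h3.trans h4
        gcongr
    _ = exp (20 * n ^ (3 / 2 : ℝ)) := by
        rw [hsq, mul_one, ← Real.exp_add, ← Real.exp_add]
        congr 1
        ring

theorem exp_neg_le_norm_Gamma_one_add (y : ℝ) :
    exp (-(π * |y|)) ≤ ‖Complex.Gamma (1 + y * Complex.I)‖ ^ 2 := by
  rcases eq_or_ne y 0 with rfl | hy
  · simp
  have hyI : (y : ℂ) * Complex.I ≠ 0 := by simp [hy]
  have h1 : ‖Complex.Gamma (1 + y * Complex.I)‖ = ‖Complex.Gamma (1 - y * Complex.I)‖ := by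
    rw [← Complex.norm_conj, ← Complex.Gamma_conj]
    simp [sub_eq_add_neg]
  have h2 := Complex.Gamma_mul_Gamma_one_sub (y * Complex.I)
  have h3 : ‖Complex.Gamma (1 + y * Complex.I)‖ ^ 2 = |π * y| / |Real.sinh (π * y)| := by
    have h4 : Complex.sin (π * (y * Complex.I)) = Real.sinh (π * y) * Complex.I := by
      rw [← mul_assoc, Complex.sin_mul_I]; push_cast; rfl
    rw [sq]
    nth_rewrite 2 [h1]
    rw [← norm_mul, add_comm, Complex.Gamma_add_one _ hyI, mul_assoc, h2, h4]
    rw [norm_mul, norm_div, norm_mul, norm_mul, Complex.norm_I, Complex.norm_real,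
      Complex.norm_real, Complex.norm_real, Real.norm_eq_abs, Real.norm_eq_abs, Real.norm_eq_abs,
      abs_mul]
    ring
  rw [h3]
  have hu : 0 < |π * y| := abs_pos.2 (mul_ne_zero Real.pi_ne_zero hy)
  rw [Real.abs_sinh, le_div_iff₀ (Real.sinh_pos_iff.2 hu),
    show π * |y| = |π * y| by rw [abs_mul, abs_of_pos Real.pi_pos]]
  generalize |π * y| = u at hu
  rw [Real.sinh_eq, mul_div_assoc', div_le_iff₀ (by norm_num), mul_sub, ← Real.exp_add,
    ← Real.exp_add]
  have := Real.add_one_le_exp (-u + -u)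
  simp only [neg_add_cancel, Real.exp_zero]
  linarith

theorem exp_neg_le_norm_Gamma (j : ℕ) (y : ℝ) :
    exp (-(π * |y| / 2)) ≤ ‖Complex.Gamma (1 + j + y * Complex.I)‖ := by
  induction j with
  | zero =>
    have h := exp_neg_le_norm_Gamma_one_add y
    rw [show -(π * |y|) = -(π * |y| / 2) + -(π * |y| / 2) by ring, Real.exp_add, ← sq] at h
    simpa using le_of_sq_le_sq h (norm_nonneg _)
  | succ k ih =>
    have hk : (1 : ℝ) ≤ ‖(1 + k + y * Complex.I : ℂ)‖ := by
      refine le_trans ?_ (Complex.re_le_norm _)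
      simp
    have h0 : (1 + k + y * Complex.I : ℂ) ≠ 0 := fun h => by
      rw [h, norm_zero] at hk
      linarith
    rw [show (1 + (k + 1 : ℕ) + y * Complex.I : ℂ) = (1 + k + y * Complex.I) + 1 by push_cast; ring,
      Complex.Gamma_add_one _ h0, norm_mul]
    nlinarith [norm_nonneg (Complex.Gamma (1 + k + y * Complex.I))]

theorem norm_riemannZeta_ge {s : ℂ} (hs : 2 ≤ s.re) : 7 / 20 ≤ ‖riemannZeta s‖ := by
  have h2 : HasSum (fun n : ℕ => 1 / ((n : ℝ) + 1) ^ 2) (π ^ 2 / 6) := by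
    have := (hasSum_nat_add_iff' 1).2 hasSum_zeta_two
    simpa using this
  have h2' : HasSum (fun n : ℕ => 1 / ((n : ℝ) + 2) ^ 2) (π ^ 2 / 6 - 1) := by
    have := (hasSum_nat_add_iff' 1).2 h2
    simp only [Finset.range_one, Finset.sum_singleton] at this
    have h (n : ℕ) : 1 / (((n + 1 : ℕ) : ℝ) + 1) ^ 2 = 1 / ((n : ℝ) + 2) ^ 2 := by
      push_cast; ring
    simpa [h, add_assoc, one_add_one_eq_two] using this
  have hb (n : ℕ) : ‖1 / ((n : ℂ) + 2) ^ s‖ ≤ 1 / ((n : ℝ) + 2) ^ 2 := by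
    have h0 : ((n : ℂ) + 2) = ((n + 2 : ℝ) : ℂ) := by push_cast; rfl
    rw [norm_div, norm_one, h0, Complex.norm_cpow_eq_rpow_re_of_pos (by positivity)]
    refine one_div_le_one_div_of_le (by positivity) ?_
    rw [← Real.rpow_natCast]
    exact Real.rpow_le_rpow_of_exponent_le (by linarith [(Nat.cast_nonneg n : (0 : ℝ) ≤ n)])
      (by exact_mod_cast hs)
  have hsum : Summable (fun n : ℕ => 1 / ((n : ℂ) + 2) ^ s) :=
    Summable.of_norm_bounded h2'.summable hb
  have hz : riemannZeta s = 1 + ∑' n : ℕ, 1 / ((n : ℂ) + 2) ^ s := by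
    rw [zeta_eq_tsum_one_div_nat_add_one_cpow (by linarith)]
    have hs1 : Summable (fun n : ℕ => 1 / ((n : ℂ) + 1) ^ s) := by
      refine (summable_nat_add_iff 1).1 ?_
      refine hsum.congr fun n => ?_
      push_cast; ring_nf
    rw [hs1.tsum_eq_zero_add]
    congr 1
    · simp
    · congr 1; ext n; push_cast; ring_nf
  have hle : ‖∑' n : ℕ, 1 / ((n : ℂ) + 2) ^ s‖ ≤ π ^ 2 / 6 - 1 :=
    tsum_of_norm_bounded h2' hb
  have h3 : ‖(1 : ℂ)‖ - ‖∑' n : ℕ, 1 / ((n : ℂ) + 2) ^ s‖ ≤ ‖riemannZeta s‖ := by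
    rw [hz]
    exact norm_sub_le_norm_add _ _
  rw [norm_one] at h3
  have := Real.pi_lt_d4
  nlinarith [Real.pi_pos]

theorem exp_neg_le_norm_xi (j : ℕ) (t : ℝ) :
    exp (-(1 + (2 + 2 * j) + |t|)) ≤ ‖xi (2 + 2 * j + t * Complex.I)‖ := by
  set c : ℂ := 2 + 2 * j + t * Complex.I with hc
  have hre : c.re = 2 + 2 * j := by simp [hc]
  have hj : (0 : ℝ) ≤ j := by positivity
  have h1 : c ≠ 1 := fun h => by
    have := congrArg Complex.re h
    simp only [hre, Complex.one_re] at this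
    linarith
  have hG : c / 2 + 1 = 1 + (j + 1 : ℕ) + (t / 2 : ℝ) * Complex.I := by
    rw [hc]; push_cast; ring
  rw [xi_eq (by rw [hre]; linarith), norm_mul, norm_mul, norm_mul, norm_pi_cpow, hre, hG,
    riemannZeta₁_eq_mul h1, norm_mul]
  have hz := norm_riemannZeta_ge (s := c) (by rw [hre]; linarith)
  have hG' := exp_neg_le_norm_Gamma (j + 1) (t / 2)
  have hn1 : 1 ≤ ‖c - 1‖ := by
    refine le_trans ?_ (Complex.re_le_norm _)
    simp [hre]
    linarith
  have hpi : exp (-(2 + 2 * j)) ≤ π ^ (-(2 + 2 * (j : ℝ)) / 2) := by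
    have hlog : log π ≤ 2 := by
      rw [Real.log_le_iff_le_exp Real.pi_pos]
      have : exp 1 * exp 1 = exp 2 := by rw [← Real.exp_add]; norm_num
      nlinarith [Real.exp_one_gt_d9, Real.pi_lt_d4]
    rw [Real.rpow_def_of_pos Real.pi_pos]
    refine Real.exp_le_exp.2 ?_
    nlinarith
  have hG2 : exp (-|t|) ≤ ‖Complex.Gamma (1 + (j + 1 : ℕ) + (t / 2 : ℝ) * Complex.I)‖ := by
    refine le_trans (Real.exp_le_exp.2 ?_) hG'
    rw [abs_div, abs_two]
    nlinarith [Real.pi_lt_four, abs_nonneg t]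
  have he : exp (-1) ≤ 2 * (7 / 20) := by
    rw [Real.exp_neg, inv_le_comm₀ (Real.exp_pos _) (by norm_num)]
    linarith [Real.exp_one_gt_d9]
  calc exp (-(1 + (2 + 2 * j) + |t|)) = exp (-1) * exp (-(2 + 2 * j)) * exp (-|t|) := by
        rw [← Real.exp_add, ← Real.exp_add]; congr 1; ring
    _ ≤ (2 * (7 / 20)) * π ^ (-(2 + 2 * (j : ℝ)) / 2) *
        ‖Complex.Gamma (1 + (j + 1 : ℕ) + (t / 2 : ℝ) * Complex.I)‖ := by gcongr
    _ = 2 * π ^ (-(2 + 2 * (j : ℝ)) / 2) *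
        ‖Complex.Gamma (1 + (j + 1 : ℕ) + (t / 2 : ℝ) * Complex.I)‖ * (1 * (7 / 20)) := by ring
    _ ≤ _ := by
        rw [Complex.norm_two]
        gcongr

theorem xi_ne_zero_of_riemannHypothesis (h : RiemannHypothesis) {s : ℂ} (hs : 1 / 2 < s.re) :
    xi s ≠ 0 := by
  have hs0 : 0 < s.re := by linarith
  rw [xi_eq hs0]
  have hpi : (π : ℂ) ≠ 0 := by exact_mod_cast Real.pi_ne_zero
  refine mul_ne_zero (mul_ne_zero (mul_ne_zero two_ne_zero ?_) ?_) ?_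
  · exact fun h => hpi ((Complex.cpow_eq_zero_iff _ _).1 h).1
  · exact Complex.Gamma_ne_zero_of_re_pos (by simp; linarith)
  · rcases eq_or_ne s 1 with rfl | h1
    · simp
    rw [riemannZeta₁_eq_mul h1]
    refine mul_ne_zero (sub_ne_zero.2 h1) fun hz => ?_
    have := h s hz (fun ⟨n, hn⟩ => by
      have := congrArg Complex.re hn
      simp at this
      have h0 : (0 : ℝ) ≤ n := by positivity
      linarith) h1
    linarith

/-- A holomorphic function without zeros on a ball has a holomorphic logarithm, normalised to
vanish at the centre. -/
theorem exists_log_on_ball {f : ℂ → ℂ} {R : ℝ} (hR : 0 < R)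
    (hf : DifferentiableOn ℂ f (Metric.ball 0 R)) (h0 : ∀ z ∈ Metric.ball (0 : ℂ) R, f z ≠ 0) :
    ∃ g : ℂ → ℂ, g 0 = 0 ∧ DifferentiableOn ℂ g (Metric.ball 0 R) ∧
      ∀ z ∈ Metric.ball (0 : ℂ) R, f z = f 0 * Complex.exp (g z) := by
  have hd : DifferentiableOn ℂ (fun z => deriv f z / f z) (Metric.ball 0 R) :=
    (hf.deriv Metric.isOpen_ball).div hf h0
  obtain ⟨g, hg0, hg⟩ := hd.isExactOn_ball.with_val_at 0 0
  refine ⟨g, hg0, fun z hz => (hg z hz).differentiableAt.differentiableWithinAt, fun z hz => ?_⟩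
  have hder : ∀ z ∈ Metric.ball (0 : ℂ) R,
      HasDerivAt (fun z => f z * Complex.exp (-g z)) 0 z := fun z hz => by
    have hfz := (hf.differentiableAt (Metric.isOpen_ball.mem_nhds hz)).hasDerivAt
    refine (hfz.mul (hg z hz).neg.cexp).congr_deriv ?_
    have := h0 z hz
    field_simp
    ring
  have hc : f z * Complex.exp (-g z) = f 0 * Complex.exp (-g 0) :=
    Metric.isOpen_ball.is_const_of_deriv_eq_zero Metric.isPreconnected_ball
      (fun z hz => (hder z hz).differentiableAt.differentiableWithinAt)
      (fun z hz => (hder z hz).deriv) hz (Metric.mem_ball_self hR)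
  rw [hg0, neg_zero, Complex.exp_zero, mul_one] at hc
  rw [← hc, mul_assoc, ← Complex.exp_add, neg_add_cancel, Complex.exp_zero, mul_one]

theorem exp_neg_le_norm_of_ball {f : ℂ → ℂ} {R r A B : ℝ} (hr : r < R) (hR : 0 < R) (hA : 0 ≤ A)
    (hB : 0 < B) (hf : DifferentiableOn ℂ f (Metric.ball 0 R))
    (h0 : ∀ z ∈ Metric.ball (0 : ℂ) R, f z ≠ 0) (hA' : exp (-A) ≤ ‖f 0‖)
    (hB' : ∀ z ∈ Metric.ball (0 : ℂ) R, ‖f z‖ ≤ exp B) {z : ℂ} (hz : ‖z‖ ≤ r) :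
    exp (-(A + 2 * (A + B) * R / (R - r))) ≤ ‖f z‖ := by
  obtain ⟨g, hg0, hg, hfg⟩ := exists_log_on_ball hR hf h0
  have hzb : z ∈ Metric.ball (0 : ℂ) R := by simpa using hz.trans_lt hr
  have hM : Set.MapsTo g (Metric.ball 0 R) {z | z.re ≤ A + B} := fun w hw => by
    have h1 := hB' w hw
    rw [hfg w hw, norm_mul, Complex.norm_exp] at h1
    have h2 : exp (-A) * exp (g w).re ≤ exp B :=
      (mul_le_mul_of_nonneg_right hA' (Real.exp_pos _).le).trans h1
    rw [← Real.exp_add, Real.exp_le_exp] at h2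
    simp only [Set.mem_ofPred_eq]
    linarith
  have h3 := Complex.borelCaratheodory_zero (by linarith : 0 < A + B) hg hM hR hzb hg0
  have h4 : 2 * (A + B) * ‖z‖ / (R - ‖z‖) ≤ 2 * (A + B) * R / (R - r) := by
    have := norm_nonneg z
    have : 0 < R - r := by linarith
    gcongr
    linarith
  have h5 := (abs_le.1 (Complex.abs_re_le_norm (g z))).1
  rw [hfg z hzb, norm_mul, Complex.norm_exp]
  calc exp (-(A + 2 * (A + B) * R / (R - r))) ≤ exp (-A + (g z).re) :=
        Real.exp_le_exp.2 (by linarith)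
    _ = exp (-A) * exp (g z).re := Real.exp_add _ _
    _ ≤ _ := by gcongr

theorem exists_exp_neg_le_norm_xi (h : ∀ s : ℂ, 1 / 2 < s.re → xi s ≠ 0) {δ : ℝ} (hδ : 0 < δ)
    (hδ' : δ ≤ 1 / 4) : ∃ C : ℝ, ∀ s : ℂ, 1 / 2 + δ ≤ s.re →
      exp (-(C * (1 + ‖s‖) ^ (3 / 2 : ℝ))) ≤ ‖xi s‖ := by
  refine ⟨9 + 2 * (9 + 160) * (3 / 2) / δ, fun s hs => ?_⟩
  set j := ⌊(s.re - 1) / 2⌋₊ with hj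
  set c : ℂ := 2 + 2 * j + s.im * Complex.I with hc
  set n := 1 + ‖s‖ with hn
  have hn1 : 1 ≤ n := by linarith [norm_nonneg s]
  have hcre : c.re = 2 + 2 * j := by simp [hc]
  have hcs : s - c = ((s.re - (2 + 2 * j) : ℝ) : ℂ) := by
    apply Complex.ext <;> simp [hc]
  have hj0 : (0 : ℝ) ≤ j := by positivity
  have hj1 : (j : ℝ) ≤ s.re / 2 := by
    rcases le_total 0 ((s.re - 1) / 2) with h | h
    · linarith [Nat.floor_le h]
    · rw [hj, Nat.floor_of_nonpos h]
      simp; linarith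
  have hsc : ‖s - c‖ ≤ 3 / 2 - δ := by
    rw [hcs, Complex.norm_real, Real.norm_eq_abs, abs_le]
    have h2 := Nat.lt_floor_add_one ((s.re - 1) / 2)
    rw [← hj] at h2
    constructor
    · rcases le_total 0 ((s.re - 1) / 2) with h | h
      · linarith [Nat.floor_le h]
      · have : (j : ℝ) = 0 := by rw [hj, Nat.floor_of_nonpos h]; simp
        linarith
    · linarith
  have hnorm : ∀ z ∈ Metric.ball (0 : ℂ) (3 / 2), 1 + ‖c + z‖ ≤ 4 * n := fun z hz => by
    have hz' : ‖z‖ < 3 / 2 := by simpa using hz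
    have : ‖c + z‖ ≤ ‖s‖ + ‖s - c‖ + ‖z‖ := by
      rw [show c + z = s - (s - c) + z by ring]
      exact (norm_add_le _ _).trans (by gcongr; exact norm_sub_le _ _)
    linarith
  have h4 : (4 * n) ^ (3 / 2 : ℝ) = 8 * n ^ (3 / 2 : ℝ) := by
    rw [Real.mul_rpow (by norm_num) (by linarith), show (4 : ℝ) = 2 ^ (2 : ℝ) by norm_num,
      ← Real.rpow_mul (by norm_num)]
    norm_num
  have hnn : n ≤ n ^ (3 / 2 : ℝ) := by
    nth_rewrite 1 [← Real.rpow_one n]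
    exact Real.rpow_le_rpow_of_exponent_le hn1 (by norm_num)
  have hre_pos : ∀ z ∈ Metric.ball (0 : ℂ) (3 / 2), 1 / 2 < (c + z).re := fun z hz => by
    have hz' : ‖z‖ < 3 / 2 := by simpa using hz
    have := (abs_le.1 (Complex.abs_re_le_norm z)).1
    rw [Complex.add_re, hcre]
    linarith
  have key := exp_neg_le_norm_of_ball (f := fun z => xi (c + z)) (R := 3 / 2) (r := 3 / 2 - δ)
    (A := 9 * n ^ (3 / 2 : ℝ)) (B := 160 * n ^ (3 / 2 : ℝ)) (by linarith) (by norm_num)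
    (by positivity) (by positivity)
    (fun z _ => (differentiable_xi.comp
      ((differentiable_const c).add differentiable_id)).differentiableAt.differentiableWithinAt)
    (fun z hz => h _ (hre_pos z hz)) ?_ ?_ hsc
  · simp only [add_sub_cancel] at key
    refine le_trans (Real.exp_le_exp.2 (le_of_eq ?_)) key
    have : 3 / 2 - (3 / 2 - δ) = δ := by ring
    rw [this]
    ring
  · simp only [add_zero]
    refine le_trans (Real.exp_le_exp.2 ?_) (exp_neg_le_norm_xi j s.im)
    have h5 := Complex.abs_im_le_norm s
    have h6 := Complex.re_le_norm s
    linarith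
  · intro z hz
    refine (norm_xi_le (by linarith [hre_pos z hz])).trans (Real.exp_le_exp.2 ?_)
    calc 20 * (1 + ‖c + z‖) ^ (3 / 2 : ℝ) ≤ 20 * (4 * n) ^ (3 / 2 : ℝ) := by
          gcongr
          exact hnorm z hz
      _ = _ := by rw [h4]; ring

theorem isBoundedUnder_xi_ratio {δ : ℝ} (hδ : 0 < δ) (hδ' : δ ≤ 1 / 4) :
    IsBoundedUnder (· ≤ ·) atTop
      fun x : ℝ => ‖xi (1 / 2 + x - δ) / xi (1 / 2 + x + δ)‖ := by
  refine isBoundedUnder_of_eventually_le (a := 4 * (20 : ℝ)) ?_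
  filter_upwards [eventually_ge_atTop 4] with x hx
  set a : ℝ := 1 / 2 + x - δ with ha
  set b : ℝ := 1 / 2 + x + δ with hb
  have ha' : (1 / 2 + x - δ : ℂ) = (a : ℂ) := by rw [ha]; push_cast; rfl
  have hb' : (1 / 2 + x + δ : ℂ) = (b : ℂ) := by rw [hb]; push_cast; rfl
  have hxi (y : ℝ) (hy : 4 ≤ y) : ‖xi (y : ℂ)‖ =
      2 * π ^ (-y / 2) * Real.Gamma (y / 2 + 1) * ‖riemannZeta₁ (y : ℂ)‖ := by
    have hG : Complex.Gamma ((y : ℂ) / 2 + 1) = (Real.Gamma (y / 2 + 1) : ℝ) := by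
      rw [← Complex.Gamma_ofReal]; push_cast; rfl
    rw [xi_eq (by simp; linarith), norm_mul, norm_mul, norm_mul, norm_pi_cpow, hG, Complex.norm_two,
      Complex.norm_real, Complex.ofReal_re, Real.norm_eq_abs,
      abs_of_pos (Real.Gamma_pos_of_pos (by linarith))]
  have hΓ : Real.Gamma (a / 2 + 1) ≤ Real.Gamma (b / 2 + 1) :=
    Real.Gamma_strictMonoOn_Ici.monotoneOn (by simp; linarith) (by simp; linarith) (by linarith)
  have hza : ‖riemannZeta₁ (a : ℂ)‖ ≤ 2 * a := by
    have h := norm_riemannZeta₁_le (s := a) (by simp; linarith)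
    rw [← Complex.ofReal_one, ← Complex.ofReal_sub, Complex.norm_real, Complex.norm_real,
      Complex.ofReal_re, Real.norm_eq_abs, Real.norm_eq_abs, abs_of_pos (by linarith),
      abs_of_pos (by linarith), mul_div_assoc, mul_div_cancel₀ _ (by linarith)] at h
    linarith
  have hzb : a / 10 ≤ ‖riemannZeta₁ (b : ℂ)‖ := by
    have h1 : (b : ℂ) ≠ 1 := by
      rw [← Complex.ofReal_one, Ne, Complex.ofReal_inj]; linarith
    have h2 := norm_riemannZeta_ge (s := b) (by simp; linarith)
    rw [riemannZeta₁_eq_mul h1, norm_mul, ← Complex.ofReal_one, ← Complex.ofReal_sub,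
      Complex.norm_real, Real.norm_eq_abs, abs_of_pos (by linarith)]
    have : (b - 1) * (7 / 20) ≤ (b - 1) * ‖riemannZeta (b : ℂ)‖ :=
      mul_le_mul_of_nonneg_left h2 (by linarith)
    linarith
  have hpi : π ^ (-a / 2) ≤ 4 * π ^ (-b / 2) := by
    have h1 : π ^ (-a / 2) = π ^ δ * π ^ (-b / 2) := by
      rw [← Real.rpow_add Real.pi_pos]; congr 1; linarith
    have h2 : π ^ δ ≤ π ^ (1 : ℝ) :=
      Real.rpow_le_rpow_of_exponent_le (by linarith [Real.pi_gt_three]) (by linarith)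
    rw [Real.rpow_one] at h2
    rw [h1]
    gcongr
    linarith [Real.pi_lt_four]
  have hG0 := Real.Gamma_pos_of_pos (by linarith : 0 < a / 2 + 1)
  rw [norm_div, ha', hb', hxi a (by linarith), hxi b (by linarith)]
  have hpos : 0 < 2 * π ^ (-b / 2) * Real.Gamma (b / 2 + 1) * ‖riemannZeta₁ (b : ℂ)‖ := by
    have : 0 < ‖riemannZeta₁ (b : ℂ)‖ := by linarith
    have : 0 < Real.Gamma (b / 2 + 1) := by linarith
    have := Real.pi_pos
    positivity
  rw [div_le_iff₀ hpos]
  calc 2 * π ^ (-a / 2) * Real.Gamma (a / 2 + 1) * ‖riemannZeta₁ (a : ℂ)‖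
      ≤ 2 * (4 * π ^ (-b / 2)) * Real.Gamma (b / 2 + 1) * (20 * ‖riemannZeta₁ (b : ℂ)‖) := by
        have := Real.pi_pos
        gcongr
        linarith
    _ = _ := by ring

theorem norm_xi_sub_le_norm_xi_add (h : ∀ s : ℂ, 1 / 2 < s.re → xi s ≠ 0) {δ : ℝ} (hδ : 0 < δ)
    (hδ' : δ ≤ 1 / 4) {z : ℂ} (hz : 0 ≤ z.re) :
    ‖xi (1 / 2 + z - δ)‖ ≤ ‖xi (1 / 2 + z + δ)‖ := by
  obtain ⟨C, hC⟩ := exists_exp_neg_le_norm_xi h hδ hδ'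
  have hden {z : ℂ} (hz : 0 ≤ z.re) : xi (1 / 2 + z + δ) ≠ 0 := h _ (by simp; linarith)
  have hd {z : ℂ} (hz : 0 ≤ z.re) :
      DifferentiableAt ℂ (fun z => xi (1 / 2 + z - δ) / xi (1 / 2 + z + δ)) z := by
    have := differentiable_xi
    exact DifferentiableAt.div (by fun_prop) (by fun_prop) (hden hz)
  have key := PhragmenLindelof.right_half_plane_of_bounded_on_real
    (f := fun z => xi (1 / 2 + z - δ) / xi (1 / 2 + z + δ)) (C := 1) (z := z) ⟨?_, ?_⟩ ?_
    (isBoundedUnder_xi_ratio hδ hδ') ?_ hz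
  · rw [norm_div, div_le_one (norm_pos_iff.2 (hden hz))] at key
    exact key
  · exact fun z hz => (hd (le_of_lt hz)).differentiableWithinAt
  · rw [Complex.closure_setOfPred_lt_re]
    exact fun z hz => (hd hz).continuousAt.continuousWithinAt
  · refine ⟨3 / 2, by norm_num, (20 + |C|) * 3 ^ (3 / 2 : ℝ), ?_⟩
    refine Asymptotics.IsBigO.of_bound 1 ?_
    have h1 : ∀ᶠ z : ℂ in Bornology.cobounded ℂ ⊓ 𝓟 {z | 0 < z.re}, 1 ≤ ‖z‖ :=
      (tendsto_norm_cobounded_atTop.mono_left inf_le_left).eventually_ge_atTop 1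
    filter_upwards [h1, mem_inf_of_right (mem_principal_self _)] with z hz1 hz2
    have hz2' : 0 < z.re := hz2
    rw [one_mul, Real.norm_eq_abs, abs_of_pos (Real.exp_pos _), norm_div]
    have hbd (w : ℂ) (hw : ‖w‖ ≤ 1 / 2) :
        (1 + ‖1 / 2 + z + w - 1 / 2 + 1 / 2‖) ^ (3 / 2 : ℝ) ≤ 3 ^ (3 / 2 : ℝ) * ‖z‖ ^ (3 / 2 : ℝ) := by
      rw [← Real.mul_rpow (by norm_num) (by positivity)]
      refine Real.rpow_le_rpow (by positivity) ?_ (by norm_num)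
      have : ‖1 / 2 + z + w - 1 / 2 + 1 / 2‖ ≤ ‖z‖ + ‖w‖ + 1 / 2 := by
        rw [show 1 / 2 + z + w - 1 / 2 + 1 / 2 = z + w + 1 / 2 by ring]
        refine (norm_add_le _ _).trans (add_le_add (norm_add_le _ _) ?_)
        simp
      linarith
    have hδn : ‖(δ : ℂ)‖ ≤ 1 / 2 := by
      rw [Complex.norm_real, Real.norm_eq_abs, abs_of_pos hδ]; linarith
    have hn := norm_xi_le (s := 1 / 2 + z - δ) (by simp; linarith)
    have hm := hC (1 / 2 + z + δ) (by simp; linarith)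
    have e1 := hbd (-δ) (by rwa [norm_neg])
    have e2 := hbd δ hδn
    rw [show 1 / 2 + z + -(δ : ℂ) - 1 / 2 + 1 / 2 = 1 / 2 + z - δ by ring] at e1
    rw [show 1 / 2 + z + (δ : ℂ) - 1 / 2 + 1 / 2 = 1 / 2 + z + δ by ring] at e2
    rw [div_le_iff₀ (norm_pos_iff.2 (hden hz2'.le))]
    refine hn.trans ?_
    refine le_trans ?_ (mul_le_mul_of_nonneg_left hm (Real.exp_pos _).le)
    rw [← Real.exp_add]
    refine Real.exp_le_exp.2 ?_
    have e3 : C * (1 + ‖1 / 2 + z + δ‖) ^ (3 / 2 : ℝ) ≤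
        |C| * (3 ^ (3 / 2 : ℝ) * ‖z‖ ^ (3 / 2 : ℝ)) :=
      (mul_le_mul_of_nonneg_right (le_abs_self C) (by positivity)).trans
        (mul_le_mul_of_nonneg_left e2 (abs_nonneg C))
    linarith
  · intro y
    have e : xi (1 / 2 + y * Complex.I - δ) =
        (starRingEnd ℂ) (xi (1 / 2 + y * Complex.I + δ)) := by
      rw [← xi_conj (by simp; linarith), ← xi_one_sub]
      congr 1
      apply Complex.ext <;> simp
      ring
    rw [norm_div, e, Complex.norm_conj]
    exact div_self_le_one _

theorem re_logDeriv_xi_nonneg (h : ∀ s : ℂ, 1 / 2 < s.re → xi s ≠ 0) {z : ℂ} (hz : 0 < z.re) :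
    0 ≤ (deriv xi (1 / 2 + z) / xi (1 / 2 + z)).re := by
  have h0 : xi (1 / 2 + z) ≠ 0 := h _ (by simp; linarith)
  set a := xi (1 / 2 + z) with ha
  set d := deriv xi (1 / 2 + z) with hd
  have hder : HasDerivAt (fun t : ℝ => xi (1 / 2 + z + t)) d 0 := by
    have h1 : HasDerivAt xi d (1 / 2 + z + ((0 : ℝ) : ℂ)) := by
      rw [Complex.ofReal_zero, add_zero]
      exact (differentiable_xi (1 / 2 + z)).hasDerivAt
    have h2 : HasDerivAt (fun t : ℝ => 1 / 2 + z + (t : ℂ)) 1 0 :=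
      (Complex.ofRealCLM.hasDerivAt).const_add _
    exact (h1.comp (0 : ℝ) h2).congr_deriv (mul_one d)
  have hg : HasDerivAt (fun t : ℝ => ‖xi (1 / 2 + z + t)‖ ^ 2) (2 * inner ℝ a d) 0 := by
    refine hder.norm_sq.congr_deriv ?_
    rw [Complex.ofReal_zero, add_zero]
  have hg2 : HasDerivAt (fun t : ℝ => ‖xi (1 / 2 + z + (-t : ℝ))‖ ^ 2) (-(2 * inner ℝ a d)) 0 := by
    have hg' : HasDerivAt (fun t : ℝ => ‖xi (1 / 2 + z + t)‖ ^ 2) (2 * inner ℝ a d) (-0) := by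
      rwa [neg_zero]
    exact (hg'.comp (0 : ℝ) (hasDerivAt_neg (0 : ℝ))).congr_deriv (mul_neg_one _)
  have hsub := hg.sub hg2
  have hlim := hsub.tendsto_slope_zero_right
  have hnn : 0 ≤ 2 * inner ℝ a d - -(2 * inner ℝ a d) := by
    refine ge_of_tendsto hlim ?_
    filter_upwards [Ioc_mem_nhdsGT (show (0 : ℝ) < 1 / 4 by norm_num)] with t ht
    have h3 := norm_xi_sub_le_norm_xi_add h ht.1 ht.2 hz.le
    have h4 : ‖xi (1 / 2 + z - t)‖ ^ 2 ≤ ‖xi (1 / 2 + z + t)‖ ^ 2 := by gcongr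
    have ht0 : 0 < t := ht.1
    simp only [Pi.sub_apply, zero_add, Complex.ofReal_neg, Complex.ofReal_zero, add_zero,
      sub_self, sub_zero, smul_eq_mul, ← sub_eq_add_neg]
    exact mul_nonneg (by positivity) (by linarith)
  have hin : inner ℝ a d = ((starRingEnd ℂ) a * d).re := by
    rw [Complex.inner, mul_comm]
  have hdiv : d / a = (starRingEnd ℂ) a * d / (Complex.normSq a : ℂ) := by
    rw [Complex.normSq_eq_conj_mul_self]
    have : (starRingEnd ℂ) a ≠ 0 := by simpa using h0
    field_simp
  rw [hdiv, Complex.div_ofReal_re]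
  exact div_nonneg (by linarith) (Complex.normSq_nonneg _)

/-- A Harnack-type bound for functions with nonnegative real part on the right half-plane. -/
theorem norm_le_of_re_nonneg {F : ℂ → ℂ} (hF : ∀ z : ℂ, 0 < z.re → DifferentiableAt ℂ F z)
    (h0 : ∀ z : ℂ, 0 < z.re → 0 ≤ (F z).re) {z : ℂ} (hz : 0 < z.re) :
    ‖F z‖ ≤ (1 + ‖F 1‖) * (1 + ‖z‖) ^ 2 / z.re := by
  set φ : ℂ → ℂ := fun w => (1 + w) / (1 - w) with hφ
  have hne {w : ℂ} (hw : w ∈ Metric.ball (0 : ℂ) 1) : 1 - w ≠ 0 := fun h => by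
    rw [sub_eq_zero] at h
    simp [← h] at hw
  have hφre {w : ℂ} (hw : w ∈ Metric.ball (0 : ℂ) 1) : 0 < (φ w).re := by
    have hw1 : ‖w‖ < 1 := by simpa using hw
    have h2 : (1 + w) / (1 - w) = ((1 + w) * (starRingEnd ℂ) (1 - w)) /
        ((Complex.normSq (1 - w) : ℝ) : ℂ) := by
      rw [Complex.normSq_eq_conj_mul_self]
      have h3 : (starRingEnd ℂ) (1 - w) ≠ 0 := (map_ne_zero _).2 (hne hw)
      have := hne hw
      field_simp
    simp only [hφ]
    rw [h2, Complex.div_ofReal_re]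
    refine div_pos ?_ (Complex.normSq_pos.2 (hne hw))
    have h4 : w.re ^ 2 + w.im ^ 2 < 1 := by
      have := Complex.sq_norm w
      rw [Complex.normSq_apply] at this
      nlinarith [norm_nonneg w]
    simp
    nlinarith
  set w : ℂ := (z - 1) / (z + 1) with hw
  have hz1 : z + 1 ≠ 0 := fun h => by
    have := congrArg Complex.re h
    simp at this
    linarith
  have hz1n : 0 < ‖z + 1‖ := norm_pos_iff.2 hz1
  have hwz : φ w = z := by
    simp only [hφ, hw]
    have : (1 - (z - 1) / (z + 1)) ≠ 0 := by
      rw [one_sub_div hz1]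
      exact div_ne_zero (by ring_nf; norm_num) hz1
    field_simp
    ring_nf
  have hw2 : ‖w‖ ^ 2 = 1 - 4 * z.re / ‖z + 1‖ ^ 2 := by
    rw [hw, norm_div, div_pow, eq_sub_iff_add_eq, ← add_div, div_eq_one_iff_eq (by positivity),
      Complex.sq_norm, Complex.sq_norm, Complex.normSq_apply, Complex.normSq_apply]
    simp
    ring
  have hpos : 0 < 4 * z.re / ‖z + 1‖ ^ 2 := by positivity
  have hw1 : ‖w‖ < 1 := by nlinarith [norm_nonneg w]
  have h1w : 2 * z.re / ‖z + 1‖ ^ 2 ≤ 1 - ‖w‖ := by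
    have : 4 * z.re / ‖z + 1‖ ^ 2 = 2 * (2 * z.re / ‖z + 1‖ ^ 2) := by ring
    nlinarith [norm_nonneg w]
  have hwb : w ∈ Metric.ball (0 : ℂ) 1 := by simpa using hw1
  have key := Complex.borelCaratheodory (f := fun w => -F (φ w)) (M := 1) (R := 1) (z := w)
    one_pos (fun v hv => ?_) (fun v hv => ?_) one_pos hwb
  · simp only [hwz, norm_neg] at key
    have hφ0 : φ 0 = 1 := by simp [hφ]
    rw [hφ0] at key
    have h2 : 0 < 1 - ‖w‖ := by linarith
    calc ‖F z‖ ≤ 2 * 1 * ‖w‖ / (1 - ‖w‖) + ‖F 1‖ * (1 + ‖w‖) / (1 - ‖w‖) := key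
      _ = (2 * ‖w‖ + ‖F 1‖ * (1 + ‖w‖)) / (1 - ‖w‖) := by ring
      _ ≤ (2 * (1 + ‖F 1‖)) / (2 * z.re / ‖z + 1‖ ^ 2) := by
          refine div_le_div₀ (by positivity) ?_ (by positivity) h1w
          nlinarith [norm_nonneg (F 1)]
      _ = (1 + ‖F 1‖) * ‖z + 1‖ ^ 2 / z.re := by field_simp
      _ ≤ _ := by
          have : ‖z + 1‖ ≤ 1 + ‖z‖ := by
            rw [add_comm]; simpa using norm_add_le 1 z
          gcongr
  · have h2 : DifferentiableAt ℂ φ v :=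
      DifferentiableAt.div (by fun_prop) (by fun_prop) (hne hv)
    exact ((hF _ (hφre hv)).comp v h2).neg.differentiableWithinAt
  · simp only [Set.mem_ofPred_eq, Complex.neg_re]
    linarith [h0 _ (hφre hv)]

/-- `F` with its first-order interpolation at `1/2` removed. -/
def interpErr (F : ℂ → ℂ) (z : ℂ) : ℂ := F z - F (1 / 2) - 2 * (F (1 / 2)).re * (z - 1 / 2)

/-- The holomorphic function `interpErr F z / (1/4 - z²)`. -/
def interpQuot (F : ℂ → ℂ) (z : ℂ) : ℂ := -dslope (interpErr F) (1 / 2) z / (z + 1 / 2)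

theorem interpErr_half (F : ℂ → ℂ) : interpErr F (1 / 2) = 0 := by simp [interpErr]

theorem add_half_ne_zero {z : ℂ} (hz : 0 ≤ z.re) : z + 1 / 2 ≠ 0 := fun h => by
  have := congrArg Complex.re h
  simp at this
  linarith

theorem interpQuot_mul (F : ℂ → ℂ) {z : ℂ} (hz : 0 ≤ z.re) (h : z ≠ 1 / 2) :
    interpQuot F z = interpErr F z / (1 / 4 - z ^ 2) := by
  have h1 := add_half_ne_zero hz
  have h2 : z - 1 / 2 ≠ 0 := sub_ne_zero.2 h
  have h3 : 1 / 4 - z ^ 2 = -((z - 1 / 2) * (z + 1 / 2)) := by ring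
  rw [interpQuot, dslope_of_ne _ h, slope_def_module, interpErr_half, sub_zero, smul_eq_mul, h3]
  field_simp

theorem differentiableAt_interpQuot {F : ℂ → ℂ} {c : ℝ} (hc : c < 1 / 2)
    (hF : ∀ z : ℂ, c < z.re → DifferentiableAt ℂ F z) {z : ℂ} (hz : c < z.re)
    (hz0 : 0 ≤ z.re) : DifferentiableAt ℂ (interpQuot F) z := by
  have hd : DifferentiableOn ℂ (interpErr F) {z | c < z.re} := fun w hw => by
    have := hF w hw
    unfold interpErr
    exact DifferentiableAt.differentiableWithinAt (by fun_prop)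
  have h2 : (1 / 2 : ℂ) ∈ {z : ℂ | c < z.re} := by simpa using hc
  have := (Complex.differentiableOn_dslope ((isOpen_re_gt c).mem_nhds h2)).2 hd
  have hdz := this.differentiableAt ((isOpen_re_gt c).mem_nhds hz)
  exact hdz.neg.div (by fun_prop) (add_half_ne_zero hz0)

theorem re_interpQuot_nonneg_of_bound {F : ℂ → ℂ} {c A : ℝ} (hc : c < 0)
    (hF : ∀ z : ℂ, c < z.re → DifferentiableAt ℂ F z)
    (hA : ∀ z : ℂ, 0 ≤ z.re → ‖F z‖ ≤ A * (1 + ‖z‖) ^ 2)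
    (h0 : ∀ z : ℂ, 0 ≤ z.re → 0 ≤ (F z).re) {z : ℂ} (hz : 0 ≤ z.re) :
    0 ≤ (interpQuot F z).re := by
  have hd {z : ℂ} (hz : 0 ≤ z.re) :
      DifferentiableAt ℂ (fun z => Complex.exp (-interpQuot F z)) z :=
    (differentiableAt_interpQuot (by linarith) hF (by linarith) hz).neg.cexp
  have hA0 : 0 ≤ A := by
    have := (norm_nonneg _).trans (hA 0 (by simp))
    simpa using this
  obtain ⟨D, hD⟩ : ∃ D : ℝ, ∀ z : ℂ, 0 ≤ z.re → 1 ≤ ‖z‖ → ‖interpQuot F z‖ ≤ D := by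
    refine ⟨(4 * A + 3 * ‖F (1 / 2)‖ + 2) * 2 + 4 * ‖F (1 / 2)‖ , fun z hz hz1 => ?_⟩
    have hne : z ≠ 1 / 2 := fun h => by rw [h] at hz1; norm_num at hz1
    rw [interpQuot_mul F hz hne, norm_div]
    have h1 : ‖z‖ ^ 2 / 2 ≤ ‖1 / 4 - z ^ 2‖ := by
      have := norm_sub_norm_le (z ^ 2) (1 / 4)
      have e : ‖(1 / 4 : ℂ)‖ = 1 / 4 := by simp
      rw [norm_pow, e] at this
      rw [norm_sub_rev]
      nlinarith
    have h2 : ‖interpErr F z‖ ≤ (4 * A + 4 * ‖F (1 / 2)‖) * ‖z‖ ^ 2 := by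
      have e1 : ‖interpErr F z‖ ≤ ‖F z‖ + ‖F (1 / 2)‖ +
          ‖(2 * (F (1 / 2)).re * (z - 1 / 2) : ℂ)‖ :=
        (norm_sub_le _ _).trans (by gcongr; exact norm_sub_le _ _)
      have e2 : ‖(2 * (F (1 / 2)).re * (z - 1 / 2) : ℂ)‖ ≤ 2 * ‖F (1 / 2)‖ * (‖z‖ + 1 / 2) := by
        rw [norm_mul, norm_mul, Complex.norm_two, Complex.norm_real, Real.norm_eq_abs]
        have := Complex.abs_re_le_norm (F (1 / 2))
        have e : ‖(1 / 2 : ℂ)‖ = 1 / 2 := by simp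
        have := norm_sub_le z (1 / 2)
        rw [e] at this
        gcongr
      have e3 := hA z hz
      have e4 : A * (1 + ‖z‖) ^ 2 ≤ A * (4 * ‖z‖ ^ 2) := by
        gcongr
        nlinarith
      have e5 : ‖F (1 / 2)‖ * (2 + 2 * ‖z‖) ≤ ‖F (1 / 2)‖ * (4 * ‖z‖ ^ 2) := by
        gcongr
        nlinarith
      linarith
    rw [div_le_iff₀ (by nlinarith)]
    have := norm_nonneg (F (1 / 2))
    have e6 : ((4 * A + 3 * ‖F (1 / 2)‖ + 2) * 2 + 4 * ‖F (1 / 2)‖) * (‖z‖ ^ 2 / 2) ≤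
      ((4 * A + 3 * ‖F (1 / 2)‖ + 2) * 2 + 4 * ‖F (1 / 2)‖) * ‖1 / 4 - z ^ 2‖ := by gcongr
    nlinarith [sq_nonneg ‖z‖]
  have hbound {z : ℂ} (hz : 0 ≤ z.re) (hz1 : 1 ≤ ‖z‖) :
      ‖Complex.exp (-interpQuot F z)‖ ≤ exp D := by
    rw [Complex.norm_exp]
    refine Real.exp_le_exp.2 ((Complex.re_le_norm _).trans ?_)
    rw [norm_neg]
    exact hD z hz hz1
  have key := PhragmenLindelof.right_half_plane_of_bounded_on_real
    (f := fun z => Complex.exp (-interpQuot F z)) (C := 1) (z := z) ⟨?_, ?_⟩ ?_ ?_ ?_ hz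
  · rw [Complex.norm_exp, Real.exp_le_one_iff, Complex.neg_re] at key
    linarith
  · exact fun z hz => (hd (le_of_lt hz)).differentiableWithinAt
  · rw [Complex.closure_setOfPred_lt_re]
    exact fun z hz => (hd hz).continuousAt.continuousWithinAt
  · refine ⟨1, by norm_num, 0, Asymptotics.IsBigO.of_bound (exp D) ?_⟩
    have h1 : ∀ᶠ z : ℂ in Bornology.cobounded ℂ ⊓ 𝓟 {z | 0 < z.re}, 1 ≤ ‖z‖ :=
      (tendsto_norm_cobounded_atTop.mono_left inf_le_left).eventually_ge_atTop 1
    filter_upwards [h1, mem_inf_of_right (mem_principal_self _)] with z hz1 hz2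
    simpa using hbound (le_of_lt hz2) hz1
  · refine isBoundedUnder_of_eventually_le (a := exp D) ?_
    filter_upwards [eventually_ge_atTop 1] with x hx
    refine hbound (by simp; linarith) ?_
    rw [Complex.norm_real]
    exact hx.trans (le_abs_self x)
  · intro y
    rw [Complex.norm_exp, Real.exp_le_one_iff, Complex.neg_re, neg_nonpos]
    have hre : 0 ≤ ((y : ℂ) * Complex.I).re := by simp
    have hne : (y : ℂ) * Complex.I ≠ 1 / 2 := fun h => by
      have := congrArg Complex.re h
      simp at this
    have hq : (1 / 4 - ((y : ℂ) * Complex.I) ^ 2) = ((1 / 4 + y ^ 2 : ℝ) : ℂ) := by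
      rw [mul_pow, Complex.I_sq]; push_cast; ring
    rw [interpQuot_mul F hre hne, hq, Complex.div_ofReal_re]
    refine div_nonneg ?_ (by positivity)
    have := h0 _ hre
    simp only [interpErr, Complex.sub_re, Complex.mul_re, Complex.ofReal_re, Complex.re_ofNat,
      Complex.im_ofNat, Complex.ofReal_im, Complex.I_re, Complex.I_im, Complex.mul_im]
    norm_num
    linarith

theorem re_interpQuot_nonneg {F : ℂ → ℂ} (hF : ∀ z : ℂ, 0 < z.re → DifferentiableAt ℂ F z)
    (h0 : ∀ z : ℂ, 0 < z.re → 0 ≤ (F z).re) {z : ℂ} (hz : 0 < z.re) :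
    0 ≤ (interpQuot F z).re := by
  have hmain {z : ℂ} (hz : 0 < z.re) (hne : z ≠ 1 / 2) : 0 ≤ (interpQuot F z).re := by
    have hcont {w : ℂ} (hw : 0 < w.re) :
        Tendsto (fun c : ℝ => F (w + c)) (𝓝[>] 0) (𝓝 (F w)) := by
      have h1 : ContinuousAt (fun c : ℝ => F (w + c)) 0 := by
        refine ContinuousAt.comp (g := F) ?_ (by fun_prop)
        simpa using (hF w hw).continuousAt
      simpa using h1.tendsto.mono_left nhdsWithin_le_nhds
    have hlim : Tendsto (fun c : ℝ => (interpQuot (fun w => F (w + c)) z).re) (𝓝[>] 0)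
        (𝓝 (interpQuot F z).re) := by
      refine (Complex.continuous_re.tendsto _).comp ?_
      simp_rw [interpQuot_mul _ hz.le hne, interpErr]
      have h2 := hcont (w := 1 / 2) (by norm_num)
      have h3 : Tendsto (fun c : ℝ => ((F (1 / 2 + c)).re : ℂ)) (𝓝[>] 0)
          (𝓝 ((F (1 / 2)).re : ℂ)) :=
        (Complex.continuous_ofReal.tendsto _).comp ((Complex.continuous_re.tendsto _).comp h2)
      exact ((((hcont hz).sub h2).sub ((h3.const_mul 2).mul_const _))).div_const _
    refine ge_of_tendsto hlim ?_
    filter_upwards [self_mem_nhdsWithin] with c hc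
    have hc : 0 < c := hc
    have hre {w : ℂ} : (w + c).re = w.re + c := by simp
    refine re_interpQuot_nonneg_of_bound (c := -c) (A := (1 + ‖F 1‖) * (1 + c) ^ 2 / c)
      (by linarith) (fun w hw => ?_) (fun w hw => ?_) (fun w hw => ?_) hz.le
    · exact DifferentiableAt.comp w (hF _ (by rw [hre]; linarith)) (by fun_prop)
    · refine (norm_le_of_re_nonneg hF h0 (by rw [hre]; linarith)).trans ?_
      have h4 : 1 + ‖w + c‖ ≤ (1 + c) * (1 + ‖w‖) := by
        have := norm_add_le w c
        rw [Complex.norm_real, Real.norm_eq_abs, abs_of_pos hc] at this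
        nlinarith [norm_nonneg w]
      calc (1 + ‖F 1‖) * (1 + ‖w + c‖) ^ 2 / (w + c).re
          ≤ (1 + ‖F 1‖) * ((1 + c) * (1 + ‖w‖)) ^ 2 / c := by
            refine div_le_div₀ (by positivity) (by gcongr) hc (by rw [hre]; linarith)
        _ = _ := by ring
    · exact h0 _ (by rw [hre]; linarith)
  rcases eq_or_ne z (1 / 2) with rfl | hne
  · have hc := (differentiableAt_interpQuot (z := 1 / 2) (c := 0) (by norm_num) hF hz
      hz.le).continuousAt
    have hlim : Tendsto (fun w => (interpQuot F w).re) (𝓝[≠] (1 / 2)) (𝓝 (interpQuot F (1 / 2)).re) :=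
      ((Complex.continuous_re.tendsto _).comp hc.tendsto).mono_left nhdsWithin_le_nhds
    refine ge_of_tendsto hlim ?_
    filter_upwards [self_mem_nhdsWithin,
      mem_nhdsWithin_of_mem_nhds ((isOpen_re_gt 0).mem_nhds hz)] with w hw hw2
    exact hmain hw2 hw
  · exact hmain hz hne

/-- The logarithmic derivative of the real Gamma function. -/
def realDigamma (x : ℝ) : ℝ := deriv Real.Gamma x / Real.Gamma x

theorem differentiableAt_realGamma {x : ℝ} (hx : 0 < x) : DifferentiableAt ℝ Real.Gamma x :=
  Real.differentiableAt_Gamma fun m => by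
    have : (0 : ℝ) ≤ m := m.cast_nonneg
    intro h; linarith

theorem hasDerivAt_log_Gamma {x : ℝ} (hx : 0 < x) :
    HasDerivAt (fun y => log (Real.Gamma y)) (realDigamma x) x :=
  (differentiableAt_realGamma hx).hasDerivAt.log (Real.Gamma_pos_of_pos hx).ne'

theorem deriv_complexGamma_ofReal {x : ℝ} (hx : 0 < x) :
    deriv Complex.Gamma x / Complex.Gamma x = realDigamma x := by
  have hd : DifferentiableAt ℂ Complex.Gamma x := Complex.differentiableAt_Gamma _ fun m h => by
    have : x = -m := by exact_mod_cast h
    have : (0 : ℝ) ≤ m := m.cast_nonneg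
    linarith
  have h1 := hd.hasDerivAt.comp_ofReal
  have h2 := (differentiableAt_realGamma hx).hasDerivAt.ofReal_comp
  have h3 : (fun y : ℝ => ((Real.Gamma y : ℝ) : ℂ)) = fun y : ℝ => Complex.Gamma y := by
    ext y; rw [Complex.Gamma_ofReal]
  rw [h3] at h2
  rw [h1.unique h2, Complex.Gamma_ofReal, realDigamma, Complex.ofReal_div]

theorem log_Gamma_add_one {x : ℝ} (hx : 0 < x) :
    log (Real.Gamma (x + 1)) = log x + log (Real.Gamma x) := by
  rw [Real.Gamma_add_one hx.ne', Real.log_mul hx.ne' (Real.Gamma_pos_of_pos hx).ne']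

theorem realDigamma_add_one {x : ℝ} (hx : 0 < x) :
    realDigamma (x + 1) = realDigamma x + 1 / x := by
  have h1 := (hasDerivAt_log_Gamma (by linarith : 0 < x + 1)).comp_add_const x 1
  have h2 := (Real.hasDerivAt_log hx.ne').add (hasDerivAt_log_Gamma hx)
  have h3 : HasDerivAt (fun y => log (Real.Gamma (y + 1))) (x⁻¹ + realDigamma x) x := by
    refine h2.congr_of_eventuallyEq ?_
    filter_upwards [lt_mem_nhds hx] with y hy
    exact log_Gamma_add_one hy
  rw [h1.unique h3, one_div, add_comm]

theorem realDigamma_le_log {x : ℝ} (hx : 0 < x) : realDigamma x ≤ log x := by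
  have := Real.convexOn_log_Gamma.le_slope_of_hasDerivAt (x := x) (y := x + 1) hx
    (by simpa using by linarith : x + 1 ∈ Set.Ioi 0) (by linarith) (hasDerivAt_log_Gamma hx)
  rw [slope_def_field] at this
  simp only [Function.comp_apply, log_Gamma_add_one hx] at this
  simpa using this

theorem log_le_realDigamma_add_one {x : ℝ} (hx : 0 < x) : log x ≤ realDigamma (x + 1) := by
  have := Real.convexOn_log_Gamma.slope_le_of_hasDerivAt (x := x) (y := x + 1) hx
    (by simpa using by linarith : x + 1 ∈ Set.Ioi 0) (by linarith)
    (hasDerivAt_log_Gamma (by linarith))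
  rw [slope_def_field] at this
  simp only [Function.comp_apply, log_Gamma_add_one hx] at this
  simpa using this

theorem realDigamma_add_nat {x : ℝ} (hx : 0 < x) (n : ℕ) :
    realDigamma (x + n) = realDigamma x + ∑ k ∈ range n, 1 / (x + k) := by
  induction n with
  | zero => simp
  | succ n ih =>
    rw [Finset.sum_range_succ, Nat.cast_succ, ← add_assoc, realDigamma_add_one (by positivity), ih]
    ring

/-- The series of the digamma function at a real argument greater than `1`. -/
theorem hasSum_realDigamma {x : ℝ} (hx : 0 < x) :
    HasSum (fun k : ℕ => x / ((k + 1) * (k + 1 + x)))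
      (realDigamma (x + 1) + eulerMascheroniConstant) := by
  rw [hasSum_iff_tendsto_nat_of_nonneg (fun k => by positivity)]
  have h1 : Tendsto (fun n : ℕ => realDigamma (x + 1 + n) - log n) atTop (𝓝 0) := by
    have h2 : Tendsto (fun n : ℕ => log (x + 1 + n) - log n) atTop (𝓝 0) := by
      have e : Tendsto (fun n : ℕ => log ((x + 1) * (n : ℝ)⁻¹ + 1)) atTop (𝓝 (log ((x + 1) * 0 + 1))) :=
        ((tendsto_inv_atTop_nhds_zero_nat.const_mul (x + 1)).add_const 1).log (by simp)
      simp only [mul_zero, zero_add, Real.log_one] at e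
      refine e.congr' ?_
      filter_upwards [eventually_gt_atTop 0] with n hn
      have hn' : (0 : ℝ) < n := by exact_mod_cast hn
      rw [← Real.log_div (by positivity) hn'.ne']
      congr 1
      field_simp
    refine tendsto_of_tendsto_of_tendsto_of_le_of_le' tendsto_const_nhds h2 ?_ ?_
    · filter_upwards [eventually_gt_atTop 0] with n hn
      have hn' : (0 : ℝ) < n := by exact_mod_cast hn
      have := log_le_realDigamma_add_one (x := x + n) (by positivity)
      have h3 := Real.log_le_log hn' (by linarith : (n : ℝ) ≤ x + n)
      rw [show x + 1 + (n : ℝ) = x + n + 1 by ring]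
      linarith
    · filter_upwards with n
      have := realDigamma_le_log (x := x + 1 + n) (by positivity)
      linarith
  have h2 := Real.tendsto_harmonic_sub_log
  have h3 := (h2.sub h1).add_const (realDigamma (x + 1))
  rw [sub_zero, add_comm eulerMascheroniConstant] at h3
  refine h3.congr fun n => ?_
  rw [realDigamma_add_nat (by linarith), harmonic]
  push_cast
  rw [show ∀ a b c d : ℝ, a - b - (c + d - b) + c = a - d by intros; ring,
    ← Finset.sum_sub_distrib]
  refine Finset.sum_congr rfl fun k _ => ?_
  have : (0 : ℝ) < k + 1 := by positivity
  have : (0 : ℝ) < x + 1 + k := by positivity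
  field_simp
  ring

/-- The integral of `(ψ(v) - v)/v²` over `[1, t]`, up to the constant `1`. -/
def psiInt (t : ℝ) : ℝ := lambdaSum t - log t - Chebyshev.psi t / t

theorem measurable_psiInt : Measurable psiInt :=
  (measurable_lambdaSum.sub Real.measurable_log).sub (measurable_psi.div measurable_id)

theorem abs_psiInt_le {t : ℝ} (ht : 1 ≤ t) : |psiInt t| ≤ log 4 + 10 := by
  have h1 := abs_lambdaSum_sub_log_le ht
  have h2 := abs_psi_div_le (by linarith : 0 < t)
  have := abs_sub (lambdaSum t - log t) (Chebyshev.psi t / t)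
  rw [psiInt]
  linarith

theorem polyBound_psiInt : PolyBound psiInt 0 :=
  ⟨measurable_psiInt, log 4 + 10, fun x hx => by
    rw [Real.rpow_zero, mul_one]; exact abs_psiInt_le hx.le⟩

theorem mellinTail_rpow_mul (f : ℝ → ℝ) (a : ℝ) (s : ℂ) :
    mellinTail (fun x => x ^ a * f x) s = mellinTail f (s - a) := by
  refine setIntegral_congr_fun measurableSet_Ioi fun x hx => ?_
  have hx1 : (1 : ℝ) < x := hx
  have hx0 : (x : ℂ) ≠ 0 := by exact_mod_cast (by linarith : x ≠ 0)
  simp only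
  rw [show -(s - a + 1) = a + -(s + 1) by ring, Complex.cpow_add _ _ hx0, Complex.ofReal_mul,
    Complex.ofReal_cpow (by linarith)]
  ring

theorem PolyBound.rpow_mul {f : ℝ → ℝ} {a : ℝ} (hf : PolyBound f a) (b : ℝ) :
    PolyBound (fun x => x ^ b * f x) (a + b) := by
  obtain ⟨hm, C, hC⟩ := hf
  refine ⟨by fun_prop, C, fun x hx => ?_⟩
  have hx0 : 0 < x := by linarith
  rw [abs_mul, abs_of_nonneg (by positivity), Real.rpow_add hx0, mul_comm, ← mul_assoc]
  gcongr
  exact hC x hx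

theorem mellinTail_lambdaSum {s : ℂ} (hs : 0 < s.re) :
    s * mellinTail lambdaSum s =
      -(deriv riemannZeta (s + 1) / riemannZeta (s + 1)) := by
  have hN : ∀ N : ℕ, ∑ k ∈ Finset.Icc 1 N, vonMangoldt k / k = lambdaSum N := by
    intro N; rw [lambdaSum, Nat.floor_natCast]; rfl
  have hs1 : 1 < (s + 1).re := by simpa using hs
  have hr : (0 : ℝ) ≤ s.re / 2 := by linarith
  have h := LSeries_eq_mul_integral_of_nonneg (fun n => vonMangoldt n / n) (r := s.re / 2) hr
    (s := s) (by linarith) (by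
      simp only [hN]
      have h1 : (fun n : ℕ => lambdaSum n) =O[atTop] fun n : ℕ => 7 + log n := by
        refine Asymptotics.IsBigO.of_bound 1 ?_
        filter_upwards [eventually_ge_atTop 1] with n hn
        have hn' : (1 : ℝ) ≤ n := by exact_mod_cast hn
        have := abs_le.1 (abs_lambdaSum_sub_log_le hn')
        have h0 := Real.log_nonneg hn'
        have h00 : 0 ≤ lambdaSum n := Finset.sum_nonneg fun n _ =>
          div_nonneg ArithmeticFunction.vonMangoldt_nonneg (by positivity)
        rw [Real.norm_of_nonneg h00, Real.norm_of_nonneg (by linarith)]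
        linarith
      refine h1.trans (Asymptotics.IsBigO.add ?_ ?_)
      · refine Asymptotics.IsBigO.of_bound 7 ?_
        filter_upwards [eventually_ge_atTop 1] with n hn
        have hn' : (1 : ℝ) ≤ n := by exact_mod_cast hn
        have h5 : 0 ≤ (n : ℝ) ^ (s.re / 2) := Real.rpow_nonneg (by linarith) _
        rw [Real.norm_of_nonneg h5, Real.norm_of_nonneg (by norm_num)]
        linarith [Real.one_le_rpow hn' hr]
      · exact ((isLittleO_log_rpow_atTop (by linarith : 0 < s.re / 2)).isBigO).comp_tendsto
          tendsto_natCast_atTop_atTop)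
    fun n => div_nonneg ArithmeticFunction.vonMangoldt_nonneg (by positivity)
  have h2 : LSeries (fun n => ((vonMangoldt n / n : ℝ) : ℂ)) s =
      LSeries (fun n => (vonMangoldt n : ℂ)) (s + 1) := by
    unfold LSeries
    congr 1; ext n
    rcases eq_or_ne n 0 with rfl | hn
    · simp
    rw [LSeries.term_of_ne_zero hn, LSeries.term_of_ne_zero hn,
      Complex.cpow_add _ _ (by exact_mod_cast hn), Complex.cpow_one]
    push_cast
    field_simp
  rw [← neg_div, ← ArithmeticFunction.LSeries_vonMangoldt_eq_deriv_riemannZeta_div hs1, ← h2, h,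
    mellinTail]
  congr 1
  refine setIntegral_congr_fun measurableSet_Ioi fun x _ => ?_
  rw [← Complex.ofReal_sum]
  congr 2

theorem polyBound_lambdaSum : PolyBound lambdaSum 1 :=
  ⟨measurable_lambdaSum, 7, fun x hx => by
    have h1 := abs_le.1 (abs_lambdaSum_sub_log_le hx.le)
    have h2 := Real.log_le_sub_one_of_pos (by linarith : 0 < x)
    have h3 := Real.log_nonneg hx.le
    rw [Real.rpow_one, abs_le]
    constructor <;> linarith⟩

theorem mellinTail_psiInt {s : ℂ} (hs : 1 < s.re) :
    mellinTail psiInt s =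
      -(deriv riemannZeta (s + 1) / riemannZeta (s + 1)) / (s * (s + 1)) - 1 / s ^ 2 := by
  have hs0 : s ≠ 0 := fun h => by norm_num [h] at hs
  have hs1 : s + 1 ≠ 0 := fun h => by
    have := congrArg Complex.re h
    simp at this; linarith
  have e : mellinTail psiInt s = mellinTail (fun x => lambdaSum x + ((-1) * log x +
      (-1) * (Chebyshev.psi x / x))) s := mellinTail_congr (fun x _ => by rw [psiInt]; ring) s
  rw [e, mellinTail_add polyBound_lambdaSum
    ((polyBound_log.const_mul (-1)).add ((polyBound_psi_div.mono zero_le_one).const_mul (-1))) hs hs,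
    mellinTail_add (polyBound_log.const_mul (-1)) (polyBound_psi_div.const_mul (-1)) hs
      (by linarith), mellinTail_const_mul, mellinTail_const_mul, mellinTail_log (by linarith),
    mellinTail_shift]
  have h1 := mellinTail_lambdaSum (s := s) (by linarith)
  have h2 := mellinTail_psi (s := s + 1) (by simp; linarith)
  rw [← h1] at h2
  rw [← h1]
  have h3 : mellinTail Chebyshev.psi (s + 1) = s * mellinTail lambdaSum s / (s + 1) := by
    rw [← h2]; field_simp
  rw [h3]
  push_cast
  field_simp
  ring

/-- The coefficients `1 / (2 k (2 k + 1))`, indexed from `k = 1`. -/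
def trivCoeff (k : ℕ) : ℝ := 1 / (2 * (k + 1) * (2 * (k + 1) + 1))

theorem trivCoeff_nonneg (k : ℕ) : 0 ≤ trivCoeff k := by unfold trivCoeff; positivity

theorem realDigamma_half : realDigamma (1 / 2) = -2 * log 2 - eulerMascheroniConstant := by
  have h := deriv_complexGamma_ofReal (x := 1 / 2) (by norm_num)
  have h2 := Complex.digamma_one_half
  rw [Complex.digamma_def, logDeriv_apply] at h2
  push_cast at h
  rw [h, ← Complex.ofReal_ofNat, ← Complex.ofReal_log (by norm_num)] at h2
  exact_mod_cast h2

theorem hasSum_trivCoeff : HasSum trivCoeff (1 - log 2) := by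
  have h := (hasSum_realDigamma (x := 1 / 2) (by norm_num)).mul_left (1 / 2)
  rw [realDigamma_add_one (by norm_num), realDigamma_half] at h
  have e1 : trivCoeff = fun i : ℕ => 1 / 2 * (1 / 2 / (((i : ℝ) + 1) * (i + 1 + 1 / 2))) := by
    ext k
    unfold trivCoeff
    have : (0 : ℝ) < k + 1 := by positivity
    field_simp
  rw [e1, show 1 - log 2 = 1 / 2 * (-2 * log 2 - eulerMascheroniConstant + 1 / (1 / 2) +
    eulerMascheroniConstant) by ring]
  exact h

/-- The contribution of the trivial zeros. -/
def trivSum (t : ℝ) : ℝ := ∑' k, trivCoeff k * t ^ (-(2 * ((k : ℝ) + 1)))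

theorem trivCoeff_mul_le {t : ℝ} (ht : 1 ≤ t) (k : ℕ) :
    trivCoeff k * t ^ (-(2 * ((k : ℝ) + 1))) ≤ trivCoeff k := by
  refine mul_le_of_le_one_right (trivCoeff_nonneg k) ?_
  exact Real.rpow_le_one_of_one_le_of_nonpos ht (by linarith [(k.cast_nonneg : (0 : ℝ) ≤ k)])

theorem trivCoeff_mul_nonneg {t : ℝ} (ht : 1 ≤ t) (k : ℕ) :
    0 ≤ trivCoeff k * t ^ (-(2 * ((k : ℝ) + 1))) := by
  have := trivCoeff_nonneg k
  positivity

theorem summable_trivSum {t : ℝ} (ht : 1 ≤ t) :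
    Summable fun k : ℕ => trivCoeff k * t ^ (-(2 * ((k : ℝ) + 1))) :=
  Summable.of_nonneg_of_le (trivCoeff_mul_nonneg ht) (trivCoeff_mul_le ht) hasSum_trivCoeff.summable

theorem trivSum_nonneg {t : ℝ} (ht : 1 ≤ t) : 0 ≤ trivSum t := tsum_nonneg (trivCoeff_mul_nonneg ht)

theorem trivSum_le {t : ℝ} (ht : 1 ≤ t) : trivSum t ≤ 1 - log 2 := by
  rw [← hasSum_trivCoeff.tsum_eq]
  exact (summable_trivSum ht).tsum_le_tsum (trivCoeff_mul_le ht) hasSum_trivCoeff.summable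

theorem measurable_trivSum : Measurable trivSum := by
  unfold trivSum
  exact Measurable.tsum fun k => by fun_prop

theorem polyBound_trivSum : PolyBound trivSum 0 :=
  ⟨measurable_trivSum, 1, fun x hx => by
    rw [Real.rpow_zero, mul_one, abs_of_nonneg (trivSum_nonneg hx.le)]
    linarith [trivSum_le hx.le, Real.log_nonneg one_le_two]⟩

theorem hasSum_mellinTail_trivSum {s : ℝ} (hs : 0 < s) :
    HasSum (fun k : ℕ => (trivCoeff k / (s + 2 * (k + 1)) : ℂ)) (mellinTail trivSum s) := by
  set f : ℕ → ℝ → ℝ := fun k t => trivCoeff k * t ^ (-(2 * ((k : ℝ) + 1))) with hf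
  have hp (k : ℕ) : PolyBound (f k) (-(2 * ((k : ℝ) + 1))) := (polyBound_rpow _).const_mul _
  have hk (k : ℕ) : -(2 * ((k : ℝ) + 1)) < (s : ℂ).re := by
    rw [Complex.ofReal_re]; linarith [(k.cast_nonneg : (0 : ℝ) ≤ k)]
  have hval (k : ℕ) : mellinTail (f k) s = (trivCoeff k / (s + 2 * (k + 1)) : ℂ) := by
    rw [hf, mellinTail_const_mul, mellinTail_rpow _ (hk k)]
    push_cast
    rw [mul_one_div]
    congr 1
    ring
  have hnorm (k : ℕ) : ∫ t in Set.Ioi (1 : ℝ), ‖(f k t : ℂ) * (t : ℂ) ^ (-((s : ℂ) + 1))‖ =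
      trivCoeff k / (s + 2 * (k + 1)) := by
    have h1 := hval k
    rw [mellinTail_ofReal] at h1
    have h2 : (∫ t in Set.Ioi (1 : ℝ), f k t * t ^ (-s - 1)) = trivCoeff k / (s + 2 * (k + 1)) := by
      exact_mod_cast h1
    rw [← h2]
    refine setIntegral_congr_fun measurableSet_Ioi fun t ht => ?_
    have ht1 : (1 : ℝ) < t := ht
    rw [norm_mellinTail_integrand _ _ (by linarith), abs_of_nonneg (trivCoeff_mul_nonneg ht1.le k),
      Complex.ofReal_re]
  have h := hasSum_integral_of_summable_integral_norm (μ := volume.restrict (Set.Ioi (1 : ℝ)))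
    (F := fun k t => (f k t : ℂ) * (t : ℂ) ^ (-((s : ℂ) + 1)))
    (fun k => (hp k).integrableOn (hk k)) (by
      simp only [hnorm]
      refine Summable.of_nonneg_of_le (fun k => ?_) (fun k => ?_)
        (hasSum_trivCoeff.summable.mul_right (1 / s))
      · have := trivCoeff_nonneg k; positivity
      · rw [mul_one_div]
        gcongr
        · exact trivCoeff_nonneg k
        · linarith [(k.cast_nonneg : (0 : ℝ) ≤ k)])
  have e1 (k : ℕ) : ∫ t in Set.Ioi (1 : ℝ), (f k t : ℂ) * (t : ℂ) ^ (-((s : ℂ) + 1)) =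
      (trivCoeff k / (s + 2 * (k + 1)) : ℂ) := hval k
  simp only [e1] at h
  have e2 : mellinTail trivSum s = ∫ t in Set.Ioi (1 : ℝ),
      ∑' k, (f k t : ℂ) * (t : ℂ) ^ (-((s : ℂ) + 1)) := by
    refine setIntegral_congr_fun measurableSet_Ioi fun t ht => ?_
    rw [tsum_mul_right, ← Complex.ofReal_tsum]
    rfl
  rw [e2]
  exact h

theorem mellinTail_trivSum {s : ℝ} (hs : 1 < s) :
    mellinTail trivSum s = (((1 - log 2) / (s - 1) - (realDigamma (s / 2 + 1) +
      eulerMascheroniConstant) / (2 * s * (s - 1)) : ℝ) : ℂ) := by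
  have h1 := hasSum_mellinTail_trivSum (by linarith : 0 < s)
  have h2 := (hasSum_trivCoeff.div_const (s - 1)).sub
    ((hasSum_realDigamma (by linarith : 0 < s / 2)).div_const (2 * s * (s - 1)))
  have h3 : HasSum (fun k : ℕ => trivCoeff k / (s + 2 * (k + 1))) ((1 - log 2) / (s - 1) -
      (realDigamma (s / 2 + 1) + eulerMascheroniConstant) / (2 * s * (s - 1))) := by
    have e (k : ℕ) : trivCoeff k / (s + 2 * (k + 1)) = trivCoeff k / (s - 1) -
        s / 2 / ((k + 1) * (k + 1 + s / 2)) / (2 * s * (s - 1)) := by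
      unfold trivCoeff
      have : (0 : ℝ) < s - 1 := by linarith
      have : (0 : ℝ) < k + 1 := by positivity
      field_simp
      ring
    simp only [e]
    exact h2
  refine h1.unique ?_
  have := (Complex.hasSum_ofReal).2 h3
  exact_mod_cast this

theorem logDeriv_xi {s : ℝ} (hs : 1 < s) :
    deriv xi s / xi s = -(log π / 2) + realDigamma (s / 2 + 1) / 2 + 1 / (s - 1) +
      deriv riemannZeta s / riemannZeta s := by
  have hs0 : (s : ℂ) ≠ 0 := by exact_mod_cast (by linarith : s ≠ 0)
  have hs1 : (s : ℂ) - 1 ≠ 0 := by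
    rw [sub_ne_zero]; exact_mod_cast hs.ne'
  have hpi : (π : ℂ) ≠ 0 := by exact_mod_cast Real.pi_ne_zero
  have hz : riemannZeta s ≠ 0 := riemannZeta_ne_zero_of_one_lt_re (by simpa using hs)
  have hG : Complex.Gamma (s / 2 + 1) ≠ 0 := by
    apply Complex.Gamma_ne_zero_of_re_pos
    rw [Complex.add_re, Complex.one_re, Complex.div_ofNat_re, Complex.ofReal_re]
    linarith
  have hGd : DifferentiableAt ℂ Complex.Gamma (s / 2 + 1) := by
    have := differentiableAt_realGamma (by linarith : 0 < s / 2 + 1)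
    refine Complex.differentiableAt_Gamma _ fun m h => ?_
    have h' : s / 2 + 1 = -m := by exact_mod_cast h
    have : (0 : ℝ) ≤ m := m.cast_nonneg
    linarith
  have hp : HasDerivAt (fun w : ℂ => (π : ℂ) ^ (-w / 2)) ((π : ℂ) ^ (-(s : ℂ) / 2) *
      Complex.log π * (-1 / 2)) s :=
    ((hasDerivAt_id (s : ℂ)).neg.div_const 2).const_cpow (Or.inl hpi)
  have hg : HasDerivAt (fun w : ℂ => Complex.Gamma (w / 2 + 1))
      (deriv Complex.Gamma (s / 2 + 1) * (1 / 2)) s :=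
    HasDerivAt.comp (h := fun w : ℂ => w / 2 + 1) (s : ℂ) hGd.hasDerivAt
      (((hasDerivAt_id (s : ℂ)).div_const 2).add_const 1)
  have hze : HasDerivAt riemannZeta (deriv riemannZeta s) s :=
    (differentiableAt_riemannZeta (sub_ne_zero.1 hs1)).hasDerivAt
  have h := (((hp.const_mul 2).mul hg).mul (((hasDerivAt_id (s : ℂ)).sub_const 1).mul hze))
  have hE : xi =ᶠ[𝓝 (s : ℂ)] fun w => 2 * (π : ℂ) ^ (-w / 2) * Complex.Gamma (w / 2 + 1) *
      ((w - 1) * riemannZeta w) := by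
    filter_upwards [(isOpen_re_gt 1).mem_nhds (by simpa using hs : (s : ℂ) ∈ {z : ℂ | 1 < z.re})]
      with w hw
    have hw1 : w ≠ 1 := fun h => by simp [h] at hw
    rw [xi_eq (by have : 1 < w.re := hw
                  linarith), riemannZeta₁_eq_mul hw1]
  have hder := (HasDerivAt.congr_of_eventuallyEq h hE).deriv
  have hlog : Complex.log π = (log π : ℝ) := (Complex.ofReal_log Real.pi_pos.le).symm
  have hdig := deriv_complexGamma_ofReal (by linarith : 0 < s / 2 + 1)
  push_cast at hdig
  have hPi : (π : ℂ) ^ (-(s : ℂ) / 2) ≠ 0 := by simp [Complex.cpow_eq_zero_iff, hpi]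
  rw [hder, hE.self_of_nhds, ← hdig, hlog]
  simp only [id, Pi.mul_apply]
  generalize Complex.Gamma (s / 2 + 1) = g at hG ⊢
  generalize deriv Complex.Gamma (s / 2 + 1) = g'
  field_simp
  ring

/-- The logarithmic derivative of `xi`, recentred at the critical line. -/
def xiLog (z : ℂ) : ℂ := deriv xi (1 / 2 + z) / xi (1 / 2 + z)

/-- The sum of `1/|ρ|²` over the zeros of `xi`, assuming the Riemann hypothesis. -/
def zeroConst : ℝ := 2 + eulerMascheroniConstant - log (4 * π)

/-- The normalised remainder in the explicit formula for `∫ (ψ(v) - v)/v²`. -/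
def phi (t : ℝ) : ℝ :=
  t ^ (1 / 2 : ℝ) * (psiInt t + (1 + eulerMascheroniConstant)) +
    t ^ (-(1 / 2) : ℝ) * (trivSum t - log (2 * π))

theorem xiLog_half : xiLog (1 / 2) = ((zeroConst / 2 : ℝ) : ℂ) := by
  have h1 : HasDerivAt xi (completedRiemannZeta₀ 1) 1 := by
    have h := (((hasDerivAt_id (1 : ℂ)).mul ((hasDerivAt_id (1 : ℂ)).sub_const 1)).mul
      (differentiable_completedZeta₀ 1).hasDerivAt).add_const 1
    refine h.congr_deriv ?_
    simp
  rw [xiLog, show (1 / 2 + 1 / 2 : ℂ) = 1 by norm_num, h1.deriv, completedRiemannZeta₀_one]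
  have : xi 1 = 1 := by simp [xi]
  rw [this, zeroConst]
  have h4 : Complex.log (4 * π) = ((log (4 * π) : ℝ) : ℂ) := by
    rw [Complex.ofReal_log (by positivity)]; push_cast; rfl
  rw [h4]
  push_cast
  ring

theorem polyBound_phi : PolyBound phi 1 := by
  have h1 : PolyBound (fun t => psiInt t + (1 + eulerMascheroniConstant)) 0 := by
    have := polyBound_psiInt.add ((polyBound_rpow 0).const_mul (1 + eulerMascheroniConstant))
    simpa using this
  have h2 : PolyBound (fun t => trivSum t - log (2 * π)) 0 := by
    have := polyBound_trivSum.add ((polyBound_rpow 0).const_mul (-log (2 * π)))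
    simpa [sub_eq_add_neg] using this
  exact ((h1.rpow_mul _).mono (by norm_num)).add ((h2.rpow_mul _).mono (by norm_num))

theorem mellinTail_phi {x : ℝ} (hx : 2 < x) : mellinTail phi x =
    mellinTail psiInt ((x - 1 / 2 : ℝ) : ℂ) + (1 + eulerMascheroniConstant) / (x - 1 / 2) +
      (mellinTail trivSum ((x + 1 / 2 : ℝ) : ℂ) - log (2 * π) / (x + 1 / 2)) := by
  have h1 : PolyBound (fun t => psiInt t + (1 + eulerMascheroniConstant) * t ^ (0 : ℝ)) 0 :=
    polyBound_psiInt.add ((polyBound_rpow 0).const_mul (1 + eulerMascheroniConstant))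
  have h2 : PolyBound (fun t => trivSum t + (-log (2 * π)) * t ^ (0 : ℝ)) 0 :=
    polyBound_trivSum.add ((polyBound_rpow 0).const_mul (-log (2 * π)))
  have e : mellinTail phi x = mellinTail (fun t =>
      t ^ (1 / 2 : ℝ) * (psiInt t + (1 + eulerMascheroniConstant) * t ^ (0 : ℝ)) +
      t ^ (-(1 / 2) : ℝ) * (trivSum t + (-log (2 * π)) * t ^ (0 : ℝ))) x :=
    mellinTail_congr (fun t _ => by rw [phi, Real.rpow_zero, mul_one, mul_one, sub_eq_add_neg]) _
  rw [e, mellinTail_add (h1.rpow_mul _) (h2.rpow_mul _) (by simp; linarith) (by simp; linarith),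
    mellinTail_rpow_mul, mellinTail_rpow_mul, mellinTail_add polyBound_psiInt
      ((polyBound_rpow 0).const_mul _) (by simp; linarith) (by simp; linarith),
    mellinTail_add polyBound_trivSum ((polyBound_rpow 0).const_mul _) (by simp; linarith)
      (by simp; linarith), mellinTail_const_mul, mellinTail_const_mul,
    mellinTail_rpow _ (by simp; linarith), mellinTail_rpow _ (by simp; linarith)]
  push_cast
  simp only [sub_neg_eq_add, sub_zero]
  ring

/-- For large real arguments `interpQuot xiLog` is the Mellin transform of `phi`. -/
theorem interpQuot_xiLog_eq {x : ℝ} (hx : 2 < x) : interpQuot xiLog x = mellinTail phi x := by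
  have hne : (x : ℂ) ≠ 1 / 2 := by
    intro h
    have := congrArg Complex.re h
    norm_num at this
    linarith
  rw [interpQuot_mul xiLog (by simpa using by linarith) hne, interpErr, xiLog_half,
    mellinTail_phi hx, mellinTail_trivSum (by linarith), mellinTail_psiInt (by simp; linarith), xiLog,
    show (1 / 2 + x : ℂ) = ((x + 1 / 2 : ℝ) : ℂ) by push_cast; ring, logDeriv_xi (by linarith),
    show ((x - 1 / 2 : ℝ) : ℂ) + 1 = ((x + 1 / 2 : ℝ) : ℂ) by push_cast; ring, Complex.ofReal_re]
  generalize deriv riemannZeta ((x + 1 / 2 : ℝ) : ℂ) / riemannZeta ((x + 1 / 2 : ℝ) : ℂ) = A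
  have hpi : (0 : ℝ) < π := Real.pi_pos
  have e1 : log (4 * π) = 2 * log 2 + log π := by
    rw [Real.log_mul (by norm_num) hpi.ne', show (4 : ℝ) = 2 ^ 2 by norm_num, Real.log_pow]; simp
  have e2 : log (2 * π) = log 2 + log π := Real.log_mul (by norm_num) hpi.ne'
  rw [zeroConst, e1, e2]
  have n1 : (x : ℂ) - 1 / 2 ≠ 0 := sub_ne_zero.2 hne
  have n2 : (x : ℂ) + 1 / 2 ≠ 0 := by
    intro h
    have := congrArg Complex.re h
    norm_num at this
    linarith
  have n3 : (2 * x : ℂ) - 1 ≠ 0 := fun h => n1 (by linear_combination h / 2)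
  have n4 : (2 * x : ℂ) + 1 ≠ 0 := fun h => n2 (by linear_combination h / 2)
  have n5 : (1 : ℂ) / 4 - x ^ 2 ≠ 0 := by
    rw [show (1 : ℂ) / 4 - x ^ 2 = -((x - 1 / 2) * (x + 1 / 2)) by ring]
    exact neg_ne_zero.2 (mul_ne_zero n1 n2)
  have n6 : (1 : ℂ) - 4 * x ^ 2 ≠ 0 := fun h => n5 (by linear_combination h / 4)
  push_cast
  generalize (realDigamma ((x + 1 / 2) / 2 + 1) : ℂ) = D
  generalize (eulerMascheroniConstant : ℂ) = g
  rw [show (x : ℂ) + 1 / 2 - 1 = x - 1 / 2 by ring,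
    show (1 : ℂ) / 4 - x ^ 2 = -((x - 1 / 2) * (x + 1 / 2)) by ring]
  generalize (log π : ℂ) = p at *
  generalize (log 2 : ℂ) = l at *
  obtain ⟨y, hy⟩ : ∃ y : ℂ, y = x - 1 / 2 := ⟨_, rfl⟩
  have hx' : (x : ℂ) = y + 1 / 2 := by rw [hy]; ring
  rw [← hy] at n1
  rw [hx', show y + 1 / 2 + 1 / 2 = y + 1 by ring] at n2
  rw [hx', show y + 1 / 2 + 1 / 2 = y + 1 by ring, show y + 1 / 2 - 1 / 2 = y by ring]
  field_simp
  ring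

theorem integral_circleMap_mul_exp_neg {f : ℂ → ℂ} {c : ℂ} {r : ℝ} (hr : 0 < r)
    (hf : DifferentiableOn ℂ f (Metric.closedBall c r)) (n : ℕ) :
    ∫ θ in (0 : ℝ)..2 * π, f (circleMap c r θ) * Complex.exp (-(n * θ * Complex.I)) =
      2 * π * r ^ n / n.factorial * iteratedDeriv n f c := by
  have h := hf.circleIntegral_one_div_sub_center_pow_smul hr n
  have hr0 : (r : ℂ) ≠ 0 := by exact_mod_cast hr.ne'
  have e : ∮ z in C(c, r), (1 / (z - c) ^ (n + 1)) • f z = Complex.I / r ^ n *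
      ∫ θ in (0 : ℝ)..2 * π, f (circleMap c r θ) * Complex.exp (-(n * θ * Complex.I)) := by
    rw [circleIntegral, ← intervalIntegral.integral_const_mul]
    congr 1; ext θ
    have e0 : circleMap 0 r θ ≠ 0 := circleMap_ne_center hr.ne'
    rw [deriv_circleMap, circleMap_sub_center, Complex.exp_neg, mul_assoc (n : ℂ), Complex.exp_nat_mul,
      smul_eq_mul, smul_eq_mul]
    rw [circleMap_zero] at e0 ⊢
    have := Complex.exp_ne_zero (θ * Complex.I)
    field_simp
    ring
  rw [e, smul_eq_mul] at h
  have hI := Complex.I_ne_zero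
  have hn : (n.factorial : ℂ) ≠ 0 := by exact_mod_cast n.factorial_ne_zero
  field_simp at h ⊢
  linear_combination h

theorem integral_circleMap_mul_exp {f : ℂ → ℂ} {c : ℂ} {r : ℝ} (hr : 0 < r)
    (hf : DifferentiableOn ℂ f (Metric.closedBall c r)) {n : ℕ} (hn : n ≠ 0) :
    ∫ θ in (0 : ℝ)..2 * π, f (circleMap c r θ) * Complex.exp (n * θ * Complex.I) = 0 := by
  obtain ⟨m, rfl⟩ := Nat.exists_eq_succ_of_ne_zero hn
  have hr0 : (r : ℂ) ≠ 0 := by exact_mod_cast hr.ne'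
  have hd : DiffContOnCl ℂ (fun z => (z - c) ^ m * f z) (Metric.ball c r) :=
    DifferentiableOn.diffContOnCl (by
      rw [closure_ball _ hr.ne']
      exact DifferentiableOn.mul (by fun_prop) hf)
  have h := hd.circleIntegral_eq_zero hr.le
  have e : ∮ z in C(c, r), (z - c) ^ m * f z = Complex.I * r ^ (m + 1) *
      ∫ θ in (0 : ℝ)..2 * π, f (circleMap c r θ) * Complex.exp ((m + 1 : ℕ) * θ * Complex.I) := by
    rw [circleIntegral, ← intervalIntegral.integral_const_mul]
    congr 1; ext θ
    rw [deriv_circleMap, circleMap_sub_center, mul_assoc ((m + 1 : ℕ) : ℂ), Complex.exp_nat_mul,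
      smul_eq_mul, circleMap_zero]
    ring
  rw [e, mul_eq_zero] at h
  exact h.resolve_left (mul_ne_zero Complex.I_ne_zero (pow_ne_zero _ hr0))

/-- **Carathéodory's inequality** for the Taylor coefficients of a function with positive real
part. -/
theorem norm_iteratedDeriv_le_of_re_nonneg {f : ℂ → ℂ} {c : ℂ} {r : ℝ} (hr : 0 < r)
    (hf : DifferentiableOn ℂ f (Metric.closedBall c r))
    (h0 : ∀ z ∈ Metric.closedBall c r, 0 ≤ (f z).re) {n : ℕ} (hn : n ≠ 0) :
    ‖iteratedDeriv n f c‖ * r ^ n / n.factorial ≤ 2 * (f c).re := by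
  have h1 := integral_circleMap_mul_exp_neg hr hf n
  have h2 := integral_circleMap_mul_exp hr hf hn
  have h3 := integral_circleMap_mul_exp_neg hr hf 0
  have hmem (θ : ℝ) : circleMap c r θ ∈ Metric.closedBall c r := circleMap_mem_closedBall c hr.le θ
  have hcont : Continuous fun θ : ℝ => f (circleMap c r θ) :=
    hf.continuousOn.comp_continuous (continuous_circleMap c r) hmem
  have h2' : ∫ θ in (0 : ℝ)..2 * π, (starRingEnd ℂ) (f (circleMap c r θ)) *
      Complex.exp (-(n * θ * Complex.I)) = 0 := by
    have := congrArg (starRingEnd ℂ) h2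
    rw [map_zero, intervalIntegral.integral_of_le Real.two_pi_pos.le, ← integral_conj,
      ← intervalIntegral.integral_of_le Real.two_pi_pos.le] at this
    rw [← this]
    congr 1; ext θ
    rw [map_mul, ← Complex.exp_conj]
    simp
  have hc1 : Continuous fun θ : ℝ => f (circleMap c r θ) * Complex.exp (-(n * θ * Complex.I)) :=
    hcont.mul (by fun_prop)
  have hc2 : Continuous fun θ : ℝ => (starRingEnd ℂ) (f (circleMap c r θ)) *
      Complex.exp (-(n * θ * Complex.I)) :=
    (Complex.continuous_conj.comp hcont).mul (by fun_prop)
  have h4 : ∫ θ in (0 : ℝ)..2 * π, (2 * (f (circleMap c r θ)).re : ℝ) *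
      Complex.exp (-(n * θ * Complex.I)) = 2 * π * r ^ n / n.factorial * iteratedDeriv n f c := by
    rw [← h1, ← add_zero (∫ θ in (0 : ℝ)..2 * π, f (circleMap c r θ) *
      Complex.exp (-(n * θ * Complex.I))), ← h2', ← intervalIntegral.integral_add
      (hc1.intervalIntegrable _ _) (hc2.intervalIntegrable _ _)]
    congr 1; ext θ
    rw [← add_mul, Complex.add_conj]
  have h5 : ∫ θ in (0 : ℝ)..2 * π, (f (circleMap c r θ)).re = 2 * π * (f c).re := by
    have h6 : ∫ θ in (0 : ℝ)..2 * π, f (circleMap c r θ) = 2 * π * f c := by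
      simpa using h3
    have h7 := congrArg Complex.re h6
    rw [intervalIntegral.integral_of_le Real.two_pi_pos.le] at h7 ⊢
    have h8 := integral_re (𝕜 := ℂ) (μ := volume.restrict (Set.Ioc 0 (2 * π)))
      (f := fun θ : ℝ => f (circleMap c r θ))
      ((intervalIntegrable_iff_integrableOn_Ioc_of_le Real.two_pi_pos.le).1
        (hcont.intervalIntegrable _ _))
    simp only [RCLike.re_eq_complex_re] at h8
    rw [h8, h7]
    simp [Complex.mul_re]
  have h9 : ‖∫ θ in (0 : ℝ)..2 * π, (2 * (f (circleMap c r θ)).re : ℝ) *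
      Complex.exp (-(n * θ * Complex.I))‖ ≤ ∫ θ in (0 : ℝ)..2 * π, 2 * (f (circleMap c r θ)).re := by
    refine intervalIntegral.norm_integral_le_of_norm_le Real.two_pi_pos.le
      (Eventually.of_forall fun θ _ => ?_) ?_
    · rw [norm_mul, Complex.norm_real, Complex.norm_exp, Real.norm_of_nonneg
        (by linarith [h0 _ (hmem θ)])]
      simp
    · exact (continuous_const.mul (Complex.continuous_re.comp hcont)).intervalIntegrable _ _
  rw [h4, intervalIntegral.integral_const_mul, h5, norm_mul, norm_div, norm_mul, norm_mul, norm_pow,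
    Complex.norm_real, Complex.norm_real, Complex.norm_two, Complex.norm_natCast,
    Real.norm_of_nonneg Real.pi_pos.le, Real.norm_of_nonneg hr.le] at h9
  have hp := Real.two_pi_pos
  have e : 2 * π * r ^ n / n.factorial * ‖iteratedDeriv n f c‖ =
      2 * π * (‖iteratedDeriv n f c‖ * r ^ n / n.factorial) := by ring
  rw [e] at h9
  exact le_of_mul_le_mul_left (by linarith) hp

theorem PolyBound.log_mul {f : ℝ → ℝ} {a b : ℝ} (hf : PolyBound f a) (hab : a < b) :
    PolyBound (fun x => log x * f x) b := by
  obtain ⟨hm, C, hC⟩ := hf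
  refine ⟨Real.measurable_log.mul hm, |C| / (b - a), fun x hx => ?_⟩
  have h1 : 0 < b - a := by linarith
  have hx0 : 0 < x := by linarith
  have h2 := Real.log_le_rpow_div hx0.le h1
  have h3 : |f x| ≤ |C| * x ^ a := (hC x hx).trans (by gcongr; exact le_abs_self C)
  rw [abs_mul, abs_of_nonneg (Real.log_nonneg hx.le)]
  calc log x * |f x| ≤ x ^ (b - a) / (b - a) * (|C| * x ^ a) := by
        gcongr
    _ = |C| / (b - a) * (x ^ (b - a) * x ^ a) := by ring
    _ = _ := by rw [← Real.rpow_add hx0, sub_add_cancel]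

theorem PolyBound.log_pow_mul {f : ℝ → ℝ} {a : ℝ} (hf : PolyBound f a) (n : ℕ) {b : ℝ}
    (hab : a < b) : PolyBound (fun x => log x ^ n * f x) b := by
  induction n generalizing b with
  | zero => simpa using hf.mono hab.le
  | succ n ih =>
    have := (ih (b := (a + b) / 2) (by linarith)).log_mul (b := b) (by linarith)
    simpa [pow_succ', mul_assoc] using this

theorem iteratedDeriv_mellinTail {f : ℝ → ℝ} {a : ℝ} (hf : PolyBound f a) (n : ℕ) {s : ℂ}
    (hs : a < s.re) :
    iteratedDeriv n (mellinTail f) s = (-1) ^ n * mellinTail (fun x => log x ^ n * f x) s := by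
  induction n generalizing s with
  | zero => simp
  | succ n ih =>
    rw [iteratedDeriv_succ]
    have h1 : iteratedDeriv n (mellinTail f) =ᶠ[𝓝 s]
        fun z => (-1) ^ n * mellinTail (fun x => log x ^ n * f x) z := by
      filter_upwards [(isOpen_re_gt a).mem_nhds hs] with z hz
      exact ih hz
    rw [h1.deriv_eq]
    have h2 := (hf.log_pow_mul n (b := (a + s.re) / 2) (by linarith)).hasDerivAt_mellinTail
      (s := s) (by linarith)
    rw [(h2.const_mul _).deriv]
    simp only [← mul_assoc, ← pow_succ']
    ring

theorem mellinTail_log_pow_mul_rpow (a : ℝ) (n : ℕ) {s : ℂ} (hs : a < s.re) :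
    mellinTail (fun x => log x ^ n * x ^ a) s = n.factorial / (s - a) ^ (n + 1) := by
  induction n generalizing s with
  | zero => simpa using mellinTail_rpow a hs
  | succ n ih =>
    have h2 := ((polyBound_rpow a).log_pow_mul n (b := (a + s.re) / 2)
      (by linarith)).hasDerivAt_mellinTail (s := s) (by linarith)
    have h1 : mellinTail (fun x => log x ^ n * x ^ a) =ᶠ[𝓝 s]
        fun z => n.factorial / (z - a) ^ (n + 1) := by
      filter_upwards [(isOpen_re_gt a).mem_nhds hs] with z hz
      exact ih hz
    have hne : s - a ≠ 0 := fun h => by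
      have := congrArg Complex.re h
      simp at this; linarith
    have h3 : HasDerivAt (fun z : ℂ => n.factorial / (z - a) ^ (n + 1))
        (-((n + 1).factorial / (s - a) ^ (n + 2))) s := by
      have := (hasDerivAt_const s (n.factorial : ℂ)).div
        (((hasDerivAt_id s).sub_const (a : ℂ)).pow (n + 1)) (pow_ne_zero _ hne)
      refine this.congr_deriv ?_
      simp only [id, Nat.factorial_succ]
      push_cast
      field_simp
      simp
      ring
    have h4 := h2.unique (h3.congr_of_eventuallyEq h1)
    rw [← neg_inj, ← h4]
    congr 2; ext x; ring

theorem differentiableAt_xiLog (h : ∀ s : ℂ, 1 / 2 < s.re → xi s ≠ 0)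
    {z : ℂ} (hz : 0 < z.re) : DifferentiableAt ℂ xiLog z := by
  have h0 : xi (1 / 2 + z) ≠ 0 := h _ (by simp; linarith)
  have hd : Differentiable ℂ (deriv xi) := by
    have := differentiable_xi.contDiff (n := 2)
    exact (this.differentiable_deriv_two)
  have h1 : DifferentiableAt ℂ (fun z : ℂ => 1 / 2 + z) z := by fun_prop
  exact ((hd _).comp z h1).div ((differentiable_xi _).comp z h1) h0

theorem differentiableAt_interpQuot_xiLog (h : ∀ s : ℂ, 1 / 2 < s.re → xi s ≠ 0)
    {z : ℂ} (hz : 0 < z.re) :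
    DifferentiableAt ℂ (interpQuot xiLog) z :=
  differentiableAt_interpQuot (c := 0) (by norm_num) (fun _ hw => differentiableAt_xiLog h hw)
    hz hz.le

theorem re_interpQuot_xiLog_nonneg (h : ∀ s : ℂ, 1 / 2 < s.re → xi s ≠ 0)
    {z : ℂ} (hz : 0 < z.re) : 0 ≤ (interpQuot xiLog z).re :=
  re_interpQuot_nonneg (fun _ hw => differentiableAt_xiLog h hw)
    (fun _ hw => re_logDeriv_xi_nonneg h hw) hz

theorem interpQuot_xiLog_eventuallyEq (h : ∀ s : ℂ, 1 / 2 < s.re → xi s ≠ 0) {x : ℝ} (hx : 2 < x) :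
    interpQuot xiLog =ᶠ[𝓝 (x : ℂ)] mellinTail phi := by
  refine eventually_eq_of_forall_real ?_ ?_ ?_
  · rw [Complex.analyticAt_iff_eventually_differentiableAt]
    filter_upwards [(isOpen_re_gt 0).mem_nhds (by simp; linarith : (0 : ℝ) < (x : ℂ).re)] with z hz
    exact differentiableAt_interpQuot_xiLog h hz
  · rw [Complex.analyticAt_iff_eventually_differentiableAt]
    filter_upwards [(isOpen_re_gt 1).mem_nhds (by simp; linarith : (1 : ℝ) < (x : ℂ).re)] with z hz
    exact polyBound_phi.differentiableAt hz
  · filter_upwards [lt_mem_nhds hx] with y hy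
    exact interpQuot_xiLog_eq hy

theorem norm_mellinTail_log_pow_mul_phi_le (h : ∀ s : ℂ, 1 / 2 < s.re → xi s ≠ 0)
    {x : ℝ} (hx : 2 < x) {n : ℕ} (hn : n ≠ 0) :
    ‖mellinTail (fun t => log t ^ n * phi t) x‖ * x ^ n / n.factorial ≤
      2 * (mellinTail phi x).re := by
  have h1 : iteratedDeriv n (interpQuot xiLog) x =
      (-1) ^ n * mellinTail (fun t => log t ^ n * phi t) x := by
    rw [(interpQuot_xiLog_eventuallyEq h hx).iteratedDeriv_eq,
      iteratedDeriv_mellinTail polyBound_phi n (by simp; linarith)]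
  have h2 (r : ℝ) (hr : r ∈ Set.Ioo 0 x) :
      ‖mellinTail (fun t => log t ^ n * phi t) x‖ * r ^ n / n.factorial ≤
        2 * (mellinTail phi x).re := by
    have hpos (z : ℂ) (hz : z ∈ Metric.closedBall (x : ℂ) r) : 0 < z.re := by
      have h3 := Complex.abs_re_le_norm (z - x)
      rw [Metric.mem_closedBall, dist_eq_norm] at hz
      have h4 := (abs_le.1 (h3.trans hz)).1
      simp only [Complex.sub_re, Complex.ofReal_re] at h4
      linarith [hr.2]
    have := norm_iteratedDeriv_le_of_re_nonneg hr.1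
      (fun z hz => (differentiableAt_interpQuot_xiLog h (hpos z hz)).differentiableWithinAt)
      (fun z hz => re_interpQuot_xiLog_nonneg h (hpos z hz)) hn
    rw [h1, (interpQuot_xiLog_eventuallyEq h hx).self_of_nhds, norm_mul] at this
    simpa using this
  have h3 : Tendsto (fun r : ℝ => ‖mellinTail (fun t => log t ^ n * phi t) x‖ * r ^ n / n.factorial)
      (𝓝[<] x) (𝓝 (‖mellinTail (fun t => log t ^ n * phi t) x‖ * x ^ n / n.factorial)) := by
    refine Tendsto.mono_left ?_ nhdsWithin_le_nhds
    exact (Continuous.tendsto (by fun_prop) x)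
  refine le_of_tendsto h3 ?_
  filter_upwards [Ioo_mem_nhdsLT (by linarith : 0 < x)] with r hr
  exact h2 r hr

theorem PolyBound.integrableOn_real {f : ℝ → ℝ} {a : ℝ} (hf : PolyBound f a) {x : ℝ} (hx : a < x) :
    IntegrableOn (fun t => f t * t ^ (-x - 1)) (Set.Ioi 1) := by
  obtain ⟨hm, C, hC⟩ := hf
  exact integrableOn_mul_rpow_of_le hm one_pos hC hx

theorem integral_log_pow_mul_rpow (a : ℝ) (n : ℕ) {x : ℝ} (hx : a < x) :
    ∫ t in Set.Ioi (1 : ℝ), log t ^ n * t ^ a * t ^ (-x - 1) = n.factorial / (x - a) ^ (n + 1) := by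
  have h := mellinTail_log_pow_mul_rpow a n (s := x) (by simpa using hx)
  rw [mellinTail_ofReal] at h
  exact_mod_cast h

theorem psiInt_of_lt_two {t : ℝ} (ht : 1 < t) (ht2 : t < 2) : psiInt t = -log t := by
  have hf : ⌊t⌋₊ = 1 := by
    rw [Nat.floor_eq_iff (by linarith)]; constructor <;> norm_num <;> linarith
  rw [psiInt, lambdaSum, Chebyshev.psi, hf]
  simp

theorem phi_le : ∃ C : ℝ, ∀ t, 1 < t → phi t ≤ zeroConst + C * (log t * t) := by
  refine ⟨50 + (1 + eulerMascheroniConstant) + |1 - log 2 - log (2 * π)|, fun t ht => ?_⟩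
  have hl := Real.log_pos ht
  have h1 : psiInt t ≤ 50 * log t := by
    rcases lt_or_ge t 2 with h | h
    · rw [psiInt_of_lt_two ht h]; linarith
    · have h2 := (abs_le.1 (abs_psiInt_le ht.le)).2
      have h3 := Real.log_le_log two_pos h
      have h4 : log 4 = 2 * log 2 := by
        rw [show (4 : ℝ) = 2 ^ 2 by norm_num, Real.log_pow]; simp
      have := Real.log_two_gt_d9
      linarith
  have hγ : 0 < 1 + eulerMascheroniConstant := by
    linarith [Real.one_half_lt_eulerMascheroniConstant]
  have hS := trivSum_le ht.le
  have hr1 : t ^ (1 / 2 : ℝ) ≤ t := by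
    simpa using Real.rpow_le_rpow_of_exponent_le ht.le (by norm_num : (1 / 2 : ℝ) ≤ 1)
  have hr0 : 1 ≤ t ^ (1 / 2 : ℝ) := Real.one_le_rpow ht.le (by norm_num)
  have hr2 : t ^ (1 / 2 : ℝ) ≤ 1 + log t * t := by
    have h5 : t ^ (1 / 2 : ℝ) = exp (log t / 2) := by
      rw [Real.rpow_def_of_pos (by linarith)]; congr 1; ring
    have h6 := Real.add_one_le_exp (-(log t / 2))
    rw [Real.exp_neg, ← h5] at h6
    have h7 : (1 - log t / 2) * t ^ (1 / 2 : ℝ) ≤ 1 := by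
      have := mul_le_mul_of_nonneg_right h6 (by linarith : 0 ≤ t ^ (1 / 2 : ℝ))
      rw [inv_mul_cancel₀ (by linarith)] at this
      linarith
    nlinarith
  have hq0 : 0 < t ^ (-(1 / 2) : ℝ) := by positivity
  have hq1 : t ^ (-(1 / 2) : ℝ) ≤ 1 := Real.rpow_le_one_of_one_le_of_nonpos ht.le (by norm_num)
  have hq2 : 1 - log t * t ≤ t ^ (-(1 / 2) : ℝ) := by
    rw [Real.rpow_def_of_pos (by linarith)]
    have := Real.add_one_le_exp (log t * (-(1 / 2)))
    nlinarith
  have e1 : log (4 * π) = 2 * log 2 + log π := by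
    rw [Real.log_mul (by norm_num) Real.pi_pos.ne', show (4 : ℝ) = 2 ^ 2 by norm_num,
      Real.log_pow]; simp
  have e2 : log (2 * π) = log 2 + log π := Real.log_mul (by norm_num) Real.pi_pos.ne'
  set k := 1 - log 2 - log (2 * π) with hk
  have hz : zeroConst = (1 + eulerMascheroniConstant) + k := by rw [zeroConst, hk, e1, e2]; ring
  have p1 : t ^ (1 / 2 : ℝ) * psiInt t ≤ 50 * (log t * t) := by
    calc t ^ (1 / 2 : ℝ) * psiInt t ≤ t ^ (1 / 2 : ℝ) * (50 * log t) := by gcongr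
      _ ≤ t * (50 * log t) := by gcongr
      _ = _ := by ring
  have p2 : t ^ (1 / 2 : ℝ) * (1 + eulerMascheroniConstant) ≤
      (1 + log t * t) * (1 + eulerMascheroniConstant) := by gcongr
  have p3 : t ^ (-(1 / 2) : ℝ) * (trivSum t - log (2 * π)) ≤ t ^ (-(1 / 2) : ℝ) * k := by
    gcongr
    linarith
  have p4 : t ^ (-(1 / 2) : ℝ) * k ≤ k + |k| * (log t * t) := by
    have h8 : (t ^ (-(1 / 2) : ℝ) - 1) * k ≤ (1 - t ^ (-(1 / 2) : ℝ)) * |k| := by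
      have := neg_abs_le k
      nlinarith
    have h9 : (1 - t ^ (-(1 / 2) : ℝ)) * |k| ≤ (log t * t) * |k| := by
      gcongr
      linarith
    linarith
  rw [phi, hz]
  nlinarith

theorem re_mellinTail_phi_le : ∃ C : ℝ, ∀ x : ℝ, 2 < x →
    x * (mellinTail phi x).re ≤ zeroConst + C * (x / (x - 1) ^ 2) := by
  obtain ⟨C, hC⟩ := phi_le
  refine ⟨C, fun x hx => ?_⟩
  have i1 : PolyBound (fun t : ℝ => t ^ (0 : ℝ)) 0 := polyBound_rpow 0
  have i2 : PolyBound (fun t : ℝ => log t ^ 1 * t ^ (1 : ℝ)) (3 / 2) :=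
    (polyBound_rpow 1).log_pow_mul 1 (by norm_num)
  have j1 := (i1.integrableOn_real (x := x) (by linarith)).const_mul zeroConst
  have j2 := (i2.integrableOn_real (x := x) (by linarith)).const_mul C
  have h1 : (mellinTail phi x).re ≤ zeroConst * (1 / x) + C * (1 / (x - 1) ^ 2) := by
    rw [mellinTail_ofReal, Complex.ofReal_re]
    have e1 := integral_log_pow_mul_rpow 0 0 (by linarith : 0 < x)
    have e2 := integral_log_pow_mul_rpow 1 1 (by linarith : 1 < x)
    simp only [pow_zero, one_mul, Nat.factorial_zero, sub_zero, zero_add, pow_one,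
      Nat.cast_one, Nat.factorial_one] at e1 e2
    simp only [pow_one] at j2
    rw [← e1, ← e2, ← integral_const_mul, ← integral_const_mul, ← integral_add j1 j2]
    refine setIntegral_mono_on (polyBound_phi.integrableOn_real (by linarith)) (j1.add j2)
      measurableSet_Ioi fun t ht => ?_
    have ht1 : (1 : ℝ) < t := ht
    rw [Real.rpow_zero, Real.rpow_one]
    have := mul_le_mul_of_nonneg_right (hC t ht1) (by positivity : 0 ≤ t ^ (-x - 1))
    simp only [one_mul]
    linarith
  have hx0 : 0 < x := by linarith
  calc x * (mellinTail phi x).re ≤ x * (zeroConst * (1 / x) + C * (1 / (x - 1) ^ 2)) := by gcongr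
    _ = _ := by field_simp

/-- The quantitative Post-Widder inversion formula. -/
theorem abs_postWidder_sub_le {f : ℝ → ℝ} (hf : PolyBound f 1) {t₀ ε C : ℝ} (ht₀ : 1 < t₀)
    (hC0 : 0 ≤ C) (hC : ∀ t, 1 < t → |f t - f t₀| ≤ ε + C * ((log t - log t₀) ^ 2 * t)) :
    ∃ D : ℝ, ∀ᶠ n : ℕ in atTop, |(mellinTail (fun t => log t ^ n * f t) ((n / log t₀ : ℝ) : ℂ)).re *
      (n / log t₀) ^ (n + 1) / n.factorial - f t₀| ≤ ε + C * (D / n) := by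
  set u := log t₀ with hu
  have hu0 : 0 < u := Real.log_pos ht₀
  set c := 2 + 2 * u + u ^ 2 with hc
  refine ⟨exp (4 * u) * u ^ 2 * (4 * (1 + c)), ?_⟩
  filter_upwards [eventually_gt_atTop 0, tendsto_natCast_atTop_atTop.eventually_ge_atTop (4 * u)]
    with n hn0 hn
  have hn1 : (1 : ℝ) ≤ n := by exact_mod_cast hn0
  set x : ℝ := n / u with hx
  have hx2 : 3 < x := by rw [hx, lt_div_iff₀ hu0]; linarith
  set w : ℝ → ℝ := fun t => log t ^ n * t ^ (-x - 1) with hw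
  have J (m : ℕ) (a : ℝ) (ha : a < 3) :
      IntegrableOn (fun t => log t ^ m * t ^ a * t ^ (-x - 1)) (Set.Ioi 1) :=
    ((polyBound_rpow a).log_pow_mul m ha).integrableOn_real hx2
  have Jf : IntegrableOn (fun t => log t ^ n * f t * t ^ (-x - 1)) (Set.Ioi 1) :=
    (hf.log_pow_mul n (by norm_num : (1 : ℝ) < 3)).integrableOn_real hx2
  have hI0 := integral_log_pow_mul_rpow 0 n (by linarith : 0 < x)
  have hfac : (0 : ℝ) < n.factorial := by positivity
  have hx0 : 0 < x := by linarith
  have hy0 : 0 < x - 1 := by linarith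
  have h1 : |(∫ t in Set.Ioi (1 : ℝ), log t ^ n * f t * t ^ (-x - 1)) -
      f t₀ * (n.factorial / x ^ (n + 1))| ≤ ε * (n.factorial / x ^ (n + 1)) +
        C * ((n + 2).factorial / (x - 1) ^ (n + 3) - 2 * u * ((n + 1).factorial / (x - 1) ^ (n + 2))
          + u ^ 2 * (n.factorial / (x - 1) ^ (n + 1))) := by
    rw [sub_zero] at hI0
    have J0 : IntegrableOn (fun t => log t ^ n * t ^ (0 : ℝ) * t ^ (-x - 1)) (Set.Ioi 1) :=
      J n 0 (by norm_num)
    have K0 (a : ℝ) : IntegrableOn (fun t => a * (log t ^ n * t ^ (0 : ℝ) * t ^ (-x - 1)))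
      (Set.Ioi 1) := J0.const_mul a
    have K1 : IntegrableOn (fun t => log t ^ (n + 2) * t ^ (1 : ℝ) * t ^ (-x - 1) -
        2 * u * (log t ^ (n + 1) * t ^ (1 : ℝ) * t ^ (-x - 1))) (Set.Ioi 1) :=
      (J (n + 2) 1 (by norm_num)).sub ((J (n + 1) 1 (by norm_num)).const_mul _)
    have K2 : IntegrableOn (fun t => u ^ 2 * (log t ^ n * t ^ (1 : ℝ) * t ^ (-x - 1)))
      (Set.Ioi 1) := (J n 1 (by norm_num)).const_mul _
    have K3 : IntegrableOn (fun t => C * (log t ^ (n + 2) * t ^ (1 : ℝ) * t ^ (-x - 1) -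
        2 * u * (log t ^ (n + 1) * t ^ (1 : ℝ) * t ^ (-x - 1)) +
        u ^ 2 * (log t ^ n * t ^ (1 : ℝ) * t ^ (-x - 1)))) (Set.Ioi 1) :=
      (K1.add K2).const_mul C
    have K4 : IntegrableOn (fun t => ε * (log t ^ n * t ^ (0 : ℝ) * t ^ (-x - 1)) +
        C * (log t ^ (n + 2) * t ^ (1 : ℝ) * t ^ (-x - 1) -
        2 * u * (log t ^ (n + 1) * t ^ (1 : ℝ) * t ^ (-x - 1)) +
        u ^ 2 * (log t ^ n * t ^ (1 : ℝ) * t ^ (-x - 1)))) (Set.Ioi 1) := (K0 ε).add K3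
    rw [← hI0, ← integral_log_pow_mul_rpow 1 n (by linarith : 1 < x),
      ← integral_log_pow_mul_rpow 1 (n + 1) (by linarith : 1 < x),
      ← integral_log_pow_mul_rpow 1 (n + 2) (by linarith : 1 < x),
      ← integral_const_mul, ← integral_const_mul, ← integral_const_mul, ← integral_const_mul,
      ← integral_sub Jf (K0 _),
      ← integral_sub (J (n + 2) 1 (by norm_num)) ((J (n + 1) 1 (by norm_num)).const_mul _),
      ← integral_add K1 K2, ← integral_const_mul, ← integral_add (K0 ε) K3]
    rw [← Real.norm_eq_abs]
    refine norm_integral_le_of_norm_le K4 ?_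
    refine (ae_restrict_mem measurableSet_Ioi).mono fun t ht => ?_
    have ht1 : (1 : ℝ) < t := ht
    have hl := Real.log_pos ht1
    have hw0 : 0 ≤ log t ^ n * t ^ (-x - 1) := by positivity
    have h2 := mul_le_mul_of_nonneg_left (hC t ht1) hw0
    rw [Real.rpow_zero, Real.rpow_one, Real.norm_eq_abs, mul_one,
      show log t ^ n * f t * t ^ (-x - 1) - f t₀ * (log t ^ n * t ^ (-x - 1)) =
        (log t ^ n * t ^ (-x - 1)) * (f t - f t₀) by ring, abs_mul, abs_of_nonneg hw0]
    refine h2.trans (le_of_eq ?_)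
    ring
  have e1 : (mellinTail (fun t => log t ^ n * f t) ((x : ℝ) : ℂ)).re =
      ∫ t in Set.Ioi (1 : ℝ), log t ^ n * f t * t ^ (-x - 1) := by
    rw [mellinTail_ofReal, Complex.ofReal_re]
  rw [e1]
  set I := ∫ t in Set.Ioi (1 : ℝ), log t ^ n * f t * t ^ (-x - 1)
  set q : ℝ := x ^ (n + 1) / n.factorial with hq
  have hq0 : 0 < q := by positivity
  have hnu : 0 < n - u := by linarith
  have e2 : q * ((n + 2).factorial / (x - 1) ^ (n + 3) -
      2 * u * ((n + 1).factorial / (x - 1) ^ (n + 2)) + u ^ 2 * (n.factorial / (x - 1) ^ (n + 1))) =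
      (n / (n - u)) ^ (n + 1) * u ^ 2 * ((n + c) / (n - u) ^ 2) := by
    have e3 : x - 1 = (n - u) / u := by rw [hx]; field_simp
    rw [hq, e3, hc, hx, Nat.factorial_succ (n + 1), Nat.factorial_succ n]
    push_cast
    simp only [div_pow]
    field_simp
    ring
  have h3 : (n / (n - u) : ℝ) ^ (n + 1) ≤ exp (4 * u) := by
    have h4 : (n / (n - u) : ℝ) ≤ exp (u / (n - u)) := by
      have := Real.add_one_le_exp (u / (n - u))
      have e : (n / (n - u) : ℝ) = u / (n - u) + 1 := by field_simp; ring
      linarith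
    have h5 : 0 ≤ (n / (n - u) : ℝ) := by positivity
    calc (n / (n - u) : ℝ) ^ (n + 1) ≤ exp (u / (n - u)) ^ (n + 1) := by gcongr
      _ = exp ((n + 1 : ℕ) * (u / (n - u))) := by rw [← Real.exp_nat_mul]
      _ ≤ exp (4 * u) := by
        rw [Real.exp_le_exp, mul_div_assoc', div_le_iff₀ hnu]
        push_cast
        nlinarith
  have h6 : ((n + c) / (n - u) ^ 2 : ℝ) ≤ 4 * (1 + c) / n := by
    have hc0 : 0 < c := by positivity
    rw [div_le_div_iff₀ (by positivity) (by linarith)]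
    have h7 : (n : ℝ) / 2 ≤ n - u := by linarith
    have h8 : ((n : ℝ) / 2) ^ 2 ≤ (n - u) ^ 2 := by gcongr
    nlinarith
  have h9 : |I * q - f t₀| ≤ ε + C * ((n / (n - u)) ^ (n + 1) * u ^ 2 * ((n + c) / (n - u) ^ 2)) := by
    rw [← e2]
    have e4 : q * (n.factorial / x ^ (n + 1)) = 1 := by rw [hq]; field_simp
    have e5 : I * q - f t₀ = q * (I - f t₀ * (n.factorial / x ^ (n + 1))) := by
      linear_combination f t₀ * e4
    rw [e5, abs_mul, abs_of_pos hq0]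
    refine (mul_le_mul_of_nonneg_left h1 hq0.le).trans (le_of_eq ?_)
    linear_combination ε * e4
  rw [mul_div_assoc]
  refine h9.trans ?_
  have hc0 : 0 < c := by positivity
  have : (n / (n - u) : ℝ) ^ (n + 1) * u ^ 2 * ((n + c) / (n - u) ^ 2) ≤
      exp (4 * u) * u ^ 2 * (4 * (1 + c) / n) := by gcongr
  rw [mul_div_assoc]
  gcongr

theorem continuousAt_trivSum {t : ℝ} (ht : 1 < t) : ContinuousAt trivSum t := by
  have h : ContinuousOn trivSum (Set.Ici 1) := by
    unfold trivSum
    refine continuousOn_tsum (u := trivCoeff) (fun k => ?_) hasSum_trivCoeff.summable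
      fun k x hx => ?_
    · refine continuousOn_const.mul (ContinuousOn.rpow_const continuousOn_id fun x hx => Or.inl ?_)
      have : (1 : ℝ) ≤ x := hx
      linarith
    · rw [Real.norm_eq_abs, abs_of_nonneg (trivCoeff_mul_nonneg hx k)]
      exact trivCoeff_mul_le hx k
  exact h.continuousAt (Ici_mem_nhds ht)

theorem lambdaSum_congr {x y : ℝ} (h : ⌊x⌋₊ = ⌊y⌋₊) : lambdaSum x = lambdaSum y := by
  rw [lambdaSum, lambdaSum, h]

theorem continuousWithinAt_phi {t₀ : ℝ} (ht : 1 < t₀) {s : Set ℝ}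
    (hs : ∀ᶠ t in 𝓝[s] t₀, ⌊t⌋₊ = ⌊t₀⌋₊) : ContinuousWithinAt phi s t₀ := by
  have h0 : t₀ ≠ 0 := by linarith
  have h : ContinuousAt (fun t : ℝ => t ^ (1 / 2 : ℝ) *
      ((lambdaSum t₀ - log t - Chebyshev.psi t₀ / t) + (1 + eulerMascheroniConstant)) +
      t ^ (-(1 / 2) : ℝ) * (trivSum t - log (2 * π))) t₀ := by
    have h1 := continuousAt_trivSum ht
    have h2 : ContinuousAt (fun t : ℝ => log t) t₀ := Real.continuousAt_log h0
    have h3 (a : ℝ) : ContinuousAt (fun t : ℝ => t ^ a) t₀ :=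
      Real.continuousAt_rpow_const _ _ (Or.inl h0)
    have h4 : ContinuousAt (fun t : ℝ => Chebyshev.psi t₀ / t) t₀ :=
      continuousAt_const.div continuousAt_id h0
    exact ((h3 _).mul (((continuousAt_const.sub h2).sub h4).add continuousAt_const)).add
      ((h3 _).mul (h1.sub continuousAt_const))
  refine h.continuousWithinAt.congr_of_eventuallyEq ?_ (by rw [phi, psiInt])
  filter_upwards [hs] with t hst
  rw [phi, psiInt, lambdaSum_congr hst, Chebyshev.psi_eq_psi_coe_floor t, hst,
    ← Chebyshev.psi_eq_psi_coe_floor]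

theorem eventually_floor_eq {t₀ : ℝ} (ht : 0 ≤ t₀) : ∀ᶠ t in 𝓝[>] t₀, ⌊t⌋₊ = ⌊t₀⌋₊ := by
  have h1 : t₀ < ⌊t₀⌋₊ + 1 := Nat.lt_floor_add_one t₀
  filter_upwards [self_mem_nhdsWithin, mem_nhdsWithin_of_mem_nhds (Iio_mem_nhds h1)] with t h2 h3
  have h2' : t₀ < t := h2
  have h3' : t < ⌊t₀⌋₊ + 1 := h3
  exact (Nat.floor_eq_iff (by linarith)).2 ⟨(Nat.floor_le ht).trans h2'.le, h3'⟩

theorem eventually_floor_eq_of_ne {t₀ : ℝ} (ht : 0 ≤ t₀) (hne : (⌊t₀⌋₊ : ℝ) ≠ t₀) :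
    ∀ᶠ t in 𝓝 t₀, ⌊t⌋₊ = ⌊t₀⌋₊ := by
  have h1 : t₀ < ⌊t₀⌋₊ + 1 := Nat.lt_floor_add_one t₀
  have h2 : (⌊t₀⌋₊ : ℝ) < t₀ := lt_of_le_of_ne (Nat.floor_le ht) hne
  filter_upwards [Iio_mem_nhds h1, Ioi_mem_nhds h2] with t h3 h4
  have hlt : t < ⌊t₀⌋₊ + 1 := h3
  have hgt : (⌊t₀⌋₊ : ℝ) < t := h4
  exact (Nat.floor_eq_iff ((Nat.cast_nonneg _).trans hgt.le)).2 ⟨hgt.le, hlt⟩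

/-- A polynomially bounded function that is continuous at a point differs there from its value by
a small constant plus a quadratic term. -/
theorem PolyBound.abs_sub_le_of_continuousAt {f : ℝ → ℝ} (hf : PolyBound f 1) {t₀ : ℝ}
    (ht₀ : 1 < t₀) (hc : ContinuousAt f t₀) {ε : ℝ} (hε : 0 < ε) :
    ∃ C : ℝ, 0 ≤ C ∧ ∀ t, 1 < t → |f t - f t₀| ≤ ε + C * ((log t - log t₀) ^ 2 * t) := by
  obtain ⟨K, hK⟩ := hf.2
  have h0 : 0 < t₀ := by linarith
  have hK0 : 0 ≤ K := by
    have := (abs_nonneg _).trans (hK t₀ ht₀)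
    rw [Real.rpow_one] at this
    exact nonneg_of_mul_nonneg_left this h0
  have h1 : ContinuousAt (fun v => f (exp v)) (log t₀) := by
    have : ContinuousAt f (exp (log t₀)) := by rwa [Real.exp_log h0]
    exact ContinuousAt.comp (f := exp) this Real.continuous_exp.continuousAt
  obtain ⟨δ, hδ, hd⟩ := Metric.continuousAt_iff.1 h1 ε hε
  refine ⟨K * (1 + t₀) / δ ^ 2, by positivity, fun t ht => ?_⟩
  have ht0 : 0 < t := by linarith
  rcases lt_or_ge (dist (log t) (log t₀)) δ with h | h
  · have h2 := hd h
    rw [Real.dist_eq, Real.exp_log ht0, Real.exp_log h0] at h2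
    have : 0 ≤ K * (1 + t₀) / δ ^ 2 * ((log t - log t₀) ^ 2 * t) := by positivity
    linarith
  · have h2 := hK t ht
    have h3 := hK t₀ ht₀
    rw [Real.rpow_one] at h2 h3
    have h4 : |f t - f t₀| ≤ |f t| + |f t₀| := abs_sub _ _
    rw [Real.dist_eq] at h
    have h5 : δ ^ 2 ≤ (log t - log t₀) ^ 2 := by
      rw [← sq_abs (log t - log t₀)]; gcongr
    have h6 : K * (1 + t₀) * t ≤ K * (1 + t₀) / δ ^ 2 * ((log t - log t₀) ^ 2 * t) := by
      rw [div_mul_eq_mul_div, le_div_iff₀ (by positivity)]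
      have : 0 ≤ K * (1 + t₀) * t := by positivity
      nlinarith
    have h7 : K * t₀ ≤ K * t₀ * t := le_mul_of_one_le_right (by positivity) ht.le
    nlinarith

theorem abs_phi_le_of_continuousAt (h : ∀ s : ℂ, 1 / 2 < s.re → xi s ≠ 0)
    {t₀ : ℝ} (ht₀ : 1 < t₀) (hc : ContinuousAt phi t₀) :
    |phi t₀| ≤ 2 * zeroConst := by
  refine le_of_forall_pos_le_add fun ε hε => ?_
  obtain ⟨C, hC0, hC⟩ := polyBound_phi.abs_sub_le_of_continuousAt ht₀ hc hε
  obtain ⟨D, hD⟩ := abs_postWidder_sub_le polyBound_phi ht₀ hC0 hC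
  obtain ⟨B, hB⟩ := re_mellinTail_phi_le
  have hu : 0 < log t₀ := Real.log_pos ht₀
  have hx : Tendsto (fun n : ℕ => (n : ℝ) / log t₀) atTop atTop :=
    tendsto_natCast_atTop_atTop.atTop_div_const hu
  have hlim : Tendsto (fun n : ℕ => 2 * (zeroConst + B * ((n / log t₀ : ℝ) /
      (n / log t₀ - 1) ^ 2)) + (ε + C * (D / n))) atTop
      (𝓝 (2 * (zeroConst + B * 0) + (ε + C * 0))) := by
    have h1 : Tendsto (fun x : ℝ => x / (x - 1) ^ 2) atTop (𝓝 0) := by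
      have h2 : Tendsto (fun x : ℝ => 2 / (x - 1)) atTop (𝓝 0) :=
        (tendsto_atTop_add_const_right _ (-1 : ℝ) tendsto_id).const_div_atTop 2
      refine squeeze_zero' ?_ ?_ h2
      · filter_upwards [eventually_gt_atTop 0] with x hx; positivity
      · filter_upwards [eventually_gt_atTop 2] with x hx
        have : 0 < x - 1 := by linarith
        rw [div_le_div_iff₀ (by positivity) this]
        nlinarith
    exact ((((h1.comp hx).const_mul B).const_add _).const_mul 2).add
      (((tendsto_const_div_atTop_nhds_zero_nat D).const_mul C).const_add ε)
  have hfin : |phi t₀| ≤ 2 * (zeroConst + B * 0) + (ε + C * 0) := by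
    refine ge_of_tendsto hlim ?_
    filter_upwards [hD, hx.eventually_gt_atTop 2, eventually_ne_atTop 0] with n h1 h2 h3
    set x : ℝ := n / log t₀ with hxd
    have h4 := norm_mellinTail_log_pow_mul_phi_le h h2 h3
    have h5 := hB x h2
    have hx0 : 0 < x := by linarith
    have h6 : |(mellinTail (fun t => log t ^ n * phi t) (x : ℂ)).re * x ^ (n + 1) / n.factorial| ≤
        2 * (x * (mellinTail phi x).re) := by
      rw [abs_div, abs_mul, abs_of_pos (by positivity : (0 : ℝ) < n.factorial),
        abs_of_pos (by positivity : 0 < x ^ (n + 1))]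
      have h7 := Complex.abs_re_le_norm (mellinTail (fun t => log t ^ n * phi t) (x : ℂ))
      calc _ ≤ ‖mellinTail (fun t => log t ^ n * phi t) x‖ * x ^ (n + 1) / n.factorial := by gcongr
        _ = x * (‖mellinTail (fun t => log t ^ n * phi t) x‖ * x ^ n / n.factorial) := by ring
        _ ≤ x * (2 * (mellinTail phi x).re) := by gcongr
        _ = _ := by ring
    have h8 := abs_sub_abs_le_abs_sub (phi t₀)
      ((mellinTail (fun t => log t ^ n * phi t) (x : ℂ)).re * x ^ (n + 1) / n.factorial)
    rw [abs_sub_comm] at h8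
    linarith
  linarith

theorem abs_phi_le (h : ∀ s : ℂ, 1 / 2 < s.re → xi s ≠ 0)
    {t₀ : ℝ} (ht₀ : 1 < t₀) : |phi t₀| ≤ 2 * zeroConst := by
  have h0 : 0 ≤ t₀ := by linarith
  have h1 : Tendsto (fun t => |phi t|) (𝓝[>] t₀) (𝓝 |phi t₀|) :=
    (continuousWithinAt_phi ht₀ (eventually_floor_eq h0)).abs
  refine le_of_tendsto h1 ?_
  filter_upwards [eventually_floor_eq h0, self_mem_nhdsWithin] with t h2 h3
  have h3' : t₀ < t := h3
  refine abs_phi_le_of_continuousAt h (by linarith) ?_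
  rw [← continuousWithinAt_univ]
  refine continuousWithinAt_phi (by linarith) ?_
  rw [nhdsWithin_univ]
  refine eventually_floor_eq_of_ne (by linarith) ?_
  rw [h2]
  exact ((Nat.floor_le h0).trans_lt h3').ne

theorem psiInt_eq_sum {t : ℝ} (ht : 0 < t) {N : ℕ} (hN : t ≤ N) : psiInt t =
    ∑ n ∈ Ioc 0 N, vonMangoldt n * max 0 (1 / (n : ℝ) - 1 / t) - log t := by
  have h1 : ∑ n ∈ Ioc 0 N, vonMangoldt n * max 0 (1 / (n : ℝ) - 1 / t) =
      ∑ n ∈ Ioc 0 ⌊t⌋₊, vonMangoldt n * (1 / (n : ℝ) - 1 / t) := by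
    have hsub : Ioc 0 ⌊t⌋₊ ⊆ Ioc 0 N :=
      Finset.Ioc_subset_Ioc_right (Nat.floor_le_of_le hN)
    rw [← Finset.sum_subset hsub fun n hn hn' => ?_]
    · refine Finset.sum_congr rfl fun n hn => ?_
      rw [Finset.mem_Ioc] at hn
      have hn0 : (0 : ℝ) < n := by exact_mod_cast hn.1
      have hnt : (n : ℝ) ≤ t := (Nat.le_floor_iff ht.le).1 hn.2
      rw [max_eq_right]
      have := one_div_le_one_div_of_le hn0 hnt
      linarith
    · rw [Finset.mem_Ioc] at hn hn'
      have hlt : ⌊t⌋₊ < n := by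
        by_contra hc
        exact hn' ⟨hn.1, not_lt.1 hc⟩
      have hnt : t < n := (Nat.floor_lt ht.le).1 hlt
      have := one_div_le_one_div_of_le ht hnt.le
      rw [max_eq_left (by linarith), mul_zero]
  rw [h1, psiInt, lambdaSum, Chebyshev.psi]
  simp only [mul_sub]
  rw [Finset.sum_sub_distrib, ← Finset.sum_mul]
  simp only [mul_one_div]
  ring

theorem continuousAt_psiInt {t : ℝ} (ht : 0 < t) : ContinuousAt psiInt t := by
  have h : ContinuousAt (fun u : ℝ => ∑ n ∈ Ioc 0 (⌊t⌋₊ + 1), vonMangoldt n *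
      max 0 (1 / (n : ℝ) - 1 / u) - log u) t := by
    refine ContinuousAt.sub ?_ (Real.continuousAt_log ht.ne')
    refine tendsto_finsetSum _ fun n _ => ?_
    have h1 : ContinuousAt (fun u : ℝ => 1 / u) t := continuousAt_const.div continuousAt_id ht.ne'
    exact (continuousAt_const.max (continuousAt_const.sub h1)).const_mul _
  refine h.congr ?_
  filter_upwards [Ioi_mem_nhds ht, Iio_mem_nhds (Nat.lt_floor_add_one t)] with u h1 h2
  have h2' : u < ⌊t⌋₊ + 1 := h2
  exact (psiInt_eq_sum h1 (by push_cast; exact h2'.le)).symm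

theorem hasDerivAt_psiInt {t : ℝ} (ht : 0 < t) (hne : (⌊t⌋₊ : ℝ) ≠ t) :
    HasDerivAt psiInt ((Chebyshev.psi t - t) / t ^ 2) t := by
  have h1 : HasDerivAt (fun u => lambdaSum t - log u - Chebyshev.psi t / u)
      (0 - t⁻¹ - (-(Chebyshev.psi t) / t ^ 2)) t := by
    refine (((hasDerivAt_const t (lambdaSum t)).fun_sub (Real.hasDerivAt_log ht.ne')).fun_sub ?_)
    have := (hasDerivAt_const t (Chebyshev.psi t)).fun_div (hasDerivAt_id t) ht.ne'
    refine this.congr_deriv ?_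
    simp
  refine (h1.congr_of_eventuallyEq ?_).congr_deriv ?_
  · filter_upwards [eventually_floor_eq_of_ne ht.le hne] with u hu
    rw [psiInt, lambdaSum_congr hu, Chebyshev.psi_eq_psi_coe_floor u, hu,
      ← Chebyshev.psi_eq_psi_coe_floor]
  · field_simp; ring

/-- The integral of `(v - ψ(v))/v²` over `v > t`. -/
def psiTail (t : ℝ) : ℝ := -(psiInt t + (1 + eulerMascheroniConstant))

theorem lambdaSum_eq (t : ℝ) :
    lambdaSum t = log t + Chebyshev.psi t / t - 1 - eulerMascheroniConstant - psiTail t := by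
  rw [psiTail, psiInt]; ring

theorem sqrt_mul_psiTail {t : ℝ} (ht : 0 < t) :
    √t * psiTail t = -phi t + (trivSum t - log (2 * π)) / √t := by
  have h : t ^ (-(1 / 2) : ℝ) = 1 / √t := by rw [Real.rpow_neg ht.le, ← Real.sqrt_eq_rpow, one_div]
  rw [phi, psiTail, h, ← Real.sqrt_eq_rpow]
  ring

theorem one_sub_log_two_lt_log_two_pi : 1 - log 2 ≤ log (2 * π) := by
  have h1 : (1 / 2 : ℝ) < log 2 := by linarith [Real.log_two_gt_d9]
  have h2 : log 2 ≤ log (2 * π) := Real.log_le_log (by norm_num) (by linarith [Real.pi_gt_three])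
  linarith

theorem psiTail_le (h : ∀ s : ℂ, 1 / 2 < s.re → xi s ≠ 0)
    {t : ℝ} (ht : 1 < t) : psiTail t ≤ 2 * zeroConst / √t := by
  have hs : 0 < √t := Real.sqrt_pos.2 (by linarith)
  rw [le_div_iff₀ hs, mul_comm, sqrt_mul_psiTail (by linarith)]
  have h1 := neg_abs_le (phi t)
  have h2 := abs_phi_le h ht
  have h3 : (trivSum t - log (2 * π)) / √t ≤ 0 := by
    refine div_nonpos_of_nonpos_of_nonneg ?_ hs.le
    linarith [trivSum_le ht.le, one_sub_log_two_lt_log_two_pi]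
  linarith

theorem le_psiTail (h : ∀ s : ℂ, 1 / 2 < s.re → xi s ≠ 0) {t : ℝ} (ht : 1 < t) :
    -(2 * zeroConst / √t + log (2 * π) / t) ≤ psiTail t := by
  have ht0 : 0 < t := by linarith
  have hs : 0 < √t := Real.sqrt_pos.2 ht0
  have h0 := sqrt_mul_psiTail ht0
  have h1 := le_abs_self (phi t)
  have h2 := abs_phi_le h ht
  have h3 : -(log (2 * π)) / √t ≤ (trivSum t - log (2 * π)) / √t := by
    gcongr; linarith [trivSum_nonneg ht.le]
  have h4 : √t * (2 * zeroConst / √t + log (2 * π) / t) = 2 * zeroConst + log (2 * π) / √t := by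
    nth_rw 3 [← Real.mul_self_sqrt ht0.le]
    field_simp
  rw [neg_div] at h3
  have h5 : √t * -(2 * zeroConst / √t + log (2 * π) / t) ≤ √t * psiTail t := by
    rw [mul_neg, h4]; linarith
  exact le_of_mul_le_mul_left h5 hs

theorem countable_floor_eq : {t : ℝ | (⌊t⌋₊ : ℝ) = t}.Countable :=
  (Set.countable_range (fun n : ℕ => (n : ℝ))).mono fun t ht =>
    Set.mem_range.2 ⟨⌊t⌋₊, ht⟩

/-- The weight `-v'`, where `v t = (1 + log t)/log² t`. -/
def tailWeight (t : ℝ) : ℝ := 1 / (t * log t ^ 2) + 2 / (t * log t ^ 3)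

theorem hasDerivAt_primitive {t : ℝ} (ht : 1 < t) (hne : (⌊t⌋₊ : ℝ) ≠ t) :
    HasDerivAt (fun t => log (log t) + eulerMascheroniConstant * (log t)⁻¹ -
      psiTail t * (log t ^ 2)⁻¹) (lambdaSum t / (t * log t ^ 2) + psiTail t * tailWeight t) t := by
  have h0 : 0 < t := by linarith
  have hl : 0 < log t := Real.log_pos ht
  have h1 : HasDerivAt psiTail (-((Chebyshev.psi t - t) / t ^ 2)) t :=
    ((hasDerivAt_psiInt h0 hne).add_const _).neg
  have h2 : HasDerivAt (fun t => (log t ^ 2)⁻¹) (-(2 / (t * log t ^ 3))) t := by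
    refine (((Real.hasDerivAt_log h0.ne').fun_pow 2).fun_inv (by positivity)).congr_deriv ?_
    field_simp
    norm_num
    ring
  refine (((hasDerivAt_log_log ht).fun_add ((hasDerivAt_inv_log ht).const_mul _)).fun_sub
    (h1.fun_mul h2)).congr_deriv ?_
  rw [lambdaSum_eq, tailWeight]
  field_simp
  ring

theorem abs_psiTail_le {t : ℝ} (ht : 1 ≤ t) :
    |psiTail t| ≤ log 4 + 10 + |1 + eulerMascheroniConstant| := by
  rw [psiTail, abs_neg]
  exact (abs_add_le _ _).trans (by gcongr; exact abs_psiInt_le ht)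

theorem measurable_psiTail : Measurable psiTail := (measurable_psiInt.add_const _).neg

theorem measurable_tailWeight : Measurable tailWeight := by
  unfold tailWeight
  have := Real.measurable_log
  fun_prop

theorem tailWeight_nonneg {t : ℝ} (ht : 1 < t) : 0 ≤ tailWeight t := by
  have := Real.log_pos ht
  unfold tailWeight
  positivity

theorem tailWeight_le {x t : ℝ} (hx : 1 < x) (ht : x ≤ t) :
    tailWeight t ≤ (1 / log x ^ 2 + 2 / log x ^ 3) / t := by
  have h0 : 0 < log x := Real.log_pos hx
  have h1 : log x ≤ log t := Real.log_le_log (by linarith) ht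
  have ht0 : 0 < t := by linarith
  have e : tailWeight t = (1 / log t ^ 2 + 2 / log t ^ 3) / t := by
    unfold tailWeight; field_simp
  rw [e]
  gcongr

theorem integrableOn_Ioc_of_abs_le {f : ℝ → ℝ} (hf : Measurable f) {x y C : ℝ}
    (h : ∀ t, x < t → t ≤ y → |f t| ≤ C) : IntegrableOn f (Set.Ioc x y) :=
  Measure.integrableOn_of_bounded (M := C) (by simp) hf.aestronglyMeasurable
    ((ae_restrict_mem measurableSet_Ioc).mono fun t ht => h t ht.1 ht.2)

theorem integrableOn_lambdaSum_div {x y : ℝ} (hx : 2 ≤ x) :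
    IntegrableOn (fun t => lambdaSum t / (t * log t ^ 2)) (Set.Ioc x y) := by
  have hl : 0 < log x := Real.log_pos (by linarith)
  refine integrableOn_Ioc_of_abs_le (C := (6 + log y) / (x * log x ^ 2)) ?_ fun t h1 h2 => ?_
  · have := Real.measurable_log
    have := measurable_lambdaSum
    fun_prop
  · have h3 := abs_le.1 (abs_lambdaSum_sub_log_le (by linarith : 1 ≤ t))
    have h4 : log t ≤ log y := Real.log_le_log (by linarith) h2
    have h5 : log x ≤ log t := Real.log_le_log (by linarith) h1.le
    have h6 : 0 ≤ lambdaSum t := Finset.sum_nonneg fun n _ =>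
      div_nonneg ArithmeticFunction.vonMangoldt_nonneg (Nat.cast_nonneg n)
    have ht : 0 < t := by linarith
    rw [abs_of_nonneg (by positivity)]
    have h7 : lambdaSum t ≤ 6 + log y := by linarith
    have h8 : 0 ≤ 6 + log y := by linarith
    gcongr

theorem integrableOn_psiTail_mul {x y : ℝ} (hx : 2 ≤ x) :
    IntegrableOn (fun t => psiTail t * tailWeight t) (Set.Ioc x y) := by
  have hl : 0 < log x := Real.log_pos (by linarith)
  refine integrableOn_Ioc_of_abs_le (C := (log 4 + 10 + |1 + eulerMascheroniConstant|) *
    ((1 / log x ^ 2 + 2 / log x ^ 3) / x)) (measurable_psiTail.mul measurable_tailWeight)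
    fun t h1 h2 => ?_
  have h3 := tailWeight_nonneg (by linarith : 1 < t)
  have h4 := tailWeight_le (by linarith : 1 < x) h1.le
  have h5 := abs_psiTail_le (by linarith : 1 ≤ t)
  have h6 : 0 ≤ log 4 := Real.log_nonneg (by norm_num)
  rw [Pi.mul_apply, abs_mul, abs_of_nonneg h3]
  have h7 : (1 / log x ^ 2 + 2 / log x ^ 3) / t ≤ (1 / log x ^ 2 + 2 / log x ^ 3) / x := by gcongr
  have h8 := h4.trans h7
  gcongr

theorem primeSum_sub_eq {x y : ℝ} (hx : 2 ≤ x) (hxy : x ≤ y) :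
    primeSum y - primeSum x = lambdaSum y / log y - lambdaSum x / log x +
      ((log (log y) + eulerMascheroniConstant * (log y)⁻¹ - psiTail y * (log y ^ 2)⁻¹) -
      (log (log x) + eulerMascheroniConstant * (log x)⁻¹ - psiTail x * (log x ^ 2)⁻¹)) -
      ∫ t in Set.Ioc x y, psiTail t * tailWeight t := by
  have h1 : ∫ t in Set.Ioc 2 y, lambdaSum t / (t * log t ^ 2) =
      (∫ t in Set.Ioc 2 x, lambdaSum t / (t * log t ^ 2)) +
      ∫ t in Set.Ioc x y, lambdaSum t / (t * log t ^ 2) := by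
    rw [← setIntegral_union (Set.Ioc_disjoint_Ioc_of_le le_rfl) measurableSet_Ioc
      (integrableOn_lambdaSum_div le_rfl) (integrableOn_lambdaSum_div hx),
      Set.Ioc_union_Ioc_eq_Ioc hx hxy]
  have h2 := integral_eq_of_hasDerivAt_off_countable_of_le
    (fun t => log (log t) + eulerMascheroniConstant * (log t)⁻¹ - psiTail t * (log t ^ 2)⁻¹)
    (fun t => lambdaSum t / (t * log t ^ 2) + psiTail t * tailWeight t) hxy countable_floor_eq
    (fun t ht => ContinuousAt.continuousWithinAt ?_)
    (fun t ht => hasDerivAt_primitive (by linarith [ht.1.1]) ht.2) ?_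
  · rw [intervalIntegral.integral_of_le hxy,
      integral_add (integrableOn_lambdaSum_div hx) (integrableOn_psiTail_mul hx)] at h2
    rw [primeSum_eq x, primeSum_eq y, h1, ← h2]
    ring
  · have ht0 : 0 < t := by linarith [ht.1]
    have hl : 0 < log t := Real.log_pos (by linarith [ht.1])
    have h3 : ContinuousAt log t := Real.continuousAt_log ht0.ne'
    have h4 : ContinuousAt psiTail t := ((continuousAt_psiInt ht0).add continuousAt_const).neg
    exact ((h3.log hl.ne').add (continuousAt_const.mul (h3.inv₀ hl.ne'))).sub
      (h4.mul ((h3.pow 2).inv₀ (pow_pos hl 2).ne'))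
  · rw [intervalIntegrable_iff_integrableOn_Ioc_of_le hxy]
    exact (integrableOn_lambdaSum_div hx).add (integrableOn_psiTail_mul hx)

theorem integral_Ioc_inv_mul_sqrt {x y : ℝ} (hx : 0 < x) (hxy : x ≤ y) :
    ∫ t in Set.Ioc x y, 1 / (t * √t) = 2 / √x - 2 / √y := by
  rw [← intervalIntegral.integral_of_le hxy]
  have hpos : ∀ t ∈ Set.uIcc x y, 0 < t := fun t ht => by
    rw [Set.uIcc_of_le hxy] at ht; linarith [ht.1]
  rw [intervalIntegral.integral_eq_sub_of_hasDerivAt (f := fun t => -2 / √t)]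
  · ring
  · intro t ht
    have h0 := hpos t ht
    have hs : 0 < √t := Real.sqrt_pos.2 h0
    refine ((hasDerivAt_const t (-2 : ℝ)).fun_div (Real.hasDerivAt_sqrt h0.ne') hs.ne').congr_deriv ?_
    rw [Real.sq_sqrt h0.le]
    field_simp
    ring
  · refine ContinuousOn.intervalIntegrable fun t ht => ContinuousAt.continuousWithinAt ?_
    have h0 := hpos t ht
    have hs : 0 < √t := Real.sqrt_pos.2 h0
    exact continuousAt_const.div (continuousAt_id.mul Real.continuous_sqrt.continuousAt)
      (mul_pos h0 hs).ne'

theorem zeroConst_nonneg (h : ∀ s : ℂ, 1 / 2 < s.re → xi s ≠ 0) : 0 ≤ zeroConst := by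
  have := (abs_nonneg _).trans (abs_phi_le h (by norm_num : (1 : ℝ) < 2))
  linarith

theorem integral_psiTail_mul_le (h : ∀ s : ℂ, 1 / 2 < s.re → xi s ≠ 0)
    {x y : ℝ} (hx : 2 ≤ x) (hxy : x ≤ y) :
    ∫ t in Set.Ioc x y, psiTail t * tailWeight t ≤
      4 * zeroConst * (1 / log x ^ 2 + 2 / log x ^ 3) / √x := by
  have hz := zeroConst_nonneg h
  set K := 2 * zeroConst * (1 / log x ^ 2 + 2 / log x ^ 3) with hK
  have hl : 0 < log x := Real.log_pos (by linarith)
  have hK0 : 0 ≤ K := by positivity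
  have h1 : IntegrableOn (fun t => K * (1 / (t * √t))) (Set.Ioc x y) := by
    refine integrableOn_Ioc_of_abs_le (C := K * (1 / (x * √x))) (by fun_prop) fun t h1 h2 => ?_
    have : 0 < x := by linarith
    have : 0 < t := by linarith
    have : 0 < √x := Real.sqrt_pos.2 (by linarith)
    rw [abs_of_nonneg (by positivity)]
    have := Real.sqrt_le_sqrt h1.le
    gcongr
  calc _ ≤ ∫ t in Set.Ioc x y, K * (1 / (t * √t)) := by
        refine setIntegral_mono_on (integrableOn_psiTail_mul hx) h1 measurableSet_Ioc fun t ht => ?_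
        have ht1 : 1 < t := by linarith [ht.1]
        have hs : 0 < √t := Real.sqrt_pos.2 (by linarith)
        calc psiTail t * tailWeight t ≤ 2 * zeroConst / √t * ((1 / log x ^ 2 + 2 / log x ^ 3) / t) :=
              mul_le_mul (psiTail_le h ht1) (tailWeight_le (by linarith) ht.1.le)
                (tailWeight_nonneg ht1) (by positivity)
          _ = K * (1 / (t * √t)) := by rw [hK]; field_simp
    _ = K * (2 / √x - 2 / √y) := by
        rw [integral_const_mul, integral_Ioc_inv_mul_sqrt (by linarith) hxy]
    _ ≤ K * (2 / √x) := by gcongr; linarith [div_nonneg (zero_le_two (α := ℝ)) (Real.sqrt_nonneg y)]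
    _ = _ := by rw [hK]; ring

theorem tendsto_psiTail (h : ∀ s : ℂ, 1 / 2 < s.re → xi s ≠ 0) : Tendsto psiTail atTop (𝓝 0) := by
  have h1 : Tendsto (fun t : ℝ => 2 * zeroConst / √t) atTop (𝓝 0) :=
    tendsto_const_nhds.div_atTop Real.tendsto_sqrt_atTop
  have h2 : Tendsto (fun t : ℝ => -(2 * zeroConst / √t + log (2 * π) / t)) atTop (𝓝 0) := by
    have := (h1.add (tendsto_const_nhds (x := log (2 * π)).div_atTop tendsto_id)).neg
    simpa using this
  refine tendsto_of_tendsto_of_tendsto_of_le_of_le' h2 h1 ?_ ?_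
  · filter_upwards [eventually_gt_atTop 1] with t ht using le_psiTail h ht
  · filter_upwards [eventually_gt_atTop 1] with t ht using psiTail_le h ht

theorem primeSum_le_of_xi (h : ∀ s : ℂ, 1 / 2 < s.re → xi s ≠ 0)
    {x : ℝ} (hx : 2 ≤ x) : primeSum x ≤ eulerMascheroniConstant +
    log (log x) + (Chebyshev.psi x - x) / (x * log x) +
    (1 / log x + 1 / log x ^ 2) * (2 * zeroConst / √x + log (2 * π) / x) +
    4 * zeroConst * (1 / log x ^ 2 + 2 / log x ^ 3) / √x := by
  have hl : 0 < log x := Real.log_pos (by linarith)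
  have key : ∀ y, x ≤ y → primeSum x ≤ (primeSum y - log (log y)) -
      (Chebyshev.psi y / y - 1) * (log y)⁻¹ + psiTail y * ((log y)⁻¹ + (log y)⁻¹ ^ 2) +
      (log (log x) + (Chebyshev.psi x - x) / (x * log x) -
      (1 / log x + 1 / log x ^ 2) * psiTail x +
      4 * zeroConst * (1 / log x ^ 2 + 2 / log x ^ 3) / √x) := fun y hy => by
    have h1 := primeSum_sub_eq hx hy
    have h2 := integral_psiTail_mul_le h hx hy
    have hly : 0 < log y := Real.log_pos (by linarith)
    have e1 : lambdaSum x / log x + (log (log x) + eulerMascheroniConstant * (log x)⁻¹ -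
        psiTail x * (log x ^ 2)⁻¹) = log (log x) + 1 + (Chebyshev.psi x - x) / (x * log x) -
        (1 / log x + 1 / log x ^ 2) * psiTail x := by
      rw [lambdaSum_eq]; field_simp; ring
    have e2 : lambdaSum y / log y + (log (log y) + eulerMascheroniConstant * (log y)⁻¹ -
        psiTail y * (log y ^ 2)⁻¹) = log (log y) + 1 + (Chebyshev.psi y / y - 1) * (log y)⁻¹ -
        psiTail y * ((log y)⁻¹ + (log y)⁻¹ ^ 2) := by
      rw [lambdaSum_eq]; field_simp; ring
    linarith
  have hinv : Tendsto (fun y => (log y)⁻¹) atTop (𝓝 0) := Real.tendsto_log_atTop.inv_tendsto_atTop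
  have hpsi : Tendsto (fun y => (Chebyshev.psi y / y - 1) * (log y)⁻¹) atTop (𝓝 0) := by
    refine bdd_le_mul_tendsto_zero' (log 4 + 4 + 1) ?_ hinv
    filter_upwards [eventually_gt_atTop 0] with y hy
    have := abs_psi_div_le hy
    refine (abs_sub _ _).trans ?_
    simp only [abs_one]
    linarith
  have hJ : Tendsto (fun y => psiTail y * ((log y)⁻¹ + (log y)⁻¹ ^ 2)) atTop (𝓝 0) := by
    have := (tendsto_psiTail h).mul (hinv.add (hinv.pow 2))
    simpa using this
  have hlim := ((tendsto_primeSum_sub_log_log.sub hpsi).add hJ).add_const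
    (log (log x) + (Chebyshev.psi x - x) / (x * log x) -
      (1 / log x + 1 / log x ^ 2) * psiTail x +
      4 * zeroConst * (1 / log x ^ 2 + 2 / log x ^ 3) / √x)
  have h1 := ge_of_tendsto hlim (by filter_upwards [eventually_ge_atTop x] with y hy using key y hy)
  have h2 := mul_le_mul_of_nonneg_left (le_psiTail h (by linarith : 1 < x))
    (by positivity : 0 ≤ 1 / log x + 1 / log x ^ 2)
  linarith

theorem log_le_half_sub_inv {y : ℝ} (hy : 1 ≤ y) : log y ≤ (y - y⁻¹) / 2 := by
  have h := monotoneOn_of_deriv_nonneg (f := fun y => (y - y⁻¹) / 2 - log y) (convex_Ici 1)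
    ?_ ?_ ?_ Set.self_mem_Ici (Set.mem_Ici.2 hy) hy
  · simp only [inv_one, sub_self, zero_div, Real.log_one] at h
    linarith
  · intro x hx
    have : x ≠ 0 := by linarith [Set.mem_Ici.1 hx]
    exact ContinuousAt.continuousWithinAt (((continuousAt_id.sub (continuousAt_id.inv₀ this)).div_const
      2).sub (Real.continuousAt_log this))
  all_goals
    intro x hx
    rw [interior_Ici, Set.mem_Ioi] at hx
    have h0 : x ≠ 0 := by linarith
    have hd : HasDerivAt (fun y => (y - y⁻¹) / 2 - log y) ((1 - -(x ^ 2)⁻¹) / 2 - x⁻¹) x :=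
      (((hasDerivAt_id x).sub (hasDerivAt_inv h0)).div_const 2).sub (Real.hasDerivAt_log h0)
  · exact hd.differentiableAt.differentiableWithinAt
  · rw [hd.deriv]
    have : (1 - -(x ^ 2)⁻¹) / 2 - x⁻¹ = (x - 1) ^ 2 / (2 * x ^ 2) := by field_simp; ring
    rw [this]
    positivity

theorem two_mul_div_le_log {u : ℝ} (hu : 0 ≤ u) : 2 * u / (2 + u) ≤ log (1 + u) := by
  have h := monotoneOn_of_deriv_nonneg (f := fun u => log (1 + u) - 2 * u / (2 + u)) (convex_Ici 0)
    ?_ ?_ ?_ Set.self_mem_Ici (Set.mem_Ici.2 hu) hu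
  · simp only [add_zero, Real.log_one, mul_zero, zero_div, sub_self] at h
    linarith
  · intro x hx
    have h0 : 0 ≤ x := hx
    have h1 : 1 + x ≠ 0 := by linarith
    have h2 : 2 + x ≠ 0 := by linarith
    refine ContinuousAt.continuousWithinAt (ContinuousAt.sub ?_ ?_)
    · exact (continuousAt_const.add continuousAt_id).log h1
    · exact (continuousAt_const.mul continuousAt_id).div (continuousAt_const.add continuousAt_id) h2
  all_goals
    intro x hx
    rw [interior_Ici, Set.mem_Ioi] at hx
    have h1 : 1 + x ≠ 0 := by linarith
    have h2 : 2 + x ≠ 0 := by linarith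
    have hd : HasDerivAt (fun u => log (1 + u) - 2 * u / (2 + u))
        (1 / (1 + x) - (2 * 1 * (2 + x) - 2 * x * 1) / (2 + x) ^ 2) x :=
      (((hasDerivAt_id x).const_add 1).log h1).sub
        (((hasDerivAt_id x).const_mul 2).div ((hasDerivAt_id x).const_add 2) h2)
  · exact hd.differentiableAt.differentiableWithinAt
  · rw [hd.deriv]
    have : 1 / (1 + x) - (2 * 1 * (2 + x) - 2 * x * 1) / (2 + x) ^ 2 =
        x ^ 2 / ((1 + x) * (2 + x) ^ 2) := by field_simp; ring
    rw [this]
    positivity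

theorem tendsto_harmonic_sub_log_add {f : ℕ → ℝ} (hf : Tendsto f atTop (𝓝 0)) :
    Tendsto (fun n : ℕ => (harmonic (n + 1) : ℝ) - log ((n + 1 : ℕ) : ℝ) + f n) atTop
      (𝓝 eulerMascheroniConstant) := by
  have := (Real.tendsto_harmonic_sub_log.comp (tendsto_add_atTop_nat 1)).add hf
  simpa using this

theorem harmonic_sub_log_sub_le (n : ℕ) : (harmonic (n + 1) : ℝ) - log ((n + 1 : ℕ) : ℝ) -
    1 / (2 * ((n + 1 : ℕ) : ℝ)) ≤ eulerMascheroniConstant := by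
  have hlim : Tendsto (fun n : ℕ => (harmonic (n + 1) : ℝ) - log ((n + 1 : ℕ) : ℝ) +
      (-(1 / (2 * ((n + 1 : ℕ) : ℝ))))) atTop (𝓝 eulerMascheroniConstant) := by
    refine tendsto_harmonic_sub_log_add ?_
    have := (tendsto_one_div_add_atTop_nhds_zero_nat (𝕜 := ℝ)).const_mul (-(1 / 2))
    rw [mul_zero] at this
    refine this.congr fun k => ?_
    push_cast
    field_simp
  have hmono : Monotone (fun n : ℕ => (harmonic (n + 1) : ℝ) - log ((n + 1 : ℕ) : ℝ) +
      (-(1 / (2 * ((n + 1 : ℕ) : ℝ))))) := by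
    refine monotone_nat_of_le_succ fun k => ?_
    rw [harmonic_succ (k + 1)]
    push_cast
    have hk : (0 : ℝ) < k + 1 := by positivity
    have h1 := log_le_half_sub_inv (y := ((k : ℝ) + 1 + 1) / (k + 1))
      (by rw [le_div_iff₀ hk]; linarith)
    rw [Real.log_div (by positivity) hk.ne', inv_div] at h1
    have e : (((k : ℝ) + 1 + 1) / (k + 1) - (k + 1) / (k + 1 + 1)) / 2 =
        1 / (2 * (k + 1)) + 1 / (2 * (k + 1 + 1)) := by field_simp; ring
    have e2 : ((k : ℝ) + 1 + 1)⁻¹ = 1 / (2 * (k + 1 + 1)) + 1 / (2 * (k + 1 + 1)) := by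
      field_simp; ring
    linarith
  have := hmono.ge_of_tendsto hlim n
  linarith

theorem le_harmonic_sub_log_sub (n : ℕ) : eulerMascheroniConstant ≤
    (harmonic (n + 1) : ℝ) - log ((n + 1 : ℕ) + 1 / 2 : ℝ) := by
  have hlim : Tendsto (fun n : ℕ => (harmonic (n + 1) : ℝ) - log ((n + 1 : ℕ) : ℝ) +
      (log ((n + 1 : ℕ) : ℝ) - log ((n + 1 : ℕ) + 1 / 2 : ℝ))) atTop
      (𝓝 eulerMascheroniConstant) := by
    refine tendsto_harmonic_sub_log_add ?_
    have h1 : Tendsto (fun n : ℕ => -(1 / 2 : ℝ) * (1 / ((n : ℝ) + 1))) atTop (𝓝 0) := by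
      have := (tendsto_one_div_add_atTop_nhds_zero_nat (𝕜 := ℝ)).const_mul (-(1 / 2))
      rwa [mul_zero] at this
    refine tendsto_of_tendsto_of_tendsto_of_le_of_le h1 tendsto_const_nhds (fun k => ?_)
      fun k => ?_
    · have hk : (0 : ℝ) < k + 1 := by positivity
      have h2 := Real.log_le_sub_one_of_pos (x := ((k : ℝ) + 1 + 1 / 2) / (k + 1)) (by positivity)
      rw [Real.log_div (by positivity) hk.ne'] at h2
      have e : ((k : ℝ) + 1 + 1 / 2) / (k + 1) - 1 = 1 / 2 * (1 / (k + 1)) := by field_simp; ring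
      push_cast
      linarith
    · have : log ((k + 1 : ℕ) : ℝ) ≤ log ((k + 1 : ℕ) + 1 / 2 : ℝ) :=
        Real.log_le_log (by positivity) (by linarith)
      linarith
  have hanti : Antitone (fun n : ℕ => (harmonic (n + 1) : ℝ) - log ((n + 1 : ℕ) : ℝ) +
      (log ((n + 1 : ℕ) : ℝ) - log ((n + 1 : ℕ) + 1 / 2 : ℝ))) := by
    refine antitone_nat_of_succ_le fun k => ?_
    rw [harmonic_succ (k + 1)]
    push_cast
    have h1 := two_mul_div_le_log (u := 1 / ((k : ℝ) + 1 + 1 / 2)) (by positivity)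
    have e1 : 1 + 1 / ((k : ℝ) + 1 + 1 / 2) = (k + 1 + 1 + 1 / 2) / (k + 1 + 1 / 2) := by
      field_simp; ring
    rw [e1, Real.log_div (by positivity) (by positivity)] at h1
    have e : 2 * (1 / ((k : ℝ) + 1 + 1 / 2)) / (2 + 1 / (k + 1 + 1 / 2)) = ((k : ℝ) + 1 + 1)⁻¹ := by
      field_simp; ring
    linarith
  have := hanti.le_of_tendsto hlim n
  linarith

theorem harmonic_64_bounds : (4743890 / 1000000 : ℝ) < (harmonic (63 + 1) : ℝ) ∧
    (harmonic (63 + 1) : ℝ) < 4743892 / 1000000 := by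
  have h : (4743890 / 1000000 : ℚ) < harmonic (63 + 1) ∧
      harmonic (63 + 1) < (4743892 / 1000000 : ℚ) := by
    rw [harmonic]
    norm_num [Finset.sum_range_succ]
  have h1 := (Rat.cast_lt (K := ℝ)).2 h.1
  have h2 := (Rat.cast_lt (K := ℝ)).2 h.2
  rw [Rat.cast_div, Rat.cast_ofNat, Rat.cast_ofNat] at h1 h2
  exact ⟨h1, h2⟩

theorem lt_eulerMascheroniConstant : 0.57719 < eulerMascheroniConstant := by
  have h := harmonic_sub_log_sub_le 63
  have e : log ((63 + 1 : ℕ) : ℝ) = 6 * log 2 := by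
    rw [show ((63 + 1 : ℕ) : ℝ) = 2 ^ 6 by norm_num, Real.log_pow]; norm_num
  rw [e] at h
  have h1 := harmonic_64_bounds.1
  have := Real.log_two_lt_d9
  norm_num at h h1 ⊢
  linarith

theorem eulerMascheroniConstant_lt : eulerMascheroniConstant < 0.57723 := by
  have h := le_harmonic_sub_log_sub 63
  have e : log ((63 + 1 : ℕ) + 1 / 2 : ℝ) = 6 * log 2 + log (1 + 1 / 128) := by
    rw [show ((63 + 1 : ℕ) + 1 / 2 : ℝ) = 2 ^ 6 * (1 + 1 / 128) by norm_num,
      Real.log_mul (by norm_num) (by norm_num), Real.log_pow]; norm_num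
  rw [e] at h
  have h1 := harmonic_64_bounds.2
  have h2 := two_mul_div_le_log (u := 1 / 128) (by norm_num)
  have := Real.log_two_gt_d9
  norm_num at h h1 h2 ⊢
  linarith

theorem log_pi_bounds : 1.1444 ≤ log π ∧ log π ≤ 1.145 := by
  have h1 : 3 * log π = 5 * log 2 + log (π ^ 3 / 32) := by
    rw [Real.log_div (by positivity) (by norm_num), Real.log_pow,
      show (32 : ℝ) = 2 ^ 5 by norm_num, Real.log_pow]
    push_cast; ring
  have h2 := Real.log_two_gt_d9
  have h3 := Real.log_two_lt_d9
  have h4 := Real.pi_gt_d4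
  have h5 := Real.pi_lt_d4
  have h6 : (31.0035 : ℝ) ≤ π ^ 3 :=
    le_trans (by norm_num) (pow_le_pow_left₀ (by norm_num) h4.le 3)
  have h7 : π ^ 3 ≤ (31.0067 : ℝ) :=
    (pow_le_pow_left₀ (by positivity) h5.le 3).trans (by norm_num)
  have h8 := Real.one_sub_inv_le_log_of_pos (x := π ^ 3 / 32) (by positivity)
  have h9 := Real.log_le_sub_one_of_pos (x := π ^ 3 / 32) (by positivity)
  have h10 : (π ^ 3 / 32)⁻¹ ≤ 1.03215 := by
    rw [inv_div, div_le_iff₀ (by positivity)]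
    linarith
  constructor <;> linarith

theorem zeroConst_le : zeroConst ≤ 0.0466 := by
  have h1 : log (4 * π) = 2 * log 2 + log π := by
    rw [Real.log_mul (by norm_num) (by positivity), show (4 : ℝ) = 2 ^ 2 by norm_num, Real.log_pow]
    norm_num
  have := log_pi_bounds.1
  have := Real.log_two_gt_d9
  have := eulerMascheroniConstant_lt
  rw [zeroConst, h1]
  norm_num at *
  linarith

theorem log_two_pi_le : log (2 * π) ≤ 1.839 := by
  rw [Real.log_mul (by norm_num) (by positivity)]
  have := log_pi_bounds.2
  have := Real.log_two_lt_d9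
  norm_num at *
  linarith

theorem lambdaSum_sub_ge {y t : ℝ} (hy : 0 < y) (ht : y ≤ t) :
    (Chebyshev.psi t - Chebyshev.psi y) / t ≤ lambdaSum t - lambdaSum y := by
  have ht0 : 0 < t := by linarith
  have hsub : Ioc 0 ⌊y⌋₊ ⊆ Ioc 0 ⌊t⌋₊ := Finset.Ioc_subset_Ioc_right (Nat.floor_mono ht)
  rw [lambdaSum, lambdaSum, Chebyshev.psi, Chebyshev.psi, ← Finset.sum_sdiff hsub,
    ← Finset.sum_sdiff hsub, add_sub_cancel_right, add_sub_cancel_right, Finset.sum_div]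
  refine Finset.sum_le_sum fun n hn => ?_
  rw [Finset.mem_sdiff, Finset.mem_Ioc] at hn
  have hn0 : (0 : ℝ) < n := by exact_mod_cast hn.1.1
  have hnt : (n : ℝ) ≤ t := (Nat.le_floor_iff ht0.le).1 hn.1.2
  have := ArithmeticFunction.vonMangoldt_nonneg (n := n)
  gcongr

theorem psiTail_le_num (h : ∀ s : ℂ, 1 / 2 < s.re → xi s ≠ 0)
    {t : ℝ} (ht : 1 < t) : psiTail t ≤ 0.0932 / √t := by
  refine (psiTail_le h ht).trans ?_
  have := zeroConst_le
  gcongr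
  norm_num at *
  linarith

theorem le_psiTail_num (h : ∀ s : ℂ, 1 / 2 < s.re → xi s ≠ 0)
    {t : ℝ} (ht : 1 < t) : -(0.0932 / √t + 1.839 / t) ≤ psiTail t := by
  refine le_trans ?_ (le_psiTail h ht)
  have h1 := zeroConst_le
  have h2 := log_two_pi_le
  have : 2 * zeroConst ≤ 0.0932 := by norm_num at *; linarith
  have : 0 < t := by linarith
  gcongr

theorem psi_le_of_xi (h : ∀ s : ℂ, 1 / 2 < s.re → xi s ≠ 0)
    {y : ℝ} (hy : 1 < y) : Chebyshev.psi y ≤ 1.3864 * y + 0.32 * √y + 1.839 := by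
  have h1 := lambdaSum_sub_ge (y := y) (t := 2 * y) (by linarith) (by linarith)
  rw [lambdaSum_eq, lambdaSum_eq, Real.log_mul (by norm_num) (by linarith)] at h1
  have h2 := psiTail_le_num h hy
  have h3 := le_psiTail_num h (by linarith : 1 < 2 * y)
  have hs : 0 < √y := Real.sqrt_pos.2 (by linarith)
  have hss : √y * √y = y := Real.mul_self_sqrt (by linarith)
  have h4 : 0.0932 / √(2 * y) ≤ 0.0667 / √y := by
    rw [Real.sqrt_mul (by norm_num), div_le_div_iff₀ (by positivity) hs]
    have : (1.4 : ℝ) ≤ √2 := Real.le_sqrt_of_sq_le (by norm_num)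
    nlinarith
  have hlog := Real.log_two_lt_d9
  have h5 : Chebyshev.psi y / (2 * y) ≤ log 2 + 0.1599 / √y + 1.839 / (2 * y) := by
    have e1 : (Chebyshev.psi (2 * y) - Chebyshev.psi y) / (2 * y) =
        Chebyshev.psi (2 * y) / (2 * y) - Chebyshev.psi y / (2 * y) := by ring
    have e2 : Chebyshev.psi y / y = 2 * (Chebyshev.psi y / (2 * y)) := by field_simp
    have e3 : (0.1599 : ℝ) / √y = 0.0932 / √y + 0.0667 / √y := by
      rw [← add_div]; norm_num
    linarith
  rw [div_le_iff₀ (by linarith)] at h5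
  have e : (log 2 + 0.1599 / √y + 1.839 / (2 * y)) * (2 * y) =
      2 * log 2 * y + 0.3198 * √y + 1.839 := by
    have : (0.1599 : ℝ) / √y * (2 * y) = 0.3198 * √y := by
      rw [div_mul_eq_mul_div, div_eq_iff hs.ne']
      linear_combination (-0.3198) * hss
    rw [add_mul, add_mul, this]
    field_simp
  rw [e] at h5
  norm_num at hlog h5 ⊢
  nlinarith

theorem le_eps {x : ℝ} (hx : 1 < x) : (1 / x - 1 / (2 * x ^ 2)) / log x ≤ eps x := by
  have hl := Real.log_pos hx
  have h := two_mul_div_le_log (u := 1 / x) (by positivity)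
  rw [eps]
  gcongr
  refine le_trans ?_ h
  have e : 2 * (1 / x) / (2 + 1 / x) = 2 / (2 * x + 1) := by
    field_simp
  have e2 : 1 / x - 1 / (2 * x ^ 2) = (2 * x - 1) / (2 * x ^ 2) := by
    field_simp
  rw [e, e2, div_le_div_iff₀ (by positivity) (by positivity)]
  nlinarith

theorem le_neg_log_one_sub {q : ℝ} (h1 : q < 1) : q ≤ -log (1 - q) := by
  have := Real.log_le_sub_one_of_pos (x := 1 - q) (by linarith)
  linarith

theorem inv_pow_lt_one {p : ℕ} (hp : p.Prime) (k : ℕ) : ((p : ℝ)⁻¹) ^ (k + 1) < 1 := by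
  obtain ⟨h0, h1⟩ := inv_prime_bounds hp
  exact pow_lt_one₀ h0.le (by linarith) (by omega)

theorem powTail_sub_saving_le_of_small {p : ℕ} {x : ℝ} (hx : 1 < x) (hp : p ∈ Nat.primesLE ⌊x⌋₊)
    (hpx : 100 * (p : ℝ) ≤ x) :
    powTail x p - saving x p ≤ 2.01 / (x * log x) * (log p / p) := by
  have hpp := Nat.prime_of_mem_primesLE hp
  have hl := Real.log_pos hx
  have hp2 : (2 : ℝ) ≤ p := by exact_mod_cast hpp.two_le
  have hlp : 0 < log p := Real.log_pos (by linarith)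
  rw [saving]
  rcases min_cases (eps x * log p) (-log (1 - ((p : ℝ)⁻¹) ^ (Nat.log p ⌊x⌋₊ + 1))) with h | h
  · rw [h.1]
    set k := Nat.log p ⌊x⌋₊ with hk
    have h1 := lt_pow_log_floor (p := p) (x := x) hpp.two_le
    rw [← hk] at h1
    have h2 : log x ≤ (k + 1) * log p := by
      have := Real.log_le_log (by linarith) h1.le
      rw [Real.log_pow] at this
      exact_mod_cast this
    have h3 : powTail x p ≤ log p / (x * log x) * (1 + 1 / (p - 1)) := by
      refine (powTail_le hpp x).trans ?_
      rw [← hk, inv_pow]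
      have e : 1 + 1 / ((p : ℝ) - 1) = 1 / (1 - (p : ℝ)⁻¹) := by
        have : (p : ℝ) - 1 ≠ 0 := by linarith
        field_simp; ring
      have h5 : 0 < 1 - (p : ℝ)⁻¹ := by linarith [(inv_prime_bounds hpp).2]
      rw [e, mul_one_div, ← div_div]
      refine div_le_div_of_nonneg_right ?_ h5.le
      have h6 : ((p : ℝ) ^ (k + 1))⁻¹ ≤ x⁻¹ := by gcongr
      have h7 : 1 / ((k : ℝ) + 1) ≤ log p / log x := by
        rw [div_le_div_iff₀ (by positivity) hl]
        linarith
      calc ((p : ℝ) ^ (k + 1))⁻¹ / (k + 1) = ((p : ℝ) ^ (k + 1))⁻¹ * (1 / ((k : ℝ) + 1)) := by ring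
        _ ≤ x⁻¹ * (log p / log x) := by gcongr
        _ = log p / (x * log x) := by field_simp
    have h4 := mul_le_mul_of_nonneg_right (le_eps hx) hlp.le
    have e4 : (1 / x - 1 / (2 * x ^ 2)) / log x * log p =
        log p / (x * log x) * (1 - 1 / (2 * x)) := by field_simp
    have h8 : 1 / ((p : ℝ) - 1) + 1 / (2 * x) ≤ 2.01 / p := by
      have h9 : 1 / ((p : ℝ) - 1) ≤ 2 / p := by
        rw [div_le_div_iff₀ (by linarith) (by linarith)]; linarith
      have h10 : 1 / (2 * x) ≤ 0.01 / p := by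
        rw [div_le_div_iff₀ (by linarith) (by linarith)]; linarith
      have : (2.01 : ℝ) / p = 2 / p + 0.01 / p := by rw [← add_div]; norm_num
      linarith
    calc powTail x p - eps x * log p
        ≤ log p / (x * log x) * (1 + 1 / (p - 1)) - log p / (x * log x) * (1 - 1 / (2 * x)) := by
          linarith
      _ = log p / (x * log x) * (1 / (p - 1) + 1 / (2 * x)) := by ring
      _ ≤ log p / (x * log x) * (2.01 / p) := by gcongr
      _ = _ := by ring
  · rw [h.1]
    have h1 := powTail_le_pow hp
    have h2 := le_neg_log_one_sub (inv_pow_lt_one hpp (Nat.log p ⌊x⌋₊))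
    have h3 : 0 ≤ 2.01 / (x * log x) * (log p / p) := by positivity
    linarith

theorem log_floor_eq_one {p : ℕ} {x : ℝ} (hp : p ∈ Nat.primesLE ⌊x⌋₊) (hx : 0 ≤ x)
    (hpx : x < (p : ℝ) ^ 2) : Nat.log p ⌊x⌋₊ = 1 := by
  have hpp := Nat.prime_of_mem_primesLE hp
  have h1 := one_le_log_of_mem_primesLE hp
  have h2 := pow_log_floor_le ((Nat.le_floor_iff hx).1 (Nat.le_of_mem_primesLE hp)) hpp.two_le
  have h3 : p ^ Nat.log p ⌊x⌋₊ < p ^ 2 := by exact_mod_cast h2.trans_lt hpx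
  have := (Nat.pow_lt_pow_iff_right hpp.one_lt).1 h3
  omega

theorem powTail_le_of_large {p : ℕ} {x : ℝ} (hp : p ∈ Nat.primesLE ⌊x⌋₊) (hx : 0 ≤ x)
    (hpx : x < (p : ℝ) ^ 2) : powTail x p ≤ 1 / (2 * p * (p - 1)) := by
  have hpp := Nat.prime_of_mem_primesLE hp
  have hp2 : (2 : ℝ) ≤ p := by exact_mod_cast hpp.two_le
  refine (powTail_le hpp x).trans (le_of_eq ?_)
  rw [log_floor_eq_one hp hx hpx, inv_pow]
  have : (p : ℝ) - 1 ≠ 0 := by linarith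
  have : (1 : ℝ) - (p : ℝ)⁻¹ ≠ 0 := by linarith [(inv_prime_bounds hpp).2]
  field_simp
  push_cast
  ring

theorem le_saving_of_large {p : ℕ} {x : ℝ} (hp : p ∈ Nat.primesLE ⌊x⌋₊) (hx : 1 < x)
    (hpx : x < (p : ℝ) ^ 2) : min (1 / (2 * x) - 1 / (4 * x ^ 2)) (1 / (p : ℝ) ^ 2) ≤ saving x p := by
  have hpp := Nat.prime_of_mem_primesLE hp
  have hp2 : (2 : ℝ) ≤ p := by exact_mod_cast hpp.two_le
  have hl := Real.log_pos hx
  have hlp : log x ≤ 2 * log p := by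
    have := Real.log_le_log (by linarith) hpx.le
    rw [Real.log_pow] at this
    exact_mod_cast this
  rw [saving]
  refine min_le_min ?_ ?_
  · have h4 := mul_le_mul_of_nonneg_right (le_eps hx) (by linarith : 0 ≤ log p)
    refine le_trans ?_ h4
    rw [div_mul_eq_mul_div, le_div_iff₀ hl]
    have : 0 ≤ 1 / (2 * x) - 1 / (4 * x ^ 2) := by
      rw [sub_nonneg, div_le_div_iff₀ (by positivity) (by positivity)]
      nlinarith
    have e : 1 / x - 1 / (2 * x ^ 2) = 2 * (1 / (2 * x) - 1 / (4 * x ^ 2)) := by field_simp; ring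
    rw [e]
    nlinarith
  · have := le_neg_log_one_sub (inv_pow_lt_one hpp (Nat.log p ⌊x⌋₊))
    refine le_trans (le_of_eq ?_) this
    rw [log_floor_eq_one hp (by linarith) hpx, inv_pow, one_div]

theorem powTail_sub_saving_nonpos {p : ℕ} {x : ℝ} (hp : p ∈ Nat.primesLE ⌊x⌋₊) (hx : 100 < x)
    (hpx : 8 * x < (p : ℝ) ^ 2) : powTail x p - saving x p ≤ 0 := by
  have h1 := powTail_le_of_large hp (by linarith) (by linarith)
  have h2 := le_saving_of_large hp (by linarith) (by linarith)
  have h3 := powTail_le_pow hp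
  rw [log_floor_eq_one hp (by linarith) (by linarith), inv_pow] at h3
  have hp2 : (2 : ℝ) ≤ p := by exact_mod_cast (Nat.prime_of_mem_primesLE hp).two_le
  rcases min_le_iff.1 h2 with h | h
  · have h4 : 1 / (2 * (p : ℝ) * (p - 1)) ≤ 1 / (4 * x) := by
      apply one_div_le_one_div_of_le (by linarith)
      nlinarith
    have h5 : 1 / (4 * x ^ 2) ≤ 1 / (4 * x) := by
      apply one_div_le_one_div_of_le (by linarith)
      nlinarith
    have h6 : 1 / (2 * x) = 1 / (4 * x) + 1 / (4 * x) := by field_simp; ring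
    linarith
  · rw [one_div] at h
    norm_num at h3
    linarith

/-- A piecewise minorant of the saving from the primes just above the square root. -/
def hat (r t : ℝ) : ℝ := min ((1 + 1 / √2) / 2 * (1 - r / t)) (1 / √2 * (r / t) - 1 / 4)

theorem inv_sqrt_two_sq : (1 / √2) ^ 2 = (1 / 2 : ℝ) := by
  rw [div_pow, Real.sq_sqrt (by norm_num), one_pow]

theorem inv_sqrt_two_bounds : 0.7071 < 1 / √2 ∧ 1 / √2 < (0.7072 : ℝ) := by
  have h := inv_sqrt_two_sq
  have h0 : 0 < 1 / √2 := by positivity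
  constructor <;> nlinarith

theorem hat_eq_left {r t : ℝ} (ht : 0 < t) (h : t ≤ √2 * r) :
    hat r t = (1 + 1 / √2) / 2 * (1 - r / t) := by
  have h2 := inv_sqrt_two_sq
  have h3 := inv_sqrt_two_bounds
  refine min_eq_left ?_
  have h4 : 1 / √2 ≤ r / t := by
    rw [div_le_div_iff₀ (by positivity) ht]; linarith
  nlinarith

theorem hat_eq_right {r t : ℝ} (ht : 0 < t) (h : √2 * r ≤ t) :
    hat r t = 1 / √2 * (r / t) - 1 / 4 := by
  have h2 := inv_sqrt_two_sq
  have h3 := inv_sqrt_two_bounds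
  refine min_eq_right ?_
  have h4 : r / t ≤ 1 / √2 := by
    rw [div_le_div_iff₀ ht (by positivity)]; linarith
  nlinarith

theorem hat_nonneg {r t : ℝ} (hr : 0 < r) (h1 : r ≤ t) (h2 : t ≤ 2 * √2 * r) : 0 ≤ hat r t := by
  have ht : 0 < t := by linarith
  have h3 := inv_sqrt_two_bounds
  refine le_min (mul_nonneg (by positivity) ?_) ?_
  · rw [sub_nonneg, div_le_one ht]; exact h1
  · rw [sub_nonneg, div_mul_div_comm, div_le_div_iff₀ (by norm_num) (by positivity)]
    have : √2 * √2 = 2 := Real.mul_self_sqrt (by norm_num)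
    have : √2 * t ≤ √2 * (2 * √2 * r) := by gcongr
    nlinarith

theorem hat_le_quarter {r t : ℝ} : hat r t ≤ 1 / 4 := by
  have h2 := inv_sqrt_two_sq
  have h3 := inv_sqrt_two_bounds
  rcases le_total (r / t) (1 / √2) with h | h
  · refine (min_le_right _ _).trans ?_
    nlinarith
  · refine (min_le_left _ _).trans ?_
    nlinarith

theorem hat_le_left {r t : ℝ} (h0 : 0 ≤ r / t) (h1 : r / t ≤ 1) : hat r t ≤ (1 - (r / t) ^ 2) / 2 := by
  have h2 := inv_sqrt_two_sq
  have h3 := inv_sqrt_two_bounds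
  rcases le_total (r / t) (1 / √2) with h | h
  · refine (min_le_right _ _).trans ?_
    nlinarith
  · refine (min_le_left _ _).trans ?_
    nlinarith

theorem hat_le_right {r t : ℝ} : hat r t ≤ (r / t) ^ 2 / 2 := by
  have h2 := inv_sqrt_two_sq
  refine (min_le_right _ _).trans ?_
  nlinarith [sq_nonneg (r / t - 1 / √2)]

theorem powTail_sub_saving_le_hat {p : ℕ} {x : ℝ} (hp : p ∈ Nat.primesLE ⌊x⌋₊) (hx : 1 < x)
    (hpx : √x < p) : powTail x p - saving x p ≤
      -(hat (√x) p / x) + (1 / (2 * x * (√x - 1)) + 1 / (4 * x ^ 2)) := by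
  have hr : 1 < √x := by rw [Real.lt_sqrt] <;> linarith
  have hrr : √x * √x = x := Real.mul_self_sqrt (by linarith)
  have hpx2 : x < (p : ℝ) ^ 2 := by nlinarith
  have h1 := powTail_le_of_large hp (by linarith) hpx2
  have h2 := le_saving_of_large hp hx hpx2
  have hp0 : 0 < (p : ℝ) := by linarith
  have hp1 : 0 < (p : ℝ) - 1 := by linarith
  have e1 : 1 / (2 * (p : ℝ) * (p - 1)) = 1 / (2 * p ^ 2) + 1 / (2 * p ^ 2 * (p - 1)) := by
    field_simp; ring
  have h3 : 1 / (2 * (p : ℝ) ^ 2 * (p - 1)) ≤ 1 / (2 * x * (√x - 1)) := by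
    have : 0 < √x - 1 := by linarith
    gcongr
  have e2 : (√x / p) ^ 2 / x = 1 / p ^ 2 := by
    rw [div_pow, Real.sq_sqrt (by linarith)]; field_simp
  have e3 : 1 / (2 * (p : ℝ) ^ 2) = 1 / p ^ 2 / 2 := by field_simp
  rcases min_le_iff.1 h2 with h | h
  · have h4 : hat (√x) p / x ≤ (1 - (√x / p) ^ 2) / 2 / x := by
      have := hat_le_left (r := √x) (t := p) (by positivity) ((div_le_one hp0).2 hpx.le)
      gcongr
    have e4 : (1 - (√x / p) ^ 2) / 2 / x = 1 / (2 * x) - (√x / p) ^ 2 / x / 2 := by field_simp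
    rw [e4, e2] at h4
    linarith
  · have h4 : hat (√x) p / x ≤ (√x / p) ^ 2 / 2 / x := by
      have := hat_le_right (r := √x) (t := p)
      gcongr
    have e4 : (√x / p) ^ 2 / 2 / x = (√x / p) ^ 2 / x / 2 := by field_simp
    rw [e4, e2] at h4
    have : 0 ≤ 1 / (4 * x ^ 2) := by positivity
    linarith

theorem sum_Ioc_floor_sub (f : ℕ → ℝ) {s t : ℝ} (hst : s ≤ t) :
    ∑ n ∈ Ioc ⌊s⌋₊ ⌊t⌋₊, f n = ∑ n ∈ Ioc 0 ⌊t⌋₊, f n - ∑ n ∈ Ioc 0 ⌊s⌋₊, f n := by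
  rw [eq_sub_iff_add_eq', Finset.sum_Ioc_consecutive _ (Nat.zero_le _) (Nat.floor_mono hst)]

theorem sum_vonMangoldt_mul_affine (u v : ℝ) {s t : ℝ} (hst : s ≤ t) :
    ∑ n ∈ Ioc ⌊s⌋₊ ⌊t⌋₊, vonMangoldt n * (u + v / n) =
      u * (Chebyshev.psi t - Chebyshev.psi s) + v * (lambdaSum t - lambdaSum s) := by
  have e : ∀ n ∈ Ioc ⌊s⌋₊ ⌊t⌋₊, vonMangoldt n * (u + v / n) =
      u * vonMangoldt n + v * (vonMangoldt n / n) := fun n _ => by ring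
  rw [Finset.sum_congr rfl e, Finset.sum_add_distrib, ← Finset.mul_sum, ← Finset.mul_sum,
    sum_Ioc_floor_sub (fun n => vonMangoldt n) hst, sum_Ioc_floor_sub (fun n => vonMangoldt n / n) hst,
    Chebyshev.psi, Chebyshev.psi, lambdaSum, lambdaSum]

theorem sum_vonMangoldt_mul_hat {r : ℝ} (hr : 0 < r) :
    ∑ n ∈ Ioc ⌊r⌋₊ ⌊2 * √2 * r⌋₊, vonMangoldt n * hat r n =
      r * ((1 / √2 - (1 + 1 / √2) / 4) * log 2 +
        (1 + 1 / √2) / 2 * (psiTail (√2 * r) - psiTail r) -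
        1 / √2 * (psiTail (2 * √2 * r) - psiTail (√2 * r))) := by
  have h1 : (1 : ℝ) ≤ √2 := Real.one_le_sqrt.2 (by norm_num)
  have hs : √2 * √2 = 2 := Real.mul_self_sqrt (by norm_num)
  have hac : r ≤ √2 * r := by nlinarith
  have hcb : √2 * r ≤ 2 * √2 * r := by nlinarith
  have hc : 0 < √2 * r := by positivity
  rw [← Finset.sum_Ioc_consecutive _ (Nat.floor_mono hac) (Nat.floor_mono hcb)]
  have e1 : ∑ n ∈ Ioc ⌊r⌋₊ ⌊√2 * r⌋₊, vonMangoldt n * hat r n =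
      ∑ n ∈ Ioc ⌊r⌋₊ ⌊√2 * r⌋₊, vonMangoldt n *
        ((1 + 1 / √2) / 2 + (-((1 + 1 / √2) / 2 * r)) / n) := by
    refine Finset.sum_congr rfl fun n hn => ?_
    rw [Finset.mem_Ioc] at hn
    have hn0 : (0 : ℝ) < n := by exact_mod_cast (Nat.zero_le _).trans_lt hn.1
    rw [hat_eq_left hn0 ((Nat.le_floor_iff hc.le).1 hn.2)]
    ring
  have e2 : ∑ n ∈ Ioc ⌊√2 * r⌋₊ ⌊2 * √2 * r⌋₊, vonMangoldt n * hat r n =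
      ∑ n ∈ Ioc ⌊√2 * r⌋₊ ⌊2 * √2 * r⌋₊, vonMangoldt n * (-(1 / 4) + (1 / √2 * r) / n) := by
    refine Finset.sum_congr rfl fun n hn => ?_
    rw [Finset.mem_Ioc] at hn
    have hn0 : (0 : ℝ) < n := by exact_mod_cast (Nat.zero_le _).trans_lt hn.1
    rw [hat_eq_right hn0 (Nat.lt_of_floor_lt hn.1).le]
    ring
  rw [e1, e2, sum_vonMangoldt_mul_affine _ _ hac, sum_vonMangoldt_mul_affine _ _ hcb,
    lambdaSum_eq (2 * √2 * r), lambdaSum_eq (√2 * r), lambdaSum_eq r,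
    Real.log_mul (by positivity) hr.ne', Real.log_mul (by positivity) hr.ne',
    Real.log_mul (by norm_num) (by positivity), Real.log_sqrt (by norm_num)]
  have hi : (√2)⁻¹ = √2 / 2 := by
    rw [inv_eq_iff_eq_inv, inv_div, eq_div_iff (by positivity), hs]
  have hr' := hr.ne'
  have hd : ∀ y : ℝ, y / (√2 * r) = √2 / 2 * y / r := fun y => by
    rw [← div_div, div_eq_mul_inv y, hi]; ring
  have hd2 : ∀ y : ℝ, y / (2 * √2 * r) = √2 / 4 * y / r := fun y => by
    rw [mul_assoc, ← div_div, hd]; ring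
  rw [hd, hd2, one_div, hi]
  have hs2 : √2 ^ 2 = 2 := Real.sq_sqrt (by norm_num)
  field_simp
  ring_nf
  rw [hs2]
  ring

theorem psi_sub_theta_nonneg_of_sum {s : Finset ℕ} {y : ℝ} (hs : s ⊆ Ioc 0 ⌊y⌋₊) :
    ∑ n ∈ s with ¬ n.Prime, vonMangoldt n ≤ Chebyshev.psi y - Chebyshev.theta y := by
  rw [Chebyshev.psi_sub_theta_eq_sum_not_prime]
  exact Finset.sum_le_sum_of_subset_of_nonneg (Finset.filter_subset_filter _ hs)
    fun _ _ _ => ArithmeticFunction.vonMangoldt_nonneg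

theorem le_log_mul_sum_hat {r : ℝ} (hr : 1 ≤ r) :
    ∑ n ∈ Ioc ⌊r⌋₊ ⌊2 * √2 * r⌋₊, vonMangoldt n * hat r n -
      (Chebyshev.psi (2 * √2 * r) - Chebyshev.theta (2 * √2 * r)) / 4 ≤
      log (2 * √2 * r) * ∑ p ∈ Ioc ⌊r⌋₊ ⌊2 * √2 * r⌋₊ with p.Prime, hat r p := by
  have h1 := psi_sub_theta_nonneg_of_sum (s := Ioc ⌊r⌋₊ ⌊2 * √2 * r⌋₊) (y := 2 * √2 * r)
    (Finset.Ioc_subset_Ioc_left (Nat.zero_le _))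
  rw [← Finset.sum_filter_add_sum_filter_not (Ioc ⌊r⌋₊ ⌊2 * √2 * r⌋₊) Nat.Prime]
  have h2 : ∑ n ∈ Ioc ⌊r⌋₊ ⌊2 * √2 * r⌋₊ with ¬ n.Prime, vonMangoldt n * hat r n ≤
      (∑ n ∈ Ioc ⌊r⌋₊ ⌊2 * √2 * r⌋₊ with ¬ n.Prime, vonMangoldt n) / 4 := by
    rw [Finset.sum_div]
    refine Finset.sum_le_sum fun n _ => ?_
    have := hat_le_quarter (r := r) (t := n)
    have := ArithmeticFunction.vonMangoldt_nonneg (n := n)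
    nlinarith
  have h3 : ∑ n ∈ Ioc ⌊r⌋₊ ⌊2 * √2 * r⌋₊ with n.Prime, vonMangoldt n * hat r n ≤
      log (2 * √2 * r) * ∑ p ∈ Ioc ⌊r⌋₊ ⌊2 * √2 * r⌋₊ with p.Prime, hat r p := by
    rw [Finset.mul_sum]
    refine Finset.sum_le_sum fun n hn => ?_
    rw [Finset.mem_filter, Finset.mem_Ioc] at hn
    have hn0 : (0 : ℝ) < n := by exact_mod_cast hn.2.pos
    have hnb : (n : ℝ) ≤ 2 * √2 * r := (Nat.le_floor_iff (by positivity)).1 hn.1.2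
    have := hat_nonneg (by linarith) (Nat.lt_of_floor_lt hn.1.1).le hnb
    rw [ArithmeticFunction.vonMangoldt_apply_prime hn.2]
    have := Real.log_le_log hn0 hnb
    gcongr
  linarith

theorem psi_le_linear_of_xi (h : ∀ s : ℂ, 1 / 2 < s.re → xi s ≠ 0)
    {y A : ℝ} (hA : 0 < A) (hy : 1 < y) :
    Chebyshev.psi y ≤ 1.3864 * y + 0.16 * (y / A + A) + 1.839 := by
  refine (psi_le_of_xi h hy).trans ?_
  have h1 : 2 * √y ≤ y / A + A := by
    have e : y / A + A - 2 * √y = (√y - A) ^ 2 / A := by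
      have : √y ^ 2 = y := Real.sq_sqrt (by linarith)
      rw [sub_sq, this]; field_simp; ring
    have : 0 ≤ (√y - A) ^ 2 / A := by positivity
    linarith
  linarith

theorem psi_sub_theta_le_of_xi (h : ∀ s : ℂ, 1 / 2 < s.re → xi s ≠ 0) {b : ℝ} (hb : 1100 ≤ b) :
    Chebyshev.psi b - Chebyshev.theta b ≤ 2.27 * √b := by
  have hb0 : 0 < b := by linarith
  refine (Chebyshev.psi_sub_theta_le_psi_add_psi_add_psi b).trans ?_
  have e2 : b ^ (2⁻¹ : ℝ) = √b := by rw [Real.sqrt_eq_rpow, one_div]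
  have hw : 33.16 ≤ √b := Real.le_sqrt_of_sq_le (by norm_num; linarith)
  have e3 : b ^ (3⁻¹ : ℝ) * 3.2 ≤ √b := by
    have h6 : (3.2 : ℝ) ≤ b ^ (6⁻¹ : ℝ) := by
      rw [Real.le_rpow_inv_iff_of_pos (by norm_num) hb0.le (by norm_num)]
      norm_num; linarith
    rw [← e2, show (2⁻¹ : ℝ) = 3⁻¹ + 6⁻¹ by norm_num, Real.rpow_add hb0]
    gcongr
  have e5 : b ^ (5⁻¹ : ℝ) * 8 ≤ √b := by
    have h6 : (8 : ℝ) ≤ b ^ (3 / 10 : ℝ) := by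
      have : (8 : ℝ) = 1024 ^ (3 / 10 : ℝ) := by
        rw [show (1024 : ℝ) = 2 ^ (10 : ℝ) by norm_num, ← Real.rpow_mul (by norm_num)]
        norm_num
      rw [this]
      exact Real.rpow_le_rpow (by norm_num) (by linarith) (by norm_num)
    rw [← e2, show (2⁻¹ : ℝ) = 5⁻¹ + 3 / 10 by norm_num, Real.rpow_add hb0]
    gcongr
  have g2 : 1 < √b := by linarith
  have g3 : 1 < b ^ (3⁻¹ : ℝ) := Real.one_lt_rpow (by linarith) (by norm_num)
  have g5 : 1 < b ^ (5⁻¹ : ℝ) := Real.one_lt_rpow (by linarith) (by norm_num)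
  have k2 := psi_le_linear_of_xi h (A := 5.8) (by norm_num) g2
  have k3 := psi_le_linear_of_xi h (A := 3.2) (by norm_num) g3
  have k5 := psi_le_linear_of_xi h (A := 2) (by norm_num) g5
  rw [e2]
  generalize b ^ (3⁻¹ : ℝ) = u at *
  generalize b ^ (5⁻¹ : ℝ) = v at *
  generalize √b = w at *
  norm_num at hw e3 e5 k2 k3 k5 ⊢
  linarith

theorem sqrt_bounds_of_log {x : ℝ} (hx0 : 0 < x) (hx : 12 ≤ log x) :
    403 ≤ √x ∧ 403 * log x ≤ 12 * √x := by
  have h1 : √x = exp 6 * exp (log x / 2 - 6) := by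
    rw [← Real.exp_add, add_sub_cancel, ← Real.log_sqrt hx0.le, Real.exp_log (Real.sqrt_pos.2 hx0)]
  have h2 : (403 : ℝ) ≤ exp 6 := by
    have h3 : exp (6 : ℝ) = exp 1 ^ 6 := by rw [← Real.exp_nat_mul]; norm_num
    rw [h3]
    refine le_trans ?_ (pow_le_pow_left₀ (by norm_num) Real.exp_one_gt_d9.le 6)
    norm_num
  have h4 := Real.add_one_le_exp (log x / 2 - 6)
  have h5 : 403 * (log x / 2 - 6 + 1) ≤ √x := by
    rw [h1]
    have : 0 ≤ log x / 2 - 6 + 1 := by linarith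
    gcongr
  constructor <;> linarith

theorem sum_log_div_le_lambdaSum {r : ℝ} (s : Finset ℕ) (hs : ∀ p ∈ s, p.Prime) :
    ∑ p ∈ s with p ≤ ⌊r⌋₊, log p / p ≤ lambdaSum r := by
  rw [lambdaSum]
  have e : ∑ p ∈ s with p ≤ ⌊r⌋₊, log p / p = ∑ p ∈ s with p ≤ ⌊r⌋₊, vonMangoldt p / p := by
    refine Finset.sum_congr rfl fun p hp => ?_
    rw [ArithmeticFunction.vonMangoldt_apply_prime (hs p (Finset.mem_filter.1 hp).1)]
  rw [e]
  refine Finset.sum_le_sum_of_subset_of_nonneg ?_ fun n _ _ =>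
    div_nonneg ArithmeticFunction.vonMangoldt_nonneg (Nat.cast_nonneg n)
  intro p hp
  rw [Finset.mem_filter] at hp
  exact Finset.mem_Ioc.2 ⟨(hs p hp.1).pos, hp.2⟩

theorem sum_powTail_sub_saving_le {x : ℝ} (hx : 403 ≤ √x) :
    ∑ p ∈ Nat.primesLE ⌊x⌋₊, (powTail x p - saving x p) ≤
      2.01 / (x * log x) * lambdaSum (√x) -
        (∑ p ∈ Ioc ⌊√x⌋₊ ⌊2 * √2 * √x⌋₊ with p.Prime, hat (√x) p) / x + 0.92 / x := by
  set r := √x with hr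
  have hx0 : 0 < x := Real.sqrt_pos.1 (by linarith)
  have hrr : r * r = x := Real.mul_self_sqrt hx0.le
  have hx1 : 403 * r ≤ x := by nlinarith
  have hs1 : (1 : ℝ) ≤ √2 := Real.one_le_sqrt.2 (by norm_num)
  have hs2 : √2 ≤ 1.4143 := by rw [Real.sqrt_le_left (by norm_num)]; norm_num
  have hss : √2 * √2 = 2 := Real.mul_self_sqrt (by norm_num)
  have hb0 : 0 ≤ 2 * √2 * r := by positivity
  have hbx : 2 * √2 * r ≤ x := by nlinarith
  set E : ℝ := 1 / (2 * x * (r - 1)) + 1 / (4 * x ^ 2) with hE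
  have hE0 : 0 ≤ E := by
    have : 0 < r - 1 := by linarith
    positivity
  have hpt : ∀ p ∈ Nat.primesLE ⌊x⌋₊, powTail x p - saving x p ≤
      (if p ≤ ⌊r⌋₊ then 2.01 / (x * log x) * (log p / p) else 0) +
        (if p ∈ Ioc ⌊r⌋₊ ⌊2 * √2 * r⌋₊ then -(hat r p / x) + E else 0) := by
    intro p hp
    by_cases h1 : p ≤ ⌊r⌋₊
    · rw [if_pos h1, if_neg (by rw [Finset.mem_Ioc]; omega), add_zero]
      have : (p : ℝ) ≤ r := (Nat.le_floor_iff (by linarith)).1 h1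
      exact powTail_sub_saving_le_of_small (by linarith) hp (by linarith)
    · rw [if_neg h1, zero_add]
      push Not at h1
      have hrp : r < p := Nat.lt_of_floor_lt h1
      by_cases h2 : p ≤ ⌊2 * √2 * r⌋₊
      · rw [if_pos (Finset.mem_Ioc.2 ⟨h1, h2⟩)]
        exact powTail_sub_saving_le_hat hp (by linarith) hrp
      · rw [if_neg (by rw [Finset.mem_Ioc]; omega)]
        push Not at h2
        have hbp : 2 * √2 * r < p := Nat.lt_of_floor_lt h2
        refine powTail_sub_saving_nonpos hp (by linarith) ?_
        have : (2 * √2 * r) ^ 2 < (p : ℝ) ^ 2 := by gcongr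
        nlinarith
  refine (Finset.sum_le_sum hpt).trans ?_
  rw [Finset.sum_add_distrib, ← Finset.sum_filter, ← Finset.sum_filter, ← Finset.mul_sum]
  have hset : (Nat.primesLE ⌊x⌋₊).filter (fun p => p ∈ Ioc ⌊r⌋₊ ⌊2 * √2 * r⌋₊) =
      (Ioc ⌊r⌋₊ ⌊2 * √2 * r⌋₊).filter Nat.Prime := by
    ext p
    rw [Finset.mem_filter, Finset.mem_filter, Nat.mem_primesLE, Finset.mem_Ioc]
    have := Nat.floor_mono hbx
    constructor
    · rintro ⟨⟨_, h1⟩, h2⟩; exact ⟨h2, h1⟩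
    · rintro ⟨h2, h1⟩; exact ⟨⟨by omega, h1⟩, h2⟩
  rw [hset, Finset.sum_add_distrib, Finset.sum_neg_distrib, ← Finset.sum_div, Finset.sum_const,
    nsmul_eq_mul]
  have hlam := sum_log_div_le_lambdaSum (r := r) (Nat.primesLE ⌊x⌋₊)
    fun p hp => Nat.prime_of_mem_primesLE hp
  have hl : 0 < log x := Real.log_pos (by linarith)
  have hcard : ((Finset.card ((Ioc ⌊r⌋₊ ⌊2 * √2 * r⌋₊).filter Nat.Prime) : ℕ) : ℝ) ≤ 1.831 * r := by
    have h1 := Finset.card_filter_le (Ioc ⌊r⌋₊ ⌊2 * √2 * r⌋₊) Nat.Prime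
    rw [Nat.card_Ioc] at h1
    have h2 : ⌊r⌋₊ ≤ ⌊2 * √2 * r⌋₊ := Nat.floor_mono (by nlinarith)
    have h3 : ((Finset.card ((Ioc ⌊r⌋₊ ⌊2 * √2 * r⌋₊).filter Nat.Prime) : ℕ) : ℝ) ≤
        (⌊2 * √2 * r⌋₊ : ℝ) - ⌊r⌋₊ := by
      rw [← Nat.cast_sub h2]; exact_mod_cast h1
    have h4 := Nat.floor_le hb0
    have h5 := Nat.lt_floor_add_one r
    norm_num at hs2 ⊢
    nlinarith
  have hE1 : 1.831 * r * E ≤ 0.92 / x := by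
    have h1 : 1 / (2 * x * (r - 1)) ≤ 0.50125 / (x * r) := by
      rw [div_le_div_iff₀ (by nlinarith) (by positivity)]
      norm_num
      nlinarith
    have h2 : 1 / (4 * x ^ 2) ≤ 0.00063 / (x * r) := by
      rw [div_le_div_iff₀ (by positivity) (by positivity)]
      norm_num
      nlinarith
    have h3 : E ≤ 0.50188 / (x * r) := by
      have : (0.50188 : ℝ) / (x * r) = 0.50125 / (x * r) + 0.00063 / (x * r) := by
        rw [← add_div]; norm_num
      linarith
    calc 1.831 * r * E ≤ 1.831 * r * (0.50188 / (x * r)) := by gcongr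
      _ = 0.91894228 / x := by field_simp; norm_num
      _ ≤ 0.92 / x := by gcongr; norm_num
  have h5 := mul_le_mul_of_nonneg_right hcard hE0
  have h6 := mul_le_mul_of_nonneg_left hlam (by positivity : 0 ≤ 2.01 / (x * log x))
  linarith

theorem lambdaSum_le_log_of_xi (h : ∀ s : ℂ, 1 / 2 < s.re → xi s ≠ 0)
    {r : ℝ} (hr : 403 ≤ r) : lambdaSum r ≤ log r := by
  have h1 := psi_le_of_xi h (y := r) (by linarith)
  have h2 := le_psiTail_num h (t := r) (by linarith)
  have h3 := lt_eulerMascheroniConstant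
  have hw : 20 ≤ √r := Real.le_sqrt_of_sq_le (by norm_num; linarith)
  have hww : √r * √r = r := Real.mul_self_sqrt (by linarith)
  have h4 : Chebyshev.psi r / r ≤ 1.42 := by
    rw [div_le_iff₀ (by linarith)]
    norm_num at h1 ⊢
    nlinarith
  have h5 : 0.0932 / √r ≤ 0.005 := by
    rw [div_le_iff₀ (by linarith)]; linarith
  have h6 : 1.839 / r ≤ 0.005 := by
    rw [div_le_iff₀ (by linarith)]; linarith
  rw [lambdaSum_eq]
  norm_num at *
  linarith

theorem le_sum_vonMangoldt_mul_hat_of_xi (h : ∀ s : ℂ, 1 / 2 < s.re → xi s ≠ 0)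
    {r : ℝ} (hr : 403 ≤ r) :
    0.177 * r ≤ ∑ n ∈ Ioc ⌊r⌋₊ ⌊2 * √2 * r⌋₊, vonMangoldt n * hat r n := by
  have hs1 : 1.4142 ≤ √2 := Real.le_sqrt_of_sq_le (by norm_num)
  have hr0 : 0 < r := by linarith
  have hw : 20.07 ≤ √r := Real.le_sqrt_of_sq_le (by norm_num; linarith)
  have j1 := le_psiTail_num h (t := √2 * r) (by nlinarith)
  have j2 := psiTail_le_num h (t := r) (by linarith)
  have j3 := psiTail_le_num h (t := 2 * √2 * r) (by nlinarith)
  have i0 : 0.0932 / √r ≤ 0.00465 := by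
    rw [div_le_iff₀ (by linarith)]; norm_num at hw ⊢; linarith
  have i1 : 0.0932 / √(√2 * r) ≤ 0.00392 := by
    have : 1.1891 * √r ≤ √(√2 * r) := by
      apply Real.le_sqrt_of_sq_le
      rw [mul_pow, Real.sq_sqrt hr0.le]
      norm_num at hs1 ⊢
      nlinarith
    rw [div_le_iff₀ (by linarith)]
    norm_num at hw this ⊢
    linarith
  have i2 : 1.839 / (√2 * r) ≤ 0.00323 := by
    rw [div_le_iff₀ (by positivity)]
    norm_num at hs1 ⊢
    nlinarith
  have i3 : 0.0932 / √(2 * √2 * r) ≤ 0.00278 := by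
    have : 1.6816 * √r ≤ √(2 * √2 * r) := by
      apply Real.le_sqrt_of_sq_le
      rw [mul_pow, Real.sq_sqrt hr0.le]
      norm_num at hs1 ⊢
      nlinarith
    rw [div_le_iff₀ (by linarith)]
    norm_num at hw this ⊢
    linarith
  have hA : -0.00715 ≤ psiTail (√2 * r) := by norm_num at j1 i1 i2 ⊢; linarith
  have hB : psiTail r ≤ 0.00465 := j2.trans i0
  have hC : psiTail (2 * √2 * r) ≤ 0.00278 := j3.trans i3
  have hb1 := inv_sqrt_two_bounds
  have hlog2 := Real.log_two_gt_d9
  rw [sum_vonMangoldt_mul_hat hr0]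
  clear j1 j2 j3 i0 i1 i2 i3 hs1 hw
  generalize 1 / √2 = κ at *
  generalize psiTail (√2 * r) = A at *
  generalize psiTail r = B at *
  generalize psiTail (2 * √2 * r) = C at *
  rw [mul_comm]
  refine mul_le_mul_of_nonneg_left ?_ hr0.le
  have k1 : 0.2803 * 0.6931 ≤ (κ - (1 + κ) / 4) * log 2 := by
    have h1 : 0.2803 ≤ κ - (1 + κ) / 4 := by norm_num at hb1 ⊢; linarith
    have h2 : 0.6931 ≤ log 2 := by norm_num at hlog2 ⊢; linarith
    exact mul_le_mul h1 h2 (by norm_num) (le_trans (by norm_num) h1)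
  have k2 : (1 + κ) / 2 * -0.0118 ≤ (1 + κ) / 2 * (A - B) := by
    refine mul_le_mul_of_nonneg_left ?_ ?_
    · norm_num at hA hB ⊢; linarith
    · norm_num at hb1 ⊢; linarith
  have k3 : κ * (C - A) ≤ κ * 0.00993 := by
    refine mul_le_mul_of_nonneg_left ?_ ?_
    · norm_num at hA hC ⊢; linarith
    · norm_num at hb1 ⊢; linarith
  norm_num at k1 k2 k3 hb1 ⊢
  linarith

theorem le_sum_hat_of_xi (h : ∀ s : ℂ, 1 / 2 < s.re → xi s ≠ 0)
    {r : ℝ} (hr : 403 ≤ r) (hl : 6 ≤ log r) :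
    0.1099 * r / log r ≤ ∑ p ∈ Ioc ⌊r⌋₊ ⌊2 * √2 * r⌋₊ with p.Prime, hat r p := by
  have hs1 : 1.4142 ≤ √2 := Real.le_sqrt_of_sq_le (by norm_num)
  have hs2 : √2 ≤ 1.4143 := by rw [Real.sqrt_le_left (by norm_num)]; norm_num
  have h1 := le_log_mul_sum_hat (r := r) (by linarith)
  have hr0 : 0 < r := by linarith
  have h2 := psi_sub_theta_le_of_xi h (b := 2 * √2 * r) (by nlinarith)
  have hw : 20.07 ≤ √r := Real.le_sqrt_of_sq_le (by norm_num; linarith)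
  have hww : √r * √r = r := Real.mul_self_sqrt hr0.le
  have h3 : √(2 * √2 * r) ≤ 1.682 * √r := by
    rw [Real.sqrt_le_left (by positivity), mul_pow, Real.sq_sqrt hr0.le]
    norm_num at hs2 ⊢
    nlinarith
  have h6 := le_sum_vonMangoldt_mul_hat_of_xi h hr
  have hS : 0 ≤ ∑ p ∈ Ioc ⌊r⌋₊ ⌊2 * √2 * r⌋₊ with p.Prime, hat r p := by
    refine Finset.sum_nonneg fun p hp => ?_
    rw [Finset.mem_filter, Finset.mem_Ioc] at hp
    exact hat_nonneg hr0 (Nat.lt_of_floor_lt hp.1.1).le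
      ((Nat.le_floor_iff (by positivity)).1 hp.1.2)
  have hlb : log (2 * √2 * r) ≤ 1.1734 * log r := by
    rw [Real.log_mul (by positivity) hr0.ne', Real.log_mul (by norm_num) (by positivity),
      Real.log_sqrt (by norm_num)]
    have := Real.log_two_lt_d9
    norm_num at this ⊢
    linarith
  rw [div_le_iff₀ (by linarith)]
  have h10 := mul_le_mul_of_nonneg_right hlb hS
  have h9 : √r ≤ r / 20.07 := by
    rw [le_div_iff₀ (by norm_num)]; nlinarith
  norm_num at h1 h2 h3 h6 h9 h10 ⊢
  linarith

theorem eps_le {x : ℝ} (hx : 1 < x) : eps x ≤ 1 / (x * log x) := by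
  have := eps_mul_le hx
  rw [← div_div, div_right_comm, le_div_iff₀ (by linarith)]
  exact this

theorem large_range_numeric {v r : ℝ} (hv0 : 0 < v) (hv1 : v ≤ 1 / 12) (hr : 403 ≤ r)
    (hvr : 403 ≤ 12 * (r * v)) :
    (v + v ^ 2) * (0.0932 * r + 1.839) + 0.1864 * r * (v ^ 2 + 2 * v ^ 3) + 0.25 * v +
      1.005 + 0.92 - 0.2198 * (r * v) < 0 := by
  have k2 : v ^ 2 ≤ v / 12 := by nlinarith
  have k3 : v ^ 3 ≤ v / 144 := by nlinarith
  have k4 : (v + v ^ 2) * (0.0932 * r + 1.839) ≤ (13 / 12 * v) * (0.0932 * r + 1.839) := by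
    refine mul_le_mul_of_nonneg_right (by linarith) (by positivity)
  have k5 : 0.1864 * r * (v ^ 2 + 2 * v ^ 3) ≤ 0.1864 * r * (14 / 144 * v) := by
    refine mul_le_mul_of_nonneg_left (by linarith) (by positivity)
  have k6 : 403 * v ≤ r * v := by gcongr
  norm_num at k4 k5 ⊢
  linarith

theorem psi_sub_mul_le_of_xi (h : ∀ s : ℂ, 1 / 2 < s.re → xi s ≠ 0) {x : ℝ} (hx : 403 ≤ x) :
    (Chebyshev.psi x - x) * (1 / (x * log x) - eps x) ≤ 0.25 / (x * log x) := by
  have hl : 0 < log x := Real.log_pos (by linarith)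
  have h1 := eps_le (x := x) (by linarith)
  have h2 := le_eps (x := x) (by linarith)
  have h3 : 1 / (x * log x) - eps x ≤ 1 / (2 * x ^ 2 * log x) := by
    have : (1 / x - 1 / (2 * x ^ 2)) / log x = 1 / (x * log x) - 1 / (2 * x ^ 2 * log x) := by
      field_simp
    linarith
  have h4 := psi_le_of_xi h (y := x) (by linarith)
  have h5 : Chebyshev.psi x - x ≤ 0.5 * x := by
    have hw : 20 ≤ √x := Real.le_sqrt_of_sq_le (by norm_num; linarith)
    have hww : √x * √x = x := Real.mul_self_sqrt (by linarith)
    norm_num at h4 ⊢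
    nlinarith
  calc (Chebyshev.psi x - x) * (1 / (x * log x) - eps x)
      ≤ 0.5 * x * (1 / (x * log x) - eps x) := by
        refine mul_le_mul_of_nonneg_right h5 (by linarith)
    _ ≤ 0.5 * x * (1 / (2 * x ^ 2 * log x)) := by gcongr
    _ = 0.25 / (x * log x) := by
        rw [mul_one_div, div_eq_div_iff (by positivity) (by positivity)]; ring

theorem log_sigma1_div_lt_of_xi (h : ∀ s : ℂ, 1 / 2 < s.re → xi s ≠ 0)
    {n : ℕ} (hn : n ≠ 0) (hx : 12 ≤ log (log n)) :
    log (sigma1 n / n) < eulerMascheroniConstant + log (log (log n)) := by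
  set x := log (n : ℝ) with hxdef
  have hx0 : 0 < x := by
    by_contra hc
    push Not at hc
    rcases (Real.log_natCast_nonneg n).lt_or_eq with h1 | h1
    · linarith
    · rw [hxdef, ← h1, Real.log_zero] at hx; linarith
  obtain ⟨hr, hrl⟩ := sqrt_bounds_of_log hx0 hx
  have hrr : √x * √x = x := Real.mul_self_sqrt hx0.le
  have hx1 : 403 ≤ x := by nlinarith
  have h1 := log_sigma1_div_le hn (x := x) (by linarith)
  have h2 := primeSum_le_of_xi h (x := x) (by linarith)
  have h3 := sum_powTail_sub_saving_le hr
  have h4 := psi_sub_mul_le_of_xi h hx1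
  have h5 := lambdaSum_le_log_of_xi h hr
  have hlr : log √x = log x / 2 := Real.log_sqrt hx0.le
  have h6 := le_sum_hat_of_xi h hr (by linarith)
  have h7 := sum_neg_log_eq x
  have h8 := zeroConst_le
  have h9 := log_two_pi_le
  rw [Finset.sum_sub_distrib] at h1 h3
  rw [hlr] at h5 h6
  set H := ∑ p ∈ Ioc ⌊√x⌋₊ ⌊2 * √2 * √x⌋₊ with p.Prime, hat (√x) p
  set L := log x with hL
  set r := √x
  have hL0 : 0 < L := by linarith
  have hr0 : 0 < r := by linarith
  set v := 1 / L with hv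
  have hv0 : 0 < v := by positivity
  have hv1 : v ≤ 1 / 12 := one_div_le_one_div_of_le (by norm_num) hx
  have hvr : 403 ≤ 12 * (r * v) := by
    rw [hv, mul_one_div, ← mul_div_assoc, le_div_iff₀ hL0]; exact hrl
  have t1 : (1 / L + 1 / L ^ 2) * (2 * zeroConst / r + log (2 * π) / x) ≤
      (v + v ^ 2) * (0.0932 * r + 1.839) / x := by
    rw [hv, div_pow, one_pow, mul_div_assoc (1 / L + 1 / L ^ 2)]
    have : (0.0932 * r + 1.839) / x = 0.0932 / r + 1.839 / x := by
      rw [add_div, ← hrr]; field_simp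
    rw [this]
    have : 2 * zeroConst ≤ 0.0932 := by norm_num at h8 ⊢; linarith
    gcongr
  have t2 : 4 * zeroConst * (1 / L ^ 2 + 2 / L ^ 3) / r ≤ 0.1864 * r * (v ^ 2 + 2 * v ^ 3) / x := by
    have e : 0.1864 * r * (v ^ 2 + 2 * v ^ 3) / x = 0.1864 * (1 / L ^ 2 + 2 / L ^ 3) / r := by
      rw [hv, ← hrr, div_pow, div_pow, one_pow, one_pow]; field_simp
    rw [e]
    have : 4 * zeroConst ≤ 0.1864 := by norm_num at h8 ⊢; linarith
    gcongr
  have t3 : 2.01 / (x * L) * lambdaSum r ≤ 1.005 / x := by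
    calc 2.01 / (x * L) * lambdaSum r ≤ 2.01 / (x * L) * (L / 2) := by gcongr
      _ = 1.005 / x := by field_simp; norm_num
  have t4 : 0.2198 * (r * v) / x ≤ H / x := by
    have e : 0.1099 * r / (L / 2) = 0.2198 * (r * v) := by
      rw [hv]; field_simp; norm_num
    rw [e] at h6
    gcongr
  have t5 : (Chebyshev.psi x - x) / (x * L) + eps x * (x - Chebyshev.psi x) ≤ 0.25 * v / x := by
    have e : 0.25 * v / x = 0.25 / (x * L) := by rw [hv]; field_simp
    have e2 : (Chebyshev.psi x - x) / (x * L) + eps x * (x - Chebyshev.psi x) =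
        (Chebyshev.psi x - x) * (1 / (x * L) - eps x) := by ring
    rw [e, e2]
    exact h4
  have key := large_range_numeric hv0 hv1 hr hvr
  have key2 := div_neg_of_neg_of_pos key hx0
  rw [sub_div, add_div, add_div, add_div, add_div] at key2
  linarith

theorem robinF_lt_of_xi (h : ∀ s : ℂ, 1 / 2 < s.re → xi s ≠ 0)
    {n : ℕ} (hn : n ≠ 0) (hx : 12 ≤ log (log n)) :
    robinF n < exp eulerMascheroniConstant := by
  rw [robinF_eq_exp hn (by linarith), Real.exp_lt_exp]
  linarith [log_sigma1_div_lt_of_xi h hn hx]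

/-- Common denominator of the fixed-point approximations below. -/
def scale : ℕ := 1152921504606846976

def logTwoLower : ℕ := 799144290025469441

def logTwoUpper : ℕ := 799144290601930194

/-- Application which makes the kernel evaluate the argument first. -/
def force {α : Type} (n : ℕ) (k : ℕ → α) : α := Nat.rec (k 0) (fun m _ => k (Nat.succ m)) n

/-- Fixed-point Horner scheme for the series of `artanh`. -/
def atanhSeries (z n : ℕ) : ℕ → ℕ :=
  Nat.rec (fun _ => 0) (fun _ ih k => Nat.add (Nat.div scale (Nat.succ (Nat.mul 2 k)))
    (Nat.div (Nat.mul z (ih (Nat.succ k))) scale)) n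

/-- A lower bound for `scale * log (a / b)`, good for `a / b` between `1` and `2`. -/
def ratioLog (a b : ℕ) : ℕ :=
  force (Nat.div (Nat.mul scale (Nat.sub a b)) (Nat.add a b)) fun z =>
    force (Nat.div (Nat.mul z z) scale) fun w =>
      Nat.div (Nat.mul (Nat.mul 2 z) (atanhSeries w 14 0)) scale

/-- A lower bound for `scale * log (a / b)`. -/
def logLower (a b : ℕ) : ℕ :=
  force (Nat.log2 (Nat.div a b)) fun e =>
    Nat.add (Nat.mul e logTwoLower) (ratioLog a (Nat.mul b (Nat.pow 2 e)))

/-- An upper bound for `scale * log (a / b)`. -/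
def logUpper (a b : ℕ) : ℕ :=
  force (Nat.succ (Nat.log2 (Nat.div a b))) fun e =>
    Nat.sub (Nat.mul e logTwoUpper) (ratioLog (Nat.mul b (Nat.pow 2 e)) a)

/-- The product of the primes up to `403`. -/
def sievePrimorial : ℕ :=
  40786437068665554814618971683922828694582892964708884701862361274616519644579867220074319283900539893834048687270253154873138028145776983601098265140488742774844290

/-- All primes `p ≥ lo` are coprime to `sieve lo`. -/
def sieve (lo : ℕ) : ℕ :=
  if lo < 4 then 1 else if lo < 20 then 6 else if lo < 516 then 9699690 else sievePrimorial

/-- A test which all primes pass. -/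
def isCand (p : ℕ) : Bool := Nat.beq (Nat.gcd p (sieve p)) 1

/-- The product of `p + c` over the `p` coprime to `m` with `lo ≤ p < lo + 2 ^ d`. -/
def candProd (m c d : ℕ) : ℕ → ℕ :=
  Nat.rec (fun lo => Nat.pow (Nat.add lo c) (Nat.div 1 (Nat.gcd lo m)))
    (fun d ih lo => Nat.mul (ih lo) (ih (Nat.add lo (Nat.pow 2 d)))) d

/-- `p + p ^ 2 + ⋯ + p ^ k`. -/
def geo (p : ℕ) : ℕ → ℕ
  | 0 => 0
  | k + 1 => p * (1 + geo p k)

/-- The exponent of the small prime `p` in the reference number, given a bound `l` for `log x`. -/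
def topExp (x l p : ℕ) : ℕ → ℕ → ℕ
  | 0, k => k
  | f + 1, k =>
    if (2 * geo p (k + 1) + 1) * logUpper p 1 ≤ 2 * x * l then topExp x l p f (k + 1) else k

/-- Whether `σ(p^k)/p^k` may be used for the small prime `p`, rather than `p/(p-1)`. -/
def isExact (x u p k : ℕ) : Bool := u * (2 * x + 1) ≤ 2 * geo p (k + 1) * logLower p 1

def smallNum (x u p k : ℕ) : ℕ := if isExact x u p k then (1 + geo p k) * p else p * p

def smallDen (x u p k : ℕ) : ℕ := if isExact x u p k then p ^ k * (p + 1) else (p - 1) * (p + 1)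

/-- The product of `f p` over the candidates `p` with `2 ≤ p < y + 2`. -/
def smallProd (f : ℕ → ℕ) : ℕ → ℕ
  | 0 => 1
  | y + 1 => smallProd f y * bif isCand (y + 2) then f (y + 2) else 1

/-- The numerical inequality at the point `a` which amounts to Robin's inequality for `log n = a`,
where `T` and `F` bound the logarithm of the reference number and of its abundancy. -/
def pointCheck (x l u T F a : ℕ) : Bool :=
  force (logLower a 1) fun g => force (logLower g scale) fun G =>
    scale ≤ g && if a * scale ≤ T then
      F < 665454763244026006 + G + (T - a * scale) * ((2 * x - 1) * scale) / (2 * x * x * u)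
    else
      F + (a * scale - T) * scale / (x * l) + 1 < 665454763244026006 + G

def stepCheck (x l u y T F a b : ℕ) : Bool :=
  force (smallProd (fun p => force (topExp x l p 20 1) fun k => p ^ (k - 1)) y) fun E =>
  force (smallProd (fun p => force (topExp x l p 20 1) fun k => smallNum x u p k) y) fun P =>
  force (smallProd (fun p => force (topExp x l p 20 1) fun k => smallDen x u p k) y) fun Q =>
  force (T + logLower E 1) fun Tx => force (F + logUpper P Q) fun Fx =>
    y + 1 ≤ x && 0 < x * l && 2 * x + 1 ≤ (y + 2) * (y + 2) + (y + 2) &&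
      (pointCheck x l u Tx Fx a && pointCheck x l u Tx Fx b)

/-- A Newton step for the square root of `n`. -/
def sqrtStep (n s : ℕ) : ℕ := (s + n / s) / 2

def checkAll : List (ℕ × ℕ) → ℕ → ℕ → ℕ → ℕ → Bool
  | [], _, _, _, a => Nat.ble 162755 a
  | (d, b) :: t, lo, T, F, a =>
    force (lo + 2 ^ d) fun hi => force (sieve lo) fun m => force (hi - 1) fun x =>
    Nat.beq m (sieve x) &&
    force (candProd m 0 d lo) fun P => force (candProd m 1 d lo) fun Q =>
    force (T + logLower P 1) fun T' => force (F + logUpper Q P) fun F' =>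
      (Nat.beq b 0 ||
        force (logLower x 1) fun l => force (logUpper x 1) fun u =>
          force (sqrtStep (2 * x) (sqrtStep (2 * x) (2 ^ (Nat.log2 (2 * x) / 2 + 1))) - 1) fun y =>
            stepCheck x l u y T' F' a b) &&
      checkAll t hi T' F' (max a b)

theorem scale_pos : (0 : ℝ) < scale := by norm_num [scale]

theorem force_eq {α : Type} (n : ℕ) (k : ℕ → α) : force n k = k n := by
  cases n <;> rfl

theorem atanhSeries_succ (z n k : ℕ) : atanhSeries z (n + 1) k =
    scale / (2 * k + 1) + z * atanhSeries z n (k + 1) / scale := rfl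

theorem ratioLog_eq (a b : ℕ) : ratioLog a b =
    2 * (scale * (a - b) / (a + b)) * atanhSeries
      (scale * (a - b) / (a + b) * (scale * (a - b) / (a + b)) / scale) 14 0 / scale := by
  rw [ratioLog, force_eq, force_eq]
  rfl

theorem logLower_eq (a b : ℕ) : logLower a b =
    Nat.log2 (a / b) * logTwoLower + ratioLog a (b * 2 ^ Nat.log2 (a / b)) := by
  rw [logLower, force_eq]
  rfl

theorem logUpper_eq (a b : ℕ) : logUpper a b =
    (Nat.log2 (a / b) + 1) * logTwoUpper - ratioLog (b * 2 ^ (Nat.log2 (a / b) + 1)) a := by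
  rw [logUpper, force_eq]
  rfl

theorem atanhSeries_le {z : ℕ} {y : ℝ} (hz : (z : ℝ) ≤ scale * y) (n k : ℕ) :
    (atanhSeries z n k : ℝ) ≤ scale * ∑ i ∈ range n, y ^ i / (2 * (k + i) + 1) := by
  have hs := scale_pos
  have hy : 0 ≤ y := nonneg_of_mul_nonneg_right ((Nat.cast_nonneg z).trans hz) hs
  induction n generalizing k with
  | zero => simp [atanhSeries]
  | succ n ih =>
    have h1 : ((scale / (2 * k + 1) : ℕ) : ℝ) ≤ scale * (1 / (2 * k + 1)) := by
      refine Nat.cast_div_le.trans (le_of_eq ?_)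
      push_cast; ring
    have h2 : ((z * atanhSeries z n (k + 1) / scale : ℕ) : ℝ) ≤ y * atanhSeries z n (k + 1) := by
      refine Nat.cast_div_le.trans ?_
      rw [div_le_iff₀ hs]
      push_cast
      calc (z : ℝ) * atanhSeries z n (k + 1) ≤ scale * y * atanhSeries z n (k + 1) :=
            mul_le_mul_of_nonneg_right hz (Nat.cast_nonneg _)
        _ = _ := by ring
    have h3 := mul_le_mul_of_nonneg_left (ih (k + 1)) hy
    rw [atanhSeries_succ, Finset.sum_range_succ']
    push_cast [Nat.cast_add] at h1 h2 h3 ⊢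
    have h4 : y * (scale * ∑ i ∈ range n, y ^ i / (2 * (k + 1 + i : ℝ) + 1)) =
        scale * ∑ i ∈ range n, y ^ (i + 1) / (2 * (k + (i + 1 : ℝ)) + 1) := by
      rw [Finset.mul_sum, Finset.mul_sum, Finset.mul_sum]
      refine Finset.sum_congr rfl fun i _ => ?_
      rw [pow_succ, add_assoc (k : ℝ), add_comm (1 : ℝ)]; ring
    rw [h4] at h3
    simp only [pow_zero, add_zero]
    linarith

theorem ratioLog_le {a b : ℕ} (hb : 0 < b) (hab : b ≤ a) :
    (ratioLog a b : ℝ) ≤ scale * log (a / b) := by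
  have hs := scale_pos
  have hb' : (0 : ℝ) < b := by exact_mod_cast hb
  have hab' : (b : ℝ) ≤ a := by exact_mod_cast hab
  have ha' : (0 : ℝ) < a := hb'.trans_le hab'
  set y : ℝ := (a - b) / (a + b) with hy
  have hy0 : 0 ≤ y := div_nonneg (by linarith) (by linarith)
  have hy1 : y < 1 := by rw [hy, div_lt_one (by linarith)]; linarith
  have hr : (1 + y) / (1 - y) = a / b := by
    have e1 : 1 + y = 2 * a / (a + b) := by rw [hy]; field_simp; ring
    have e2 : 1 - y = 2 * b / (a + b) := by rw [hy]; field_simp; ring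
    rw [e1, e2]; field_simp
  rw [ratioLog_eq]
  set z := scale * (a - b) / (a + b) with hz
  have hzy : (z : ℝ) ≤ scale * y := by
    refine Nat.cast_div_le.trans (le_of_eq ?_)
    push_cast [Nat.cast_sub hab]
    rw [hy]; ring
  have hz2 : ((z * z / scale : ℕ) : ℝ) ≤ scale * y ^ 2 := by
    refine Nat.cast_div_le.trans ?_
    rw [div_le_iff₀ hs]
    push_cast
    calc (z : ℝ) * z ≤ (scale * y) * (scale * y) := by gcongr
      _ = _ := by ring
  have h1 := atanhSeries_le hz2 14 0
  have h2 := Real.sum_range_le_log_div hy0 hy1 14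
  rw [hr] at h2
  have h3 : y * ∑ i ∈ range 14, (y ^ 2) ^ i / (2 * ((0 : ℕ) + i) + 1) =
      ∑ i ∈ range 14, y ^ (2 * i + 1) / (2 * i + 1) := by
    rw [Finset.mul_sum]
    refine Finset.sum_congr rfl fun i _ => ?_
    rw [Nat.cast_zero, zero_add, pow_succ y (2 * i), pow_mul]; ring
  refine Nat.cast_div_le.trans ?_
  rw [div_le_iff₀ hs]
  push_cast at h1 h3 ⊢
  calc (2 : ℝ) * z * (atanhSeries (z * z / scale) 14 0) ≤
      2 * (scale * y) * (scale * ∑ i ∈ range 14, (y ^ 2) ^ i / (2 * (0 + i) + 1)) := by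
        gcongr
    _ = 2 * scale * scale * (y * ∑ i ∈ range 14, (y ^ 2) ^ i / (2 * (0 + i) + 1)) := by ring
    _ ≤ 2 * scale * scale * (1 / 2 * log (a / b)) := by rw [h3]; gcongr
    _ = _ := by ring

theorem logTwoLower_le : (logTwoLower : ℝ) ≤ scale * log 2 := by
  have := Real.log_two_gt_d9
  have hs := scale_pos
  have : (logTwoLower : ℝ) ≤ scale * 0.6931471803 := by norm_num [logTwoLower, scale]
  nlinarith

theorem le_logTwoUpper : scale * log 2 ≤ (logTwoUpper : ℝ) := by
  have := Real.log_two_lt_d9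
  have hs := scale_pos
  have : scale * 0.6931471808 ≤ (logTwoUpper : ℝ) := by norm_num [logTwoUpper, scale]
  nlinarith

theorem logLower_le {a b : ℕ} (hb : 0 < b) (hab : b ≤ a) :
    (logLower a b : ℝ) ≤ scale * log (a / b) := by
  set e := Nat.log2 (a / b) with he
  have h1 : b * 2 ^ e ≤ a := by
    have := Nat.log2_self_le (n := a / b) (by have := Nat.div_pos hab hb; omega)
    calc b * 2 ^ e ≤ b * (a / b) := Nat.mul_le_mul_left _ this
      _ ≤ a := Nat.mul_div_le a b
  have h2 := ratioLog_le (by positivity) h1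
  have hb' : (0 : ℝ) < b := by exact_mod_cast hb
  have ha' : (0 : ℝ) < a := by exact_mod_cast hb.trans_le hab
  have h3 : log ((a : ℝ) / (b * 2 ^ e : ℕ)) = log (a / b) - e * log 2 := by
    push_cast
    rw [← div_div, Real.log_div (by positivity) (by positivity), Real.log_pow]
  have h4 := mul_le_mul_of_nonneg_left logTwoLower_le (Nat.cast_nonneg (α := ℝ) e)
  rw [logLower_eq, ← he]
  push_cast at h2 ⊢
  rw [← Nat.cast_ofNat (R := ℝ) (n := 2)] at h2
  push_cast at h2 h3
  rw [h3] at h2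
  linarith

theorem le_logUpper {a b : ℕ} (ha : 0 < a) (hb : 0 < b) :
    scale * log (a / b) ≤ (logUpper a b : ℝ) := by
  set e := Nat.log2 (a / b) + 1 with he
  have h1 : a ≤ b * 2 ^ e := by
    have := Nat.lt_log2_self (n := a / b)
    rw [← he, Nat.div_lt_iff_lt_mul hb] at this
    linarith
  have h2 := ratioLog_le ha h1
  have hb' : (0 : ℝ) < b := by exact_mod_cast hb
  have ha' : (0 : ℝ) < a := by exact_mod_cast ha
  have h3 : log (((b * 2 ^ e : ℕ) : ℝ) / a) = e * log 2 - log (a / b) := by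
    push_cast
    rw [Real.log_div (by positivity) (by positivity), Real.log_div (by positivity) (by positivity),
      Real.log_mul (by positivity) (by positivity), Real.log_pow]
    ring
  have h4 := mul_le_mul_of_nonneg_left le_logTwoUpper (Nat.cast_nonneg (α := ℝ) e)
  rw [logUpper_eq, ← he]
  have h5 : ((e * logTwoUpper : ℕ) : ℝ) - (ratioLog (b * 2 ^ e) a : ℝ) ≤
      ((e * logTwoUpper - ratioLog (b * 2 ^ e) a : ℕ) : ℝ) := by
    rw [sub_le_iff_le_add]
    exact_mod_cast le_tsub_add
  rw [h3] at h2
  push_cast at h5 ⊢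
  linarith

theorem coprime_of_dvd_factorial {p m k : ℕ} (hp : p.Prime) (hm : m ∣ k.factorial) (hk : k < p) :
    Nat.Coprime p m :=
  (Nat.Prime.coprime_iff_not_dvd hp).2 fun h =>
    not_le.2 hk ((Nat.Prime.dvd_factorial hp).1 (h.trans hm))

theorem coprime_sieve {p lo : ℕ} (hp : p.Prime) (h : lo ≤ p) : Nat.Coprime p (sieve lo) := by
  rw [sieve]
  split_ifs with h1 h2 h3
  · exact Nat.coprime_one_right p
  · exact coprime_of_dvd_factorial (k := 3) hp (by decide) (by omega)
  · exact coprime_of_dvd_factorial (k := 19) hp (by decide +kernel) (by omega)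
  · exact coprime_of_dvd_factorial (k := 403) hp (by decide +kernel) (by omega)

theorem sieve_eq_of_le {a b p : ℕ} (h : sieve a = sieve b) (hap : a ≤ p) (hpb : p ≤ b) :
    sieve p = sieve a := by
  have h0 : sievePrimorial ≠ 9699690 ∧ sievePrimorial ≠ 6 ∧ sievePrimorial ≠ 1 := by
    norm_num [sievePrimorial]
  unfold sieve at *
  split_ifs at * <;> omega

theorem isCand_iff {p : ℕ} : isCand p = true ↔ Nat.gcd p (sieve p) = 1 := by
  rw [isCand, Nat.beq_eq]

theorem isCand_of_prime {p : ℕ} (hp : p.Prime) : isCand p = true :=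
  isCand_iff.2 (coprime_sieve hp le_rfl)

theorem candProd_eq {m c : ℕ} (d lo : ℕ) (hm : ∀ p, lo ≤ p → p < lo + 2 ^ d → sieve p = m) :
    candProd m c d lo = ∏ p ∈ (Finset.Ico lo (lo + 2 ^ d)).filter (fun p => isCand p), (p + c) := by
  induction d generalizing lo with
  | zero =>
    have : candProd m c 0 lo = (lo + c) ^ (1 / Nat.gcd lo m) := rfl
    rw [this, pow_zero, ← Order.succ_eq_add_one, Order.succ_eq_add_one, Nat.Ico_succ_singleton,
      Finset.filter_singleton]
    have h1 := hm lo le_rfl (by simp)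
    split_ifs with h
    · rw [isCand_iff, h1] at h
      simp [h]
    · rw [isCand_iff, h1] at h
      have : 1 / Nat.gcd lo m = 0 := by
        rcases Nat.eq_zero_or_pos (Nat.gcd lo m) with h' | h'
        · rw [h']
        · exact Nat.div_eq_of_lt (by omega)
      simp [this]
  | succ d ih =>
    have : candProd m c (d + 1) lo = candProd m c d lo * candProd m c d (lo + 2 ^ d) := rfl
    have h2 : lo + 2 ^ (d + 1) = lo + 2 ^ d + 2 ^ d := by rw [pow_succ]; ring
    rw [h2] at hm ⊢
    rw [this, ih lo fun p h h' => hm p h (by omega), ih (lo + 2 ^ d) fun p h h' => hm p (by omega) h',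
      ← Finset.Ico_union_Ico_eq_Ico (Nat.le_add_right lo (2 ^ d)) (Nat.le_add_right _ (2 ^ d)),
      Finset.filter_union,
      Finset.prod_union]
    exact Finset.disjoint_filter_filter (Finset.Ico_disjoint_Ico_consecutive _ _ _)

/-- An upper bound for `log (σ(n)/n)` from bounds for the contributions of the small primes. -/
theorem log_sigma1_div_le_sum {n : ℕ} (hn : n ≠ 0) {x : ℝ} (hx : 1 < x) {S : Finset ℕ} {B : ℕ → ℝ}
    (hS : ∀ p : ℕ, p.Prime → (p : ℝ) ≤ x → p ∈ S)
    (hB : ∀ p ∈ S, ∀ j, logSigma p j ≤ eps x * (j * log p) + B p) :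
    log (sigma1 n / n) ≤ eps x * log n + ∑ p ∈ S, B p := by
  set U := n.primeFactors ∪ S with hU
  have hfac : ∀ p ∈ U, p ∉ n.primeFactors → n.factorization p = 0 := by
    intro p _ hp
    rwa [← Nat.support_factorization, Finsupp.notMem_support_iff] at hp
  have h1 : log (sigma1 n / n) = ∑ p ∈ U, logSigma p (n.factorization p) := by
    rw [log_sigma1_div hn]
    refine Finset.sum_subset Finset.subset_union_left fun p hp hp' => ?_
    rw [hfac p hp hp', logSigma_zero]
  have h2 : log n = ∑ p ∈ U, n.factorization p * log p := by
    rw [log_natCast_eq hn]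
    refine Finset.sum_subset Finset.subset_union_left fun p hp hp' => ?_
    rw [hfac p hp hp']; simp
  have h3 : ∀ p ∈ U, logSigma p (n.factorization p) ≤ eps x * (n.factorization p * log p) +
      if p ∈ S then B p else 0 := by
    intro p hp
    split_ifs with h
    · exact hB p h _
    · have hpp := Nat.prime_of_mem_primeFactors ((Finset.mem_union.1 hp).resolve_right h)
      rw [add_zero]
      exact logSigma_le_large hpp.two_le hx (not_le.1 fun h' => h (hS p hpp h')) _
  rw [h1]
  refine (Finset.sum_le_sum h3).trans (le_of_eq ?_)
  rw [Finset.sum_add_distrib, ← Finset.mul_sum, ← h2, Finset.sum_ite_mem,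
    Finset.inter_eq_right.2 Finset.subset_union_right]

theorem geo_succ (p k : ℕ) : geo p (k + 1) = geo p k + p ^ (k + 1) := by
  induction k with
  | zero => simp [geo]
  | succ k ih =>
    calc geo p (k + 2) = p * (1 + geo p (k + 1)) := rfl
      _ = p * (1 + geo p k) + p * p ^ (k + 1) := by rw [ih]; ring
      _ = geo p (k + 1) + p ^ (k + 2) := by rw [← geo, ← pow_succ']

theorem geo_eq (p k : ℕ) : (geo p k : ℝ) = ∑ i ∈ Finset.Icc 1 k, (p : ℝ) ^ i := by
  induction k with
  | zero => simp [geo]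
  | succ k ih => rw [geo_succ, Finset.sum_Icc_succ_top (by omega), ← ih]; push_cast; ring

theorem geo_mono (p : ℕ) : Monotone (geo p) :=
  monotone_nat_of_le_succ fun k => by rw [geo_succ]; omega

theorem geo_pos {p k : ℕ} (hp : 2 ≤ p) (hk : 1 ≤ k) : 0 < geo p k := by
  have : geo p 1 = p := by simp [geo]
  have := geo_mono p hk
  omega

theorem logSigma_succ_sub {p : ℕ} (hp : 2 ≤ p) (k : ℕ) :
    logSigma p (k + 1) - logSigma p k = log (1 + 1 / geo p (k + 1)) := by
  rw [logSigma_succ hp, geo_eq]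

theorem log_one_add_inv_geo_anti {p j k : ℕ} (hp : 2 ≤ p) (hj : 1 ≤ j) (hjk : j ≤ k) :
    log (1 + 1 / geo p k) ≤ log (1 + 1 / geo p j) := by
  have h1 : (0 : ℝ) < geo p j := by exact_mod_cast geo_pos hp hj
  have h2 : (geo p j : ℝ) ≤ geo p k := by exact_mod_cast geo_mono p hjk
  apply Real.log_le_log (by positivity)
  gcongr

theorem logSigma_add_mul_le {p k j : ℕ} (hp : 2 ≤ p) {c : ℝ} (hc : c ≤ log (1 + 1 / geo p k))
    (hjk : j ≤ k) : logSigma p j + (k - j : ℝ) * c ≤ logSigma p k := by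
  induction k, hjk using Nat.le_induction with
  | base => simp
  | succ k hk ih =>
    have h1 := logSigma_succ_sub hp k
    rcases Nat.eq_zero_or_pos k with rfl | hk0
    · obtain rfl : j = 0 := by omega
      push_cast
      linarith
    · have := ih (hc.trans (log_one_add_inv_geo_anti hp hk0 (by omega)))
      push_cast
      linarith

theorem logSigma_le_add_mul {p k j : ℕ} (hp : 2 ≤ p) {c : ℝ} (hc : log (1 + 1 / geo p (k + 1)) ≤ c)
    (hkj : k ≤ j) : logSigma p j ≤ logSigma p k + (j - k : ℝ) * c := by
  induction j, hkj using Nat.le_induction with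
  | base => simp
  | succ j hj ih =>
    have h1 := logSigma_succ_sub hp j
    have h2 := log_one_add_inv_geo_anti hp (j := k + 1) (k := j + 1) (by omega) (by omega)
    push_cast
    linarith

theorem two_div_le_log {s : ℝ} (hs : 0 < s) : 2 / (2 * s + 1) ≤ log (1 + 1 / s) := by
  have := two_mul_div_le_log (u := 1 / s) (by positivity)
  refine le_trans (le_of_eq ?_) this
  field_simp

theorem log_one_add_inv_le {s : ℝ} (hs : 0 < s) : log (1 + 1 / s) ≤ 1 / s := by
  have := Real.log_le_sub_one_of_pos (x := 1 + 1 / s) (by positivity)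
  linarith

/-- The exact form of the bound for a prime whose optimal exponent is `k`. -/
theorem logSigma_le_of_exact {p k : ℕ} (hp : 2 ≤ p) {e : ℝ} (h1 : e * log p ≤ log (1 + 1 / geo p k))
    (h2 : log (1 + 1 / geo p (k + 1)) ≤ e * log p) (j : ℕ) :
    logSigma p j ≤ e * (j * log p) + (logSigma p k - e * (k * log p)) := by
  rcases le_total j k with h | h
  · have := logSigma_add_mul_le hp h1 h
    linarith
  · have := logSigma_le_add_mul hp h2 h
    linarith

/-- The bound for a prime whose optimal exponent is at least `k`. -/
theorem logSigma_le_of_limit {p k : ℕ} (hp : 2 ≤ p) {e : ℝ} (he : 0 ≤ e)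
    (h1 : e * log p ≤ log (1 + 1 / geo p k)) (j : ℕ) :
    logSigma p j ≤ e * (j * log p) + (-log (1 - (p : ℝ)⁻¹) - e * (k * log p)) := by
  rcases le_total j k with h | h
  · have := logSigma_add_mul_le hp h1 h
    have := logSigma_le hp k
    linarith
  · have h3 := logSigma_le hp j
    have h4 : e * (k * log p) ≤ e * (j * log p) := by
      have : 0 ≤ log (p : ℝ) := Real.log_natCast_nonneg p
      have : (k : ℝ) ≤ j := by exact_mod_cast h
      gcongr
    linarith

theorem logSigma_eq_geo {p : ℕ} (hp : 2 ≤ p) (k : ℕ) :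
    logSigma p k = log ((1 + geo p k) / (p : ℝ) ^ k) := by
  have hp' : (0 : ℝ) < p := by exact_mod_cast (by omega : 0 < p)
  rw [logSigma]
  congr 1
  induction k with
  | zero => simp [geo]
  | succ k ih =>
    rw [Finset.sum_range_succ, ih, geo]
    push_cast
    rw [inv_pow, pow_succ]
    field_simp
    ring

theorem eps_mul_log_le_log {p : ℕ} (hp : 2 ≤ p) {x : ℝ} (hx : (p : ℝ) ≤ x) :
    eps x * log p ≤ log (1 + 1 / p) := by
  have := eps_mul_log_le_logSigma_succ (j := 0) hp (x := x) (by simpa using hx)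
  rwa [logSigma_succ_sub hp, show geo p (0 + 1) = p by simp [geo]] at this

theorem log_le_eps_mul_log_of_le {p s : ℕ} (hs : 0 < s) {x : ℝ} (hx : 1 < x)
    (h : log x * (2 * x + 1) ≤ 2 * s * log p) : log (1 + 1 / s) ≤ eps x * log p := by
  have hs' : (0 : ℝ) < s := by exact_mod_cast hs
  have hL := Real.log_pos hx
  have hp : 0 ≤ log (p : ℝ) := Real.log_natCast_nonneg p
  have h1 := two_div_le_log (s := x) (by linarith)
  refine (log_one_add_inv_le hs').trans ?_
  calc 1 / (s : ℝ) ≤ 2 / (2 * x + 1) / log x * log p := by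
        rw [div_div, div_mul_eq_mul_div, div_le_div_iff₀ hs' (by positivity)]
        linarith
    _ ≤ _ := by rw [eps]; gcongr

/-- The bound for a prime for which only the exponents `0` and `1` matter. -/
theorem logSigma_le_of_one {p : ℕ} (hp : 2 ≤ p) {x : ℝ} (hpx : (p : ℝ) ≤ x)
    (h : 2 * x + 1 ≤ p * p + p) (j : ℕ) :
    logSigma p j ≤ eps x * (j * log p) + (log ((p + 1) / p) - eps x * log p) := by
  have hp' : (2 : ℝ) ≤ p := by exact_mod_cast hp
  have hg : geo p 1 = p := by simp [geo]
  have hg2 : geo p (1 + 1) = p + p * p := by simp [geo]; ring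
  have h1 : eps x * log p ≤ log (1 + 1 / geo p 1) := by rw [hg]; exact eps_mul_log_le_log hp hpx
  have h2 : log (1 + 1 / geo p (1 + 1)) ≤ eps x * log p := by
    refine log_le_eps_mul_log_of_le (geo_pos hp (by omega)) (by linarith) ?_
    have h3 : log x ≤ 2 * log p := by
      rw [← Nat.cast_ofNat (R := ℝ) (n := 2), ← Real.log_pow]
      exact Real.log_le_log (by linarith) (by nlinarith)
    have h4 : 0 < log (p : ℝ) := Real.log_pos (by linarith)
    rw [hg2]
    push_cast
    have h5 : 0 ≤ 2 * x + 1 := by linarith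
    calc log x * (2 * x + 1) ≤ (2 * log p) * (p * p + p) := by gcongr
      _ = _ := by ring
  have h3 := logSigma_le_of_exact hp h1 h2 j
  rw [logSigma_eq_geo hp 1, hg, pow_one, add_comm (1 : ℝ)] at h3
  simpa using h3

theorem topExp_spec (x l p : ℕ) (f k : ℕ) (hk : 1 ≤ k) :
    1 ≤ topExp x l p f k ∧ (topExp x l p f k = k ∨
      (2 * geo p (topExp x l p f k) + 1) * logUpper p 1 ≤ 2 * x * l) := by
  induction f generalizing k with
  | zero => exact ⟨hk, Or.inl rfl⟩
  | succ f ih =>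
    rw [topExp]
    split_ifs with h
    · obtain ⟨h1, h2⟩ := ih (k + 1) (by omega)
      refine ⟨h1, Or.inr ?_⟩
      rcases h2 with h2 | h2
      · rw [h2]; exact h
      · exact h2
    · exact ⟨hk, Or.inl rfl⟩

theorem eps_mul_log_le_of_topExp {x l p f : ℕ} (hp : 2 ≤ p) (hpx : p ≤ x)
    (hl : (l : ℝ) ≤ scale * log x) :
    eps x * log p ≤ log (1 + 1 / geo p (topExp x l p f 1)) := by
  obtain ⟨h1, h2⟩ := topExp_spec x l p f 1 le_rfl
  set k := topExp x l p f 1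
  have hpx' : (p : ℝ) ≤ x := by exact_mod_cast hpx
  have hp' : (2 : ℝ) ≤ p := by exact_mod_cast hp
  rcases h2 with h2 | h2
  · rw [h2, show geo p 1 = p by simp [geo]]
    exact eps_mul_log_le_log hp hpx'
  have hs : (0 : ℝ) < geo p k := by exact_mod_cast geo_pos hp h1
  refine le_trans ?_ (two_div_le_log hs)
  have h3 : (2 * geo p k + 1 : ℝ) * logUpper p 1 ≤ 2 * x * l := by exact_mod_cast h2
  have h4 := le_logUpper (a := p) (b := 1) (by omega) one_pos
  rw [Nat.cast_one, div_one] at h4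
  have hLx : 0 < log (x : ℝ) := Real.log_pos (by linarith)
  have hLp : 0 < log (p : ℝ) := Real.log_pos (by linarith)
  have hsc := scale_pos
  have h5 : (2 * geo p k + 1 : ℝ) * log p ≤ 2 * (x * log x) := by
    have e1 : (2 * geo p k + 1 : ℝ) * (scale * log p) ≤ 2 * x * (scale * log x) :=
      (mul_le_mul_of_nonneg_left h4 (by positivity)).trans
        (h3.trans (mul_le_mul_of_nonneg_left hl (by positivity)))
    refine le_of_mul_le_mul_left ?_ hsc
    linarith
  calc eps x * log p ≤ 1 / (x * log x) * log p := by
        gcongr; exact eps_le (by linarith)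
    _ ≤ _ := by
        rw [div_mul_eq_mul_div, one_mul, div_le_div_iff₀ (mul_pos (by linarith) hLx) (by positivity)]
        linarith

theorem logSigma_le_of_small {x l u p : ℕ} (hp : 2 ≤ p) (hpx : p ≤ x)
    (hl : (l : ℝ) ≤ scale * log x) (hu : scale * log x ≤ (u : ℝ)) (j : ℕ) :
    logSigma p j ≤ eps x * (j * log p) + (log ((p + 1) / p) - eps x * log p +
      (log ((smallNum x u p (topExp x l p 20 1) : ℝ) / smallDen x u p (topExp x l p 20 1)) -
        eps x * log (p ^ (topExp x l p 20 1 - 1) : ℕ))) := by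
  have h1 := eps_mul_log_le_of_topExp (f := 20) hp hpx hl
  have hk := (topExp_spec x l p 20 1 le_rfl).1
  set k := topExp x l p 20 1
  have hp' : (2 : ℝ) ≤ p := by exact_mod_cast hp
  have hpx' : (p : ℝ) ≤ x := by exact_mod_cast hpx
  have hlk : log ((p ^ (k - 1) : ℕ) : ℝ) = (k - 1) * log p := by
    push_cast
    rw [Real.log_pow, Nat.cast_sub hk, Nat.cast_one]
  have he : 0 < eps x := eps_pos (by linarith)
  rw [hlk, smallNum, smallDen]
  split_ifs with h
  · have h2 : log (1 + 1 / geo p (k + 1)) ≤ eps x * log p := by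
      refine log_le_eps_mul_log_of_le (geo_pos hp (by omega)) (by linarith) ?_
      rw [isExact, decide_eq_true_eq] at h
      have h3 : (u : ℝ) * (2 * x + 1) ≤ 2 * geo p (k + 1) * logLower p 1 := by exact_mod_cast h
      have h4 := logLower_le (a := p) (b := 1) one_pos (by omega)
      rw [Nat.cast_one, div_one] at h4
      have e1 : scale * log x * (2 * x + 1) ≤ 2 * geo p (k + 1) * (scale * log p) :=
        (mul_le_mul_of_nonneg_right hu (by positivity)).trans
          (h3.trans (mul_le_mul_of_nonneg_left h4 (by positivity)))
      refine le_of_mul_le_mul_left ?_ scale_pos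
      linarith
    have h3 := logSigma_le_of_exact hp h1 h2 j
    have h4 : log (((1 + geo p k) * p : ℕ) / ((p ^ k * (p + 1) : ℕ) : ℝ)) =
        logSigma p k - log ((p + 1) / p) := by
      rw [logSigma_eq_geo hp, ← Real.log_div (by positivity) (by positivity)]
      congr 1
      push_cast
      field_simp
    rw [h4]
    linarith
  · have h3 := logSigma_le_of_limit hp he.le h1 j
    have h4 : log ((p * p : ℕ) / (((p - 1) * (p + 1) : ℕ) : ℝ)) =
        -log (1 - (p : ℝ)⁻¹) - log ((p + 1) / p) := by
      have h5 : (p : ℝ) - 1 ≠ 0 := by linarith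
      have h6 : 1 - (p : ℝ)⁻¹ = (p - 1) / p := by field_simp
      rw [h6, ← Real.log_inv, ← Real.log_div (by positivity) (by positivity)]
      congr 1
      push_cast [Nat.cast_sub (by omega : 1 ≤ p)]
      field_simp
    rw [h4]
    linarith

/-- The candidates `p` with `2 ≤ p < hi`. -/
def cands (hi : ℕ) : Finset ℕ := (Finset.Ico 2 hi).filter (fun p => isCand p)

theorem mem_cands {hi p : ℕ} : p ∈ cands hi ↔ (2 ≤ p ∧ p < hi) ∧ isCand p = true := by
  rw [cands, Finset.mem_filter, Finset.mem_Ico]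

theorem smallProd_eq (f : ℕ → ℕ) (y : ℕ) : smallProd f y = ∏ p ∈ cands (y + 2), f p := by
  rw [cands, Finset.prod_filter]
  induction y with
  | zero => simp [smallProd]
  | succ y ih =>
    rw [smallProd, ih, show y + 1 + 2 = y + 2 + 1 by omega,
      Finset.prod_Ico_succ_top (show 2 ≤ y + 2 by omega)]
    cases isCand (y + 2) <;> simp

theorem log_prod_div {ι : Type*} (S : Finset ι) (f g : ι → ℕ) (hf : ∀ p ∈ S, 0 < f p)
    (hg : ∀ p ∈ S, 0 < g p) :
    log (((∏ p ∈ S, f p : ℕ) : ℝ) / (∏ p ∈ S, g p : ℕ)) = ∑ p ∈ S, log ((f p : ℝ) / g p) := by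
  rw [Nat.cast_prod, Nat.cast_prod, ← Finset.prod_div_distrib, Real.log_prod]
  intro p hp
  have := hf p hp
  have := hg p hp
  positivity

theorem log_prod_cast {ι : Type*} (S : Finset ι) (f : ι → ℕ) (hf : ∀ p ∈ S, 0 < f p) :
    log ((∏ p ∈ S, f p : ℕ) : ℝ) = ∑ p ∈ S, log (f p : ℝ) := by
  rw [Nat.cast_prod, Real.log_prod]
  intro p hp
  have := hf p hp
  positivity

theorem smallNum_pos {x u p k : ℕ} (hp : 2 ≤ p) : 0 < smallNum x u p k := by
  rw [smallNum]; split_ifs <;> positivity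

theorem smallDen_pos {x u p k : ℕ} (hp : 2 ≤ p) : 0 < smallDen x u p k := by
  have : 0 < p - 1 := by omega
  rw [smallDen]; split_ifs <;> positivity

theorem lt_log_log_of_endpoints {A e c a b t : ℝ} (ha : 1 < a) (hat : a ≤ t) (htb : t ≤ b)
    (h1 : A + e * a < c + log (log a)) (h2 : A + e * b < c + log (log b)) :
    A + e * t < c + log (log t) := by
  have ht : 1 < t := ha.trans_le hat
  have h3 := log_log_le_tangent ht ha
  have h4 := log_log_le_tangent ht (ht.trans_le htb)
  rw [div_eq_mul_inv] at h3 h4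
  set m := (t * log t)⁻¹
  rcases le_total e m with h | h
  · nlinarith
  · nlinarith

theorem lt_of_pointCheck {x l u T F a : ℕ} (hx : 2 ≤ x) (hl0 : 0 < x * l)
    (hl : (l : ℝ) ≤ scale * log x) (hu : scale * log x ≤ (u : ℝ)) (ha : 3 ≤ a)
    (h : pointCheck x l u T F a = true) :
    (F : ℝ) / scale + eps x * (a - T / scale) < 0.57719 + log (log a) := by
  have hs := scale_pos
  have hx' : (2 : ℝ) ≤ x := by exact_mod_cast hx
  have hL : 0 < log (x : ℝ) := Real.log_pos (by linarith)
  rw [pointCheck, force_eq, force_eq, Bool.and_eq_true, decide_eq_true_eq] at h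
  obtain ⟨h0, h⟩ := h
  have hG : (logLower (logLower a 1) scale : ℝ) ≤ scale * log (log a) := by
    have e1 := logLower_le (a := a) (b := 1) one_pos (by omega)
    rw [Nat.cast_one, div_one] at e1
    have e0 : (scale : ℝ) ≤ logLower a 1 := by exact_mod_cast h0
    refine (logLower_le (by norm_num [scale]) h0).trans
      (mul_le_mul_of_nonneg_left (Real.log_le_log (div_pos (hs.trans_le e0) hs) ?_) hs.le)
    rw [div_le_iff₀ hs]
    linarith
  have hC : (665454763244026006 : ℝ) ≤ scale * 0.57719 := by norm_num [scale]
  have goal : (F : ℝ) + eps x * (a * scale - T) < scale * 0.57719 + scale * log (log a) → 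
      (F : ℝ) / scale + eps x * (a - T / scale) < 0.57719 + log (log a) := by
    intro hh
    refine lt_of_mul_lt_mul_left ?_ hs.le
    calc scale * ((F : ℝ) / scale + eps x * (a - T / scale))
        = (F : ℝ) + eps x * (a * scale - T) := by field_simp
      _ < _ := by linarith
  apply goal
  split_ifs at h with haT
  · rw [decide_eq_true_eq] at h
    have haT' : (a : ℝ) * scale ≤ T := by exact_mod_cast haT
    have h1 : (F : ℝ) < 665454763244026006 + logLower (logLower a 1) scale +
        (T - a * scale) * ((2 * x - 1) * scale) / (2 * x * x * u) := by
      have := Nat.cast_div_le (α := ℝ) (m := (T - a * scale) * ((2 * x - 1) * scale))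
        (n := 2 * x * x * u)
      push_cast [Nat.cast_sub haT, Nat.cast_sub (by omega : 1 ≤ 2 * x)] at this
      have h' : (F : ℝ) < 665454763244026006 + logLower (logLower a 1) scale +
        (((T - a * scale) * ((2 * x - 1) * scale) / (2 * x * x * u) : ℕ) : ℝ) := by
        exact_mod_cast h
      linarith
    have hu0 : (0 : ℝ) < u := lt_of_lt_of_le (by positivity) hu
    have h2 : (2 * x - 1) * scale / (2 * x * x * u) ≤ eps x := by
      refine le_trans ?_ (le_eps (by linarith))
      rw [le_div_iff₀ hL, div_mul_eq_mul_div, div_le_iff₀ (by positivity)]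
      have e : (1 / (x : ℝ) - 1 / (2 * x ^ 2)) * (2 * x * x * u) = (2 * x - 1) * u := by
        field_simp
      rw [e, mul_assoc]
      exact mul_le_mul_of_nonneg_left hu (by linarith)
    have h3 := mul_le_mul_of_nonneg_left h2 (sub_nonneg.2 haT')
    rw [← mul_div_assoc] at h3
    linarith
  · rw [decide_eq_true_eq] at h
    have haT' : T ≤ a * scale := (not_le.1 haT).le
    have haT'' : (T : ℝ) ≤ a * scale := by exact_mod_cast haT'
    have hxl : (0 : ℝ) < x * l := by exact_mod_cast hl0
    have hl1 : (0 : ℝ) < l := pos_of_mul_pos_right hxl (by linarith)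
    have h1 : (F : ℝ) + (a * scale - T) * scale / (x * l) <
        665454763244026006 + logLower (logLower a 1) scale := by
      have h5 : ((a * scale - T) * scale : ℝ) / (x * l) <
          (((a * scale - T) * scale / (x * l) : ℕ) : ℝ) + 1 := by
        have := Nat.lt_floor_add_one ((((a * scale - T) * scale : ℕ) : ℝ) / (x * l : ℕ))
        rw [Nat.floor_div_eq_div] at this
        push_cast [Nat.cast_sub haT'] at this
        exact this
      have h' : (F : ℝ) + (((a * scale - T) * scale / (x * l) : ℕ) : ℝ) + 1 <
        665454763244026006 + logLower (logLower a 1) scale := by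
        exact_mod_cast h
      linarith
    have h2 : eps x ≤ scale / (x * l) := by
      refine (eps_le (by linarith)).trans ?_
      rw [div_le_div_iff₀ (mul_pos (by linarith) hL) hxl]
      have := mul_le_mul_of_nonneg_left hl (by linarith : (0 : ℝ) ≤ x)
      linarith
    have h3 := mul_le_mul_of_nonneg_left h2 (sub_nonneg.2 haT'')
    rw [← mul_div_assoc] at h3
    linarith

theorem lt_of_stepCheck {x l u y T F a b n : ℕ} (hx : 2 ≤ x)
    (hl : (l : ℝ) ≤ scale * log x) (hu : scale * log x ≤ (u : ℝ)) (ha : 3 ≤ a)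
    (hT : (T : ℝ) ≤ scale * ∑ p ∈ cands (x + 1), log (p : ℝ))
    (hF : scale * ∑ p ∈ cands (x + 1), log (((p + 1 : ℕ) : ℝ) / p) ≤ F)
    (h : stepCheck x l u y T F a b = true) (hn : n ≠ 0) (han : a ≤ log (n : ℝ))
    (hnb : log (n : ℝ) ≤ b) : log (sigma1 n / n) < 0.57719 + log (log (log n)) := by
  have hs := scale_pos
  have hx' : (2 : ℝ) ≤ x := by exact_mod_cast hx
  have ha' : (3 : ℝ) ≤ a := by exact_mod_cast ha
  have hb : 3 ≤ b := by exact_mod_cast ha'.trans (han.trans hnb)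
  simp only [stepCheck, force_eq, Bool.and_eq_true, decide_eq_true_eq, smallProd_eq] at h
  set T' := T + logLower (∏ p ∈ cands (y + 2), p ^ (topExp x l p 20 1 - 1)) 1 with hT'
  set F' := F + logUpper (∏ p ∈ cands (y + 2), smallNum x u p (topExp x l p 20 1))
    (∏ p ∈ cands (y + 2), smallDen x u p (topExp x l p 20 1)) with hF'
  obtain ⟨⟨⟨hyx, hl0⟩, hy⟩, h1, h2⟩ := h
  have hsub : cands (y + 2) = (cands (x + 1)).filter (fun p => p < y + 2) := by
    ext p
    simp only [mem_cands, Finset.mem_filter]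
    constructor
    · rintro ⟨⟨h1, h2⟩, h3⟩
      exact ⟨⟨⟨h1, by omega⟩, h3⟩, h2⟩
    · rintro ⟨⟨⟨h1, _⟩, h3⟩, h2⟩
      exact ⟨⟨h1, h2⟩, h3⟩
  have htwo : ∀ {z p : ℕ}, p ∈ cands z → 2 ≤ p := fun h => (mem_cands.1 h).1.1
  have key := log_sigma1_div_le_sum hn (x := (x : ℝ)) (by linarith) (S := cands (x + 1))
    (B := fun p => log (((p + 1 : ℕ) : ℝ) / p) - eps x * log p + if p < y + 2 then
      (log ((smallNum x u p (topExp x l p 20 1) : ℝ) / smallDen x u p (topExp x l p 20 1)) -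
        eps x * log (p ^ (topExp x l p 20 1 - 1) : ℕ)) else 0)
    (fun p hp hpx => mem_cands.2 ⟨⟨hp.two_le, Nat.lt_succ_of_le (by exact_mod_cast hpx)⟩,
      isCand_of_prime hp⟩)
    (by
      intro p hp j
      obtain ⟨⟨hp2, hpx⟩, -⟩ := mem_cands.1 hp
      push_cast
      split_ifs with hpy
      · have := logSigma_le_of_small hp2 (by omega) hl hu j
        push_cast at this
        exact this
      · rw [add_zero]
        refine logSigma_le_of_one hp2 (by exact_mod_cast (by omega : p ≤ x)) ?_ j
        have : 2 * x + 1 ≤ p * p + p := hy.trans (by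
          have : y + 2 ≤ p := by omega
          gcongr)
        exact_mod_cast this)
  have hsum : ∑ p ∈ cands (x + 1), (log (((p + 1 : ℕ) : ℝ) / p) - eps x * log p +
      if p < y + 2 then
      (log ((smallNum x u p (topExp x l p 20 1) : ℝ) / smallDen x u p (topExp x l p 20 1)) -
        eps x * log (p ^ (topExp x l p 20 1 - 1) : ℕ)) else 0) =
      ∑ p ∈ cands (x + 1), log (((p + 1 : ℕ) : ℝ) / p) -
        eps x * ∑ p ∈ cands (x + 1), log (p : ℝ) +
      (log ((∏ p ∈ cands (y + 2), smallNum x u p (topExp x l p 20 1) : ℕ) /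
        (∏ p ∈ cands (y + 2), smallDen x u p (topExp x l p 20 1) : ℕ) : ℝ) -
        eps x * log (∏ p ∈ cands (y + 2), p ^ (topExp x l p 20 1 - 1) : ℕ)) := by
    rw [log_prod_div _ _ _ (fun p hp => smallNum_pos (htwo hp)) (fun p hp => smallDen_pos (htwo hp)),
      log_prod_cast _ _ (fun p hp => Nat.pow_pos (by have := htwo hp; omega)),
      Finset.sum_add_distrib, Finset.sum_sub_distrib, Finset.mul_sum, hsub, Finset.sum_filter,
      Finset.mul_sum, Finset.sum_filter, ← Finset.sum_sub_distrib, ← Finset.sum_sub_distrib]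
    congr 1
    refine Finset.sum_congr rfl fun p _ => ?_
    split_ifs <;> simp
  rw [hsum] at key
  set D := log (((∏ p ∈ cands (y + 2), smallNum x u p (topExp x l p 20 1) : ℕ) : ℝ) /
        (∏ p ∈ cands (y + 2), smallDen x u p (topExp x l p 20 1) : ℕ)) with hD
  set E := log ((∏ p ∈ cands (y + 2), p ^ (topExp x l p 20 1 - 1) : ℕ) : ℝ) with hE
  set Θ := ∑ p ∈ cands (x + 1), log (p : ℝ)
  set M := ∑ p ∈ cands (x + 1), log (((p + 1 : ℕ) : ℝ) / p)
  have hTle : (T' : ℝ) / scale ≤ Θ + E := by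
    have := logLower_le (a := ∏ p ∈ cands (y + 2), p ^ (topExp x l p 20 1 - 1)) (b := 1) one_pos
      (Finset.prod_pos fun p hp => Nat.pow_pos (by have := htwo hp; omega))
    rw [Nat.cast_one, div_one, ← hE] at this
    rw [div_le_iff₀ hs, hT', Nat.cast_add]
    linarith
  have hFle : M + D ≤ (F' : ℝ) / scale := by
    have := le_logUpper (a := ∏ p ∈ cands (y + 2), smallNum x u p (topExp x l p 20 1))
      (b := ∏ p ∈ cands (y + 2), smallDen x u p (topExp x l p 20 1))
      (Finset.prod_pos fun p hp => smallNum_pos (htwo hp))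
      (Finset.prod_pos fun p hp => smallDen_pos (htwo hp))
    rw [← hD] at this
    rw [le_div_iff₀ hs, hF', Nat.cast_add]
    linarith
  have he : 0 < eps x := eps_pos (by linarith)
  have h3 := lt_of_pointCheck hx hl0 hl hu ha h1
  have h4 := lt_of_pointCheck hx hl0 hl hu hb h2
  have h5 := mul_le_mul_of_nonneg_left hTle he.le
  have h6 := lt_log_log_of_endpoints (A := (F' : ℝ) / scale - eps x * (T' / scale)) (e := eps x)
    (c := 0.57719) (a := a) (b := b) (t := log n) (by linarith) han hnb (by linarith) (by linarith)
  linarith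

theorem sum_cands_add (f : ℕ → ℝ) {lo hi : ℕ} (h1 : 2 ≤ lo) (h2 : lo ≤ hi) :
    ∑ p ∈ cands hi, f p =
      ∑ p ∈ cands lo, f p + ∑ p ∈ (Finset.Ico lo hi).filter (fun p => isCand p), f p := by
  rw [cands, cands, Finset.sum_filter, Finset.sum_filter, Finset.sum_filter,
    Finset.sum_Ico_consecutive _ h1 h2]

theorem lt_of_checkAll (L : List (ℕ × ℕ)) (lo T F a : ℕ) (hlo : 2 ≤ lo) (ha : 3 ≤ a)
    (hT : (T : ℝ) ≤ scale * ∑ p ∈ cands lo, log (p : ℝ))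
    (hF : scale * ∑ p ∈ cands lo, log (((p + 1 : ℕ) : ℝ) / p) ≤ F)
    (h : checkAll L lo T F a = true) {n : ℕ} (hn : n ≠ 0) (han : a < log (n : ℝ))
    (hnb : log (n : ℝ) ≤ 162755) : log (sigma1 n / n) < 0.57719 + log (log (log n)) := by
  induction L generalizing lo T F a with
  | nil =>
    have : (162755 : ℝ) ≤ a := by exact_mod_cast Nat.le_of_ble_eq_true h
    linarith
  | cons db L ih =>
    obtain ⟨d, b⟩ := db
    simp only [checkAll, force_eq, Bool.and_eq_true, Bool.or_eq_true, Nat.beq_eq] at h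
    obtain ⟨hm, hstep, hrest⟩ := h
    have hd : 1 ≤ 2 ^ d := Nat.one_le_two_pow
    have hsieve : ∀ p, lo ≤ p → p < lo + 2 ^ d → sieve p = sieve lo := fun p h1 h2 =>
      sieve_eq_of_le hm h1 (by omega)
    have hpos : ∀ c, ∀ p ∈ (Finset.Ico lo (lo + 2 ^ d)).filter (fun p => isCand p), 0 < p + c := by
      intro c p hp
      have := (Finset.mem_Ico.1 (Finset.mem_filter.1 hp).1).1
      omega
    have hP0 : 0 < candProd (sieve lo) 0 d lo := by
      rw [candProd_eq d lo hsieve]; exact Finset.prod_pos (hpos 0)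
    have hQ0 : 0 < candProd (sieve lo) 1 d lo := by
      rw [candProd_eq d lo hsieve]; exact Finset.prod_pos (hpos 1)
    have hT' : ((T + logLower (candProd (sieve lo) 0 d lo) 1 : ℕ) : ℝ) ≤
        scale * ∑ p ∈ cands (lo + 2 ^ d), log (p : ℝ) := by
      have := logLower_le (a := candProd (sieve lo) 0 d lo) (b := 1) one_pos hP0
      rw [Nat.cast_one, div_one, candProd_eq d lo hsieve, log_prod_cast _ _ (hpos 0),
        ← candProd_eq d lo hsieve] at this
      rw [sum_cands_add _ hlo (by omega), mul_add, Nat.cast_add]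
      exact add_le_add hT this
    have hF' : scale * ∑ p ∈ cands (lo + 2 ^ d), log (((p + 1 : ℕ) : ℝ) / p) ≤
        (F + logUpper (candProd (sieve lo) 1 d lo) (candProd (sieve lo) 0 d lo) : ℕ) := by
      have := le_logUpper hQ0 hP0
      rw [candProd_eq d lo hsieve, candProd_eq d lo hsieve, log_prod_div _ _ _ (hpos 1) (hpos 0),
        ← candProd_eq d lo hsieve, ← candProd_eq d lo hsieve] at this
      rw [sum_cands_add _ hlo (by omega), mul_add, Nat.cast_add]
      exact add_le_add hF this
    by_cases hb : b < log (n : ℝ)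
    · exact ih _ _ _ _ (by omega) (le_max_of_le_left ha) hT' hF' hrest (by
        rw [Nat.cast_max]; exact max_lt han hb)
    replace hb := not_lt.1 hb
    replace hstep := hstep.resolve_left (by
      rintro rfl
      have : (0 : ℝ) ≤ a := a.cast_nonneg
      rw [Nat.cast_zero] at hb
      linarith)
    obtain ⟨x, hx⟩ : ∃ x, lo + 2 ^ d = x + 1 := ⟨lo + 2 ^ d - 1, by omega⟩
    rw [hx] at hT' hF' hstep
    rw [Nat.add_sub_cancel] at hstep
    have hx2 : 2 ≤ x := by omega
    refine lt_of_stepCheck hx2 ?_ ?_ ha hT' hF' hstep hn han.le hb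
    · have := logLower_le (a := x) (b := 1) one_pos (by omega)
      rwa [Nat.cast_one, div_one] at this
    · have := le_logUpper (a := x) (b := 1) (by omega) one_pos
      rwa [Nat.cast_one, div_one] at this

set_option maxRecDepth 100000 in
set_option maxHeartbeats 4000000 in
theorem checkAll_eq_true :
    checkAll
      [(1, 0), (2, 0), (1, 0), (1, 13), (1, 17), (1, 20), (2, 27), (2, 32), (2, 38), (2, 44),
        (2, 50), (3, 62), (3, 72), (3, 84), (3, 96), (4, 118), (4, 139), (4, 159), (4,
        179), (5, 222), (5, 263), (5, 304), (5, 343), (6, 418), (6, 499), (6, 580), (6,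
        657), (7, 815), (7, 968), (7, 1121), (7, 1274), (8, 1567), (8, 1865), (8, 2152),
        (8, 2449), (9, 3034), (9, 3609), (9, 4198), (9, 4767), (10, 5906), (10, 7046),
        (10, 8159), (10, 9288), (10, 10433), (10, 11534), (10, 12635), (10, 13770), (11,
        15992), (11, 18206), (11, 20404), (11, 22641), (11, 24853), (11, 27014), (11,
        29212), (11, 31411), (12, 35819), (12, 40161), (12, 44527), (12, 48818), (12,
        53192), (12, 57542), (12, 61889), (12, 66120), (13, 74747), (13, 83425), (13,
        92009), (13, 100639), (13, 109137), (13, 117701), (13, 126300), (13, 134866), (13,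
        143432), (13, 151872), (13, 160423), (13, 168824)]
      2 0 0 9 = true := by
  decide +kernel

/-- Robin's inequality in the intermediate range. -/
theorem robinF_lt_of_le {n : ℕ} (hn : 10080 ≤ n) (h : log (log n) < 12) :
    robinF n < exp eulerMascheroniConstant := by
  have hn' : (10080 : ℝ) ≤ n := by exact_mod_cast hn
  have h9 : 9 < log (n : ℝ) := by
    rw [Real.lt_log_iff_exp_lt (by linarith)]
    have h1 := Real.exp_one_lt_d9
    calc exp (9 : ℝ) = exp 1 ^ 9 := by rw [← Real.exp_nat_mul]; norm_num
      _ ≤ 2.7182818286 ^ 9 := by gcongr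
      _ < n := lt_of_lt_of_le (by norm_num) hn'
  have hu : log (n : ℝ) ≤ 162755 := by
    rw [Real.log_lt_iff_lt_exp (by linarith)] at h
    have h1 := Real.exp_one_lt_d9
    calc log (n : ℝ) ≤ exp (12 : ℝ) := h.le
      _ = exp 1 ^ 12 := by rw [← Real.exp_nat_mul]; norm_num
      _ ≤ 2.7182818286 ^ 12 := by gcongr
      _ ≤ 162755 := by norm_num
  have h1 := lt_of_checkAll _ 2 0 0 9 le_rfl (by norm_num) (by simp [cands]) (by simp [cands])
    checkAll_eq_true (n := n) (by omega) (by exact_mod_cast h9) hu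
  rw [robinF_eq_exp (by omega) (Real.log_pos (by linarith)), Real.exp_lt_exp]
  have := lt_eulerMascheroniConstant
  linarith

theorem robinF_lt_of_riemannHypothesis (h : RiemannHypothesis) {n : ℕ} (hn : 10080 ≤ n) :
    robinF n < exp eulerMascheroniConstant := by
  rcases lt_or_ge (log (log (n : ℝ))) 12 with h1 | h1
  · exact robinF_lt_of_le hn h1
  · exact robinF_lt_of_xi (fun s hs => xi_ne_zero_of_riemannHypothesis h hs) (by omega) h1

end Robin

theorem rh_iff_infinitely_many_extremely_abundant :
    RiemannHypothesis ↔ {n : ℕ | ExtremelyAbundant n}.Infinite :=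
  ⟨fun h => Robin.infinite_extremelyAbundant_iff.2 fun _ hn =>
      Robin.robinF_lt_of_riemannHypothesis h hn,
    fun h => Robin.riemannHypothesis_of_robin (Robin.infinite_extremelyAbundant_iff.1 h)⟩
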